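/- Let D ⊂ ℂⁿ be a bounded hyperconvex domain, u₀, u₁ ∈ PSH⁻(D), and let (u_t)_{0<t<1} be the geodesic for u₀ and u₁. Then u_t converges to u₀ in L¹_loc(D) (and in capacity) as t → 0 if and only if P[u₁](u₀) = u₀. -/

import Mathlib

open MeasureTheory Filter Topology
open scoped ENNReal

noncomputable section

/-- Complex Euclidean space `ℂⁿ`. -/
abbrev Cn (n : ℕ) : Type := Fin n → ℂ

section Defs

variable {E : Type*} [NormedAddCommGroup E] [NormedSpace ℂ E]

/-- `u` is plurisubharmonic on `Ω`: it is upper semicontinuous on `Ω` (with values in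
`EReal`) and on every closed disc of every complex line contained in `Ω` it satisfies the
maximum principle with respect to real parts of complex polynomials (an equivalent form of
the sub-mean value property on complex lines). -/
def PlurisubharmonicOn (u : E → EReal) (Ω : Set E) : Prop :=
  UpperSemicontinuousOn u Ω ∧
  ∀ a b : E, ∀ r : ℝ, 0 < r →
    (∀ ζ : ℂ, ‖ζ‖ ≤ r → a + ζ • b ∈ Ω) →
    ∀ p : Polynomial ℂ,
      (∀ ζ : ℂ, ‖ζ‖ = r → u (a + ζ • b) ≤ ((Polynomial.eval ζ p).re : EReal)) →
      ∀ ζ : ℂ, ‖ζ‖ ≤ r → u (a + ζ • b) ≤ ((Polynomial.eval ζ p).re : EReal)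

/-- Negative plurisubharmonic functions on `Ω` : the class `PSH⁻(Ω)`. -/
def PSHNeg (u : E → EReal) (Ω : Set E) : Prop :=
  PlurisubharmonicOn u Ω ∧ ∀ z ∈ Ω, u z ≤ 0

/-- A set is pluripolar if it is contained in `{u = -∞}` for some psh `u ≢ -∞`
defined on a neighborhood of the set. -/
def Pluripolar (S : Set E) : Prop :=
  ∃ Ω : Set E, IsOpen Ω ∧ S ⊆ Ω ∧
    ∃ u : E → EReal, PlurisubharmonicOn u Ω ∧ (∃ z ∈ Ω, u z ≠ ⊥) ∧ ∀ z ∈ S, u z = ⊥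

/-- Upper semicontinuous regularization (relative to `Ω`) of a function. -/
def uscReg (f : E → EReal) (Ω : Set E) : E → EReal :=
  fun z => Filter.limsup f (nhdsWithin z Ω)

/-- The psh envelope `P(h)` of a function `h` on `Ω`: the usc regularization of the
supremum of all psh minorants of `h` on `Ω`. -/
def PEnv (h : E → EReal) (Ω : Set E) : E → EReal :=
  uscReg (fun z =>
    ⨆ v ∈ {v : E → EReal | PlurisubharmonicOn v Ω ∧ ∀ x ∈ Ω, v x ≤ h x}, v z) Ω

/-- The rooftop envelope `P(u,v) = P(min{u,v})`. -/
def Rooftop (u v : E → EReal) (Ω : Set E) : E → EReal :=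
  PEnv (fun z => min (u z) (v z)) Ω

/-- The Green–Poisson residual function `g_φ`: usc regularization of the supremum of all
negative psh `w` with `w ≤ φ + C_w` on `Ω` for some constant `C_w`. -/
def gp (φ : E → EReal) (Ω : Set E) : E → EReal :=
  uscReg (fun z =>
    ⨆ w ∈ {w : E → EReal | PSHNeg w Ω ∧ ∃ C : ℝ, ∀ x ∈ Ω, w x ≤ φ x + (C : EReal)}, w z) Ω

/-- The residual Green function `g_φ^o`: usc regularization of the supremum of all
negative psh `w` with `w ≤ φ + O(1)` locally in `Ω`. -/
def gpO (φ : E → EReal) (Ω : Set E) : E → EReal :=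
  uscReg (fun z =>
    ⨆ w ∈ {w : E → EReal | PSHNeg w Ω ∧
      ∀ a ∈ Ω, ∃ U ∈ nhds a, ∃ C : ℝ, ∀ x ∈ U ∩ Ω, w x ≤ φ x + (C : EReal)}, w z) Ω

/-- The residual Poisson function `g_φ^b`: usc regularization of the supremum of all
negative psh `w` with `w ≤ φ + O(1)` in a neighborhood of `∂Ω`. -/
def gpB (φ : E → EReal) (Ω : Set E) : E → EReal :=
  uscReg (fun z =>
    ⨆ w ∈ {w : E → EReal | PSHNeg w Ω ∧
      ∃ U : Set E, IsOpen U ∧ frontier Ω ⊆ U ∧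
        ∃ C : ℝ, ∀ x ∈ U ∩ Ω, w x ≤ φ x + (C : EReal)}, w z) Ω

/-- The asymptotic rooftop `P[φ](ψ) = lim*_{C→∞} P(ψ, φ+C)`. -/
def asympRooftop (ψ φ : E → EReal) (Ω : Set E) : E → EReal :=
  uscReg (fun z => ⨆ C : ℝ, Rooftop ψ (fun x => φ x + (C : EReal)) Ω z) Ω

/-- The unbounded locus `L(φ)` of `φ` in `Ω`: points of `Ω` having no neighborhood on
which `φ` is bounded. -/
def Lset (φ : E → EReal) (Ω : Set E) : Set E :=
  {a | a ∈ Ω ∧ ∀ U ∈ nhds a, ¬ ∃ M : ℝ, ∀ x ∈ U ∩ Ω, -(M : EReal) ≤ φ x ∧ φ x ≤ (M : EReal)}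

/-- The boundary unbounded locus `BL(φ)`: boundary points near which `φ` is unbounded. -/
def BLset (φ : E → EReal) (Ω : Set E) : Set E :=
  {b | b ∈ frontier Ω ∧
    ∀ U ∈ nhds b, ¬ ∃ M : ℝ, ∀ x ∈ U ∩ Ω, -(M : EReal) ≤ φ x ∧ φ x ≤ (M : EReal)}

/-- `PSH_s⁻(Ω)` : negative psh functions with small unbounded locus (both `L(φ)` and
`BL(φ)` pluripolar). -/
def PSHs (φ : E → EReal) (Ω : Set E) : Prop :=
  PSHNeg φ Ω ∧ Pluripolar (Lset φ Ω) ∧ Pluripolar (BLset φ Ω)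

/-- `u` is a maximal psh function on the set `U`: it is psh there and for every `G ⋐ U`
and every psh `v` on a neighborhood of `closure G` with `v ≤ u` on `∂G`, one has `v ≤ u`
on `G`. -/
def MaximalOn (u : E → EReal) (U : Set E) : Prop :=
  PlurisubharmonicOn u U ∧
  ∀ G : Set E, IsOpen G → IsCompact (closure G) → closure G ⊆ U →
    ∀ W : Set E, IsOpen W → closure G ⊆ W →
      ∀ v : E → EReal, PlurisubharmonicOn v W →
        (∀ z ∈ frontier G, v z ≤ u z) → ∀ z ∈ G, v z ≤ u z

/-- B-regularity of a domain: every continuous function on the boundary is the boundary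
value of a psh function continuous up to the closure. -/
def BRegular (Ω : Set E) : Prop :=
  ∀ η : E → ℝ, ContinuousOn η (frontier Ω) →
    ∃ u : E → ℝ, PlurisubharmonicOn (fun z => ((u z : ℝ) : EReal)) Ω ∧
      ContinuousOn u (closure Ω) ∧ ∀ ζ ∈ frontier Ω, u ζ = η ζ

/-- Pseudoconvexity: existence of a continuous psh exhaustion function. -/
def Pseudoconvex (Ω : Set E) : Prop :=
  IsOpen Ω ∧ ∃ u : E → ℝ, ContinuousOn u Ω ∧
    PlurisubharmonicOn (fun z => ((u z : ℝ) : EReal)) Ω ∧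
    ∀ c : ℝ, IsCompact {z | z ∈ Ω ∧ u z ≤ c}

/-- Hyperconvexity: existence of a negative psh exhaustion function. -/
def Hyperconvex (Ω : Set E) : Prop :=
  ∃ ρ : E → EReal, PlurisubharmonicOn ρ Ω ∧ (∀ z ∈ Ω, ρ z < 0) ∧
    ∀ c : ℝ, c < 0 →
      IsCompact (closure {z | z ∈ Ω ∧ ρ z ≤ (c : EReal)}) ∧
      closure {z | z ∈ Ω ∧ ρ z ≤ (c : EReal)} ⊆ Ω

/-- `H` is the least maximal psh majorant (`fb φ`) of `φ` on `Ω` (within `PSH⁻(Ω)`). -/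
def IsLeastMaxMajorant (φ H : E → EReal) (Ω : Set E) : Prop :=
  MaximalOn H Ω ∧ (∀ z ∈ Ω, H z ≤ 0) ∧ (∀ z ∈ Ω, φ z ≤ H z) ∧
  ∀ H' : E → EReal, MaximalOn H' Ω → (∀ z ∈ Ω, H' z ≤ 0) → (∀ z ∈ Ω, φ z ≤ H' z) →
    ∀ z ∈ Ω, H z ≤ H' z

/-- Extended-real logarithm, with `log 0 = -∞`. -/
def elog (x : ℝ) : EReal := if x ≤ 0 then (⊥ : EReal) else ((Real.log x : ℝ) : EReal)

end Defs

section MA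

/-- Real second directional derivative `D²u(z)(v,w)`. -/
def reB (n : ℕ) (u : Cn n → ℝ) (z v w : Cn n) : ℝ :=
  fderiv ℝ (fun x => fderiv ℝ u x w) z v

/-- Entry `∂²u/∂z_j∂z̄_k` of the complex Hessian of a (C²) function `u`. -/
def cHessEntry (n : ℕ) (u : Cn n → ℝ) (z : Cn n) (j k : Fin n) : ℂ :=
  (1 / 4 : ℂ) *
    ( ((reB n u z ((Pi.single j (1 : ℂ) : Cn n)) ((Pi.single k (1 : ℂ) : Cn n)) : ℝ) : ℂ)
    + ((reB n u z ((Pi.single j Complex.I : Cn n)) ((Pi.single k Complex.I : Cn n)) : ℝ) : ℂ)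
    + Complex.I *
      ( ((reB n u z ((Pi.single j (1 : ℂ) : Cn n)) ((Pi.single k Complex.I : Cn n)) : ℝ) : ℂ)
      - ((reB n u z ((Pi.single j Complex.I : Cn n)) ((Pi.single k (1 : ℂ) : Cn n)) : ℝ) : ℂ)))

/-- Density of the Monge–Ampère measure `(dd^c u)ⁿ` of a smooth function `u`. -/
def maDensity (n : ℕ) (u : Cn n → ℝ) (z : Cn n) : ℝ :=
  (4 : ℝ) ^ n * (n.factorial : ℝ) * (Matrix.det (Matrix.of fun j k => cHessEntry n u z j k)).re

/-- `μ` is the Bedford–Taylor Monge–Ampère measure `(dd^c u)ⁿ` of `u` on `Ω`: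
it is locally finite on `Ω`, carried by `Ω`, and for every open `U ⊆ Ω` and every
decreasing sequence of smooth psh functions on `U` converging pointwise to `u`, the
corresponding smooth Monge–Ampère measures converge to `μ` against test functions
supported in `U`. -/
def IsMAMeasure (n : ℕ) (u : Cn n → EReal) (Ω : Set (Cn n)) (μ : Measure (Cn n)) : Prop :=
  μ Ωᶜ = 0 ∧ (∀ K : Set (Cn n), IsCompact K → K ⊆ Ω → μ K ≠ ⊤) ∧
  ∀ U : Set (Cn n), IsOpen U → U ⊆ Ω →
    ∀ v : ℕ → Cn n → ℝ,
      (∀ k, ContDiffOn ℝ (⊤ : ℕ∞) (v k) U) →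
      (∀ k, PlurisubharmonicOn (fun z => ((v k z : ℝ) : EReal)) U) →
      (∀ k, ∀ z ∈ U, v (k + 1) z ≤ v k z) →
      (∀ z ∈ U, (⨅ k, ((v k z : ℝ) : EReal)) = u z) →
      ∀ f : Cn n → ℝ, Continuous f → HasCompactSupport f → tsupport f ⊆ U →
        Filter.Tendsto (fun k => ∫ z, f z * maDensity n (v k) z) Filter.atTop
          (nhds (∫ z, f z ∂μ))

/-- The Cegrell class `E₀(Ω)`: bounded negative psh functions with zero boundary values
and finite total Monge–Ampère mass. -/
def ClassE0 (n : ℕ) (Ω : Set (Cn n)) (φ : Cn n → EReal) : Prop :=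
  PSHNeg φ Ω ∧ (∃ M : ℝ, ∀ z ∈ Ω, -(M : EReal) ≤ φ z) ∧
  (∀ ζ ∈ frontier Ω, Filter.Tendsto φ (nhdsWithin ζ Ω) (nhds (0 : EReal))) ∧
  ∃ μ : Measure (Cn n), IsMAMeasure n φ Ω μ ∧ μ Ω ≠ ⊤

/-- The Cegrell class `E(Ω)`: negative psh functions that are locally decreasing limits
of functions of `E₀(Ω)` with uniformly bounded total Monge–Ampère masses. -/
def ClassE (n : ℕ) (Ω : Set (Cn n)) (φ : Cn n → EReal) : Prop :=
  PSHNeg φ Ω ∧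
  ∀ z ∈ Ω, ∃ U : Set (Cn n), IsOpen U ∧ z ∈ U ∧ U ⊆ Ω ∧
    ∃ h : ℕ → Cn n → EReal, ∃ M : ℝ≥0∞, M ≠ ⊤ ∧
      (∀ j, ClassE0 n Ω (h j)) ∧
      (∀ j, ∀ x ∈ Ω, h (j + 1) x ≤ h j x) ∧
      (∀ x ∈ U, (⨅ j, h j x) = φ x) ∧
      (∀ j, ∀ μ : Measure (Cn n), IsMAMeasure n (h j) Ω μ → μ Ω ≤ M)

/-- The Cegrell class `N(Ω) = {w ∈ E(Ω) : fb w = 0}`. -/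
def ClassN (n : ℕ) (Ω : Set (Cn n)) : Set (Cn n → EReal) :=
  {w | ClassE n Ω w ∧ IsLeastMaxMajorant w 0 Ω}

/-- The Cegrell class `F(Ω) = {w ∈ E(Ω) : ∫ (dd^c w)ⁿ < ∞ and fb w = 0}`. -/
def ClassF (n : ℕ) (Ω : Set (Cn n)) : Set (Cn n → EReal) :=
  {w | ClassE n Ω w ∧ IsLeastMaxMajorant w 0 Ω ∧
    ∀ μ : Measure (Cn n), IsMAMeasure n w Ω μ → μ Ω ≠ ⊤}

/-- Membership `φ ∈ K(Ω, H)`: `φ ∈ E(Ω)` and `H + w ≤ φ ≤ H` for some `w ∈ K`. -/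
def InClassRel (n : ℕ) (Ω : Set (Cn n)) (K : Set (Cn n → EReal)) (H φ : Cn n → EReal) : Prop :=
  ClassE n Ω φ ∧ ∃ w ∈ K, ∀ z ∈ Ω, H z + w z ≤ φ z ∧ φ z ≤ H z

/-- The annulus `A = {1 < |ζ| < e}`. -/
def annA : Set ℂ := {ζ : ℂ | 1 < ‖ζ‖ ∧ ‖ζ‖ < Real.exp 1}

/-- The class `W(u₀,u₁)` of subgeodesics: negative psh functions on `Ω × A` with boundary
limsups dominated by `u₀` on `|ζ| = 1` and by `u₁` on `|ζ| = e`. -/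
def geodClass (n : ℕ) (Ω : Set (Cn n)) (u0 u1 : Cn n → EReal) : Set (Cn n × ℂ → EReal) :=
  {u | PSHNeg u (Ω ×ˢ annA) ∧
    (∀ z ∈ Ω, Filter.limsup (fun ζ : ℂ => u (z, ζ))
        ((nhds (1 : ℝ)).comap (fun ζ : ℂ => ‖ζ‖) ⊓ Filter.principal annA) ≤ u0 z) ∧
    (∀ z ∈ Ω, Filter.limsup (fun ζ : ℂ => u (z, ζ))
        ((nhds (Real.exp 1)).comap (fun ζ : ℂ => ‖ζ‖) ⊓ Filter.principal annA) ≤ u1 z)}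

/-- The geodesic `u_t(z) = P_W(z, e^t)`, the Perron envelope of the class `W(u₀,u₁)`. -/
def geodesic (n : ℕ) (Ω : Set (Cn n)) (u0 u1 : Cn n → EReal) (t : ℝ) (z : Cn n) : EReal :=
  ⨆ u ∈ geodClass n Ω u0 u1, u (z, ((Real.exp t : ℝ) : ℂ))

/-- The Monge–Ampère capacity `Cap(S) = sup {∫_S (dd^c u)ⁿ : u psh, -1 ≤ u ≤ 0}`. -/
def MACap (n : ℕ) (Ω : Set (Cn n)) (S : Set (Cn n)) : ℝ≥0∞ :=
  ⨆ u ∈ {u : Cn n → EReal | PlurisubharmonicOn u Ω ∧ ∀ z ∈ Ω, -1 ≤ u z ∧ u z ≤ 0},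
    ⨆ μ ∈ {μ : Measure (Cn n) | IsMAMeasure n u Ω μ}, μ S

/-- Convergence `u t → g` in capacity as `t → t₀` within `(0,1)`. -/
def TendstoInCap (n : ℕ) (Ω : Set (Cn n)) (u : ℝ → Cn n → EReal) (g : Cn n → EReal)
    (t0 : ℝ) : Prop :=
  ∀ ε : ℝ, 0 < ε → ∀ K : Set (Cn n), IsCompact K → K ⊆ Ω →
    Filter.Tendsto
      (fun t => MACap n Ω
        {z | z ∈ K ∧ ¬ (u t z ≤ g z + (ε : EReal) ∧ g z ≤ u t z + (ε : EReal))})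
      (nhdsWithin t0 (Set.Ioo (0 : ℝ) 1)) (nhds (0 : ℝ≥0∞))

/-- Convergence `u t → g` in `L¹_loc(Ω)` as `t → t₀` within `(0,1)`. -/
def TendstoL1loc (n : ℕ) (Ω : Set (Cn n)) (u : ℝ → Cn n → EReal) (g : Cn n → EReal)
    (t0 : ℝ) : Prop :=
  ∀ K : Set (Cn n), IsCompact K → K ⊆ Ω →
    Filter.Tendsto (fun t => ∫⁻ z in K, ENNReal.ofReal |(u t z).toReal - (g z).toReal|)
      (nhdsWithin t0 (Set.Ioo (0 : ℝ) 1)) (nhds (0 : ℝ≥0∞))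

end MA

section CircleApprox

/-- Continuous real functions on a circle are uniform limits of real parts of polynomials. -/
lemma exists_poly_re_approx {r : ℝ} (hr : 0 < r) {g : ℂ → ℝ}
    (hg : ContinuousOn g (Metric.sphere 0 r)) {ε : ℝ} (hε : 0 < ε) :
    ∃ p : Polynomial ℂ, ∀ ζ : ℂ, ‖ζ‖ = r → |g ζ - (p.eval ζ).re| < ε := by
  have : Fact (0 < 2 * Real.pi) := ⟨by positivity⟩
  let G : C(AddCircle (2 * Real.pi), ℂ) :=
    { toFun := fun x => (g (r * (AddCircle.toCircle x : ℂ)) : ℂ)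
      continuous_toFun := by
        refine Complex.continuous_ofReal.comp (hg.comp_continuous ?_ ?_)
        · exact continuous_const.mul (continuous_subtype_val.comp AddCircle.continuous_toCircle)
        · intro x
          simp only [mem_sphere_zero_iff_norm, norm_mul, Complex.norm_real, Real.norm_eq_abs,
            abs_of_pos hr, Circle.norm_coe, mul_one] }
  have hspan : ∀ h ∈ Submodule.span ℂ (Set.range (@fourier (2 * Real.pi))),
      ∃ p q : Polynomial ℂ, ∀ x : AddCircle (2 * Real.pi),
        h x = p.eval ((r : ℂ) * (AddCircle.toCircle x : ℂ)) +
          (starRingEnd ℂ) (q.eval ((r : ℂ) * (AddCircle.toCircle x : ℂ))) := by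
    intro h hh
    have hr0 : (r : ℂ) ≠ 0 := by exact_mod_cast hr.ne'
    induction hh using Submodule.span_induction with
    | mem h hh =>
      obtain ⟨m, rfl⟩ := hh
      obtain ⟨k, rfl | rfl⟩ := m.eq_nat_or_neg
      · refine ⟨Polynomial.C ((r : ℂ)⁻¹ ^ k) * Polynomial.X ^ k, 0, fun x => ?_⟩
        have : ((r : ℂ)⁻¹ ^ k) * ((r : ℂ) * (AddCircle.toCircle x : ℂ)) ^ k
            = (AddCircle.toCircle x : ℂ) ^ k := by
          rw [← mul_pow, ← mul_assoc]; simp [hr0]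
        rw [fourier_apply, natCast_zsmul, AddCircle.toCircle_nsmul]
        simp only [Polynomial.eval_zero, Polynomial.eval_mul, Polynomial.eval_C,
          Polynomial.eval_pow, Polynomial.eval_X, this, map_zero, add_zero]
        rfl
      · refine ⟨0, Polynomial.C ((r : ℂ)⁻¹ ^ k) * Polynomial.X ^ k, fun x => ?_⟩
        rw [fourier_apply, neg_smul, AddCircle.toCircle_neg, natCast_zsmul,
          AddCircle.toCircle_nsmul]
        have : ((r : ℂ)⁻¹ ^ k) * ((r : ℂ) * (AddCircle.toCircle x : ℂ)) ^ k
            = (AddCircle.toCircle x : ℂ) ^ k := by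
          rw [← mul_pow, ← mul_assoc]; simp [hr0]
        simp only [Polynomial.eval_zero, Polynomial.eval_mul, Polynomial.eval_C,
          Polynomial.eval_pow, Polynomial.eval_X, this, zero_add]
        rw [Circle.coe_inv_eq_conj]
        simp
    | zero => exact ⟨0, 0, fun x => by simp⟩
    | add h1 h2 _ _ ih1 ih2 =>
      obtain ⟨p1, q1, e1⟩ := ih1
      obtain ⟨p2, q2, e2⟩ := ih2
      refine ⟨p1 + p2, q1 + q2, fun x => ?_⟩
      simp only [ContinuousMap.add_apply, e1, e2, Polynomial.eval_add, map_add]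
      ring
    | smul c h _ ih =>
      obtain ⟨p, q, e⟩ := ih
      refine ⟨Polynomial.C c * p, Polynomial.C ((starRingEnd ℂ) c) * q, fun x => ?_⟩
      simp only [ContinuousMap.smul_apply, e, Polynomial.eval_mul, Polynomial.eval_C, map_mul,
        smul_eq_mul, Complex.conj_conj]
      ring
  have hG : G ∈ (Submodule.span ℂ (Set.range (@fourier (2 * Real.pi)))).topologicalClosure := by
    rw [span_fourier_closure_eq_top]; trivial
  obtain ⟨h, hh, hd⟩ := Metric.mem_closure_iff.1 hG ε hε
  obtain ⟨p, q, e⟩ := hspan h hh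
  refine ⟨p + q, fun ζ hζ => ?_⟩
  have hu : ‖ζ / r‖ = 1 := by
    rw [norm_div, hζ]; simp [abs_of_pos hr, hr.ne']
  obtain ⟨x, hx⟩ := (AddCircle.homeomorphCircle').surjective
    (⟨ζ / r, mem_sphere_zero_iff_norm.2 hu⟩ : Circle)
  have hx' : AddCircle.toCircle x = (⟨ζ / r, mem_sphere_zero_iff_norm.2 hu⟩ : Circle) := by
    rw [← hx]
    have := AddCircle.homeomorphCircle_apply (T := 2 * Real.pi) (by positivity) x
    rw [← this]
    induction x using QuotientAddGroup.induction_on with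
    | H z =>
      rw [AddCircle.homeomorphCircle_apply]
      erw [AddCircle.homeomorphCircle'_apply_mk]
      rw [AddCircle.toCircle_apply_mk]
      congr 1
      field_simp
  have hz : (r : ℂ) * (AddCircle.toCircle x : ℂ) = ζ := by
    rw [hx']
    have hr0 : (r : ℂ) ≠ 0 := by exact_mod_cast hr.ne'
    show (r : ℂ) * (ζ / r) = ζ
    field_simp
  have h1 : ‖G x - h x‖ < ε := by
    refine lt_of_le_of_lt ?_ hd
    rw [dist_eq_norm]
    exact (G - h).norm_coe_le_norm x
  rw [e, hz] at h1
  have h2 : G x = (g ζ : ℂ) := by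
    show ((g (r * (AddCircle.toCircle x : ℂ)) : ℝ) : ℂ) = _
    rw [hz]
  rw [h2] at h1
  refine lt_of_le_of_lt ?_ h1
  refine le_trans (le_of_eq ?_) (Complex.abs_re_le_norm _)
  simp

/-- A bounded upper semicontinuous function is the pointwise limit of a decreasing
sequence of continuous functions with the same bounds. -/
lemma exists_seq_continuous_of_usc {X : Type*} [PseudoMetricSpace X] [Nonempty X] {φ : X → ℝ}
    (hφ : UpperSemicontinuous φ) {M : ℝ} (hM : ∀ x, |φ x| ≤ M) :
    ∃ f : ℕ → X → ℝ, (∀ k, Continuous (f k)) ∧ (∀ k x, φ x ≤ f k x) ∧ (∀ k x, |f k x| ≤ M) ∧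
      ∀ x, Tendsto (fun k => f k x) atTop (𝓝 (φ x)) := by
  let f : ℕ → X → ℝ := fun k x => ⨆ y, (φ y - k * dist x y)
  have hle : ∀ (k : ℕ) x y, φ y - k * dist x y ≤ M := fun k x y => by
    have := (abs_le.1 (hM y)).2
    have : 0 ≤ (k : ℝ) * dist x y := mul_nonneg (Nat.cast_nonneg _) dist_nonneg
    linarith
  have hbdd : ∀ (k : ℕ) x, BddAbove (Set.range fun y => φ y - k * dist x y) := fun k x =>
    ⟨M, by rintro _ ⟨y, rfl⟩; exact hle k x y⟩
  have hge : ∀ k x, φ x ≤ f k x := fun k x => by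
    have := le_ciSup (hbdd k x) x
    simpa using this
  refine ⟨f, fun k => ?_, hge, fun k x => ?_, fun x => ?_⟩
  · refine (LipschitzWith.of_le_add_mul k fun x y => ?_).continuous
    refine ciSup_le fun z => ?_
    have h1 := le_ciSup (hbdd k y) z
    have h2 := dist_triangle y x z
    have h3 : (k : ℝ) * dist y z ≤ k * (dist y x + dist x z) := by gcongr
    rw [dist_comm y x] at h3
    simp only [NNReal.coe_natCast]
    show _ ≤ f k y + _
    have : φ z - k * dist y z ≤ f k y := h1
    linarith
  · exact abs_le.2 ⟨(abs_le.1 (hM x)).1.trans (hge k x), ciSup_le (hle k x)⟩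
  · refine tendsto_order.2 ⟨fun a ha => Eventually.of_forall fun k => ha.trans_le (hge k x),
      fun a ha => ?_⟩
    obtain ⟨b, hb1, hb2⟩ := exists_between ha
    obtain ⟨δ, hδ, hball⟩ := Metric.eventually_nhds_iff.1 (hφ x b hb1)
    obtain ⟨k0, hk0⟩ := exists_nat_gt ((M - b) / δ)
    filter_upwards [eventually_ge_atTop k0] with k hk
    refine lt_of_le_of_lt (ciSup_le fun y => ?_) hb2
    rcases lt_or_ge (dist y x) δ with h | h
    · have h1 : φ y < b := hball h
      have : 0 ≤ (k : ℝ) * dist x y := by positivity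
      linarith
    · have h1 := (abs_le.1 (hM y)).2
      rw [div_lt_iff₀ hδ] at hk0
      have : (k0 : ℝ) * δ ≤ k * dist x y := by
        rw [dist_comm x y]; gcongr
      linarith

/-- The circle average of the real part of a polynomial is its value at the centre. -/
lemma circleAverage_re_poly (p : Polynomial ℂ) (c : ℂ) (r : ℝ) :
    Real.circleAverage (fun ζ => (p.eval ζ).re) c r = (p.eval c).re := by
  have h1 : Real.circleAverage (fun ζ => p.eval ζ) c r = p.eval c :=
    DiffContOnCl.circleAverage p.differentiable.diffContOnCl
  have h2 := ContinuousLinearMap.circleAverage_comp_comm Complex.reCLM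
    (f := fun ζ => p.eval ζ) (c := c) (R := r)
    (p.continuous.continuousOn.circleIntegrable')
  rw [h1] at h2
  exact h2

lemma circleIntegrable_re_poly (p : Polynomial ℂ) (c : ℂ) (r : ℝ) :
    CircleIntegrable (fun ζ => (p.eval ζ).re) c r :=
  ContinuousOn.circleIntegrable' (Complex.continuous_re.comp p.continuous).continuousOn

/-- Bounded upper semicontinuous functions on a circle are circle integrable. -/
lemma circleIntegrable_of_usc {φ : ℂ → ℝ} {c : ℂ} {r : ℝ} (hr : 0 ≤ r)
    (hφ : UpperSemicontinuousOn φ (Metric.sphere c r)) {M : ℝ}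
    (hM : ∀ ζ ∈ Metric.sphere c r, |φ ζ| ≤ M) : CircleIntegrable φ c r := by
  have hmeas : Measurable (fun θ => φ (circleMap c r θ)) := by
    apply UpperSemicontinuous.measurable
    rw [← upperSemicontinuousOn_univ_iff]
    exact hφ.comp (continuous_circleMap c r).continuousOn
      (fun θ _ => circleMap_mem_sphere c hr θ)
  rw [CircleIntegrable, intervalIntegrable_iff]
  refine Measure.integrableOn_of_bounded (M := M) (by rw [Real.volume_uIoc]; exact ENNReal.ofReal_ne_top) hmeas.aestronglyMeasurable ?_
  filter_upwards with θ
  exact hM _ (circleMap_mem_sphere c hr θ)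

/-- A bounded upper semicontinuous function on a circle is dominated by the real part of a
polynomial with almost the same mean value. -/
lemma exists_poly_ge_of_usc {r : ℝ} (hr : 0 < r) {φ : ℂ → ℝ}
    (hφ : UpperSemicontinuousOn φ (Metric.sphere 0 r)) {M : ℝ}
    (hM : ∀ ζ ∈ Metric.sphere (0 : ℂ) r, |φ ζ| ≤ M) {ε : ℝ} (hε : 0 < ε) :
    ∃ p : Polynomial ℂ, (∀ ζ : ℂ, ‖ζ‖ = r → φ ζ ≤ (p.eval ζ).re) ∧
      (p.eval 0).re ≤ Real.circleAverage φ 0 r + ε := by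
  have : Nonempty (Metric.sphere (0 : ℂ) r) :=
    (NormedSpace.sphere_nonempty.2 hr.le).to_subtype
  obtain ⟨f, hfc, hfge, hfM, hft⟩ := exists_seq_continuous_of_usc
    (upperSemicontinuousOn_iff_restrict.2 hφ) (M := M) (fun x => hM x x.2)
  -- extend by zero
  classical
  let F : ℕ → ℂ → ℝ := fun k ζ => if h : ζ ∈ Metric.sphere (0 : ℂ) r then f k ⟨ζ, h⟩ else 0
  have hF : ∀ k, ContinuousOn (F k) (Metric.sphere 0 r) := fun k => by
    rw [continuousOn_iff_continuous_domRestrict]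
    refine (hfc k).congr fun x => ?_
    show f k x = F k x.1
    simp only [F, dif_pos x.2]
  have hFt : Tendsto (fun k => Real.circleAverage (F k) 0 r) atTop
      (𝓝 (Real.circleAverage φ 0 r)) := by
    simp only [Real.circleAverage_def]
    refine Tendsto.const_smul ?_ _
    refine intervalIntegral.tendsto_integral_filter_of_dominated_convergence (fun _ => M) ?_ ?_
      (by simp) ?_
    · refine Eventually.of_forall fun k => ?_
      refine Continuous.aestronglyMeasurable ?_
      exact (hF k).comp_continuous (continuous_circleMap 0 r)
        (fun θ => circleMap_mem_sphere 0 hr.le θ)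
    · refine Eventually.of_forall fun k => Eventually.of_forall fun θ _ => ?_
      have h := circleMap_mem_sphere 0 hr.le θ
      show ‖F k _‖ ≤ M
      simp only [F, dif_pos h]
      exact hfM _ _
    · refine Eventually.of_forall fun θ _ => ?_
      have h := circleMap_mem_sphere 0 hr.le θ
      simp only [F, dif_pos h]
      exact hft ⟨_, h⟩
  obtain ⟨k, hk⟩ := (hFt.eventually (gt_mem_nhds (show _ < Real.circleAverage φ 0 r + ε / 3 by linarith))).exists
  obtain ⟨p, hp⟩ := exists_poly_re_approx hr (hF k) (show 0 < ε / 3 by linarith)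
  refine ⟨p + Polynomial.C ((ε / 3 : ℝ) : ℂ), fun ζ hζ => ?_, ?_⟩
  · have hm : ζ ∈ Metric.sphere (0 : ℂ) r := by simpa using hζ
    have h1 := abs_lt.1 (hp ζ hζ)
    have h2 : φ ζ ≤ F k ζ := by
      simp only [F, dif_pos hm]
      exact hfge k ⟨ζ, hm⟩
    rw [Polynomial.eval_add, Polynomial.eval_C, Complex.add_re, Complex.ofReal_re]
    linarith
  · rw [← circleAverage_re_poly _ 0 r]
    have : Real.circleAverage (fun ζ => ((p + Polynomial.C ((ε / 3 : ℝ) : ℂ)).eval ζ).re) 0 r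
        ≤ Real.circleAverage (fun ζ => F k ζ + 2 * ε / 3) 0 r := by
      refine Real.circleAverage_mono (circleIntegrable_re_poly _ _ _) ?_ ?_
      · exact ((hF k).add continuousOn_const).circleIntegrable hr.le
      · intro ζ hζ
        rw [abs_of_pos hr] at hζ
        have h1 := abs_lt.1 (hp ζ (by simpa using hζ))
        rw [Polynomial.eval_add, Polynomial.eval_C, Complex.add_re, Complex.ofReal_re]
        linarith
    rw [Real.circleAverage_fun_add ((hF k).circleIntegrable hr.le)
      (circleIntegrable_const _ _ _), Real.circleAverage_const] at this
    linarith

end CircleApprox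

section RealPsh

variable {E : Type*} [NormedAddCommGroup E] [NormedSpace ℂ E]

/-- Plurisubharmonicity for real valued functions. -/
def RPsh (f : E → ℝ) (Ω : Set E) : Prop := PlurisubharmonicOn (fun z => (f z : EReal)) Ω

lemma continuous_disc (a b : E) : Continuous fun ζ : ℂ => a + ζ • b := by fun_prop

lemma rpsh_iff {f : E → ℝ} {Ω : Set E} : RPsh f Ω ↔ UpperSemicontinuousOn f Ω ∧
    ∀ a b : E, ∀ r : ℝ, 0 < r → (∀ ζ : ℂ, ‖ζ‖ ≤ r → a + ζ • b ∈ Ω) → ∀ p : Polynomial ℂ,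
      (∀ ζ : ℂ, ‖ζ‖ = r → f (a + ζ • b) ≤ (p.eval ζ).re) →
      ∀ ζ : ℂ, ‖ζ‖ ≤ r → f (a + ζ • b) ≤ (p.eval ζ).re := by
  unfold RPsh PlurisubharmonicOn
  simp only [EReal.coe_le_coe_iff]
  refine and_congr_left fun _ => ⟨fun h x hx y hy => ?_, fun h => ?_⟩
  · have := h x hx (y : EReal) (EReal.coe_lt_coe_iff.2 hy)
    filter_upwards [this] with z hz
    exact EReal.coe_lt_coe_iff.1 hz
  · exact continuous_coe_real_ereal.comp_upperSemicontinuousOn h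
      (fun _ _ hab => EReal.coe_le_coe_iff.2 hab)

lemma RPsh.usc {f : E → ℝ} {Ω : Set E} (h : RPsh f Ω) : UpperSemicontinuousOn f Ω :=
  (rpsh_iff.1 h).1

lemma PlurisubharmonicOn.mono {u : E → EReal} {Ω Ω' : Set E} (h : PlurisubharmonicOn u Ω)
    (hs : Ω' ⊆ Ω) : PlurisubharmonicOn u Ω' :=
  ⟨h.1.mono hs, fun a b r hr hd => h.2 a b r hr fun ζ hζ => hs (hd ζ hζ)⟩

lemma RPsh.mono {f : E → ℝ} {Ω Ω' : Set E} (h : RPsh f Ω) (hs : Ω' ⊆ Ω) : RPsh f Ω' :=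
  PlurisubharmonicOn.mono h hs

lemma UpperSemicontinuousOn.congr' {X Y : Type*} [TopologicalSpace X] [Preorder Y]
    {f g : X → Y} {s : Set X} (h : UpperSemicontinuousOn f s) (hfg : Set.EqOn f g s) :
    UpperSemicontinuousOn g s := by
  intro x hx y hy
  rw [← hfg hx] at hy
  filter_upwards [h x hx y hy, self_mem_nhdsWithin] with z hz hzs
  rwa [← hfg hzs]

lemma PlurisubharmonicOn.congr {u v : E → EReal} {Ω : Set E} (h : PlurisubharmonicOn u Ω)
    (huv : Set.EqOn u v Ω) : PlurisubharmonicOn v Ω := by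
  refine ⟨h.1.congr' huv, fun a b r hr hd p hp ζ hζ => ?_⟩
  rw [← huv (hd ζ hζ)]
  refine h.2 a b r hr hd p (fun ξ hξ => ?_) ζ hζ
  rw [huv (hd ξ hξ.le)]
  exact hp ξ hξ

lemma usc_disc {f : E → ℝ} {Ω : Set E} (h : UpperSemicontinuousOn f Ω) {a b : E} {s : Set ℂ}
    (hs : ∀ ζ ∈ s, a + ζ • b ∈ Ω) : UpperSemicontinuousOn (fun ζ : ℂ => f (a + ζ • b)) s :=
  h.comp (continuous_disc a b).continuousOn hs

lemma circleIntegrable_disc {f : E → ℝ} {Ω : Set E} (h : UpperSemicontinuousOn f Ω) {M : ℝ}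
    (hM : ∀ z ∈ Ω, |f z| ≤ M) {a b : E} {R : ℝ} (hR : 0 ≤ R)
    (hd : ∀ ζ : ℂ, ‖ζ‖ = R → a + ζ • b ∈ Ω) :
    CircleIntegrable (fun ζ : ℂ => f (a + ζ • b)) 0 R :=
  circleIntegrable_of_usc hR (usc_disc h fun ζ hζ => hd ζ (by simpa using hζ))
    (M := M) fun ζ hζ => hM _ (hd ζ (by simpa using hζ))

/-- Monotonicity of circular means of bounded psh functions. -/
lemma RPsh.circleAverage_mono_radius {f : E → ℝ} {Ω : Set E} (h : RPsh f Ω) {M : ℝ}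
    (hM : ∀ z ∈ Ω, |f z| ≤ M) {a b : E} {r R : ℝ} (hr : 0 ≤ r) (hrR : r ≤ R) (hR : 0 < R)
    (hd : ∀ ζ : ℂ, ‖ζ‖ ≤ R → a + ζ • b ∈ Ω) :
    Real.circleAverage (fun ζ : ℂ => f (a + ζ • b)) 0 r ≤
      Real.circleAverage (fun ζ : ℂ => f (a + ζ • b)) 0 R := by
  refine le_of_forall_pos_le_add fun ε hε => ?_
  obtain ⟨p, hp1, hp2⟩ := exists_poly_ge_of_usc hR (φ := fun ζ : ℂ => f (a + ζ • b))
    (usc_disc h.usc fun ζ hζ => hd ζ (by simp at hζ; exact hζ.le)) (M := M)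
    (fun ζ hζ => hM _ (hd ζ (by simp at hζ; exact hζ.le))) hε
  refine le_trans ?_ hp2
  have h2 := (rpsh_iff.1 h).2 a b R hR hd p hp1
  rw [← circleAverage_re_poly p 0 r]
  refine Real.circleAverage_mono (circleIntegrable_disc h.usc hM hr
    fun ζ hζ => hd ζ (hζ.le.trans hrR)) (circleIntegrable_re_poly _ _ _) fun ζ hζ => ?_
  rw [abs_of_nonneg hr] at hζ
  exact h2 ζ ((mem_sphere_zero_iff_norm.1 hζ).le.trans hrR)

/-- Sub-mean value inequality for bounded psh functions. -/
lemma RPsh.le_circleAverage {f : E → ℝ} {Ω : Set E} (h : RPsh f Ω) {M : ℝ}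
    (hM : ∀ z ∈ Ω, |f z| ≤ M) {a b : E} {R : ℝ} (hR : 0 < R)
    (hd : ∀ ζ : ℂ, ‖ζ‖ ≤ R → a + ζ • b ∈ Ω) :
    f a ≤ Real.circleAverage (fun ζ : ℂ => f (a + ζ • b)) 0 R := by
  have := h.circleAverage_mono_radius hM le_rfl hR.le hR hd
  simpa using this

/-- Bounded upper semicontinuous functions with the sub-mean value property are psh. -/
lemma rpsh_of_le_circleAverage {f : E → ℝ} {Ω : Set E} (h : UpperSemicontinuousOn f Ω) {M : ℝ}
    (hM : ∀ z ∈ Ω, |f z| ≤ M)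
    (hmean : ∀ a b : E, (∀ ζ : ℂ, ‖ζ‖ ≤ 1 → a + ζ • b ∈ Ω) →
      f a ≤ Real.circleAverage (fun ζ : ℂ => f (a + ζ • b)) 0 1) : RPsh f Ω := by
  refine rpsh_iff.2 ⟨h, fun a b r hr hd p hp ζ0 hζ0 => ?_⟩
  by_contra! hlt
  set δ := f (a + ζ0 • b) - (p.eval ζ0).re with hδ
  have hδ0 : 0 < δ := by linarith
  obtain ⟨η, hη, hηr⟩ : ∃ η : ℝ, 0 < η ∧ η * r ^ 2 < δ :=
    ⟨δ / (2 * r ^ 2), by positivity, by field_simp; linarith⟩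
  let G : ℂ → ℝ := fun ζ => f (a + ζ • b) + (-(p.eval ζ).re + η * (‖ζ‖ ^ 2 - r ^ 2))
  have hGusc : UpperSemicontinuousOn G (Metric.closedBall 0 r) := by
    refine UpperSemicontinuousOn.add (usc_disc h fun ζ hζ => hd ζ (by simpa using hζ)) ?_
    refine Continuous.upperSemicontinuous ?_ |>.upperSemicontinuousOn _
    have := Complex.continuous_re.comp p.continuous
    exact this.neg.add (by fun_prop)
  obtain ⟨ζ1, hζ1, hmax⟩ := hGusc.exists_isMaxOn
    ⟨0, by simp [hr.le]⟩ (isCompact_closedBall (0 : ℂ) r)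
  have hζ1' : ‖ζ1‖ ≤ r := by simpa using hζ1
  have hG1 : 0 < G ζ1 := by
    have h1 : G ζ0 ≤ G ζ1 := hmax (by simpa using hζ0)
    have h2 : 0 < G ζ0 := by
      simp only [G]
      nlinarith [sq_nonneg ‖ζ0‖, mul_nonneg hη.le (sq_nonneg ‖ζ0‖)]
    linarith
  have hlt1 : ‖ζ1‖ < r := by
    refine lt_of_le_of_ne hζ1' fun he => ?_
    have := hp ζ1 he
    simp only [G, he] at hG1
    linarith
  set ρ := r - ‖ζ1‖ with hρ
  have hρ0 : 0 < ρ := by linarith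
  have hdisc : ∀ ξ : ℂ, ‖ξ‖ ≤ 1 → ‖ζ1 + ρ * ξ‖ ≤ r := fun ξ hξ => by
    calc ‖ζ1 + ρ * ξ‖ ≤ ‖ζ1‖ + ρ * ‖ξ‖ := by
          refine (norm_add_le _ _).trans ?_
          simp [abs_of_pos hρ0]
      _ ≤ ‖ζ1‖ + ρ * 1 := by gcongr
      _ = r := by rw [hρ]; ring
  have hre : ∀ ξ : ℂ, (a + ζ1 • b) + ξ • ((ρ : ℂ) • b) = a + (ζ1 + ρ * ξ) • b := fun ξ => by
    rw [smul_smul, add_smul, mul_comm ξ, add_assoc]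
  have hd' : ∀ ξ : ℂ, ‖ξ‖ ≤ 1 → (a + ζ1 • b) + ξ • ((ρ : ℂ) • b) ∈ Ω := fun ξ hξ => by
    rw [hre]; exact hd _ (hdisc ξ hξ)
  have hm := hmean (a + ζ1 • b) ((ρ : ℂ) • b) hd'
  let q : Polynomial ℂ := p.comp (Polynomial.C ζ1 + Polynomial.C (ρ : ℂ) * Polynomial.X)
    - Polynomial.C (((2 * η * ρ : ℝ) : ℂ) * (starRingEnd ℂ) ζ1) * Polynomial.X
    + Polynomial.C ((G ζ1 - η * (‖ζ1‖ ^ 2 + ρ ^ 2 - r ^ 2) : ℝ) : ℂ)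
  have hq : ∀ ξ : ℂ, ‖ξ‖ = 1 → f ((a + ζ1 • b) + ξ • ((ρ : ℂ) • b)) ≤ (q.eval ξ).re := by
    intro ξ hξ
    have h1 : G (ζ1 + ρ * ξ) ≤ G ζ1 := hmax (by simpa using hdisc ξ hξ.le)
    have h2 : ‖ζ1 + ρ * ξ‖ ^ 2 = ‖ζ1‖ ^ 2 + ρ ^ 2 + 2 * ρ * ((starRingEnd ℂ) ζ1 * ξ).re := by
      have h3 : ‖ξ‖ ^ 2 = 1 := by rw [hξ]; norm_num
      rw [← Complex.normSq_eq_norm_sq, Complex.normSq_apply] at h3 ⊢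
      rw [← Complex.normSq_eq_norm_sq, Complex.normSq_apply]
      simp
      linear_combination ρ ^ 2 * h3
    rw [hre]
    simp only [G, h2] at h1
    simp only [q, Polynomial.eval_add, Polynomial.eval_sub, Polynomial.eval_comp,
      Polynomial.eval_mul, Polynomial.eval_C, Polynomial.eval_X, Complex.add_re, Complex.sub_re,
      Complex.ofReal_re]
    rw [mul_assoc (((2 * η * ρ : ℝ) : ℂ)), Complex.re_ofReal_mul]
    simp only [G] at *
    linarith
  have h3 : Real.circleAverage (fun ξ : ℂ => f ((a + ζ1 • b) + ξ • ((ρ : ℂ) • b))) 0 1 ≤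
      (q.eval 0).re := by
    rw [← circleAverage_re_poly q 0 1]
    refine Real.circleAverage_mono (circleIntegrable_disc h hM zero_le_one
      fun ξ hξ => hd' ξ hξ.le) (circleIntegrable_re_poly _ _ _) fun ξ hξ => hq ξ (by simpa using hξ)
  have h4 : (q.eval 0).re = (p.eval ζ1).re + (G ζ1 - η * (‖ζ1‖ ^ 2 + ρ ^ 2 - r ^ 2)) := by
    simp only [q, Polynomial.eval_add, Polynomial.eval_sub, Polynomial.eval_comp,
      Polynomial.eval_mul, Polynomial.eval_C, Polynomial.eval_X, Complex.add_re,
      Complex.ofReal_re, mul_zero, add_zero, sub_zero]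
  rw [h4] at h3
  have h5 : G ζ1 = f (a + ζ1 • b) + (-(p.eval ζ1).re + η * (‖ζ1‖ ^ 2 - r ^ 2)) := rfl
  have h6 : 0 < η * ρ ^ 2 := by positivity
  nlinarith

end RealPsh

section Closure

variable {E : Type*} [NormedAddCommGroup E] [NormedSpace ℂ E]

/-- Real parts of polynomials on discs obey the maximum principle. -/
lemma rpsh_const (x : ℝ) (Ω : Set E) : RPsh (fun _ : E => x) Ω := by
  refine rpsh_of_le_circleAverage upperSemicontinuousOn_const (M := |x|) (fun _ _ => le_rfl) ?_
  intro a b _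
  rw [Real.circleAverage_const]

lemma PlurisubharmonicOn.max {u v : E → EReal} {Ω : Set E} (hu : PlurisubharmonicOn u Ω)
    (hv : PlurisubharmonicOn v Ω) : PlurisubharmonicOn (fun z => max (u z) (v z)) Ω := by
  refine ⟨hu.1.sup hv.1, fun a b r hr hd p hp ζ hζ => max_le ?_ ?_⟩
  · exact hu.2 a b r hr hd p (fun ξ hξ => (le_max_left _ _).trans (hp ξ hξ)) ζ hζ
  · exact hv.2 a b r hr hd p (fun ξ hξ => (le_max_right _ _).trans (hp ξ hξ)) ζ hζ

lemma RPsh.max {f g : E → ℝ} {Ω : Set E} (hf : RPsh f Ω) (hg : RPsh g Ω) :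
    RPsh (fun z => max (f z) (g z)) Ω := by
  have := PlurisubharmonicOn.max hf hg
  refine this.congr fun z _ => ?_
  exact (EReal.coe_strictMono.monotone.map_max).symm

lemma PlurisubharmonicOn.comp_affine {F : Type*} [NormedAddCommGroup F] [NormedSpace ℂ F]
    {u : E → EReal} {Ω : Set E} (hu : PlurisubharmonicOn u Ω) (L : F →L[ℂ] E) (c : E)
    {Ω' : Set F} (h : ∀ x ∈ Ω', L x + c ∈ Ω) :
    PlurisubharmonicOn (fun x => u (L x + c)) Ω' := by
  refine ⟨hu.1.comp (L.continuous.add continuous_const).continuousOn h,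
    fun a b r hr hd p hp ζ hζ => ?_⟩
  have hre : ∀ ζ : ℂ, L (a + ζ • b) + c = (L a + c) + ζ • L b := fun ζ => by
    simp only [map_add, map_smul]; abel
  simp only [hre] at hp ⊢
  exact hu.2 _ _ r hr (fun ξ hξ => by rw [← hre]; exact h _ (hd ξ hξ)) p hp ζ hζ

lemma RPsh.comp_affine {F : Type*} [NormedAddCommGroup F] [NormedSpace ℂ F]
    {f : E → ℝ} {Ω : Set E} (hf : RPsh f Ω) (L : F →L[ℂ] E) (c : E)
    {Ω' : Set F} (h : ∀ x ∈ Ω', L x + c ∈ Ω) : RPsh (fun x => f (L x + c)) Ω' :=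
  PlurisubharmonicOn.comp_affine hf L c h

lemma RPsh.add {f g : E → ℝ} {Ω : Set E} (hf : RPsh f Ω) (hg : RPsh g Ω) {M N : ℝ}
    (hM : ∀ z ∈ Ω, |f z| ≤ M) (hN : ∀ z ∈ Ω, |g z| ≤ N) : RPsh (fun z => f z + g z) Ω := by
  refine rpsh_of_le_circleAverage (hf.usc.add hg.usc) (M := M + N) (fun z hz => ?_) ?_
  · exact (abs_add_le _ _).trans (add_le_add (hM z hz) (hN z hz))
  · intro a b hd
    rw [Real.circleAverage_fun_add
      (circleIntegrable_disc hf.usc hM zero_le_one fun ζ hζ => hd ζ hζ.le)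
      (circleIntegrable_disc hg.usc hN zero_le_one fun ζ hζ => hd ζ hζ.le)]
    exact add_le_add (hf.le_circleAverage hM one_pos hd) (hg.le_circleAverage hN one_pos hd)

lemma RPsh.const_mul {f : E → ℝ} {Ω : Set E} (hf : RPsh f Ω) {M : ℝ}
    (hM : ∀ z ∈ Ω, |f z| ≤ M) {c : ℝ} (hc : 0 ≤ c) : RPsh (fun z => c * f z) Ω := by
  refine rpsh_of_le_circleAverage ?_ (M := c * M) (fun z hz => ?_) ?_
  · have : Continuous fun x : ℝ => c * x := by fun_prop
    exact this.comp_upperSemicontinuousOn hf.usc (fun x y hxy => mul_le_mul_of_nonneg_left hxy hc)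
  · rw [abs_mul, abs_of_nonneg hc]; exact mul_le_mul_of_nonneg_left (hM z hz) hc
  · intro a b hd
    have := Real.circleAverage_fun_smul (a := c) (f := fun ζ : ℂ => f (a + ζ • b)) (c := 0) (R := 1)
    simp only [smul_eq_mul] at this
    rw [this]
    exact mul_le_mul_of_nonneg_left (hf.le_circleAverage hM one_pos hd) hc

/-- Pluriharmonic functions may be added to plurisubharmonic ones. -/
lemma PlurisubharmonicOn.add_pluriharmonic {u : E → EReal} {Ω : Set E}
    (hu : PlurisubharmonicOn u Ω) {l : E → ℝ} (hlc : ContinuousOn l Ω) (hl : RPsh l Ω)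
    (hl' : RPsh (fun z => -l z) Ω) : PlurisubharmonicOn (fun z => u z + (l z : EReal)) Ω := by
  have hmax : ∀ (x : ℝ) (e : EReal) (y : ℝ), e + (x : EReal) ≤ y ↔ e ≤ ((y - x : ℝ) : EReal) := by
    intro x e y
    rw [EReal.coe_sub]
    rw [EReal.le_sub_iff_add_le] <;> simp
  refine ⟨?_, fun a b r hr hd p hp ζ hζ => ?_⟩
  · refine UpperSemicontinuousOn.add' hu.1
      ((continuous_coe_real_ereal.comp_continuousOn hlc).upperSemicontinuousOn) ?_
    intro x hx
    exact EReal.continuousAt_add (Or.inr (EReal.coe_ne_bot _)) (Or.inr (EReal.coe_ne_top _))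
  · have key : ∀ ε : ℝ, 0 < ε → u (a + ζ • b) + (l (a + ζ • b) : EReal) ≤
        (((p.eval ζ).re + ε : ℝ) : EReal) := by
      intro ε hε
      have hc : ContinuousOn (fun ζ : ℂ => l (a + ζ • b)) (Metric.sphere 0 r) :=
        hlc.comp (continuous_disc a b).continuousOn fun ξ hξ => hd ξ (by simp at hξ; exact hξ.le)
      obtain ⟨q, hq⟩ := exists_poly_re_approx hr hc (half_pos hε)
      have h1 := (rpsh_iff.1 hl).2 a b r hr hd (q + Polynomial.C ((ε / 2 : ℝ) : ℂ)) (fun ξ hξ => by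
        have := abs_lt.1 (hq ξ hξ)
        simp only [Polynomial.eval_add, Polynomial.eval_C, Complex.add_re, Complex.ofReal_re]
        linarith) ζ hζ
      have h2 := hu.2 a b r hr hd (p - q + Polynomial.C ((ε / 2 : ℝ) : ℂ)) (fun ξ hξ => by
        have h3 := abs_lt.1 (hq ξ hξ)
        refine ((hmax _ _ _).1 (hp ξ hξ)).trans ?_
        simp only [Polynomial.eval_add, Polynomial.eval_sub, Polynomial.eval_C, Complex.add_re,
          Complex.sub_re, Complex.ofReal_re, EReal.coe_le_coe_iff]
        linarith) ζ hζ
      rw [hmax]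
      refine h2.trans ?_
      simp only [Polynomial.eval_add, Polynomial.eval_sub, Polynomial.eval_C, Complex.add_re,
        Complex.sub_re, Complex.ofReal_re, EReal.coe_le_coe_iff] at h1 ⊢
      linarith
    rw [hmax]
    refine le_of_forall_gt_imp_ge_of_dense fun c hc => ?_
    induction c with
    | bot => simp at hc
    | top => exact le_top
    | coe c =>
      rw [EReal.coe_lt_coe_iff] at hc
      have := key (c - ((p.eval ζ).re - l (a + ζ • b))) (by linarith)
      rw [hmax] at this
      refine this.trans (EReal.coe_le_coe_iff.2 (by linarith))

/-- An `EReal` bound holding up to every positive error. -/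
lemma ereal_le_coe_of_forall_add {e : EReal} {y : ℝ}
    (h : ∀ ε : ℝ, 0 < ε → e ≤ ((y + ε : ℝ) : EReal)) : e ≤ y := by
  refine le_of_forall_gt_imp_ge_of_dense fun c hc => ?_
  induction c with
  | bot => simp at hc
  | top => exact le_top
  | coe c =>
    rw [EReal.coe_lt_coe_iff] at hc
    simpa using h (c - y) (by linarith)

lemma usc_lt_eventually {X : Type*} [TopologicalSpace X] {u : X → EReal} {s : Set X} {x : X}
    (hu : UpperSemicontinuousWithinAt u s x) {g : X → ℝ} (hg : ContinuousWithinAt g s x)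
    (h : u x < (g x : EReal)) : ∀ᶠ y in 𝓝[s] x, u y < (g y : EReal) := by
  obtain ⟨c, hc1, hc2⟩ := exists_between h
  have h2 := (continuous_coe_real_ereal.continuousAt.comp_continuousWithinAt hg).eventually
    (lt_mem_nhds hc2)
  filter_upwards [hu c hc1, h2] with y h3 h4 using h3.trans h4

/-- Decreasing limits of psh functions are psh. -/
lemma plurisubharmonicOn_iInf {u : ℕ → E → EReal} {Ω : Set E}
    (hu : ∀ k, PlurisubharmonicOn (u k) Ω) (hanti : ∀ k, ∀ z ∈ Ω, u (k + 1) z ≤ u k z) :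
    PlurisubharmonicOn (fun z => ⨅ k, u k z) Ω := by
  refine ⟨upperSemicontinuousOn_iInf fun k => (hu k).1, fun a b r hr hd p hp ζ hζ => ?_⟩
  have hanti' : ∀ z ∈ Ω, Antitone fun k => u k z := fun z hz =>
    antitone_nat_of_succ_le fun k => hanti k z hz
  refine ereal_le_coe_of_forall_add fun ε hε => ?_
  have hcpt := isCompact_sphere (0 : ℂ) r
  have : ∃ k, ∀ ζ ∈ Metric.sphere (0 : ℂ) r, u k (a + ζ • b) ≤ (((p.eval ζ).re + ε : ℝ) : EReal) := by
    refine hcpt.induction_on (p := fun s => ∃ k, ∀ ζ ∈ s ∩ Metric.sphere (0 : ℂ) r,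
      u k (a + ζ • b) ≤ (((p.eval ζ).re + ε : ℝ) : EReal)) ⟨0, by simp⟩
      (fun s t hst ⟨k, hk⟩ => ⟨k, fun ζ hζ => hk ζ ⟨hst hζ.1, hζ.2⟩⟩)
      (fun s t ⟨k, hk⟩ ⟨l, hl⟩ => ⟨max k l, fun ζ hζ => ?_⟩) (fun ζ hζ => ?_) |>.imp
      fun k hk ζ hζ => hk ζ ⟨hζ, hζ⟩
    · have hm : a + ζ • b ∈ Ω := hd ζ (by simpa using (mem_sphere_zero_iff_norm.1 hζ.2).le)
      rcases hζ.1 with h | h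
      · exact (hanti' _ hm (le_max_left k l)).trans (hk ζ ⟨h, hζ.2⟩)
      · exact (hanti' _ hm (le_max_right k l)).trans (hl ζ ⟨h, hζ.2⟩)
    · have h1 := hp ζ (by simpa using hζ)
      have h2 : (⨅ k, u k (a + ζ • b)) < (((p.eval ζ).re + ε : ℝ) : EReal) :=
        lt_of_le_of_lt h1 (EReal.coe_lt_coe_iff.2 (by linarith))
      obtain ⟨k, hk⟩ := iInf_lt_iff.1 h2
      have husc : UpperSemicontinuousOn (fun ζ : ℂ => u k (a + ζ • b)) (Metric.sphere 0 r) :=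
        (hu k).1.comp (continuous_disc a b).continuousOn
          fun ξ hξ => hd ξ (mem_sphere_zero_iff_norm.1 hξ).le
      have h3 := usc_lt_eventually (husc ζ hζ) (g := fun ζ => (p.eval ζ).re + ε)
        ((Complex.continuous_re.comp p.continuous).add continuous_const).continuousWithinAt hk
      exact ⟨_, h3, k, fun ξ hξ => le_of_lt hξ.1⟩
  obtain ⟨k, hk⟩ := this
  refine (iInf_le _ k).trans ?_
  have := (hu k).2 a b r hr hd (p + Polynomial.C (ε : ℂ)) (fun ξ hξ => ?_) ζ hζ
  · simpa using this
  · simpa using hk ξ (by simpa using hξ)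

lemma le_uscReg {f : E → EReal} {Ω : Set E} {z : E} (hz : z ∈ Ω) : f z ≤ uscReg f Ω z := by
  refine le_limsup_of_frequently_le' ?_
  refine Filter.Frequently.filter_mono ?_ (pure_le_nhdsWithin hz)
  simp

lemma uscReg_usc (f : E → EReal) (Ω : Set E) : UpperSemicontinuousOn (uscReg f Ω) Ω := by
  intro x hx y hy
  obtain ⟨c, hc1, hc2⟩ := exists_between hy
  have h := eventually_lt_of_limsup_lt hc1
  have h' := eventually_eventually_nhdsWithin.2 h
  filter_upwards [h'] with z hz
  refine lt_of_le_of_lt ?_ hc2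
  exact limsup_le_of_le (h := hz.mono fun w hw => hw.le)

lemma uscReg_le {f h : E → EReal} {Ω : Set E} (hf : ∀ z ∈ Ω, f z ≤ h z)
    (hh : UpperSemicontinuousOn h Ω) {z : E} (hz : z ∈ Ω) : uscReg f Ω z ≤ h z := by
  refine le_of_forall_gt_imp_ge_of_dense fun c hc => ?_
  refine limsup_le_of_le (h := ?_)
  filter_upwards [hh z hz c hc, self_mem_nhdsWithin] with w hw hwΩ
  exact (hf w hwΩ).trans hw.le

/-- The regularized supremum of a family of negative psh functions is psh. -/
lemma plurisubharmonicOn_uscReg_iSup {ι : Sort*} {u : ι → E → EReal} {Ω : Set E} (hΩ : IsOpen Ω)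
    (hu : ∀ i, PlurisubharmonicOn (u i) Ω) :
    PlurisubharmonicOn (uscReg (fun z => ⨆ i, u i z) Ω) Ω := by
  refine ⟨uscReg_usc _ _, fun a b r hr hd p hp ζ hζ => ?_⟩
  refine ereal_le_coe_of_forall_add fun ε hε => ?_
  set s : E → EReal := fun z => ⨆ i, u i z with hs
  have hcont : Continuous fun z : E × ℂ => z.1 + z.2 • b := by fun_prop
  have h1 : ∀ᶠ y in 𝓝 a, ∀ ξ ∈ Metric.sphere (0 : ℂ) r,
      s (y + ξ • b) ≤ (((p.eval ξ).re + ε : ℝ) : EReal) := by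
    refine (isCompact_sphere (0 : ℂ) r).eventually_forall_of_forall_eventually fun ξ hξ => ?_
    have hξr := mem_sphere_zero_iff_norm.1 hξ
    have h2 : uscReg s Ω (a + ξ • b) < (((p.eval ξ).re + ε / 2 : ℝ) : EReal) :=
      lt_of_le_of_lt (hp ξ hξr) (EReal.coe_lt_coe_iff.2 (by linarith))
    have h3 := eventually_lt_of_limsup_lt h2
    rw [hΩ.nhdsWithin_eq (hd ξ hξr.le)] at h3
    have h4 : ∀ᶠ z : E × ℂ in 𝓝 (a, ξ), s (z.1 + z.2 • b) < (((p.eval ξ).re + ε / 2 : ℝ) : EReal) :=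
      (hcont.tendsto (a, ξ)).eventually h3
    have h5 : ∀ᶠ z : E × ℂ in 𝓝 (a, ξ), (p.eval ξ).re - ε / 2 < (p.eval z.2).re := by
      have : Continuous fun z : E × ℂ => (p.eval z.2).re :=
        (Complex.continuous_re.comp p.continuous).comp continuous_snd
      exact this.continuousAt.eventually (lt_mem_nhds (by simp; linarith))
    filter_upwards [h4, h5] with z h6 h7
    exact h6.le.trans (EReal.coe_le_coe_iff.2 (by linarith))
  have h2 : ∀ᶠ y in 𝓝 a, ∀ ξ ∈ Metric.closedBall (0 : ℂ) r, y + ξ • b ∈ Ω := by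
    refine (isCompact_closedBall (0 : ℂ) r).eventually_forall_of_forall_eventually fun ξ hξ => ?_
    exact hcont.continuousAt.eventually (hΩ.mem_nhds (hd ξ (by simpa using hξ)))
  have h3 : ∀ᶠ y in 𝓝 a, s (y + ζ • b) ≤ (((p.eval ζ).re + ε : ℝ) : EReal) := by
    filter_upwards [h1, h2] with y h4 h5
    refine iSup_le fun i => ?_
    have := (hu i).2 y b r hr (fun ξ hξ => h5 ξ (by simpa using hξ)) (p + Polynomial.C (ε : ℂ))
      (fun ξ hξ => ?_) ζ hζ
    · simpa using this
    · refine (le_iSup (fun i => u i (y + ξ • b)) i).trans ?_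
      have := h4 ξ (by simpa using hξ)
      simpa only [Polynomial.eval_add, Polynomial.eval_C, Complex.add_re, Complex.ofReal_re]
        using this
  have h4 : Tendsto (fun x => x - ζ • b) (𝓝 (a + ζ • b)) (𝓝 a) := by
    have : Continuous fun x : E => x - ζ • b := by fun_prop
    simpa using this.tendsto (a + ζ • b)
  refine limsup_le_of_le (h := ?_)
  refine Filter.Eventually.filter_mono nhdsWithin_le_nhds ?_
  filter_upwards [h4.eventually h3] with x hx
  simpa using hx

/-- Truncation of a negative function at level `-N`. -/
def trunc (N : ℝ) (u : E → EReal) (z : E) : ℝ := (max (u z) ((-N : ℝ) : EReal)).toReal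

lemma coe_trunc {u : E → EReal} {z : E} (h : u z ≤ 0) (N : ℝ) :
    ((trunc N u z : ℝ) : EReal) = max (u z) ((-N : ℝ) : EReal) := by
  refine EReal.coe_toReal (ne_of_lt ?_) (ne_of_gt ?_)
  · exact max_lt (h.trans_lt EReal.zero_lt_top) (EReal.coe_lt_top _)
  · exact lt_max_of_lt_right (EReal.bot_lt_coe _)

lemma trunc_le_zero {u : E → EReal} {z : E} (h : u z ≤ 0) {N : ℝ} (hN : 0 ≤ N) :
    trunc N u z ≤ 0 := by
  rw [← EReal.coe_le_coe_iff, coe_trunc h]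
  exact max_le h (EReal.coe_le_coe_iff.2 (by linarith))

lemma neg_le_trunc {u : E → EReal} {z : E} (h : u z ≤ 0) (N : ℝ) : -N ≤ trunc N u z := by
  rw [← EReal.coe_le_coe_iff, coe_trunc h]
  exact le_max_right _ _

lemma abs_trunc_le {u : E → EReal} {z : E} (h : u z ≤ 0) {N : ℝ} (hN : 0 ≤ N) :
    |trunc N u z| ≤ N :=
  abs_le.2 ⟨neg_le_trunc h N, (trunc_le_zero h hN).trans hN⟩

lemma trunc_mono {u v : E → EReal} {z : E} (huv : u z ≤ v z) (hv : v z ≤ 0) (N : ℝ) :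
    trunc N u z ≤ trunc N v z := by
  rw [← EReal.coe_le_coe_iff, coe_trunc hv, coe_trunc (huv.trans hv)]
  exact max_le_max_right _ huv

lemma PSHNeg.rpsh_trunc {u : E → EReal} {Ω : Set E} (hu : PSHNeg u Ω) (N : ℝ) : RPsh (trunc N u) Ω :=
  (hu.1.max (rpsh_const (-N) Ω)).congr fun z hz => (coe_trunc (hu.2 z hz) N).symm

lemma iInf_trunc {u : E → EReal} {z : E} (h : u z ≤ 0) :
    (⨅ N : ℕ, ((trunc N u z : ℝ) : EReal)) = u z := by
  refine le_antisymm ?_ (le_iInf fun N => by rw [coe_trunc h]; exact le_max_left _ _)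
  refine le_of_forall_gt_imp_ge_of_dense fun c hc => ?_
  induction c with
  | bot => simp at hc
  | top => exact le_top
  | coe c =>
    obtain ⟨N, hN⟩ := exists_nat_ge (-c)
    refine (iInf_le _ N).trans ?_
    rw [coe_trunc h]
    exact max_le hc.le (EReal.coe_le_coe_iff.2 (by linarith))

lemma trunc_anti {u : E → EReal} {z : E} (h : u z ≤ 0) {N N' : ℝ} (hN : N ≤ N') :
    trunc N' u z ≤ trunc N u z := by
  rw [← EReal.coe_le_coe_iff, coe_trunc h, coe_trunc h]
  exact max_le_max_left _ (EReal.coe_le_coe_iff.2 (by linarith))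

lemma trunc_eq_bot_or {u : E → EReal} {z : E} (h : u z ≤ 0) (hb : u z ≠ ⊥) (N : ℝ) :
    trunc N u z = max (u z).toReal (-N) := by
  have : u z = (((u z).toReal : ℝ) : EReal) :=
    (EReal.coe_toReal (ne_of_lt (h.trans_lt EReal.zero_lt_top)) hb).symm
  rw [← EReal.coe_eq_coe_iff, coe_trunc h, EReal.coe_strictMono.monotone.map_max, ← this]

/-- Sums of negative psh functions. -/
lemma PSHNeg.add {u v : E → EReal} {Ω : Set E} (hu : PSHNeg u Ω) (hv : PSHNeg v Ω) :
    PSHNeg (fun z => u z + v z) Ω := by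
  refine ⟨?_, fun z hz => add_nonpos (hu.2 z hz) (hv.2 z hz)⟩
  have h1 : ∀ k : ℕ, RPsh (fun z => trunc k u z + trunc k v z) Ω := fun k =>
    (hu.rpsh_trunc k).add (hv.rpsh_trunc k) (M := k) (N := k)
      (fun z hz => abs_trunc_le (hu.2 z hz) k.cast_nonneg)
      (fun z hz => abs_trunc_le (hv.2 z hz) k.cast_nonneg)
  refine (plurisubharmonicOn_iInf h1 fun k z hz => ?_).congr fun z hz => ?_
  · refine EReal.coe_le_coe_iff.2 (add_le_add ?_ ?_)
    · exact trunc_anti (hu.2 z hz) (by push_cast; linarith)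
    · exact trunc_anti (hv.2 z hz) (by push_cast; linarith)
  · have hu0 := hu.2 z hz
    have hv0 := hv.2 z hz
    refine le_antisymm ?_ (le_iInf fun k => ?_)
    · refine EReal.le_add_of_forall_gt (Or.inr (ne_of_lt (hv0.trans_lt EReal.zero_lt_top)))
        (Or.inl (ne_of_lt (hu0.trans_lt EReal.zero_lt_top))) fun a' ha b' hb => ?_
      rw [← iInf_trunc hu0] at ha
      rw [← iInf_trunc hv0] at hb
      obtain ⟨k, hk⟩ := iInf_lt_iff.1 ha
      obtain ⟨l, hl⟩ := iInf_lt_iff.1 hb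
      refine (iInf_le _ (max k l)).trans ?_
      rw [EReal.coe_add]
      refine add_le_add (le_trans (EReal.coe_le_coe_iff.2 ?_) hk.le)
        (le_trans (EReal.coe_le_coe_iff.2 ?_) hl.le)
      · exact trunc_anti hu0 (by exact_mod_cast le_max_left k l)
      · exact trunc_anti hv0 (by exact_mod_cast le_max_right k l)
    · rw [EReal.coe_add, coe_trunc hu0, coe_trunc hv0]
      exact add_le_add (le_max_left _ _) (le_max_left _ _)

/-- `C log ‖ζ‖` is harmonic on the annulus. -/
lemma rpsh_log (C : ℝ) : RPsh (fun ζ : ℂ => C * Real.log ‖ζ‖) annA := by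
  have hb : ∀ ζ ∈ annA, |Real.log ‖ζ‖| ≤ 1 := fun ζ hζ => by
    have h0 : 0 < ‖ζ‖ := by have := hζ.1; linarith
    rw [abs_of_nonneg (Real.log_nonneg hζ.1.le), Real.log_le_iff_le_exp h0]
    exact hζ.2.le
  refine rpsh_of_le_circleAverage (M := |C|) ?_ (fun ζ hζ => ?_) fun a b hd => ?_
  · refine ContinuousOn.upperSemicontinuousOn (continuousOn_const.mul ?_)
    refine continuous_norm.continuousOn.log fun ζ hζ => ?_
    have := hζ.1
    intro h0
    linarith
  · rw [abs_mul]
    have := mul_le_mul_of_nonneg_left (hb ζ hζ) (abs_nonneg C)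
    simpa using this
  · have hh : InnerProductSpace.HarmonicOnNhd (fun ζ : ℂ => Real.log ‖a + ζ • b‖)
        (Metric.closedBall 0 |1|) := by
      intro ζ hζ
      have hζ' : a + ζ • b ∈ annA := hd ζ (by simpa using hζ)
      refine AnalyticAt.harmonicAt_log_norm (f := fun ζ : ℂ => a + ζ • b) ?_ ?_
      · exact analyticAt_const.add (analyticAt_id.smul analyticAt_const)
      · intro h0
        have := hζ'.1
        simp only [h0, norm_zero] at this
        linarith
    have := InnerProductSpace.HarmonicOnNhd.circleAverage_eq hh
    have h2 := Real.circleAverage_fun_smul (a := C) (f := fun ζ : ℂ => Real.log ‖a + ζ • b‖)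
      (c := 0) (R := 1)
    simp only [smul_eq_mul] at h2 this ⊢
    rw [h2, this]
    simp

end Closure

section Kernel

lemma coe_smul_eq {E : Type*} [NormedAddCommGroup E] [NormedSpace ℂ E] [NormedSpace ℝ E]
    [IsScalarTower ℝ ℂ E] (t : ℝ) (x : E) : (t : ℂ) • x = t • x := by
  rw [← algebraMap_smul ℂ t x]; rfl

variable {E : Type*} [NormedAddCommGroup E] [NormedSpace ℂ E] [NormedSpace ℝ E]
  [IsScalarTower ℝ ℂ E] [FiniteDimensional ℝ E] [MeasurableSpace E] [BorelSpace E]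

lemma exists_kernel (μ : Measure E) [μ.IsAddHaarMeasure] : ∃ ρ : E → ℝ,
    ContDiff ℝ (⊤ : ℕ∞) ρ ∧ (∀ y, 0 ≤ ρ y) ∧ (∀ y, ρ y ≠ 0 → ‖y‖ < 1) ∧ HasCompactSupport ρ ∧
    ∫ y, ρ y ∂μ = 1 ∧ (∀ (ζ : ℂ) (y : E), ‖ζ‖ = 1 → ρ (ζ • y) = ρ y) ∧ 0 < ρ 0 := by
  have hfin : FiniteDimensional ℂ E := FiniteDimensional.right ℝ ℂ E
  let e : E ≃L[ℂ] EuclideanSpace ℂ (Fin (Module.finrank ℂ E)) :=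
    ContinuousLinearEquiv.ofFinrankEq (by simp)
  obtain ⟨C, hC, hCe⟩ : ∃ C : ℝ, 0 < C ∧ ∀ y : E, ‖y‖ ≤ C * ‖e y‖ := by
    let es : EuclideanSpace ℂ (Fin (Module.finrank ℂ E)) →L[ℂ] E := e.symm.toContinuousLinearMap
    refine ⟨‖es‖ + 1, by positivity, fun y => ?_⟩
    have := es.le_opNorm (e y)
    have he : es (e y) = y := e.symm_apply_apply y
    rw [he] at this
    nlinarith [norm_nonneg (e y)]
  let eR : E →L[ℝ] EuclideanSpace ℂ (Fin (Module.finrank ℂ E)) :=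
    (e : E →L[ℂ] _).restrictScalars ℝ
  let ρ0 : E → ℝ := fun y => Real.smoothTransition (1 - C ^ 2 * ‖e y‖ ^ 2)
  have hs : ContDiff ℝ (⊤ : ℕ∞) ρ0 := by
    refine Real.smoothTransition.contDiff.comp (contDiff_const.sub (contDiff_const.mul ?_))
    exact (contDiff_norm_sq ℂ).comp eR.contDiff
  have hsupp : ∀ y, ρ0 y ≠ 0 → ‖y‖ < 1 := fun y hy => by
    by_contra! h
    apply hy
    refine Real.smoothTransition.zero_of_nonpos ?_
    have h1 := hCe y
    have : 1 ≤ C * ‖e y‖ := h.trans h1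
    nlinarith
  have hcs : HasCompactSupport ρ0 := by
    refine HasCompactSupport.of_support_subset_isCompact (isCompact_closedBall (0 : E) 1) ?_
    intro y hy
    simpa using (hsupp y hy).le
  have hpos : 0 < ∫ y, ρ0 y ∂μ := by
    refine hs.continuous.integral_pos_of_hasCompactSupport_nonneg_nonzero hcs
      (fun y => Real.smoothTransition.nonneg _) (x := 0) ?_
    simp [ρ0]
  refine ⟨fun y => (∫ y, ρ0 y ∂μ)⁻¹ * ρ0 y, contDiff_const.mul hs,
    fun y => mul_nonneg (inv_nonneg.2 hpos.le) (Real.smoothTransition.nonneg _),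
    fun y hy => hsupp y (right_ne_zero_of_mul hy), hcs.mul_left, ?_, fun ζ y hζ => ?_,
    mul_pos (inv_pos.2 hpos) (by simp [ρ0])⟩
  · rw [integral_const_mul, inv_mul_cancel₀ hpos.ne']
  · simp [ρ0, norm_smul, hζ]

/-- A smooth, compactly supported, circle invariant mollification kernel. -/
def kern (μ : Measure E) [μ.IsAddHaarMeasure] : E → ℝ := (exists_kernel μ).choose

variable (μ : Measure E) [μ.IsAddHaarMeasure]

lemma kern_smooth : ContDiff ℝ (⊤ : ℕ∞) (kern μ) := (exists_kernel μ).choose_spec.1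
lemma kern_nonneg (y : E) : 0 ≤ kern μ y := (exists_kernel μ).choose_spec.2.1 y
lemma kern_supp {y : E} (h : kern μ y ≠ 0) : ‖y‖ < 1 := (exists_kernel μ).choose_spec.2.2.1 y h
lemma kern_compact : HasCompactSupport (kern μ) := (exists_kernel μ).choose_spec.2.2.2.1
lemma kern_integral : ∫ y, kern μ y ∂μ = 1 := (exists_kernel μ).choose_spec.2.2.2.2.1
lemma kern_circle {ζ : ℂ} (hζ : ‖ζ‖ = 1) (y : E) : kern μ (ζ • y) = kern μ y :=
  (exists_kernel μ).choose_spec.2.2.2.2.2.1 ζ y hζ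
lemma kern_zero_pos : 0 < kern μ 0 := (exists_kernel μ).choose_spec.2.2.2.2.2.2
lemma kern_integrable : Integrable (kern μ) μ :=
  (kern_smooth μ).continuous.integrable_of_hasCompactSupport (kern_compact μ)

/-- Multiplication by a unit complex number preserves Haar measure. -/
lemma measurePreserving_circle {ζ : ℂ} (hζ : ‖ζ‖ = 1) :
    MeasurePreserving (fun y : E => ζ • y) μ μ := by
  have hζ0 : ζ ≠ 0 := by intro h; simp [h] at hζ
  let fC : E →L[ℂ] E := ζ • ContinuousLinearMap.id ℂ E
  let f : E →L[ℝ] E := fC.restrictScalars ℝ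
  have hf : ∀ y, f y = ζ • y := fun y => rfl
  have himg : f '' Metric.ball 0 1 = Metric.ball 0 1 := by
    ext y
    simp only [Set.mem_image, mem_ball_zero_iff, hf]
    constructor
    · rintro ⟨x, hx, rfl⟩
      rwa [norm_smul, hζ, one_mul]
    · intro hy
      refine ⟨ζ⁻¹ • y, ?_, ?_⟩
      · rwa [norm_smul, norm_inv, hζ, inv_one, one_mul]
      · rw [smul_smul, mul_inv_cancel₀ hζ0, one_smul]
  have h1 := Measure.addHaar_image_continuousLinearMap μ f (Metric.ball 0 1)
  rw [himg] at h1
  have h2 : ENNReal.ofReal |LinearMap.det (f : E →ₗ[ℝ] E)| = 1 := by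
    have hb : μ (Metric.ball (0 : E) 1) ≠ 0 := (Metric.measure_ball_pos μ 0 one_pos).ne'
    have hb' : μ (Metric.ball (0 : E) 1) ≠ ⊤ := measure_ball_lt_top.ne
    rw [eq_comm, ENNReal.mul_eq_right hb hb'] at h1
    exact h1
  have h3 : |LinearMap.det (f : E →ₗ[ℝ] E)| = 1 := by
    rwa [ENNReal.ofReal_eq_one] at h2
  have h4 : LinearMap.det (f : E →ₗ[ℝ] E) ≠ 0 := by
    intro h; rw [h] at h3; simp at h3
  refine ⟨f.continuous.measurable, ?_⟩
  have := Measure.map_linearMap_addHaar_eq_smul_addHaar μ h4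
  rw [abs_inv, h3, inv_one, ENNReal.ofReal_one, one_smul] at this
  exact this

/-- Mollification of a function. -/
def moll (δ : ℝ) (F : E → ℝ) (x : E) : ℝ := ∫ y, kern μ y * F (x - δ • y) ∂μ

section Basic

variable {F G : E → ℝ} (hF : Measurable F) {M : ℝ} (hM : ∀ x, |F x| ≤ M)
include hF hM

lemma kern_mul_integrable (φ : E → E) (hφ : Measurable φ) :
    Integrable (fun y => kern μ y * F (φ y)) μ :=
  (kern_integrable μ).mul_bdd (c := M) (hF.comp hφ).aestronglyMeasurable
    (Eventually.of_forall fun y => hM _)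

lemma moll_integrable (δ : ℝ) (x : E) : Integrable (fun y => kern μ y * F (x - δ • y)) μ :=
  kern_mul_integrable μ hF hM _ (by fun_prop)

lemma abs_moll_le (δ : ℝ) (x : E) : |moll μ δ F x| ≤ M := by
  have h1 : |moll μ δ F x| ≤ ∫ y, kern μ y * M ∂μ := by
    refine (abs_integral_le_integral_abs).trans (integral_mono ?_ ?_ fun y => ?_)
    · exact (moll_integrable μ hF hM δ x).abs
    · exact (kern_integrable μ).mul_const M
    · simp only [abs_mul, abs_of_nonneg (kern_nonneg μ y)]
      exact mul_le_mul_of_nonneg_left (hM _) (kern_nonneg μ y)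
  rwa [integral_mul_const, kern_integral, one_mul] at h1

lemma moll_contDiff {δ : ℝ} (hδ : 0 < δ) : ContDiff ℝ (⊤ : ℕ∞) (moll μ δ F) := by
  let k : E → ℝ := fun w => kern μ (δ⁻¹ • w)
  have hk : ContDiff ℝ (⊤ : ℕ∞) k := (kern_smooth μ).comp
    (contDiff_const_smul δ⁻¹ : ContDiff ℝ (⊤ : ℕ∞) (fun w : E => δ⁻¹ • w))
  have hkc : HasCompactSupport k := by
    refine HasCompactSupport.of_support_subset_isCompact (isCompact_closedBall (0 : E) δ) ?_
    intro y hy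
    have := kern_supp μ hy
    rw [norm_smul, norm_inv, Real.norm_of_nonneg hδ.le, inv_mul_lt_iff₀ hδ, mul_one] at this
    simpa using this.le
  have hloc : LocallyIntegrable F μ := by
    refine (locallyIntegrable_const M).mono hF.aestronglyMeasurable ?_
    refine Eventually.of_forall fun x => ?_
    exact (hM x).trans (le_abs_self M)
  have hconv := hkc.contDiff_convolution_left (ContinuousLinearMap.mul ℝ ℝ) hk hloc
  have heq : moll μ δ F = fun x => |(δ ^ Module.finrank ℝ E)⁻¹| *
      convolution k F (ContinuousLinearMap.mul ℝ ℝ) μ x := by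
    ext x
    have := Measure.integral_comp_smul μ (fun w => k w * F (x - w)) δ
    rw [convolution_def, ← smul_eq_mul]
    simp only [ContinuousLinearMap.mul_apply']
    rw [← this]
    simp only [k, smul_smul, inv_mul_cancel₀ hδ.ne', one_smul, moll]
  rw [heq]
  exact contDiff_const.mul hconv

lemma moll_mono_fun (hG : Measurable G) (hMG : ∀ x, |G x| ≤ M) (h : ∀ x, F x ≤ G x)
    (δ : ℝ) (x : E) : moll μ δ F x ≤ moll μ δ G x :=
  integral_mono (moll_integrable μ hF hM δ x) (moll_integrable μ hG hMG δ x)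
    fun y => mul_le_mul_of_nonneg_left (h _) (kern_nonneg μ y)

/-- Fubini for circle averages against the kernel. -/
lemma kern_circle_fubini {c : ℝ → E → E} (hc : Continuous fun q : ℝ × E => c q.1 q.2) :
    Integrable (fun y => kern μ y * ((2 * Real.pi)⁻¹ * ∫ θ in (0 : ℝ)..(2 * Real.pi), F (c θ y))) μ ∧
    ∫ y, kern μ y * ((2 * Real.pi)⁻¹ * ∫ θ in (0 : ℝ)..(2 * Real.pi), F (c θ y)) ∂μ =
      (2 * Real.pi)⁻¹ * ∫ θ in (0 : ℝ)..(2 * Real.pi), ∫ y, kern μ y * F (c θ y) ∂μ := by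
  have hpi : (0 : ℝ) ≤ 2 * Real.pi := by positivity
  simp only [intervalIntegral.integral_of_le hpi]
  have hInt : Integrable (fun q : E × ℝ => kern μ q.1 * F (c q.2 q.1))
      (μ.prod (volume.restrict (Set.Ioc 0 (2 * Real.pi)))) := by
    have h1 : Integrable (fun q : E × ℝ => kern μ q.1)
        (μ.prod (volume.restrict (Set.Ioc 0 (2 * Real.pi)))) := by
      have := (kern_integrable μ).mul_prod (g := fun _ : ℝ => (1 : ℝ))
        (ν := volume.restrict (Set.Ioc 0 (2 * Real.pi))) (integrable_const _)
      simpa using this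
    refine h1.mul_bdd (c := M) ?_ (Eventually.of_forall fun q => hM _)
    exact (hF.comp (hc.measurable.comp measurable_swap)).aestronglyMeasurable
  have heq : ∀ y, kern μ y * ((2 * Real.pi)⁻¹ * ∫ θ in Set.Ioc 0 (2 * Real.pi), F (c θ y)) =
      (2 * Real.pi)⁻¹ * ∫ θ in Set.Ioc 0 (2 * Real.pi), kern μ y * F (c θ y) := fun y => by
    rw [integral_const_mul]; ring
  simp only [heq]
  refine ⟨hInt.integral_prod_left.const_mul _, ?_⟩
  rw [integral_const_mul, integral_integral_swap]
  exact hInt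

end Basic

end Kernel

section Moll

lemma measurable_indicator_usc {X : Type*} [TopologicalSpace X] [MeasurableSpace X] [BorelSpace X]
    {f : X → ℝ} {Ω : Set X} (hΩ : IsOpen Ω) (h : UpperSemicontinuousOn f Ω) :
    Measurable (Ω.indicator f) := by
  refine measurable_of_restrict_of_restrict_compl hΩ.measurableSet ?_ ?_
  · have : Ω.domRestrict (Ω.indicator f) = Ω.domRestrict f := by
      ext x; simp [Set.domRestrict, x.2]
    rw [this]
    exact (upperSemicontinuousOn_iff_restrict.2 h).measurable
  · have : Ωᶜ.domRestrict (Ω.indicator f) = fun _ => 0 := by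
      ext x
      have := x.2
      simp only [Set.domRestrict]
      exact Set.indicator_of_notMem this _
    rw [this]
    exact measurable_const

variable {E : Type*} [NormedAddCommGroup E] [NormedSpace ℂ E]

lemma RPsh.congr {f g : E → ℝ} {Ω : Set E} (h : RPsh f Ω) (hfg : Set.EqOn f g Ω) : RPsh g Ω :=
  PlurisubharmonicOn.congr h fun z hz => by simp only [hfg hz]

/-- The points whose closed `δ`-ball lies in `Ω`. -/
def shrink (Ω : Set E) (δ : ℝ) : Set E := {x | Metric.closedBall x δ ⊆ Ω}

lemma shrink_subset {Ω : Set E} {δ : ℝ} (hδ : 0 ≤ δ) : shrink Ω δ ⊆ Ω :=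
  fun _ hx => hx (Metric.mem_closedBall_self hδ)

lemma shrink_anti {Ω : Set E} {δ δ' : ℝ} (h : δ' ≤ δ) : shrink Ω δ ⊆ shrink Ω δ' :=
  fun _ hx => (Metric.closedBall_subset_closedBall h).trans hx

lemma exists_mem_shrink {Ω : Set E} (hΩ : IsOpen Ω) {x : E} (hx : x ∈ Ω) :
    ∃ δ, 0 < δ ∧ x ∈ shrink Ω δ :=
  Metric.nhds_basis_closedBall.mem_iff.1 (hΩ.mem_nhds hx)

variable [NormedSpace ℝ E] [IsScalarTower ℝ ℂ E] [FiniteDimensional ℝ E] [MeasurableSpace E]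
  [BorelSpace E] (μ : Measure E) [μ.IsAddHaarMeasure]

variable {F : E → ℝ} (hF : Measurable F) {M : ℝ} (hM : ∀ x, |F x| ≤ M) {Ω : Set E}
  (hP : RPsh F Ω)

section
include hF

lemma moll_rot {δ : ℝ} (hδ : 0 < δ) {ζ : ℂ} (hζ : ‖ζ‖ = δ) (x : E) :
    ∫ y, kern μ y * F (x + ζ • y) ∂μ = moll μ δ F x := by
  set w : ℂ := -(ζ / δ) with hw
  have hw1 : ‖w‖ = 1 := by
    simp [hw, hζ, abs_of_pos hδ, hδ.ne']
  have hδ' : (δ : ℂ) ≠ 0 := by exact_mod_cast hδ.ne'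
  have h := measurePreserving_circle μ hw1
  have h1 : moll μ δ F x = ∫ y, kern μ y * F (x - δ • y) ∂(Measure.map (fun y => w • y) μ) := by
    rw [h.map_eq]; rfl
  rw [h1, integral_map h.measurable.aemeasurable]
  · refine integral_congr_ae (Eventually.of_forall fun y => ?_)
    simp only [kern_circle μ hw1]
    congr 2
    rw [← coe_smul_eq δ, smul_smul, sub_eq_add_neg, ← neg_smul]
    congr 2
    rw [hw]; field_simp
  · exact (((kern_smooth μ).continuous.measurable).mul
      (hF.comp (by fun_prop : Measurable fun y : E => x - δ • y))).aestronglyMeasurable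

include hM

lemma moll_eq_circle {δ : ℝ} (hδ : 0 < δ) (x : E) :
    Integrable (fun y => kern μ y * Real.circleAverage (fun ζ => F (x + ζ • y)) 0 δ) μ ∧
    moll μ δ F x = ∫ y, kern μ y * Real.circleAverage (fun ζ => F (x + ζ • y)) 0 δ ∂μ := by
  have hc : Continuous fun q : ℝ × E => x + circleMap 0 δ q.1 • q.2 := by
    have : Continuous fun q : ℝ × E => circleMap 0 δ q.1 :=
      (continuous_circleMap 0 δ).comp continuous_fst
    fun_prop
  have h := kern_circle_fubini μ hF hM (c := fun θ y => x + circleMap 0 δ θ • y) hc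
  simp only [Real.circleAverage_def, smul_eq_mul]
  refine ⟨h.1, ?_⟩
  rw [h.2]
  have : ∀ θ : ℝ, ∫ y, kern μ y * F (x + circleMap 0 δ θ • y) ∂μ = moll μ δ F x := fun θ =>
    moll_rot μ hF hδ (by simp [abs_of_pos hδ]) x
  simp only [this, intervalIntegral.integral_const, smul_eq_mul, sub_zero]
  field_simp

include hP

lemma moll_mono {δ δ' : ℝ} (hδ' : 0 < δ') (h : δ' ≤ δ) {x : E} (hx : x ∈ shrink Ω δ) :
    moll μ δ' F x ≤ moll μ δ F x := by
  have hδ : 0 < δ := hδ'.trans_le h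
  obtain ⟨i1, e1⟩ := moll_eq_circle μ hF hM hδ' x
  obtain ⟨i2, e2⟩ := moll_eq_circle μ hF hM hδ x
  rw [e1, e2]
  refine integral_mono i1 i2 fun y => ?_
  by_cases hy : kern μ y = 0
  · simp [hy]
  refine mul_le_mul_of_nonneg_left ?_ (kern_nonneg μ y)
  refine hP.circleAverage_mono_radius (fun z _ => hM z) hδ'.le h hδ fun ζ hζ => hx ?_
  have := kern_supp μ hy
  simp only [Metric.mem_closedBall, dist_self_add_left, norm_smul]
  nlinarith [norm_nonneg ζ, norm_nonneg y]

lemma le_moll {δ : ℝ} (hδ : 0 < δ) {x : E} (hx : x ∈ shrink Ω δ) : F x ≤ moll μ δ F x := by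
  obtain ⟨i2, e2⟩ := moll_eq_circle μ hF hM hδ x
  have h1 : F x = ∫ y, kern μ y * F x ∂μ := by
    rw [integral_mul_const, kern_integral, one_mul]
  rw [h1, e2]
  refine integral_mono ((kern_integrable μ).mul_const _) i2 fun y => ?_
  by_cases hy : kern μ y = 0
  · simp [hy]
  refine mul_le_mul_of_nonneg_left ?_ (kern_nonneg μ y)
  refine hP.le_circleAverage (fun z _ => hM z) hδ fun ζ hζ => hx ?_
  have := kern_supp μ hy
  simp only [Metric.mem_closedBall, dist_self_add_left, norm_smul]
  nlinarith [norm_nonneg ζ, norm_nonneg y]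

lemma moll_tendsto (hΩ : IsOpen Ω) {x : E} (hx : x ∈ Ω) :
    Tendsto (fun δ => moll μ δ F x) (𝓝[>] 0) (𝓝 (F x)) := by
  obtain ⟨δ0, hδ0, hxs⟩ := exists_mem_shrink hΩ hx
  rw [tendsto_order]
  constructor
  · intro a ha
    filter_upwards [Ioo_mem_nhdsGT hδ0] with δ hδ
    exact ha.trans_le (le_moll μ hF hM hP hδ.1 (shrink_anti hδ.2.le hxs))
  · intro a ha
    obtain ⟨c, hc1, hc2⟩ := exists_between ha
    have h1 : ∀ᶠ y in 𝓝 x, F y < c := by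
      have := hP.usc x hx c hc1
      rwa [hΩ.nhdsWithin_eq hx] at this
    obtain ⟨ε, hε, hball⟩ := Metric.eventually_nhds_iff_ball.1 h1
    filter_upwards [Ioo_mem_nhdsGT hε] with δ hδ
    refine lt_of_le_of_lt ?_ hc2
    have h2 : c = ∫ y, kern μ y * c ∂μ := by
      rw [integral_mul_const, kern_integral, one_mul]
    rw [h2]
    refine integral_mono (moll_integrable μ hF hM δ x) ((kern_integrable μ).mul_const _)
      fun y => ?_
    by_cases hy : kern μ y = 0
    · simp [hy]
    refine mul_le_mul_of_nonneg_left (hball _ ?_).le (kern_nonneg μ y)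
    have := kern_supp μ hy
    simp only [Metric.mem_ball, dist_eq_norm, sub_sub_cancel_left, norm_neg, norm_smul,
      Real.norm_of_nonneg hδ.1.le]
    nlinarith [hδ.1, hδ.2, norm_nonneg y]

lemma rpsh_moll {δ : ℝ} (hδ : 0 < δ) : RPsh (moll μ δ F) (shrink Ω δ) := by
  refine rpsh_of_le_circleAverage (M := M)
    ((moll_contDiff μ hF hM hδ).continuous.upperSemicontinuous.upperSemicontinuousOn _)
    (fun z _ => abs_moll_le μ hF hM δ z) fun a b hab => ?_
  have hc : Continuous fun q : ℝ × E => a - δ • q.2 + circleMap 0 1 q.1 • b := by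
    have : Continuous fun q : ℝ × E => circleMap 0 1 q.1 :=
      (continuous_circleMap 0 1).comp continuous_fst
    fun_prop
  obtain ⟨i, e⟩ := kern_circle_fubini μ hF hM (c := fun θ y => a - δ • y + circleMap 0 1 θ • b) hc
  have h1 : Real.circleAverage (fun ζ : ℂ => moll μ δ F (a + ζ • b)) 0 1 =
      (2 * Real.pi)⁻¹ * ∫ θ in (0 : ℝ)..(2 * Real.pi),
        ∫ y, kern μ y * F (a - δ • y + circleMap 0 1 θ • b) ∂μ := by
    simp only [Real.circleAverage_def, smul_eq_mul, moll]
    congr 2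
    ext θ
    congr 1
    ext y
    congr 2
    abel
  rw [h1, ← e]
  refine integral_mono (moll_integrable μ hF hM δ a) i fun y => ?_
  by_cases hy : kern μ y = 0
  · simp [hy]
  refine mul_le_mul_of_nonneg_left ?_ (kern_nonneg μ y)
  have h2 := hP.le_circleAverage (fun z _ => hM z) (a := a - δ • y) (b := b) one_pos
    fun ζ hζ => by
      refine hab ζ hζ ?_
      have := kern_supp μ hy
      simp only [Metric.mem_closedBall, dist_eq_norm]
      have e : a - δ • y + ζ • b - (a + ζ • b) = -(δ • y) := by abel
      rw [e, norm_neg, norm_smul, Real.norm_of_nonneg hδ.le]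
      nlinarith [norm_nonneg y]
  simpa only [Real.circleAverage_def, smul_eq_mul] using h2

end

end Moll

section Levi

lemma deriv_deriv_nonneg_of_isLocalMin {g : ℝ → ℝ} {x : ℝ} (h : IsLocalMin g x)
    (hc : ContinuousAt g x) : 0 ≤ deriv (deriv g) x := by
  by_contra! hneg
  have hmax := isLocalMax_of_deriv_deriv_neg hneg h.deriv_eq_zero hc
  have hconst : g =ᶠ[𝓝 x] fun _ => g x := by
    filter_upwards [h, hmax] with y h1 h2 using le_antisymm h2 h1
  have h1 : deriv g =ᶠ[𝓝 x] fun _ => (0 : ℝ) := by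
    have := hconst.deriv
    simpa using this
  have h2 := h1.deriv_eq
  simp only [deriv_const] at h2
  linarith

lemma exists_forall_neg_of_antitone {X : Type*} [TopologicalSpace X] {K : Set X}
    (hK : IsCompact K) {g : ℕ → X → ℝ} (hg : ∀ k, ContinuousOn (g k) K)
    (hanti : ∀ k, ∀ x ∈ K, g (k + 1) x ≤ g k x) (h : ∀ x ∈ K, ∃ k, g k x < 0) :
    ∃ k, ∀ x ∈ K, g k x < 0 := by
  by_contra! hcon
  have hmono : ∀ x ∈ K, Antitone fun k => g k x := fun x hx => antitone_nat_of_succ_le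
    fun k => hanti k x hx
  have : CompactSpace K := isCompact_iff_compactSpace.1 hK
  let S : ℕ → Set K := fun k => {x | 0 ≤ g k x}
  have hclosed : ∀ k, IsClosed (S k) := fun k =>
    isClosed_le continuous_const (continuousOn_iff_continuous_domRestrict.1 (hg k))
  obtain ⟨x, hx⟩ := IsCompact.nonempty_iInter_of_sequence_nonempty_isCompact_isClosed S
    (fun k x hx => le_trans hx (hanti k x x.2))
    (fun k => by obtain ⟨x, hx, hx'⟩ := hcon k; exact ⟨⟨x, hx⟩, hx'⟩)
    (hclosed 0).isCompact hclosed
  obtain ⟨k, hk⟩ := h x x.2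
  exact absurd (Set.mem_iInter.1 hx k) (not_le.2 hk)

variable {E : Type*} [NormedAddCommGroup E] [NormedSpace ℝ E]

lemma fderiv_fderiv_apply {f : E → ℝ} {x : E} (hf : ContDiffAt ℝ 2 f x) (v w : E) :
    fderiv ℝ (fun y => fderiv ℝ f y w) x v = fderiv ℝ (fderiv ℝ f) x v w := by
  have h : DifferentiableAt ℝ (fderiv ℝ f) x :=
    (hf.fderiv_right (m := 1) (by norm_num)).differentiableAt (by norm_num)
  rw [fderiv_clm_apply h (differentiableAt_const w)]
  simp

lemma nonneg_of_isLocalMin {g d : ℝ → ℝ} {x a : ℝ} (h : IsLocalMin g x)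
    (hd : ∀ᶠ s in 𝓝 x, HasDerivAt g (d s) s) (ha : HasDerivAt d a x) : 0 ≤ a := by
  have h1 := deriv_deriv_nonneg_of_isLocalMin h hd.self_of_nhds.continuousAt
  have h2 : deriv g =ᶠ[𝓝 x] d := hd.mono fun s hs => hs.deriv
  rwa [h2.deriv_eq, ha.deriv] at h1

/-- Second derivative of a function along a curve. -/
lemma exists_hasDerivAt_comp_curve {f : E → ℝ} {γ γ1 : ℝ → E} {γ2 : E} {t : ℝ}
    (hf : ContDiffAt ℝ 2 f (γ t)) (h1 : ∀ s, HasDerivAt γ (γ1 s) s) (h2 : HasDerivAt γ1 γ2 t) :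
    ∃ d : ℝ → ℝ, (∀ᶠ s in 𝓝 t, HasDerivAt (fun s => f (γ s)) (d s) s) ∧
      HasDerivAt d (fderiv ℝ (fderiv ℝ f) (γ t) (γ1 t) (γ1 t) + fderiv ℝ f (γ t) γ2) t := by
  have hev : ∀ᶠ s in 𝓝 t, ContDiffAt ℝ 2 f (γ s) :=
    (h1 t).continuousAt.eventually (hf.eventually (by simp))
  refine ⟨fun s => fderiv ℝ f (γ s) (γ1 s), ?_, ?_⟩
  · filter_upwards [hev] with s hs
    exact (hs.differentiableAt (by norm_num)).hasFDerivAt.comp_hasDerivAt s (h1 s)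
  have hD : DifferentiableAt ℝ (fderiv ℝ f) (γ t) :=
    (hf.fderiv_right (m := 1) (by norm_num)).differentiableAt (by norm_num)
  exact (hD.hasFDerivAt.comp_hasDerivAt t (h1 t)).clm_apply h2

variable [NormedSpace ℂ E] [IsScalarTower ℝ ℂ E]

/-- The Levi form (up to a factor) of a function. -/
def levi (f : E → ℝ) (x b : E) : ℝ :=
  fderiv ℝ (fderiv ℝ f) x b b + fderiv ℝ (fderiv ℝ f) x (Complex.I • b) (Complex.I • b)

lemma hasDerivAt_line (g g1 : ℂ → E) (hg : ∀ ζ, HasDerivAt g (g1 ζ) ζ) (ζ v : ℂ) (t : ℝ) :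
    HasDerivAt (fun s : ℝ => g (ζ + s * v)) (v • g1 (ζ + t * v)) t := by
  have h1 : HasDerivAt (fun s : ℝ => ζ + (s : ℂ) * v) v t := by
    have := ((Complex.ofRealCLM.hasDerivAt (x := t)).mul_const v).const_add ζ
    simpa using this
  have := (hg (ζ + t * v)).scomp t h1
  exact this

/-- The auxiliary function `- Re p + c |ζ|²` has constant Laplacian. -/
lemma laplace_re_poly (p : Polynomial ℂ) (c : ℝ) (ζ : ℂ) :
    (∃ d1 dI : ℝ → ℝ, ∃ a1 aI : ℝ,
      (∀ s : ℝ, HasDerivAt (fun s : ℝ => -(p.eval (ζ + s * 1)).re + c * ‖ζ + s * 1‖ ^ 2) (d1 s) s) ∧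
      (∀ s : ℝ, HasDerivAt (fun s : ℝ => -(p.eval (ζ + s * Complex.I)).re +
        c * ‖ζ + s * Complex.I‖ ^ 2) (dI s) s) ∧
      HasDerivAt d1 a1 0 ∧ HasDerivAt dI aI 0 ∧ a1 + aI = 4 * c) := by
  have key : ∀ v : ℂ, ‖v‖ = 1 → ∃ d : ℝ → ℝ,
      (∀ s : ℝ, HasDerivAt (fun s : ℝ => -(p.eval (ζ + s * v)).re + c * ‖ζ + s * v‖ ^ 2) (d s) s) ∧
      HasDerivAt d (-(v * (v * (p.derivative.derivative.eval ζ))).re + 2 * c) 0 := by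
    intro v hv
    have e1 : ∀ s : ℝ, ‖ζ + s * v‖ ^ 2 = ‖ζ‖ ^ 2 + 2 * s * (ζ.re * v.re + ζ.im * v.im) + s ^ 2 := by
      intro s
      rw [← Complex.normSq_eq_norm_sq, ← Complex.normSq_eq_norm_sq]
      have : v.re * v.re + v.im * v.im = 1 := by
        rw [← Complex.normSq_apply, Complex.normSq_eq_norm_sq, hv]; norm_num
      simp [Complex.normSq_apply]
      linear_combination s ^ 2 * this
    simp only [e1]
    refine ⟨fun s => -(v * p.derivative.eval (ζ + s * v)).re +
      c * (2 * (ζ.re * v.re + ζ.im * v.im) + 2 * s), fun s => ?_, ?_⟩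
    · have h1 := hasDerivAt_line (fun ζ => p.eval ζ) _ (fun ζ => p.hasDerivAt ζ) ζ v s
      have h2 := (Complex.reCLM.hasFDerivAt.comp_hasDerivAt s h1).neg
      have h3 : HasDerivAt (fun s : ℝ => c * (‖ζ‖ ^ 2 + 2 * s * (ζ.re * v.re + ζ.im * v.im) + s ^ 2))
          (c * (2 * (ζ.re * v.re + ζ.im * v.im) + 2 * s)) s := by
        refine HasDerivAt.const_mul c ?_
        have h4 := ((((hasDerivAt_id s).const_mul 2).mul_const
          (ζ.re * v.re + ζ.im * v.im)).const_add (‖ζ‖ ^ 2)).add ((hasDerivAt_id s).pow 2)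
        refine h4.congr_deriv ?_
        simp
      exact h2.add h3
    · have h1 := hasDerivAt_line (fun ζ => p.derivative.eval ζ) _
        (fun ζ => p.derivative.hasDerivAt ζ) ζ v 0
      have h2 := (Complex.reCLM.hasFDerivAt.comp_hasDerivAt 0 (h1.const_mul v)).neg
      have h3 : HasDerivAt (fun s : ℝ => c * (2 * (ζ.re * v.re + ζ.im * v.im) + 2 * s))
          (2 * c) 0 := by
        have := (((hasDerivAt_id (0 : ℝ)).const_mul 2).const_add
          (2 * (ζ.re * v.re + ζ.im * v.im))).const_mul c
        refine this.congr_deriv ?_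
        ring
      refine (h2.add h3).congr_deriv ?_
      simp
  obtain ⟨d1, h1, h1'⟩ := key 1 (by simp)
  obtain ⟨dI, hI, hI'⟩ := key Complex.I (by simp)
  refine ⟨d1, dI, _, _, h1, hI, h1', hI', ?_⟩
  rw [← mul_assoc, ← mul_assoc, Complex.I_mul_I]
  simp only [one_mul, neg_one_mul, Complex.neg_re]
  ring

/-- Maximum principle along a holomorphic curve. -/
lemma not_isLocalMax_of_levi {f : E → ℝ} {g g1 g2 : ℂ → E} (hg : ∀ ζ, HasDerivAt g (g1 ζ) ζ)
    (hg1 : ∀ ζ, HasDerivAt g1 (g2 ζ) ζ) {ζ : ℂ} (hf : ContDiffAt ℝ 2 f (g ζ)) (p : Polynomial ℂ)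
    {c : ℝ} (hc : 0 < levi f (g ζ) (g1 ζ) + 4 * c) :
    ¬ IsLocalMax (fun ζ => f (g ζ) + (-(p.eval ζ).re + c * ‖ζ‖ ^ 2)) ζ := by
  intro hmax
  obtain ⟨d1, dI, a1, aI, h1, hI, h1', hI', hsum⟩ := laplace_re_poly p c ζ
  have key : ∀ (v : ℂ) (d : ℝ → ℝ) (a : ℝ),
      (∀ s : ℝ, HasDerivAt (fun s : ℝ => -(p.eval (ζ + s * v)).re + c * ‖ζ + s * v‖ ^ 2) (d s) s) →
      HasDerivAt d a 0 → fderiv ℝ (fderiv ℝ f) (g ζ) (v • g1 ζ) (v • g1 ζ) +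
        fderiv ℝ f (g ζ) (v • v • g2 ζ) + a ≤ 0 := by
    intro v d a hd ha
    obtain ⟨e, he, he'⟩ := exists_hasDerivAt_comp_curve (f := f)
      (γ := fun s : ℝ => g (ζ + s * v)) (γ1 := fun s : ℝ => v • g1 (ζ + s * v)) (t := 0)
      (by simpa using hf) (fun s => hasDerivAt_line g g1 hg ζ v s)
      ((hasDerivAt_line g1 g2 hg1 ζ v 0).const_smul v)
    have hline : Tendsto (fun s : ℝ => ζ + s * v) (𝓝 0) (𝓝 ζ) := by
      have : Continuous fun s : ℝ => ζ + s * v := by fun_prop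
      simpa using this.tendsto 0
    have hmin : IsLocalMin (fun s : ℝ => -(f (g (ζ + s * v)) +
        (-(p.eval (ζ + s * v)).re + c * ‖ζ + s * v‖ ^ 2))) 0 := by
      have := hline.eventually hmax
      refine this.mono fun s hs => neg_le_neg ?_
      simpa using hs
    have := nonneg_of_isLocalMin hmin (he.mono fun s hs => (hs.add (hd s)).neg) (he'.add ha).neg
    simp only [Complex.ofReal_zero, zero_mul, add_zero] at this
    linarith
  have k1 := key 1 d1 a1 h1 h1'
  have k2 := key Complex.I dI aI hI hI'
  have : fderiv ℝ f (g ζ) (Complex.I • Complex.I • g2 ζ) = - fderiv ℝ f (g ζ) (g2 ζ) := by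
    rw [smul_smul, Complex.I_mul_I, neg_one_smul, map_neg]
  rw [this] at k2
  simp only [one_smul] at k1
  rw [levi] at hc
  linarith

lemma levi_neg {f : E → ℝ} (x b : E) : levi (fun y => -f y) x b = -levi f x b := by
  have h : fderiv ℝ (fun y => -f y) = fun y => -fderiv ℝ f y := by
    ext1 y; exact fderiv_fun_neg
  simp only [levi, h, fderiv_fun_neg]
  simp
  ring

lemma continuousAt_levi {f : E → ℝ} {x : E} (hf : ContDiffAt ℝ 2 f x) (b : E) :
    ContinuousAt (fun y => levi f y b) x := by
  have h : ContinuousAt (fderiv ℝ (fderiv ℝ f)) x :=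
    (((hf.fderiv_right (m := 1) (by norm_num)).fderiv_right (m := 0)
      (by norm_num))).continuousAt
  unfold levi
  fun_prop

/-- The Levi form of a plurisubharmonic function is nonnegative. -/
lemma RPsh.levi_nonneg {f : E → ℝ} {Ω : Set E} (hΩ : IsOpen Ω) (h : RPsh f Ω) {x : E}
    (hx : x ∈ Ω) (hf : ContDiffAt ℝ 2 f x) (b : E) : 0 ≤ levi f x b := by
  by_contra! hneg
  obtain ⟨η, hη, hη'⟩ : ∃ η : ℝ, 0 < η ∧ levi f x b < -(4 * η) :=
    ⟨-levi f x b / 8, by linarith, by linarith⟩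
  have hline : Tendsto (fun ζ : ℂ => x + ζ • b) (𝓝 0) (𝓝 x) := by
    have : Continuous fun ζ : ℂ => x + ζ • b := by fun_prop
    simpa using this.tendsto 0
  have hev : ∀ᶠ ζ in 𝓝 (0 : ℂ), x + ζ • b ∈ Ω ∧ ContDiffAt ℝ 2 f (x + ζ • b) ∧
      levi f (x + ζ • b) b < -(4 * η) :=
    hline.eventually ((show ∀ᶠ y in 𝓝 x, y ∈ Ω from hΩ.mem_nhds hx).and ((hf.eventually (by simp)).and
      ((continuousAt_levi hf b).eventually (gt_mem_nhds hη'))))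
  obtain ⟨r, hr, hball⟩ := Metric.nhds_basis_closedBall.eventually_iff.1 hev
  simp only [mem_closedBall_zero_iff] at hball
  have hcont : ContinuousOn (fun ζ : ℂ => f (x + ζ • b)) (Metric.closedBall 0 r) := by
    intro ζ hζ
    have := (hball (mem_closedBall_zero_iff.1 hζ)).2.1.continuousAt
    exact (ContinuousAt.comp (f := fun ζ : ℂ => x + ζ • b) this
      (continuous_disc x b).continuousAt).continuousWithinAt
  obtain ⟨p, hp⟩ := exists_poly_re_approx (g := fun ζ : ℂ => f (x + ζ • b)) hr
    (hcont.mono Metric.sphere_subset_closedBall) (ε := η * r ^ 2 / 4) (by positivity)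
  -- at the centre
  have h0 : f x ≤ (p.eval 0).re + η * r ^ 2 / 4 := by
    have := (rpsh_iff.1 h).2 x b r hr (fun ζ hζ => (hball hζ).1)
      (p + Polynomial.C ((η * r ^ 2 / 4 : ℝ) : ℂ)) (fun ζ hζ => by
        simp only [Polynomial.eval_add, Polynomial.eval_C, Complex.add_re, Complex.ofReal_re]
        linarith [(abs_lt.1 (hp ζ hζ)).2]) 0 (by simpa using hr.le)
    simpa only [Polynomial.eval_add, Polynomial.eval_C, Complex.add_re, Complex.ofReal_re,
      zero_smul, add_zero] using this
  -- maximum of the auxiliary function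
  set φ : ℂ → ℝ := fun ζ => -f (x + ζ • b) + (-((-p).eval ζ).re + (-η) * ‖ζ‖ ^ 2) with hφ
  have hφc : ContinuousOn φ (Metric.closedBall 0 r) :=
    hcont.neg.add (by fun_prop)
  obtain ⟨ζ, hζ, hmax⟩ := (isCompact_closedBall (0 : ℂ) r).exists_isMaxOn
    ⟨0, Metric.mem_closedBall_self hr.le⟩ hφc
  rcases (mem_closedBall_zero_iff.1 hζ).lt_or_eq with hlt | heq
  · have hloc : IsLocalMax φ ζ := hmax.isLocalMax
      (mem_of_superset (Metric.isOpen_ball.mem_nhds (mem_ball_zero_iff.2 hlt))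
        Metric.ball_subset_closedBall)
    have hd : ∀ ζ : ℂ, HasDerivAt (fun ζ : ℂ => x + ζ • b) b ζ := fun ζ => by
      simpa using ((hasDerivAt_id ζ).smul_const b).const_add x
    refine not_isLocalMax_of_levi (f := fun y => -f y) (g := fun ζ : ℂ => x + ζ • b)
      (g1 := fun _ => b) (g2 := fun _ => 0) hd (fun ζ => hasDerivAt_const ζ b)
      (hball hlt.le).2.1.neg (-p) (c := -η) ?_ hloc
    rw [levi_neg]
    linarith [(hball hlt.le).2.2]
  · have h1 := hmax (Metric.mem_closedBall_self hr.le)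
    have h2 := hp ζ heq
    simp only [hφ, Set.mem_ofPred_eq, heq, norm_zero, zero_smul, add_zero, Polynomial.eval_neg,
      Complex.neg_re, neg_neg] at h1
    have := (abs_lt.1 h2).1
    nlinarith [sq_pos_of_pos hr, mul_pos hη (sq_pos_of_pos hr)]

/-- Smooth case of the maximum principle along holomorphic curves. -/
lemma le_of_levi_nonneg {f : E → ℝ} {V : Set E} (hf : ∀ x ∈ V, ContDiffAt ℝ 2 f x)
    (hlevi : ∀ x ∈ V, ∀ b, 0 ≤ levi f x b) {g g1 g2 : ℂ → E}
    (hg : ∀ ζ, HasDerivAt g (g1 ζ) ζ) (hg1 : ∀ ζ, HasDerivAt g1 (g2 ζ) ζ) {r : ℝ} (hr : 0 < r)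
    (hV : ∀ ζ, ‖ζ‖ ≤ r → g ζ ∈ V) (p : Polynomial ℂ)
    (hp : ∀ ζ, ‖ζ‖ = r → f (g ζ) ≤ (p.eval ζ).re) {ζ : ℂ} (hζ : ‖ζ‖ ≤ r) :
    f (g ζ) ≤ (p.eval ζ).re := by
  refine le_of_forall_pos_le_add fun η hη => ?_
  set c := η / r ^ 2 with hc
  have hc0 : 0 < c := by positivity
  have hcr : c * r ^ 2 = η := by rw [hc]; field_simp
  set φ : ℂ → ℝ := fun ζ => f (g ζ) + (-(p.eval ζ).re + c * ‖ζ‖ ^ 2) with hφ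
  have hφc : ContinuousOn φ (Metric.closedBall 0 r) := by
    refine ContinuousOn.add (fun ζ hζ => ?_) (by fun_prop)
    exact (ContinuousAt.comp (f := g) (hf _ (hV ζ (mem_closedBall_zero_iff.1 hζ))).continuousAt
      (hg ζ).continuousAt).continuousWithinAt
  obtain ⟨ζ0, hζ0, hmax⟩ := (isCompact_closedBall (0 : ℂ) r).exists_isMaxOn
    ⟨0, Metric.mem_closedBall_self hr.le⟩ hφc
  rcases (mem_closedBall_zero_iff.1 hζ0).lt_or_eq with hlt | heq
  · have hloc : IsLocalMax φ ζ0 := hmax.isLocalMax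
      (mem_of_superset (Metric.isOpen_ball.mem_nhds (mem_ball_zero_iff.2 hlt))
        Metric.ball_subset_closedBall)
    refine absurd hloc (not_isLocalMax_of_levi hg hg1 (hf _ (hV _ hlt.le)) p ?_)
    linarith [hlevi _ (hV _ hlt.le) (g1 ζ0)]
  · have h1 := hmax (mem_closedBall_zero_iff.2 hζ)
    have h2 := hp ζ0 heq
    simp only [hφ, Set.mem_ofPred_eq, heq] at h1
    nlinarith [mul_nonneg hc0.le (sq_nonneg ‖ζ‖)]

variable [FiniteDimensional ℝ E]

/-- The maximum principle for psh functions along entire curves. -/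
lemma PSHNeg.le_re_poly_of_curve {u : E → EReal} {Ω : Set E} (hΩ : IsOpen Ω) (hu : PSHNeg u Ω)
    {g g1 g2 : ℂ → E} (hg : ∀ ζ, HasDerivAt g (g1 ζ) ζ) (hg1 : ∀ ζ, HasDerivAt g1 (g2 ζ) ζ)
    {r : ℝ} (hr : 0 < r) (hV : ∀ ζ, ‖ζ‖ ≤ r → g ζ ∈ Ω) (p : Polynomial ℂ)
    (hp : ∀ ζ, ‖ζ‖ = r → u (g ζ) ≤ ((p.eval ζ).re : EReal)) {ζ : ℂ} (hζ : ‖ζ‖ ≤ r) :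
    u (g ζ) ≤ ((p.eval ζ).re : EReal) := by
  letI : MeasurableSpace E := borel E
  have : BorelSpace E := ⟨rfl⟩
  obtain ⟨μ, hμ⟩ : ∃ μ : Measure E, μ.IsAddHaarMeasure := ⟨Measure.addHaar, inferInstance⟩
  have hgc : Continuous g := continuous_iff_continuousAt.2 fun ζ => (hg ζ).continuousAt
  -- a truncation level
  obtain ⟨N, hN0, hN⟩ : ∃ N : ℝ, 0 ≤ N ∧ ∀ ζ, ‖ζ‖ = r → -N ≤ (p.eval ζ).re := by
    obtain ⟨C, hC⟩ := (isCompact_sphere (0 : ℂ) r).exists_bound_of_continuousOn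
      (f := fun ζ => (p.eval ζ).re) (by fun_prop)
    refine ⟨max C 0, le_max_right _ _, fun ζ hζ => ?_⟩
    have := hC ζ (by simpa using hζ)
    have h2 := (abs_le.1 this).1
    have := le_max_left C 0
    linarith
  have hle : ∀ z ∈ Ω, u z ≤ ((trunc N u z : ℝ) : EReal) := fun z hz => by
    rw [coe_trunc (hu.2 z hz)]; exact le_max_left _ _
  have htr : ∀ ζ, ‖ζ‖ = r → trunc N u (g ζ) ≤ (p.eval ζ).re := fun ζ hζ => by
    rw [← EReal.coe_le_coe_iff, coe_trunc (hu.2 _ (hV ζ hζ.le))]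
    exact max_le (hp ζ hζ) (EReal.coe_le_coe_iff.2 (hN ζ hζ))
  set F : E → ℝ := Ω.indicator (trunc N u) with hF
  have hPt : RPsh (trunc N u) Ω := hu.rpsh_trunc N
  have hFm : Measurable F := measurable_indicator_usc hΩ hPt.usc
  have hFb : ∀ x, |F x| ≤ N := fun x => by
    by_cases hx : x ∈ Ω
    · rw [hF, Set.indicator_of_mem hx]; exact abs_trunc_le (hu.2 x hx) hN0
    · rw [hF, Set.indicator_of_notMem hx, abs_zero]; exact hN0
  have hFe : ∀ x ∈ Ω, F x = trunc N u x := fun x hx => Set.indicator_of_mem hx _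
  have hFP : RPsh F Ω := hPt.congr fun x hx => (hFe x hx).symm
  obtain ⟨δ0, hδ0, hthick⟩ := ((isCompact_closedBall (0 : ℂ) r).image hgc).exists_cthickening_subset_open
    hΩ (by rintro _ ⟨ζ, hζ, rfl⟩; exact hV ζ (mem_closedBall_zero_iff.1 hζ))
  have hshrink : ∀ ζ, ‖ζ‖ ≤ r → g ζ ∈ shrink Ω δ0 := fun ζ hζ =>
    (Metric.closedBall_subset_cthickening
      (Set.mem_image_of_mem g (mem_closedBall_zero_iff.2 hζ)) δ0).trans hthick
  set δ : ℕ → ℝ := fun k => δ0 / 2 / (k + 1) with hδ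
  have hδpos : ∀ k, 0 < δ k := fun k => by positivity
  have hδle : ∀ k, δ k < δ0 := fun k => by
    have h1 : δ k ≤ δ0 / 2 := by
      rw [hδ]; exact div_le_self (by positivity) (by linarith [(Nat.cast_nonneg k : (0 : ℝ) ≤ k)])
    linarith
  have hδanti : ∀ k, δ (k + 1) ≤ δ k := fun k => by
    simp only [hδ]; gcongr; linarith
  have hδlim : Tendsto δ atTop (𝓝[>] 0) := by
    refine tendsto_nhdsWithin_iff.2 ⟨?_, Eventually.of_forall hδpos⟩
    have := (tendsto_one_div_add_atTop_nhds_zero_nat (𝕜 := ℝ)).const_mul (δ0 / 2)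
    rw [mul_zero] at this
    exact this.congr fun k => by simp only [hδ]; ring
  refine ereal_le_coe_of_forall_add fun ε hε => ?_
  obtain ⟨k, hk⟩ := exists_forall_neg_of_antitone (isCompact_sphere (0 : ℂ) r)
    (g := fun k ζ => moll μ (δ k) F (g ζ) - ((p.eval ζ).re + ε))
    (fun k => by
      have h1 := (moll_contDiff μ hFm hFb (hδpos k)).continuous.comp hgc
      have h2 : Continuous fun ζ => (p.eval ζ).re + ε := by fun_prop
      exact (h1.sub h2).continuousOn)
    (fun k ζ hζ => by
      have := moll_mono μ hFm hFb hFP (hδpos (k + 1)) (hδanti k)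
        (shrink_anti (hδle k).le (hshrink ζ (by simp at hζ; exact hζ.le)))
      linarith)
    (fun ζ hζ => by
      have hζ' : ‖ζ‖ = r := by simpa using hζ
      have h1 := (moll_tendsto μ hFm hFb hFP hΩ (hV ζ hζ'.le)).comp hδlim
      have h2 : F (g ζ) < (p.eval ζ).re + ε := by
        rw [hFe _ (hV ζ hζ'.le)]; linarith [htr ζ hζ']
      obtain ⟨k, hk⟩ := (h1.eventually (gt_mem_nhds h2)).exists
      exact ⟨k, sub_neg.2 hk⟩)
  have hsm := moll_contDiff μ hFm hFb (hδpos k)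
  have hVo : g ζ ∈ shrink Ω (δ k) := shrink_anti (hδle k).le (hshrink ζ hζ)
  set V : Set E := interior (shrink Ω (δ k)) with hVdef
  have hgV : ∀ ζ, ‖ζ‖ ≤ r → g ζ ∈ V := fun ζ hζ => by
    refine mem_interior_iff_mem_nhds.2 (Metric.mem_nhds_iff.2 ⟨δ0 - δ k, sub_pos.2 (hδle k), ?_⟩)
    intro y hy z hz
    refine hshrink ζ hζ ?_
    have h1 := Metric.mem_ball.1 hy
    have h2 := Metric.mem_closedBall.1 hz
    have h3 := dist_triangle z y (g ζ)
    exact Metric.mem_closedBall.2 (by linarith)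
  have hsmAt : ∀ x, ContDiffAt ℝ 2 (moll μ (δ k) F) x := fun x =>
    hsm.contDiffAt.of_le (WithTop.coe_le_coe.2 le_top)
  have := le_of_levi_nonneg (V := V) (fun x _ => hsmAt x)
    (fun x hx b => ((rpsh_moll μ hFm hFb hFP (hδpos k)).mono interior_subset).levi_nonneg
      isOpen_interior hx (hsmAt x) b) hg hg1 hr hgV
    (p + Polynomial.C (ε : ℂ)) (fun ζ hζ => by
      simp only [Polynomial.eval_add, Polynomial.eval_C, Complex.add_re, Complex.ofReal_re]
      linarith [hk ζ (by simpa using hζ)]) hζ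
  simp only [Polynomial.eval_add, Polynomial.eval_C, Complex.add_re, Complex.ofReal_re] at this
  refine (hle _ (hV ζ hζ)).trans (EReal.coe_le_coe_iff.2 ?_)
  have h3 := le_moll μ hFm hFb hFP (hδpos k) hVo
  rw [hFe _ (hV ζ hζ)] at h3
  linarith

end Levi

section DetCalc

open Matrix

variable {ι : Type*} [Fintype ι] [DecidableEq ι]

lemma sum_perm_prod_erase_eq {R : Type*} [CommRing R] (A B : Matrix ι ι R) :
    ∑ σ : Equiv.Perm ι, ((Equiv.Perm.sign σ : ℤ) : R) *
      ∑ i, (∏ j ∈ Finset.univ.erase i, A (σ j) j) * B (σ i) i =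
      ∑ i, (A.updateCol i fun k => B k i).det := by
  simp only [Matrix.det_apply', Finset.mul_sum]
  rw [Finset.sum_comm]
  refine Finset.sum_congr rfl fun i _ => Finset.sum_congr rfl fun σ _ => ?_
  congr 1
  rw [← Finset.prod_erase_mul _ _ (Finset.mem_univ i)]
  congr 1
  · refine Finset.prod_congr rfl fun j hj => ?_
    rw [Matrix.updateCol_ne (Finset.ne_of_mem_erase hj)]
  · simp

lemma trace_adjugate_mul_eq {R : Type*} [CommRing R] (A B : Matrix ι ι R) :
    (A.adjugate * B).trace = ∑ i, (A.updateRow i (B i)).det := by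
  rw [Matrix.trace_mul_comm, Matrix.trace]
  refine Finset.sum_congr rfl fun i _ => ?_
  rw [← Matrix.cramer_transpose_apply, Matrix.cramer_eq_adjugate_mulVec, ← Matrix.adjugate_transpose]
  simp [Matrix.mul_apply, Matrix.mulVec, dotProduct, mul_comm]

lemma sum_updateRow_eq {R : Type*} [CommRing R] (A B : Matrix ι ι R) :
    ∑ σ : Equiv.Perm ι, ((Equiv.Perm.sign σ : ℤ) : R) *
      ∑ i, (∏ j ∈ Finset.univ.erase i, A j (σ j)) * B i (σ i) =
      ∑ i, (A.updateRow i (B i)).det := by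
  have := sum_perm_prod_erase_eq Aᵀ Bᵀ
  simp only [Matrix.transpose_apply] at this
  rw [this]
  refine Finset.sum_congr rfl fun i _ => ?_
  rw [← Matrix.det_transpose (A.updateRow i (B i)), ← Matrix.updateCol_transpose]

lemma det_eq_sum_rows {R : Type*} [CommRing R] (A : Matrix ι ι R) : A.det =
    ∑ σ : Equiv.Perm ι, ((Equiv.Perm.sign σ : ℤ) : R) * ∏ i, A i (σ i) := by
  rw [← Matrix.det_transpose, Matrix.det_apply']
  rfl

/-- Derivative of a determinant. -/
lemma hasFDerivAt_det {E : Type*} [NormedAddCommGroup E] [NormedSpace ℝ E]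
    {A : E → Matrix ι ι ℂ} {A' : ι → ι → E →L[ℝ] ℂ} {z : E}
    (h : ∀ j k, HasFDerivAt (fun z => A z j k) (A' j k) z) :
    ∃ L : E →L[ℝ] ℂ, HasFDerivAt (fun z => (A z).det) L z ∧
      ∀ v, L v = ∑ i, ((A z).updateRow i fun k => A' i k v).det := by
  have h1 : ∀ σ : Equiv.Perm ι, HasFDerivAt (fun z => ∏ i, A z i (σ i))
      (∑ i, (∏ j ∈ Finset.univ.erase i, A z j (σ j)) • A' i (σ i)) z := fun σ =>
    HasFDerivAt.finsetProd fun i _ => h i (σ i)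
  have h2 := HasFDerivAt.fun_sum (u := Finset.univ) fun (σ : Equiv.Perm ι) _ =>
    (h1 σ).const_mul ((Equiv.Perm.sign σ : ℤ) : ℂ)
  refine ⟨_, h2.congr_of_eventuallyEq (Eventually.of_forall fun z => det_eq_sum_rows _), fun v => ?_⟩
  refine Eq.trans ?_ (sum_updateRow_eq (A z) (Matrix.of fun i k => A' i k v))
  simp

lemma hasDerivAt_det_add_smul (A B : Matrix ι ι ℂ) (t : ℝ) :
    HasDerivAt (fun t : ℝ => (A + (t : ℂ) • B).det)
      ((A + (t : ℂ) • B).adjugate * B).trace t := by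
  have h : ∀ j k, HasFDerivAt (fun t : ℝ => (A + (t : ℂ) • B) j k)
      (ContinuousLinearMap.toSpanSingleton ℝ (B j k)) t := fun j k => by
    have := ((Complex.ofRealCLM.hasDerivAt (x := t)).mul_const (B j k)).const_add (A j k)
    have := this.hasFDerivAt
    simpa using this
  obtain ⟨L, hL, hL'⟩ := hasFDerivAt_det h
  have := hL.hasDerivAt
  refine this.congr_deriv ?_
  rw [hL', trace_adjugate_mul_eq]
  simp

end DetCalc

section PSD

open Matrix
open scoped ComplexOrder MatrixOrder

variable {ι : Type*} [Fintype ι] [DecidableEq ι]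

lemma PosSemidef.exists_eq {A : Matrix ι ι ℂ} (hA : A.PosSemidef) : ∃ B : Matrix ι ι ℂ, A = Bᴴ * B := by
  obtain ⟨B, hB⟩ := CStarAlgebra.nonneg_iff_eq_star_mul_self.1 hA.nonneg
  exact ⟨B, hB⟩

lemma posSemidef_adjugate {A : Matrix ι ι ℂ} (hA : A.PosSemidef) : A.adjugate.PosSemidef := by
  obtain ⟨B, rfl⟩ := PosSemidef.exists_eq hA
  rw [Matrix.adjugate_mul_distrib, ← Matrix.adjugate_conjTranspose]
  exact Matrix.posSemidef_self_mul_conjTranspose _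

lemma trace_mul_nonneg {A C : Matrix ι ι ℂ} (hA : A.PosSemidef) (hC : C.PosSemidef) :
    0 ≤ (A * C).trace.re := by
  obtain ⟨B, rfl⟩ := PosSemidef.exists_eq hA
  obtain ⟨D, rfl⟩ := PosSemidef.exists_eq hC
  have : (Bᴴ * B * (Dᴴ * D)).trace = ((B * Dᴴ)ᴴ * (B * Dᴴ)).trace := by
    rw [Matrix.conjTranspose_mul, Matrix.conjTranspose_conjTranspose]
    rw [← Matrix.mul_assoc, Matrix.trace_mul_comm]
    simp only [Matrix.mul_assoc]
  rw [this]
  exact (Complex.le_def.1 (Matrix.posSemidef_conjTranspose_mul_self (B * Dᴴ)).trace_nonneg).1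

lemma det_re_mono {A B : Matrix ι ι ℂ} (hA : A.PosSemidef) (hB : B.PosSemidef) :
    A.det.re ≤ (A + B).det.re := by
  have hd : ∀ t : ℝ, HasDerivAt (fun t : ℝ => (A + (t : ℂ) • B).det.re)
      ((A + (t : ℂ) • B).adjugate * B).trace.re t := fun t =>
    Complex.reCLM.hasFDerivAt.comp_hasDerivAt t (hasDerivAt_det_add_smul A B t)
  have hmono : MonotoneOn (fun t : ℝ => (A + (t : ℂ) • B).det.re) (Set.Icc 0 1) := by
    refine monotoneOn_of_deriv_nonneg (convex_Icc 0 1)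
      (fun t _ => (hd t).continuousAt.continuousWithinAt)
      (fun t _ => (hd t).differentiableAt.differentiableWithinAt) fun t ht => ?_
    rw [interior_Icc] at ht
    rw [(hd t).deriv]
    refine trace_mul_nonneg (posSemidef_adjugate (hA.add (hB.smul ?_))) hB
    exact_mod_cast ht.1.le
  simpa using hmono (Set.left_mem_Icc.2 zero_le_one) (Set.right_mem_Icc.2 zero_le_one) zero_le_one

lemma det_re_nonneg {A : Matrix ι ι ℂ} (hA : A.PosSemidef) : 0 ≤ A.det.re :=
  (Complex.le_def.1 hA.det_nonneg).1

lemma det_re_add_smul_ge {A B : Matrix ι ι ℂ} (hA : A.PosSemidef) (hB : B.PosSemidef) {c : ℝ}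
    (hc : 0 ≤ c) : c ^ Fintype.card ι * B.det.re ≤ (A + (c : ℂ) • B).det.re := by
  have h := det_re_mono (hB.smul (show (0 : ℂ) ≤ c by exact_mod_cast hc)) hA
  rw [add_comm A]
  refine le_trans (le_of_eq ?_) h
  rw [Matrix.det_smul, ← Complex.ofReal_pow, Complex.re_ofReal_mul]

lemma adjugate_diag_eq (A : Matrix ι ι ℂ) (i : ι) :
    A.adjugate i i = (A + Matrix.single i i 1).det - A.det := by
  have : A + Matrix.single i i 1 = A.updateRow i (A i + Pi.single i 1) := by
    ext j k
    by_cases hj : j = i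
    · subst hj
      by_cases hk : k = j
      · subst hk; simp
      · simp [hk, Ne.symm hk]
    · simp [hj, Ne.symm hj]
  rw [this, Matrix.det_updateRow_add, Matrix.adjugate_apply, Matrix.updateRow_eq_self]
  ring

lemma posSemidef_single (i : ι) : (Matrix.single i i (1 : ℂ)).PosSemidef := by
  have : Matrix.single i i (1 : ℂ) = Matrix.diagonal (Pi.single i 1) := by
    rw [Matrix.diagonal_single]
  rw [this]
  refine Matrix.PosSemidef.diagonal ?_
  rw [Pi.le_def]
  intro j
  by_cases h : j = i
  · subst h; simp
  · simp [h]

lemma trace_adjugate_le {A : Matrix ι ι ℂ} (hA : A.PosSemidef) :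
    A.adjugate.trace.re ≤ Fintype.card ι * (A + 1).det.re := by
  have h : ∀ i, (A.adjugate i i).re ≤ (A + 1).det.re := fun i => by
    rw [adjugate_diag_eq, Complex.sub_re]
    have h1 := det_re_nonneg hA
    have h2 : (A + Matrix.single i i 1).det.re ≤ (A + Matrix.single i i 1 + (1 - Matrix.single i i 1)).det.re := by
      refine det_re_mono (hA.add (posSemidef_single i)) ?_
      have : (1 : Matrix ι ι ℂ) - Matrix.single i i 1 = Matrix.diagonal (1 - Pi.single i 1) := by
        rw [← Matrix.diagonal_single, ← Matrix.diagonal_one, Matrix.diagonal_sub]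
        rfl
      rw [this]
      refine Matrix.PosSemidef.diagonal ?_
      rw [Pi.le_def]
      intro j
      by_cases h : j = i
      · subst h; simp
      · simp [h]
    have h3 : A + Matrix.single i i 1 + (1 - Matrix.single i i 1) = A + 1 := by abel
    rw [h3] at h2
    linarith
  rw [Matrix.trace, Complex.re_sum]
  refine (Finset.sum_le_sum fun i _ => h i).trans ?_
  simp

/-- A Hermitian matrix is dominated by a multiple of the identity. -/
lemma posSemidef_smul_one_sub {M : Matrix ι ι ℂ} (hM : M.IsHermitian) {c : ℝ}
    (hc : ∀ j k, ‖M j k‖ ≤ c) :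
    (((Fintype.card ι * c : ℝ) : ℂ) • (1 : Matrix ι ι ℂ) - M).PosSemidef := by
  refine Matrix.PosSemidef.of_dotProduct_mulVec_nonneg ?_ fun x => ?_
  · refine Matrix.IsHermitian.sub ?_ hM
    simp [Matrix.IsHermitian, Matrix.conjTranspose_smul]
  rw [Complex.le_def]
  have him : (star x ⬝ᵥ (((Fintype.card ι * c : ℝ) : ℂ) • (1 : Matrix ι ι ℂ) - M) *ᵥ x).im = 0 := by
    refine Matrix.IsHermitian.im_star_dotProduct_mulVec_self ?_ x
    refine Matrix.IsHermitian.sub ?_ hM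
    simp [Matrix.IsHermitian, Matrix.conjTranspose_smul]
  refine ⟨?_, him.symm⟩
  have h1 : (star x ⬝ᵥ M *ᵥ x).re ≤ ∑ j, ∑ k, c * ((‖x j‖ ^ 2 + ‖x k‖ ^ 2) / 2) := by
    refine (Complex.re_le_norm _).trans ?_
    simp only [dotProduct, Matrix.mulVec, Finset.mul_sum]
    refine (norm_sum_le _ _).trans (Finset.sum_le_sum fun j _ => (norm_sum_le _ _).trans
      (Finset.sum_le_sum fun k _ => ?_))
    simp only [norm_mul, Pi.star_apply, norm_star]
    have h2 : ‖x j‖ * ‖x k‖ ≤ (‖x j‖ ^ 2 + ‖x k‖ ^ 2) / 2 := by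
      nlinarith [sq_nonneg (‖x j‖ - ‖x k‖)]
    calc ‖x j‖ * (‖M j k‖ * ‖x k‖) = ‖M j k‖ * (‖x j‖ * ‖x k‖) := by ring
      _ ≤ c * ((‖x j‖ ^ 2 + ‖x k‖ ^ 2) / 2) :=
        mul_le_mul (hc j k) h2 (by positivity) ((norm_nonneg _).trans (hc j k))
  have h3 : ∑ j, ∑ k, c * ((‖x j‖ ^ 2 + ‖x k‖ ^ 2) / 2) =
      Fintype.card ι * c * ∑ j, ‖x j‖ ^ 2 := by
    simp only [← Finset.mul_sum, ← Finset.sum_div, Finset.sum_add_distrib, Finset.sum_const,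
      Finset.card_univ, nsmul_eq_mul]
    ring
  have h4 : (star x ⬝ᵥ (((Fintype.card ι * c : ℝ) : ℂ) • (1 : Matrix ι ι ℂ)) *ᵥ x).re =
      Fintype.card ι * c * ∑ j, ‖x j‖ ^ 2 := by
    rw [Matrix.smul_mulVec, Matrix.one_mulVec, dotProduct_smul, smul_eq_mul, Complex.re_ofReal_mul]
    congr 1
    simp only [dotProduct, Pi.star_apply, Complex.re_sum]
    refine Finset.sum_congr rfl fun j _ => ?_
    rw [← Complex.normSq_eq_norm_sq]
    simp [Complex.normSq_apply]
  rw [Matrix.sub_mulVec, dotProduct_sub, Complex.sub_re, h4, Complex.zero_re]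
  linarith

lemma abs_trace_mul_le {A M : Matrix ι ι ℂ} (hA : A.PosSemidef) (hM : M.IsHermitian) {c : ℝ}
    (hc : ∀ j k, ‖M j k‖ ≤ c) : |(A * M).trace.re| ≤ Fintype.card ι * c * A.trace.re := by
  have h1 := trace_mul_nonneg hA (posSemidef_smul_one_sub hM hc)
  have h2 := trace_mul_nonneg hA (posSemidef_smul_one_sub hM.neg (c := c) (by simpa using hc))
  simp only [Matrix.mul_sub, Matrix.trace_sub, Matrix.mul_smul, Matrix.mul_one, Matrix.trace_smul,
    Complex.sub_re, smul_eq_mul, Complex.re_ofReal_mul, Matrix.mul_neg, Matrix.trace_neg,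
    Complex.neg_re] at h1 h2
  rw [abs_le]
  constructor <;> linarith

end PSD

section Wirtinger

variable {n : ℕ}

/-- The standard basis vector `e_j` of `ℂⁿ`. -/
def eb (j : Fin n) : Cn n := Pi.single j 1

/-- The vector `i e_j` of `ℂⁿ`. -/
def ib (j : Fin n) : Cn n := Pi.single j Complex.I

/-- The `∂/∂z_j` component of a real-linear functional. -/
def wL (j : Fin n) (L : Cn n →L[ℝ] ℂ) : ℂ := (1 / 2 : ℂ) * (L (eb j) - Complex.I * L (ib j))

/-- The `∂/∂z̄_j` component of a real-linear functional. -/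
def wbL (j : Fin n) (L : Cn n →L[ℝ] ℂ) : ℂ := (1 / 2 : ℂ) * (L (eb j) + Complex.I * L (ib j))

/-- The Wirtinger derivative `∂f/∂z_j`. -/
def wd (j : Fin n) (f : Cn n → ℂ) (z : Cn n) : ℂ := wL j (fderiv ℝ f z)

/-- The Wirtinger derivative `∂f/∂z̄_j`. -/
def wbd (j : Fin n) (f : Cn n → ℂ) (z : Cn n) : ℂ := wbL j (fderiv ℝ f z)

/-- A real function regarded as complex valued. -/
def cx (f : Cn n → ℝ) (z : Cn n) : ℂ := f z

/-- The complex Hessian matrix. -/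
def chess (φ : Cn n → ℝ) (z : Cn n) : Matrix (Fin n) (Fin n) ℂ :=
  Matrix.of fun j k => cHessEntry n φ z j k

lemma cx_contDiff {φ : Cn n → ℝ} (h : ContDiff ℝ (⊤ : ℕ∞) φ) : ContDiff ℝ (⊤ : ℕ∞) (cx φ) :=
  Complex.ofRealCLM.contDiff.comp h

lemma fderiv_apply_contDiff {F : Type*} [NormedAddCommGroup F] [NormedSpace ℝ F]
    {f : Cn n → F} (h : ContDiff ℝ (⊤ : ℕ∞) f) (v : Cn n) :
    ContDiff ℝ (⊤ : ℕ∞) fun z => fderiv ℝ f z v :=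
  (h.fderiv_right (m := ((⊤ : ℕ∞) : WithTop ℕ∞)) le_rfl).clm_apply contDiff_const

lemma wd_contDiff {f : Cn n → ℂ} (h : ContDiff ℝ (⊤ : ℕ∞) f) (j : Fin n) :
    ContDiff ℝ (⊤ : ℕ∞) (wd j f) :=
  contDiff_const.mul ((fderiv_apply_contDiff h _).sub (contDiff_const.mul (fderiv_apply_contDiff h _)))

lemma wbd_contDiff {f : Cn n → ℂ} (h : ContDiff ℝ (⊤ : ℕ∞) f) (j : Fin n) :
    ContDiff ℝ (⊤ : ℕ∞) (wbd j f) :=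
  contDiff_const.mul ((fderiv_apply_contDiff h _).add (contDiff_const.mul (fderiv_apply_contDiff h _)))

lemma ContDiff.diff_top {F : Type*} [NormedAddCommGroup F] [NormedSpace ℝ F]
    {f : Cn n → F} (h : ContDiff ℝ (⊤ : ℕ∞) f) : Differentiable ℝ f :=
  h.differentiable (by simp)

lemma fderiv_cx {φ : Cn n → ℝ} {z : Cn n} (h : DifferentiableAt ℝ φ z) (v : Cn n) :
    fderiv ℝ (cx φ) z v = (fderiv ℝ φ z v : ℂ) := by
  have := (Complex.ofRealCLM.hasFDerivAt.comp z h.hasFDerivAt).fderiv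
  have h2 : (⇑Complex.ofRealCLM ∘ φ) = cx φ := rfl
  rw [h2] at this
  rw [this]; rfl

lemma wL_add (j : Fin n) (L M) : wL j (L + M) = wL j L + wL j M := by
  simp [wL]; ring

lemma wL_smul (j : Fin n) (c : ℂ) (L : Cn n →L[ℝ] ℂ) : wL j (c • L) = c * wL j L := by
  simp [wL]; ring

lemma wd_mul {f g : Cn n → ℂ} {z : Cn n} (hf : DifferentiableAt ℝ f z)
    (hg : DifferentiableAt ℝ g z) (j : Fin n) :
    wd j (fun z => f z * g z) z = wd j f z * g z + f z * wd j g z := by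
  rw [wd, fderiv_fun_mul hf hg, wL_add, wL_smul, wL_smul, wd, wd]; ring

lemma wd_sum {ι : Type*} {s : Finset ι} {f : ι → Cn n → ℂ} {z : Cn n}
    (hf : ∀ i ∈ s, DifferentiableAt ℝ (f i) z) (j : Fin n) :
    wd j (fun z => ∑ i ∈ s, f i z) z = ∑ i ∈ s, wd j (f i) z := by
  rw [wd, fderiv_fun_sum hf]
  simp only [wL, wd, sum_apply, Finset.mul_sum, ← Finset.sum_sub_distrib]

lemma wL_cx_conj {φ : Cn n → ℝ} {z : Cn n} (h : DifferentiableAt ℝ φ z) (j : Fin n) :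
    star (wd j (cx φ) z) = wbd j (cx φ) z := by
  simp [wd, wbd, wL, wbL, fderiv_cx h]

lemma fderiv_fderiv_symm {f : Cn n → ℂ} (h : ContDiff ℝ (⊤ : ℕ∞) f) (z v w : Cn n) :
    fderiv ℝ (fun x => fderiv ℝ f x v) z w = fderiv ℝ (fun x => fderiv ℝ f x w) z v := by
  have hd : DifferentiableAt ℝ (fderiv ℝ f) z :=
    (h.fderiv_right (m := ((⊤ : ℕ∞) : WithTop ℕ∞)) le_rfl).diff_top z
  rw [fderiv_clm_apply hd (differentiableAt_const v), fderiv_clm_apply hd (differentiableAt_const w)]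
  simp only [fderiv_fun_const, Pi.zero_apply, ContinuousLinearMap.comp_zero, zero_add,
    ContinuousLinearMap.flip_apply]
  exact (h.contDiffAt.isSymmSndFDerivAt (by simp; exact WithTop.coe_le_coe.2 le_top)) _ _

lemma fderiv_wd {f : Cn n → ℂ} (h : ContDiff ℝ (⊤ : ℕ∞) f) (j : Fin n) (z v : Cn n) :
    fderiv ℝ (wd j f) z v = (1 / 2 : ℂ) * (fderiv ℝ (fun x => fderiv ℝ f x (eb j)) z v
      - Complex.I * fderiv ℝ (fun x => fderiv ℝ f x (ib j)) z v) := by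
  have h1 := ((fderiv_apply_contDiff h (eb j)).diff_top z).hasFDerivAt
  have h2 := ((fderiv_apply_contDiff h (ib j)).diff_top z).hasFDerivAt
  have := ((h1.sub (h2.const_mul Complex.I)).const_mul (1 / 2 : ℂ)).fderiv
  have e : wd j f = fun y => (1 / 2 : ℂ) * (fderiv ℝ f y (eb j) - Complex.I * fderiv ℝ f y (ib j)) := rfl
  rw [e]
  erw [this]
  simp

lemma fderiv_wbd {f : Cn n → ℂ} (h : ContDiff ℝ (⊤ : ℕ∞) f) (j : Fin n) (z v : Cn n) :
    fderiv ℝ (wbd j f) z v = (1 / 2 : ℂ) * (fderiv ℝ (fun x => fderiv ℝ f x (eb j)) z v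
      + Complex.I * fderiv ℝ (fun x => fderiv ℝ f x (ib j)) z v) := by
  have h1 := ((fderiv_apply_contDiff h (eb j)).diff_top z).hasFDerivAt
  have h2 := ((fderiv_apply_contDiff h (ib j)).diff_top z).hasFDerivAt
  have := ((h1.add (h2.const_mul Complex.I)).const_mul (1 / 2 : ℂ)).fderiv
  have e : wbd j f = fun y => (1 / 2 : ℂ) * (fderiv ℝ f y (eb j) + Complex.I * fderiv ℝ f y (ib j)) := rfl
  rw [e]
  erw [this]
  simp [mul_add]

lemma wd_comm {f : Cn n → ℂ} (h : ContDiff ℝ (⊤ : ℕ∞) f) (j k : Fin n) (z : Cn n) :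
    wd j (wd k f) z = wd k (wd j f) z := by
  rw [wd, wd, wL, wL, fderiv_wd h, fderiv_wd h, fderiv_wd h, fderiv_wd h,
    fderiv_fderiv_symm h z (eb k) (eb j), fderiv_fderiv_symm h z (ib k) (eb j),
    fderiv_fderiv_symm h z (eb k) (ib j), fderiv_fderiv_symm h z (ib k) (ib j)]
  ring

lemma reB_cx {φ : Cn n → ℝ} (h : ContDiff ℝ (⊤ : ℕ∞) φ) (z v w : Cn n) :
    (reB n φ z v w : ℂ) = fderiv ℝ (fun x => fderiv ℝ (cx φ) x w) z v := by
  have e : (fun x => fderiv ℝ (cx φ) x w) = cx fun x => fderiv ℝ φ x w :=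
    funext fun x => fderiv_cx (h.diff_top x) w
  rw [e, fderiv_cx ((fderiv_apply_contDiff h w).diff_top z), reB]

lemma chess_apply {φ : Cn n → ℝ} (h : ContDiff ℝ (⊤ : ℕ∞) φ) (z : Cn n) (j k : Fin n) :
    chess φ z j k = wd j (wbd k (cx φ)) z := by
  have h' := cx_contDiff h
  rw [chess, Matrix.of_apply, cHessEntry, reB_cx h, reB_cx h, reB_cx h, reB_cx h,
    wd, wL, fderiv_wbd h', fderiv_wbd h']
  simp only [eb, ib]
  ring_nf
  simp only [Complex.I_sq]
  ring

lemma chess_contDiff {φ : Cn n → ℝ} (h : ContDiff ℝ (⊤ : ℕ∞) φ) (j k : Fin n) :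
    ContDiff ℝ (⊤ : ℕ∞) fun z => chess φ z j k := by
  simp only [chess_apply h]
  exact wd_contDiff (wbd_contDiff (cx_contDiff h) k) j

lemma wL_det {ι : Type*} [Fintype ι] [DecidableEq ι] (A : Matrix ι ι ℂ)
    (A' : ι → ι → Cn n →L[ℝ] ℂ) (L : Cn n →L[ℝ] ℂ)
    (hL : ∀ v, L v = ∑ i, (A.updateRow i fun k => A' i k v).det) (j : Fin n) :
    wL j L = ∑ i, (A.updateRow i fun k => wL j (A' i k)).det := by
  rw [wL, hL, hL, Finset.mul_sum, ← Finset.sum_sub_distrib, Finset.mul_sum]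
  refine Finset.sum_congr rfl fun i _ => ?_
  have e : (fun k => wL j (A' i k)) = (1 / 2 : ℂ) • ((fun k => A' i k (eb j)) +
      (-Complex.I) • fun k => A' i k (ib j)) := by
    ext k; simp [wL]; ring
  rw [e, Matrix.det_updateRow_smul, Matrix.det_updateRow_add, Matrix.det_updateRow_smul]
  ring

lemma det_updateRow_swap {ι : Type*} [Fintype ι] [DecidableEq ι] (A : Matrix ι ι ℂ) {i j : ι}
    (hij : i ≠ j) (s t : ι → ℂ) :
    ((A.updateRow i s).updateRow j t).det = -((A.updateRow j s).updateRow i t).det := by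
  have h := Matrix.det_permute (Equiv.swap i j) ((A.updateRow i t).updateRow j s)
  rw [Equiv.Perm.sign_swap hij] at h
  have e : ((A.updateRow i t).updateRow j s).submatrix (Equiv.swap i j) id =
      (A.updateRow i s).updateRow j t := by
    ext a b
    by_cases ha : a = i
    · subst ha; simp [Matrix.updateRow_apply, hij]
    · by_cases hb : a = j
      · subst hb; simp [Matrix.updateRow_apply, hij]
      · simp [Matrix.updateRow_apply, ha, hb, Equiv.swap_apply_of_ne_of_ne ha hb]
  rw [e] at h
  rw [h, Matrix.updateRow_comm _ hij]
  simp

lemma adjugate_chess_contDiff {φ : Cn n → ℝ} (h : ContDiff ℝ (⊤ : ℕ∞) φ) (j k : Fin n) :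
    ContDiff ℝ (⊤ : ℕ∞) fun z => (chess φ z).adjugate k j := by
  simp only [Matrix.adjugate_apply, det_eq_sum_rows]
  refine ContDiff.sum fun σ _ => contDiff_const.mul (contDiff_prod fun i _ => ?_)
  simp only [Matrix.updateRow_apply]
  split_ifs
  · exact contDiff_const
  · exact chess_contDiff h _ _

/-- The Piola identity. -/
lemma sum_wd_adjugate {φ : Cn n → ℝ} (h : ContDiff ℝ (⊤ : ℕ∞) φ) (k : Fin n) (z : Cn n) :
    ∑ j, wd j (fun z => (chess φ z).adjugate k j) z = 0 := by
  classical
  set A := chess φ z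
  have key : ∀ j, wd j (fun z => (chess φ z).adjugate k j) z = ∑ i, if i = j then 0 else
      ((A.updateRow j (Pi.single k 1)).updateRow i fun l => wd j (fun z => chess φ z i l) z).det := by
    intro j
    set A' : Fin n → Fin n → Cn n →L[ℝ] ℂ := fun i l =>
      if i = j then 0 else fderiv ℝ (fun z => chess φ z i l) z
    obtain ⟨L, hL, hL'⟩ := hasFDerivAt_det (ι := Fin n)
      (A := fun z => (chess φ z).updateRow j (Pi.single k 1)) (A' := A') (z := z) (by
        intro i l
        simp only [Matrix.updateRow_apply, A']
        split_ifs
        · exact hasFDerivAt_const _ _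
        · exact ((chess_contDiff h i l).diff_top z).hasFDerivAt)
    simp only [Matrix.adjugate_apply]
    rw [wd, hL.fderiv, wL_det _ _ _ hL']
    refine Finset.sum_congr rfl fun i _ => ?_
    by_cases hi : i = j
    · simp only [hi, A', if_true]
      refine Matrix.det_eq_zero_of_row_eq_zero j fun l => ?_
      simp [wL]
    · simp only [hi, A', if_false, wd]
      rfl
  simp only [key]
  set T : Fin n → Fin n → ℂ := fun j i => if i = j then 0 else
      ((A.updateRow j (Pi.single k 1)).updateRow i fun l => wd j (fun z => chess φ z i l) z).det
  have hT : ∀ i j, T i j = -T j i := by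
    intro i j
    by_cases hij : i = j
    · simp [T, hij]
    · have hij' : j ≠ i := fun h => hij h.symm
      simp only [T, hij, hij', if_false]
      rw [det_updateRow_swap _ hij]
      have : ∀ l, wd i (fun z => chess φ z j l) z = wd j (fun z => chess φ z i l) z := by
        intro l
        simp only [chess_apply h]
        exact wd_comm (wbd_contDiff (cx_contDiff h) l) i j z
      simp only [this]
  have h1 : ∑ j, ∑ i, T j i = -∑ j, ∑ i, T j i := by
    conv_lhs => rw [Finset.sum_comm]
    rw [← Finset.sum_neg_distrib]
    refine Finset.sum_congr rfl fun j _ => ?_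
    rw [← Finset.sum_neg_distrib]
    exact Finset.sum_congr rfl fun i _ => hT i j
  exact self_eq_neg.1 h1

lemma integral_wd_eq_zero {F : Cn n → ℂ} (hF : ContDiff ℝ (⊤ : ℕ∞) F) (hc : HasCompactSupport F)
    (j : Fin n) : ∫ z, wd j F z = 0 := by
  have hi : ∀ v, Integrable fun z => fderiv ℝ F z v := fun v =>
    (fderiv_apply_contDiff hF v).continuous.integrable_of_hasCompactSupport
      (hc.fderiv_apply ℝ v)
  have h0 : ∀ v, ∫ z, fderiv ℝ F z v = 0 := fun v => by
    have := integral_mul_fderiv_eq_neg_fderiv_mul_of_integrable (μ := (volume : Measure (Cn n)))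
      (f := fun _ : Cn n => (1 : ℂ)) (g := F) (v := v) (by simp) (by simpa using hi v)
      (by simpa using hF.continuous.integrable_of_hasCompactSupport hc)
      (fun x _ => differentiableAt_const _) (fun x _ => hF.diff_top x)
    simpa using this
  simp only [wd, wL]
  rw [integral_const_mul, integral_sub (hi _) ((hi _).const_mul _), integral_const_mul, h0, h0]
  simp

/-- Integration by parts for the linearised Monge–Ampère operator. -/
lemma integral_mul_trace_adjugate {φ f g : Cn n → ℝ} (hφ : ContDiff ℝ (⊤ : ℕ∞) φ)
    (hf : ContDiff ℝ (⊤ : ℕ∞) f) (hg : ContDiff ℝ (⊤ : ℕ∞) g)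
    (hc : HasCompactSupport f ∨ HasCompactSupport g) :
    ∫ z, (f z : ℂ) * ((chess φ z).adjugate * chess g z).trace =
      -∫ z, ∑ j, ∑ k, wd j (cx f) z * (chess φ z).adjugate k j * wbd k (cx g) z := by
  have hF : ∀ j, ContDiff ℝ (⊤ : ℕ∞) fun z =>
      ∑ k, cx f z * ((chess φ z).adjugate k j * wbd k (cx g) z) := fun j =>
    ContDiff.sum fun k _ => (cx_contDiff hf).mul ((adjugate_chess_contDiff hφ j k).mul
      (wbd_contDiff (cx_contDiff hg) k))
  have hcg : HasCompactSupport g → ∀ k, HasCompactSupport (wbd k (cx g)) := fun h k => by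
    have h' : HasCompactSupport (cx g) := h.comp_left (g := Complex.ofReal) Complex.ofReal_zero
    refine (h'.fderiv ℝ).comp_left (g := fun L => wbL k L) ?_
    simp [wbL]
  have hFc : ∀ j, HasCompactSupport fun z =>
      ∑ k, cx f z * ((chess φ z).adjugate k j * wbd k (cx g) z) := fun j => by
    rcases hc with h | h
    · have h' : HasCompactSupport (cx f) := h.comp_left (g := Complex.ofReal) Complex.ofReal_zero
      simp only [← Finset.mul_sum]
      exact h'.mul_right
    · refine HasCompactSupport.intro' (K := ⋃ k, tsupport (wbd k (cx g)))
        (isCompact_iUnion fun k => hcg h k)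
        (isCompact_iUnion fun k => hcg h k).isClosed fun x hx => ?_
      refine Finset.sum_eq_zero fun k _ => ?_
      rw [image_eq_zero_of_notMem_tsupport (f := wbd k (cx g)) fun hk =>
        hx (Set.mem_iUnion.2 ⟨k, hk⟩)]
      simp
  have h0 := fun j => integral_wd_eq_zero (hF j) (hFc j) j
  have hInt : ∀ j, Integrable (wd j fun z =>
      ∑ k, cx f z * ((chess φ z).adjugate k j * wbd k (cx g) z)) := fun j =>
    (wd_contDiff (hF j) j).continuous.integrable_of_hasCompactSupport (by
      refine ((hFc j).fderiv ℝ).comp_left (g := fun L => wL j L) ?_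
      simp [wL])
  have h1 : ∫ z, ∑ j, wd j (fun z =>
      ∑ k, cx f z * ((chess φ z).adjugate k j * wbd k (cx g) z)) z = 0 := by
    rw [integral_finsetSum _ fun j _ => hInt j]
    exact Finset.sum_eq_zero fun j _ => h0 j
  have hd1 := fun z => (cx_contDiff hf).diff_top z
  have hd2 := fun k z => (wbd_contDiff (cx_contDiff hg) k).diff_top z
  have hd3 := fun j k z => (adjugate_chess_contDiff hφ j k).diff_top z
  have hpt : ∀ z, ∑ j, wd j (fun z =>
      ∑ k, cx f z * ((chess φ z).adjugate k j * wbd k (cx g) z)) z =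
      (∑ j, ∑ k, wd j (cx f) z * (chess φ z).adjugate k j * wbd k (cx g) z) +
      (f z : ℂ) * ((chess φ z).adjugate * chess g z).trace := by
    intro z
    have e1 : ∀ j k, wd j (fun z => cx f z * ((chess φ z).adjugate k j * wbd k (cx g) z)) z =
        wd j (cx f) z * (chess φ z).adjugate k j * wbd k (cx g) z +
        (f z : ℂ) * (wd j (fun z => (chess φ z).adjugate k j) z * wbd k (cx g) z) +
        (f z : ℂ) * ((chess φ z).adjugate k j * chess g z j k) := by
      intro j k
      rw [wd_mul (hd1 z) ((hd3 j k z).fun_mul (hd2 k z)), wd_mul (hd3 j k z) (hd2 k z),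
        chess_apply hg]
      simp only [cx]
      ring
    have e2 : ∀ j, wd j (fun z =>
        ∑ k, cx f z * ((chess φ z).adjugate k j * wbd k (cx g) z)) z = ∑ k,
        wd j (fun z => cx f z * ((chess φ z).adjugate k j * wbd k (cx g) z)) z := fun j =>
      wd_sum (fun k _ => (hd1 z).fun_mul ((hd3 j k z).fun_mul (hd2 k z))) j
    simp only [e2, e1, Finset.sum_add_distrib]
    have e3 : ∑ j, ∑ k, (f z : ℂ) * (wd j (fun z => (chess φ z).adjugate k j) z * wbd k (cx g) z)
        = 0 := by
      rw [Finset.sum_comm]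
      refine Finset.sum_eq_zero fun k _ => ?_
      rw [← Finset.mul_sum, ← Finset.sum_mul, sum_wd_adjugate hφ]
      simp
    rw [e3, add_zero]
    congr 1
    rw [Matrix.trace, Finset.mul_sum, Finset.sum_comm]
    refine Finset.sum_congr rfl fun k _ => ?_
    rw [Matrix.diag_apply, Matrix.mul_apply, Finset.mul_sum]
  have hi2 : Integrable fun z => (f z : ℂ) * ((chess φ z).adjugate * chess g z).trace := by
    refine Continuous.integrable_of_hasCompactSupport ?_ ?_
    · refine (Complex.continuous_ofReal.comp hf.continuous).mul ?_
      simp only [Matrix.trace, Matrix.diag_apply, Matrix.mul_apply]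
      exact continuous_finsetSum _ fun k _ => continuous_finsetSum _ fun j _ =>
        (adjugate_chess_contDiff hφ _ _).continuous.mul (chess_contDiff hg _ _).continuous
    · rcases hc with h | h
      · have h' : HasCompactSupport (cx f) := h.comp_left (g := Complex.ofReal) Complex.ofReal_zero
        exact h'.mul_right
      · refine HasCompactSupport.mul_left ?_
        refine HasCompactSupport.intro' (K := ⋃ k, tsupport (wbd k (cx g)))
          (isCompact_iUnion fun k => hcg h k)
          (isCompact_iUnion fun k => hcg h k).isClosed fun x hx => ?_
        have : chess g x = 0 := by
          ext j k
          rw [chess_apply hg, wd]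
          rw [image_eq_zero_of_notMem_tsupport (f := fderiv ℝ (wbd k (cx g))) fun hk =>
            hx (Set.mem_iUnion.2 ⟨k, tsupport_fderiv_subset ℝ hk⟩)]
          simp [wL]
        rw [this]; simp
  have hi1 : Integrable fun z => ∑ j, ∑ k, wd j (cx f) z * (chess φ z).adjugate k j *
      wbd k (cx g) z := by
    have := (integrable_finsetSum Finset.univ fun j _ => hInt j).sub hi2
    refine this.congr (Eventually.of_forall fun z => ?_)
    simp only [Pi.sub_apply, hpt z]
    ring
  simp only [hpt] at h1
  rw [integral_add hi1 hi2] at h1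
  linear_combination h1

end Wirtinger

section Hess

open Matrix
open scoped ComplexOrder

variable {n : ℕ}

lemma cHessEntry_of_contDiffAt {φ : Cn n → ℝ} {z : Cn n} (h : ContDiffAt ℝ 2 φ z) (j k : Fin n) :
    chess φ z j k = (1 / 4 : ℂ) * ((fderiv ℝ (fderiv ℝ φ) z (eb j) (eb k) : ℂ) +
      fderiv ℝ (fderiv ℝ φ) z (ib j) (ib k) + Complex.I *
      ((fderiv ℝ (fderiv ℝ φ) z (eb j) (ib k) : ℂ) - fderiv ℝ (fderiv ℝ φ) z (ib j) (eb k))) := by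
  rw [chess, Matrix.of_apply, cHessEntry]
  simp only [reB, fderiv_fderiv_apply h]
  rfl

lemma chess_isHermitian {φ : Cn n → ℝ} {z : Cn n} (h : ContDiffAt ℝ 2 φ z) :
    (chess φ z).IsHermitian := by
  ext j k
  have hs := h.isSymmSndFDerivAt (by simp)
  rw [conjTranspose_apply, cHessEntry_of_contDiffAt h, cHessEntry_of_contDiffAt h,
    hs.eq (eb k), hs.eq (ib k), hs.eq (eb k) (ib j), hs.eq (ib k) (eb j)]
  simp
  ring

lemma sum_eb (G : Cn n →L[ℝ] ℂ) (b : Cn n) :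
    ∑ j, b j * (G (eb j) - Complex.I * G (ib j)) = G b - Complex.I * G (Complex.I • b) := by
  have hb : b = ∑ j, ((b j).re • eb j + (b j).im • ib j) := by
    ext k
    simp only [Finset.sum_apply, Pi.add_apply, Pi.smul_apply, eb, ib, Pi.single_apply]
    simp [Finset.sum_add_distrib, mul_comm]
    conv_lhs => rw [← Complex.re_add_im (b k)]
    ring
  have hib : Complex.I • b = ∑ j, ((b j).re • ib j - (b j).im • eb j) := by
    ext k
    simp only [Finset.sum_apply, Pi.sub_apply, Pi.smul_apply, eb, ib, Pi.single_apply]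
    simp [Finset.sum_sub_distrib]
    conv_lhs => rw [← Complex.re_add_im (b k)]
    ring_nf; simp; ring
  have h1 : G b = ∑ j, ((b j).re * G (eb j) + (b j).im * G (ib j)) := by
    conv_lhs => rw [hb]
    simp [map_sum]
  have h2 : G (Complex.I • b) = ∑ j, ((b j).re * G (ib j) - (b j).im * G (eb j)) := by
    rw [hib]
    simp [map_sum]
  rw [h1, h2, Finset.mul_sum, ← Finset.sum_sub_distrib]
  refine Finset.sum_congr rfl fun j _ => ?_
  conv_lhs => rw [← Complex.re_add_im (b j)]
  linear_combination (-((b j).im * G (ib j)) : ℂ) * Complex.I_sq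

lemma sum_eb_conj (G : Cn n →L[ℝ] ℂ) (b : Cn n) :
    ∑ j, star (b j) * (G (eb j) + Complex.I * G (ib j)) = G b + Complex.I * G (Complex.I • b) := by
  have := congrArg star (sum_eb ((Complex.conjCLE : ℂ →L[ℝ] ℂ).comp G) b)
  simpa [mul_comm] using this

lemma quad_chess {φ : Cn n → ℝ} {z : Cn n} (h : ContDiffAt ℝ 2 φ z) (b : Cn n) :
    ∑ j, ∑ k, b j * star (b k) * chess φ z j k = ((levi φ z b / 4 : ℝ) : ℂ) := by
  have hs := h.isSymmSndFDerivAt (by simp)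
  set B := fderiv ℝ (fderiv ℝ φ) z
  let G1 : Cn n → (Cn n →L[ℝ] ℂ) := fun v => Complex.ofRealCLM.comp (B v)
  have e1 : ∀ j k, chess φ z j k = (1 / 4 : ℂ) * ((G1 (eb j) (eb k) + Complex.I * G1 (eb j) (ib k))
      - Complex.I * (G1 (ib j) (eb k) + Complex.I * G1 (ib j) (ib k))) := by
    intro j k
    rw [cHessEntry_of_contDiffAt h]
    simp only [G1, ContinuousLinearMap.comp_apply, Complex.ofRealCLM_apply]
    linear_combination (1 / 4 : ℂ) * (B (ib j) (ib k) : ℂ) * Complex.I_sq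
  have e2 : ∀ j, ∑ k, b j * star (b k) * chess φ z j k = (1 / 4 : ℂ) * (b j *
      ((G1 (eb j) b + Complex.I * G1 (eb j) (Complex.I • b)) -
        Complex.I * (G1 (ib j) b + Complex.I * G1 (ib j) (Complex.I • b)))) := by
    intro j
    rw [← sum_eb_conj, ← sum_eb_conj, Finset.mul_sum, ← Finset.sum_sub_distrib, Finset.mul_sum,
      Finset.mul_sum]
    refine Finset.sum_congr rfl fun k _ => ?_
    rw [e1]; ring
  simp only [e2]
  let G2 : Cn n →L[ℝ] ℂ := Complex.ofRealCLM.comp (B.flip b) +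
    Complex.I • Complex.ofRealCLM.comp (B.flip (Complex.I • b))
  have := sum_eb G2 b
  rw [← Finset.mul_sum]
  have e3 : ∀ j, G2 (eb j) = G1 (eb j) b + Complex.I * G1 (eb j) (Complex.I • b) := fun j => rfl
  have e4 : ∀ j, G2 (ib j) = G1 (ib j) b + Complex.I * G1 (ib j) (Complex.I • b) := fun j => rfl
  simp only [← e3, ← e4]
  rw [this]
  have e5 : ∀ v, G2 v = (B v b : ℂ) + Complex.I * (B v (Complex.I • b) : ℂ) := fun v => rfl
  rw [e5, e5, levi, hs.eq b (Complex.I • b)]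
  push_cast
  linear_combination (-1 / 4 : ℂ) * (B (Complex.I • b) (Complex.I • b) : ℂ) * Complex.I_sq

lemma posSemidef_chess {φ : Cn n → ℝ} {z : Cn n} (h : ContDiffAt ℝ 2 φ z)
    (hl : ∀ b, 0 ≤ levi φ z b) : (chess φ z).PosSemidef := by
  refine PosSemidef.of_dotProduct_mulVec_nonneg (chess_isHermitian h) fun x => ?_
  have := quad_chess h (star x)
  have e : star x ⬝ᵥ (chess φ z *ᵥ x) = ∑ j, ∑ k, (star x) j * star ((star x) k) * chess φ z j k := by
    simp only [dotProduct, mulVec, Finset.mul_sum]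
    refine Finset.sum_congr rfl fun j _ => Finset.sum_congr rfl fun k _ => ?_
    simp; ring
  rw [e, this]
  have := hl (star x)
  exact_mod_cast (by positivity : 0 ≤ levi φ z (star x) / 4)

lemma levi_nonneg_of_posSemidef {φ : Cn n → ℝ} {z : Cn n} (h : ContDiffAt ℝ 2 φ z)
    (hl : (chess φ z).PosSemidef) (b : Cn n) : 0 ≤ levi φ z b := by
  have := quad_chess h b
  have h2 := hl.dotProduct_mulVec_nonneg (star b)
  have e : star (star b) ⬝ᵥ (chess φ z *ᵥ star b) = ∑ j, ∑ k, b j * star (b k) * chess φ z j k := by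
    simp only [dotProduct, mulVec, Finset.mul_sum]
    refine Finset.sum_congr rfl fun j _ => Finset.sum_congr rfl fun k _ => ?_
    simp; ring
  rw [e, this] at h2
  have : 0 ≤ levi φ z b / 4 := by exact_mod_cast h2
  linarith

lemma ContDiff.two {F : Type*} [NormedAddCommGroup F] [NormedSpace ℝ F] {φ : Cn n → F}
    (h : ContDiff ℝ (⊤ : ℕ∞) φ) (z : Cn n) : ContDiffAt ℝ 2 φ z :=
  (h.of_le (WithTop.coe_le_coe.2 le_top)).contDiffAt

lemma chess_add {φ ψ : Cn n → ℝ} (hφ : ContDiff ℝ (⊤ : ℕ∞) φ) (hψ : ContDiff ℝ (⊤ : ℕ∞) ψ)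
    (c : ℝ) (z : Cn n) :
    chess (fun z => φ z + c * ψ z) z = chess φ z + (c : ℂ) • chess ψ z := by
  have hd : ∀ (f : Cn n → ℝ), ContDiff ℝ (⊤ : ℕ∞) f → ∀ w, Differentiable ℝ fun x => fderiv ℝ f x w :=
    fun f hf w => (fderiv_apply_contDiff hf w).diff_top
  have e : ∀ v w, reB n (fun z => φ z + c * ψ z) z v w = reB n φ z v w + c * reB n ψ z v w := by
    intro v w
    have : (fun x => fderiv ℝ (fun z => φ z + c * ψ z) x w) =
        fun x => fderiv ℝ φ x w + c * fderiv ℝ ψ x w := by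
      ext x
      rw [fderiv_fun_add (hφ.diff_top x) ((hψ.diff_top x).const_mul c),
        fderiv_const_mul (hψ.diff_top x)]
      simp
    rw [reB, this, fderiv_fun_add (hd φ hφ w z) ((hd ψ hψ w z).const_mul c),
      fderiv_const_mul (hd ψ hψ w z)]
    simp [reB]
  ext j k
  simp only [chess, Matrix.of_apply, Matrix.add_apply, Matrix.smul_apply, cHessEntry, e]
  push_cast
  simp only [smul_eq_mul]
  ring

lemma chess_sub {φ ψ : Cn n → ℝ} (hφ : ContDiff ℝ (⊤ : ℕ∞) φ) (hψ : ContDiff ℝ (⊤ : ℕ∞) ψ)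
    (z : Cn n) : chess (fun z => φ z - ψ z) z = chess φ z - chess ψ z := by
  have := chess_add hφ hψ (-1) z
  simp only [neg_mul, one_mul, ← sub_eq_add_neg] at this
  rw [this]
  simp [sub_eq_add_neg]

lemma chess_congr {φ ψ : Cn n → ℝ} {z : Cn n} (h : φ =ᶠ[𝓝 z] ψ) : chess φ z = chess ψ z := by
  have e : ∀ v w, reB n φ z v w = reB n ψ z v w := by
    intro v w
    have h2 : (fun x => fderiv ℝ φ x w) =ᶠ[𝓝 z] fun x => fderiv ℝ ψ x w := ?_
    · rw [reB, reB, h2.fderiv_eq]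
    filter_upwards [h.fderiv (𝕜 := ℝ)] with x hx
    rw [hx]
  ext j k
  simp only [chess, Matrix.of_apply, cHessEntry, e]

/-- Symmetry of the linearised Monge–Ampère operator. -/
lemma integral_trace_symm {φ f g : Cn n → ℝ} (hφ : ContDiff ℝ (⊤ : ℕ∞) φ)
    (hf : ContDiff ℝ (⊤ : ℕ∞) f) (hg : ContDiff ℝ (⊤ : ℕ∞) g)
    (hc : HasCompactSupport f ∨ HasCompactSupport g) :
    ∫ z, f z * ((chess φ z).adjugate * chess g z).trace.re =
      ∫ z, g z * ((chess φ z).adjugate * chess f z).trace.re := by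
  have hreal : ∀ {f g : Cn n → ℝ}, ContDiff ℝ (⊤ : ℕ∞) f → ContDiff ℝ (⊤ : ℕ∞) g → ∀ z,
      (f z : ℂ) * ((chess φ z).adjugate * chess g z).trace =
      ((f z * ((chess φ z).adjugate * chess g z).trace.re : ℝ) : ℂ) := by
    intro f g hf hg z
    have h1 : ((chess φ z).adjugate).IsHermitian := by
      rw [IsHermitian, Matrix.adjugate_conjTranspose, chess_isHermitian (ContDiff.two hφ z)]
    have h2 := chess_isHermitian (ContDiff.two hg z)
    have : star ((chess φ z).adjugate * chess g z).trace = ((chess φ z).adjugate * chess g z).trace := by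
      rw [← Matrix.trace_conjTranspose, Matrix.conjTranspose_mul, h1, h2, Matrix.trace_mul_comm]
    have := Complex.conj_eq_iff_re.1 this
    push_cast
    rw [this]
  have hA := integral_mul_trace_adjugate hφ hf hg hc
  have hB := integral_mul_trace_adjugate hφ hg hf hc.symm
  have key : ∀ z, star (∑ j, ∑ k, wd j (cx g) z * (chess φ z).adjugate k j * wbd k (cx f) z) =
      ∑ j, ∑ k, wd j (cx f) z * (chess φ z).adjugate k j * wbd k (cx g) z := by
    intro z
    have h1 : ((chess φ z).adjugate).IsHermitian := by
      rw [IsHermitian, Matrix.adjugate_conjTranspose, chess_isHermitian (ContDiff.two hφ z)]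
    simp only [star_sum, star_mul']
    rw [Finset.sum_comm]
    refine Finset.sum_congr rfl fun j _ => Finset.sum_congr rfl fun k _ => ?_
    rw [h1.apply, wL_cx_conj (hg.diff_top z), ← wL_cx_conj (hf.diff_top z), star_star]
    ring
  have hAB : ∫ z, (f z : ℂ) * ((chess φ z).adjugate * chess g z).trace =
      star (∫ z, (g z : ℂ) * ((chess φ z).adjugate * chess f z).trace) := by
    rw [hA, hB, star_neg]
    congr 1
    simp only [← key]
    exact integral_conj
  simp only [hreal hf hg, hreal hg hf, integral_complex_ofReal] at hAB
  simpa using hAB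

/-- A sign for the linearised operator tested against functions of `h`. -/
lemma integral_mul_trace_nonpos {φ f h : Cn n → ℝ} (hφ : ContDiff ℝ (⊤ : ℕ∞) φ)
    (hf : ContDiff ℝ (⊤ : ℕ∞) f) (hh : ContDiff ℝ (⊤ : ℕ∞) h) (hc : HasCompactSupport f)
    (hr : ∀ z, fderiv ℝ f z ≠ 0 → (chess φ z).PosSemidef ∧
      ∃ ρ : ℝ, 0 ≤ ρ ∧ fderiv ℝ f z = ρ • fderiv ℝ h z) :
    ∫ z, f z * ((chess φ z).adjugate * chess h z).trace.re ≤ 0 := by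
  have hA := integral_mul_trace_adjugate hφ hf hh (Or.inl hc)
  have hpt : ∀ z, 0 ≤ (∑ j, ∑ k, wd j (cx f) z * (chess φ z).adjugate k j * wbd k (cx h) z).re := by
    intro z
    by_cases h0 : fderiv ℝ f z = 0
    · have : ∀ j, wd j (cx f) z = 0 := fun j => by
        simp [wd, wL, fderiv_cx (hf.diff_top z), h0]
      simp [this]
    · obtain ⟨hpsd, ρ, hρ, hρ'⟩ := hr z h0
      have e1 : ∀ j, wd j (cx f) z = ρ * wd j (cx h) z := fun j => by
        simp [wd, wL, fderiv_cx (hf.diff_top z), fderiv_cx (hh.diff_top z), hρ']; ring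
      have h2 := (posSemidef_adjugate hpsd).dotProduct_mulVec_nonneg (fun j => wd j (cx h) z)
      have e2 : ∑ j, ∑ k, wd j (cx f) z * (chess φ z).adjugate k j * wbd k (cx h) z =
          ρ * (star (fun j => wd j (cx h) z) ⬝ᵥ ((chess φ z).adjugate *ᵥ fun j => wd j (cx h) z)) := by
        simp only [dotProduct, mulVec, Finset.mul_sum, e1]
        rw [Finset.sum_comm]
        refine Finset.sum_congr rfl fun j _ => Finset.sum_congr rfl fun k _ => ?_
        rw [← wL_cx_conj (hh.diff_top z)]
        simp only [Pi.star_apply]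
        ring
      rw [e2, Complex.re_ofReal_mul]
      exact mul_nonneg hρ (Complex.le_def.1 h2).1
  have e : ∫ z, f z * ((chess φ z).adjugate * chess h z).trace.re =
      (∫ z, (f z : ℂ) * ((chess φ z).adjugate * chess h z).trace).re := by
    have hi : Integrable fun z => (f z : ℂ) * ((chess φ z).adjugate * chess h z).trace := by
      refine Continuous.integrable_of_hasCompactSupport ?_ ?_
      · refine (Complex.continuous_ofReal.comp hf.continuous).mul ?_
        simp only [Matrix.trace, Matrix.diag_apply, Matrix.mul_apply]
        exact continuous_finsetSum _ fun k _ => continuous_finsetSum _ fun j _ =>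
          (adjugate_chess_contDiff hφ _ _).continuous.mul (chess_contDiff hh _ _).continuous
      · exact (hc.comp_left (g := Complex.ofReal) Complex.ofReal_zero).mul_right
    have := integral_re hi
    simp only [RCLike.re_to_complex] at this
    rw [← this]
    exact integral_congr_ae (Eventually.of_forall fun z => by simp)
  rw [e, hA, Complex.neg_re]
  rw [neg_nonpos]
  by_cases hi : Integrable fun z =>
      ∑ j, ∑ k, wd j (cx f) z * (chess φ z).adjugate k j * wbd k (cx h) z
  · have := integral_re hi
    simp only [RCLike.re_to_complex] at this
    rw [← this]
    exact integral_nonneg hpt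
  · rw [integral_undef hi]; simp

end Hess

section Energy

open Matrix
open scoped ComplexOrder

lemma hasDerivAt_setIntegral_compact {X : Type*} [TopologicalSpace X] [MeasurableSpace X]
    [OpensMeasurableSpace X] [T2Space X] {μ : Measure X} [IsFiniteMeasureOnCompacts μ] {S : Set X}
    (hS : IsCompact S) {Φ Φ' : ℝ → X → ℝ} (hc : ∀ t, Continuous (Φ t))
    (hc' : Continuous fun p : ℝ × X => Φ' p.1 p.2)
    (hd : ∀ t x, HasDerivAt (fun t => Φ t x) (Φ' t x) t) (t : ℝ) :
    HasDerivAt (fun t => ∫ x in S, Φ t x ∂μ) (∫ x in S, Φ' t x ∂μ) t := by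
  obtain ⟨C, hC⟩ := ((isCompact_Icc (a := t - 1) (b := t + 1)).prod hS).exists_bound_of_continuousOn
    hc'.continuousOn
  have hct : ∀ t, Continuous (Φ' t) := fun t => hc'.comp (Continuous.prodMk_right t)
  refine (hasDerivAt_integral_of_dominated_loc_of_deriv_le (s := Set.Icc (t - 1) (t + 1))
    (bound := fun _ => C)
    (Icc_mem_nhds (by linarith) (by linarith))
    (Eventually.of_forall fun t => ((hc t).continuousOn.integrableOn_compact hS).aestronglyMeasurable)
    ((hc t).continuousOn.integrableOn_compact hS)
    ((hct t).continuousOn.integrableOn_compact hS).aestronglyMeasurable ?_ ?_ ?_).2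
  · refine (ae_restrict_iff' hS.measurableSet).2 (Eventually.of_forall fun x hx t' ht' => ?_)
    exact hC (t', x) ⟨ht', hx⟩
  · exact continuousOn_const.integrableOn_compact hS
  · exact Eventually.of_forall fun x t' _ => hd t' x

variable {n : ℕ}

lemma chess_continuous {φ : Cn n → ℝ} (h : ContDiff ℝ (⊤ : ℕ∞) φ) : Continuous (chess φ) :=
  continuous_matrix fun j k => (chess_contDiff h j k).continuous

lemma integral_eq_setIntegral_of_zero {X : Type*} [MeasurableSpace X] {μ : Measure X}
    {f : X → ℝ} {S : Set X} (h : ∀ x, x ∉ S → f x = 0) : ∫ x, f x ∂μ = ∫ x in S, f x ∂μ :=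
  (setIntegral_eq_integral_of_forall_compl_eq_zero h).symm

lemma hasDerivAt_det_re (A B : Matrix (Fin n) (Fin n) ℂ) (t : ℝ) :
    HasDerivAt (fun t : ℝ => (A + (t : ℂ) • B).det.re)
      ((A + (t : ℂ) • B).adjugate * B).trace.re t :=
  Complex.reCLM.hasFDerivAt.comp_hasDerivAt t (hasDerivAt_det_add_smul A B t)

lemma chess_lerp {φ ψ : Cn n → ℝ} (hφ : ContDiff ℝ (⊤ : ℕ∞) φ) (hψ : ContDiff ℝ (⊤ : ℕ∞) ψ)
    (s : ℝ) (z : Cn n) :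
    chess (fun z => ψ z + s * (φ z - ψ z)) z =
      chess ψ z + (s : ℂ) • chess (fun z => φ z - ψ z) z :=
  chess_add hψ (hφ.sub hψ) s z

lemma posSemidef_lerp {A B : Matrix (Fin n) (Fin n) ℂ} (hA : A.PosSemidef) (hB : B.PosSemidef)
    {s : ℝ} (h0 : 0 ≤ s) (h1 : s ≤ 1) : (B + (s : ℂ) • (A - B)).PosSemidef := by
  have e : B + (s : ℂ) • (A - B) = ((1 - s : ℝ) : ℂ) • B + (s : ℂ) • A := by
    ext; simp; ring
  rw [e]
  refine (hB.smul ?_).add (hA.smul ?_)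
  · exact_mod_cast (by linarith : (0 : ℝ) ≤ 1 - s)
  · exact_mod_cast h0

/-- A comparison principle for smooth functions. -/
lemma integral_mul_det_le {φ ψ f : Cn n → ℝ} (hφ : ContDiff ℝ (⊤ : ℕ∞) φ)
    (hψ : ContDiff ℝ (⊤ : ℕ∞) ψ) (hf : ContDiff ℝ (⊤ : ℕ∞) f) (hc : HasCompactSupport f)
    (hr : ∀ z, fderiv ℝ f z ≠ 0 → (chess φ z).PosSemidef ∧ (chess ψ z).PosSemidef ∧
      ∃ ρ : ℝ, 0 ≤ ρ ∧ fderiv ℝ f z = ρ • fderiv ℝ (fun z => φ z - ψ z) z) :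
    ∫ z, f z * (chess φ z).det.re ≤ ∫ z, f z * (chess ψ z).det.re := by
  set h : Cn n → ℝ := fun z => φ z - ψ z with hh
  have hhs : ContDiff ℝ (⊤ : ℕ∞) h := hφ.sub hψ
  have hcψ := chess_continuous hψ
  have hch := chess_continuous hhs
  have hd := hasDerivAt_setIntegral_compact (μ := (volume : Measure (Cn n))) (S := tsupport f) hc
    (Φ := fun t z => f z * (chess ψ z + (t : ℂ) • chess h z).det.re)
    (Φ' := fun t z => f z * ((chess ψ z + (t : ℂ) • chess h z).adjugate * chess h z).trace.re)
    (fun t => hf.continuous.mul (Complex.continuous_re.comp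
      (hcψ.add (hch.const_smul (t : ℂ))).matrix_det)) (by
      refine (hf.continuous.comp continuous_snd).mul (Complex.continuous_re.comp ?_)
      refine Continuous.matrix_trace (Continuous.matrix_mul (Continuous.matrix_adjugate ?_)
        (hch.comp continuous_snd))
      exact (hcψ.comp continuous_snd).add
        ((Complex.continuous_ofReal.comp continuous_fst).smul (hch.comp continuous_snd)))
    (fun t z => (hasDerivAt_det_re _ _ t).const_mul (f z))
  have hanti : AntitoneOn (fun t : ℝ => ∫ z in tsupport f,
      f z * (chess ψ z + (t : ℂ) • chess h z).det.re) (Set.Icc 0 1) := by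
    refine antitoneOn_of_deriv_nonpos (convex_Icc 0 1)
      (fun t _ => (hd t).continuousAt.continuousWithinAt)
      (fun t _ => (hd t).differentiableAt.differentiableWithinAt) fun t ht => ?_
    rw [interior_Icc] at ht
    rw [(hd t).deriv, ← integral_eq_setIntegral_of_zero fun x hx => by
      rw [image_eq_zero_of_notMem_tsupport hx, zero_mul]]
    have hsm : ContDiff ℝ (⊤ : ℕ∞) fun z => ψ z + t * (φ z - ψ z) :=
      hψ.add (contDiff_const.mul hhs)
    have := integral_mul_trace_nonpos (h := h) hsm hf hhs hc (fun z hz => by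
      obtain ⟨h1, h2, h3⟩ := hr z hz
      refine ⟨?_, h3⟩
      rw [chess_lerp hφ hψ, chess_sub hφ hψ]
      exact posSemidef_lerp h1 h2 ht.1.le ht.2.le)
    simpa only [chess_lerp hφ hψ] using this
  have := hanti (Set.left_mem_Icc.2 zero_le_one) (Set.right_mem_Icc.2 zero_le_one) zero_le_one
  simp only [Complex.ofReal_one, one_smul, Complex.ofReal_zero, zero_smul, add_zero, hh,
    chess_sub hφ hψ, add_sub_cancel] at this
  rw [← integral_eq_setIntegral_of_zero fun x hx => by
      rw [image_eq_zero_of_notMem_tsupport hx, zero_mul], ← integral_eq_setIntegral_of_zero fun x hx => by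
      rw [image_eq_zero_of_notMem_tsupport hx, zero_mul]] at this
  exact this

/-- Smooth functions with semipositive Hessian which agree with `q` outside a compact set. -/
structure Adm (q a : Cn n → ℝ) : Prop where
  smooth : ContDiff ℝ (⊤ : ℕ∞) a
  compact : HasCompactSupport fun z => a z - q z
  psd : ∀ z, (chess a z).PosSemidef

/-- The Monge–Ampère energy of `a` relative to `q`. -/
def energy (q a : Cn n → ℝ) : ℝ :=
  ∫ s in Set.Icc (0 : ℝ) 1, ∫ z, (a z - q z) * (chess q z + (s : ℂ) • (chess a z - chess q z)).det.re

section Pencil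

variable {q H k : Cn n → ℝ}

/-- The complex Hessian of `q + s (H + t k)` at `z`, where `p = (s, z)`. -/
def pencil (q H k : Cn n → ℝ) (t : ℝ) (p : ℝ × Cn n) : Matrix (Fin n) (Fin n) ℂ :=
  chess q p.2 + (p.1 : ℂ) • (chess H p.2 + (t : ℂ) • chess k p.2)

lemma pencil_continuous (hq : ContDiff ℝ (⊤ : ℕ∞) q) (hH : ContDiff ℝ (⊤ : ℕ∞) H)
    (hk : ContDiff ℝ (⊤ : ℕ∞) k) : Continuous fun p : ℝ × (ℝ × Cn n) => pencil q H k p.1 p.2 := by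
  have e2 : Continuous fun p : ℝ × (ℝ × Cn n) => p.2.2 := by fun_prop
  have e1 : Continuous fun p : ℝ × (ℝ × Cn n) => (p.2.1 : ℂ) := by fun_prop
  have e0 : Continuous fun p : ℝ × (ℝ × Cn n) => (p.1 : ℂ) := by fun_prop
  exact ((chess_continuous hq).comp e2).add (e1.smul (((chess_continuous hH).comp e2).add
    (e0.smul ((chess_continuous hk).comp e2))))

lemma pencil_continuous_right (hq : ContDiff ℝ (⊤ : ℕ∞) q) (hH : ContDiff ℝ (⊤ : ℕ∞) H)
    (hk : ContDiff ℝ (⊤ : ℕ∞) k) (t : ℝ) : Continuous (pencil q H k t) := by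
  have e2 : Continuous fun p : ℝ × Cn n => p.2 := by fun_prop
  have e1 : Continuous fun p : ℝ × Cn n => (p.1 : ℂ) := by fun_prop
  exact ((chess_continuous hq).comp e2).add (e1.smul (((chess_continuous hH).comp e2).add
    (((chess_continuous hk).comp e2).const_smul (t : ℂ))))

lemma pencil_eq_chess (hq : ContDiff ℝ (⊤ : ℕ∞) q) (hH : ContDiff ℝ (⊤ : ℕ∞) H)
    (hk : ContDiff ℝ (⊤ : ℕ∞) k) (t s : ℝ) (z : Cn n) :
    pencil q H k t (s, z) = chess (fun z => q z + s * (H z + t * k z)) z := by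
  rw [chess_add hq (hH.add (contDiff_const.mul hk)), chess_add hH hk, pencil]

lemma hasDerivAt_pencil_integral (hq : ContDiff ℝ (⊤ : ℕ∞) q) (hH : ContDiff ℝ (⊤ : ℕ∞) H)
    (hk : ContDiff ℝ (⊤ : ℕ∞) k) {S : Set (ℝ × Cn n)} (hS : IsCompact S) (t : ℝ) :
    HasDerivAt (fun t => ∫ p in S, (H p.2 + t * k p.2) * (pencil q H k t p).det.re
        ∂((volume : Measure ℝ).prod volume))
      (∫ p in S, (k p.2 * (pencil q H k t p).det.re + (H p.2 + t * k p.2) *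
        (p.1 * ((pencil q H k t p).adjugate * chess k p.2).trace.re))
        ∂((volume : Measure ℝ).prod volume)) t := by
  have hMc := pencil_continuous hq hH hk
  have hMt := pencil_continuous_right hq hH hk
  have hck := chess_continuous hk
  refine hasDerivAt_setIntegral_compact hS
    (Φ := fun t p => (H p.2 + t * k p.2) * (pencil q H k t p).det.re)
    (Φ' := fun t p => k p.2 * (pencil q H k t p).det.re +
      (H p.2 + t * k p.2) * (p.1 * ((pencil q H k t p).adjugate * chess k p.2).trace.re))
    (fun t => ?_) ?_ (fun t p => ?_) t
  · exact ((hH.continuous.add (continuous_const.mul hk.continuous)).comp continuous_snd).mul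
      (Complex.continuous_re.comp (hMt t).matrix_det)
  · have e2 : Continuous fun p : ℝ × (ℝ × Cn n) => p.2.2 := by fun_prop
    have e1 : Continuous fun p : ℝ × (ℝ × Cn n) => p.2.1 := by fun_prop
    have e0 : Continuous fun p : ℝ × (ℝ × Cn n) => p.1 := by fun_prop
    refine ((hk.continuous.comp e2).mul (Complex.continuous_re.comp hMc.matrix_det)).add ?_
    refine ((hH.continuous.comp e2).add (e0.mul (hk.continuous.comp e2))).mul (e1.mul ?_)
    exact Complex.continuous_re.comp (hMc.matrix_adjugate.matrix_mul (hck.comp e2)).matrix_trace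
  · have h1 : HasDerivAt (fun t : ℝ => H p.2 + t * k p.2) (k p.2) t := by
      simpa using ((hasDerivAt_id t).mul_const (k p.2)).const_add (H p.2)
    have h2 := hasDerivAt_det_re (chess q p.2 + (p.1 : ℂ) • chess H p.2) ((p.1 : ℂ) • chess k p.2) t
    have e : ∀ t : ℝ, chess q p.2 + (p.1 : ℂ) • chess H p.2 + (t : ℂ) • (p.1 : ℂ) • chess k p.2 =
        pencil q H k t p := fun t => by
      rw [pencil, smul_add, smul_comm (t : ℂ) (p.1 : ℂ), add_assoc]
    rw [e t, funext fun t : ℝ => congrArg (fun A => (Matrix.det A).re) (e t)] at h2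
    refine (h1.mul h2).congr_deriv ?_
    rw [Matrix.mul_smul, Matrix.trace_smul, smul_eq_mul, Complex.re_ofReal_mul]

lemma pencil_slice (hq : ContDiff ℝ (⊤ : ℕ∞) q) (hH : ContDiff ℝ (⊤ : ℕ∞) H)
    (hk : ContDiff ℝ (⊤ : ℕ∞) k) {K : Set (Cn n)} (hKc : IsCompact K)
    (hH0 : ∀ z, z ∉ K → H z = 0) (hk0 : ∀ z, z ∉ K → k z = 0) (t s : ℝ) :
    ∫ z in K, (k z * (pencil q H k t (s, z)).det.re +
      (H z + t * k z) * (s * ((pencil q H k t (s, z)).adjugate * chess k z).trace.re)) =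
      ∫ z in K, k z * ((pencil q H k t (s, z)).det.re + s * ((pencil q H k t (s, z)).adjugate *
        chess (fun z => H z + t * k z) z).trace.re) := by
  have hkc : HasCompactSupport k := HasCompactSupport.intro hKc hk0
  have hfam : ContDiff ℝ (⊤ : ℕ∞) fun z => H z + t * k z := hH.add (contDiff_const.mul hk)
  have hMs : Continuous fun z => pencil q H k t (s, z) :=
    (pencil_continuous_right hq hH hk t).comp (Continuous.prodMk_right s)
  have hsym := integral_trace_symm (hq.add (contDiff_const.mul hfam) :
    ContDiff ℝ (⊤ : ℕ∞) fun z => q z + s * (H z + t * k z)) hfam hk (Or.inr hkc)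
  simp only [← pencil_eq_chess hq hH hk] at hsym
  rw [integral_eq_setIntegral_of_zero (S := K) (f := fun z => (H z + t * k z) *
      ((pencil q H k t (s, z)).adjugate * chess k z).trace.re)
      (fun z hz => by rw [hH0 z hz, hk0 z hz]; simp),
    integral_eq_setIntegral_of_zero (S := K) (f := fun z => k z * ((pencil q H k t (s, z)).adjugate *
      chess (fun z => H z + t * k z) z).trace.re)
      (fun z hz => by rw [hk0 z hz, zero_mul])] at hsym
  have i1 : IntegrableOn (fun z => k z * (pencil q H k t (s, z)).det.re) K :=
    (hk.continuous.mul (Complex.continuous_re.comp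
      hMs.matrix_det)).continuousOn.integrableOn_compact hKc
  have i2 : IntegrableOn (fun z => (H z + t * k z) *
      ((pencil q H k t (s, z)).adjugate * chess k z).trace.re) K :=
    (hfam.continuous.mul (Complex.continuous_re.comp (hMs.matrix_adjugate.matrix_mul
      (chess_continuous hk)).matrix_trace)).continuousOn.integrableOn_compact hKc
  have i3 : IntegrableOn (fun z => k z * ((pencil q H k t (s, z)).adjugate *
      chess (fun z => H z + t * k z) z).trace.re) K :=
    (hk.continuous.mul (Complex.continuous_re.comp (hMs.matrix_adjugate.matrix_mul
      (chess_continuous hfam)).matrix_trace)).continuousOn.integrableOn_compact hKc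
  simp only [mul_add, mul_left_comm _ s]
  rw [integral_add i1 (i2.const_mul s), integral_add i1 (i3.const_mul s), integral_const_mul,
    integral_const_mul, hsym]

lemma pencil_value (hq : ContDiff ℝ (⊤ : ℕ∞) q) (hH : ContDiff ℝ (⊤ : ℕ∞) H)
    (hk : ContDiff ℝ (⊤ : ℕ∞) k) (t : ℝ) (z : Cn n) :
    ∫ s in Set.Icc (0 : ℝ) 1, ((pencil q H k t (s, z)).det.re + s *
      ((pencil q H k t (s, z)).adjugate * chess (fun z => H z + t * k z) z).trace.re) =
      (chess q z + (chess H z + (t : ℂ) • chess k z)).det.re := by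
  have hder : ∀ s ∈ Set.uIcc (0 : ℝ) 1, HasDerivAt (fun s : ℝ => s * (pencil q H k t (s, z)).det.re)
      ((pencil q H k t (s, z)).det.re + s * ((pencil q H k t (s, z)).adjugate *
        chess (fun z => H z + t * k z) z).trace.re) s := by
    intro s _
    have := (hasDerivAt_id s).mul (hasDerivAt_det_re (chess q z) (chess H z + (t : ℂ) • chess k z) s)
    simp only [id, one_mul] at this
    rw [chess_add hH hk]
    exact this
  have hci : Continuous fun s => (pencil q H k t (s, z)).det.re + s *
      ((pencil q H k t (s, z)).adjugate * chess (fun z => H z + t * k z) z).trace.re := by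
    have : Continuous fun s => pencil q H k t (s, z) :=
      (pencil_continuous_right hq hH hk t).comp (by fun_prop)
    refine (Complex.continuous_re.comp this.matrix_det).add (continuous_id.mul
      (Complex.continuous_re.comp ?_))
    exact (this.matrix_adjugate.matrix_mul continuous_const).matrix_trace
  have := intervalIntegral.integral_eq_sub_of_hasDerivAt hder (hci.intervalIntegrable 0 1)
  rw [intervalIntegral.integral_of_le zero_le_one, ← integral_Icc_eq_integral_Ioc] at this
  rw [this]
  simp only [pencil, one_mul, zero_mul, sub_zero, Complex.ofReal_one, one_smul]

lemma pencil_total (hq : ContDiff ℝ (⊤ : ℕ∞) q) (hH : ContDiff ℝ (⊤ : ℕ∞) H)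
    (hk : ContDiff ℝ (⊤ : ℕ∞) k) {K : Set (Cn n)} (hKc : IsCompact K)
    (hH0 : ∀ z, z ∉ K → H z = 0) (hk0 : ∀ z, z ∉ K → k z = 0) (t : ℝ) :
    (∫ p in Set.Icc (0 : ℝ) 1 ×ˢ K, (k p.2 * (pencil q H k t p).det.re + (H p.2 + t * k p.2) *
        (p.1 * ((pencil q H k t p).adjugate * chess k p.2).trace.re))
        ∂((volume : Measure ℝ).prod volume)) =
      ∫ z, k z * (chess q z + (chess H z + (t : ℂ) • chess k z)).det.re := by
  have hMt := pencil_continuous_right hq hH hk t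
  have hfam : ContDiff ℝ (⊤ : ℕ∞) fun z => H z + t * k z := hH.add (contDiff_const.mul hk)
  have hcont3 : Continuous fun p : ℝ × Cn n => k p.2 * ((pencil q H k t p).det.re + p.1 *
      ((pencil q H k t p).adjugate * chess (fun z => H z + t * k z) p.2).trace.re) := by
    refine (hk.continuous.comp continuous_snd).mul ((Complex.continuous_re.comp
      hMt.matrix_det).add (continuous_fst.mul (Complex.continuous_re.comp ?_)))
    exact (hMt.matrix_adjugate.matrix_mul
      ((chess_continuous hfam).comp continuous_snd)).matrix_trace
  have hcont4 : Continuous fun p : ℝ × Cn n => k p.2 * (pencil q H k t p).det.re +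
      (H p.2 + t * k p.2) * (p.1 * ((pencil q H k t p).adjugate * chess k p.2).trace.re) := by
    refine ((hk.continuous.comp continuous_snd).mul (Complex.continuous_re.comp
      hMt.matrix_det)).add ((hfam.continuous.comp continuous_snd).mul
        (continuous_fst.mul (Complex.continuous_re.comp ?_)))
    exact (hMt.matrix_adjugate.matrix_mul ((chess_continuous hk).comp continuous_snd)).matrix_trace
  have hSc : IsCompact (Set.Icc (0 : ℝ) 1 ×ˢ K) := isCompact_Icc.prod hKc
  rw [setIntegral_prod _ (hcont4.continuousOn.integrableOn_compact hSc)]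
  simp only [pencil_slice hq hH hk hKc hH0 hk0]
  rw [← setIntegral_prod (f := fun p : ℝ × Cn n => k p.2 * ((pencil q H k t p).det.re + p.1 *
    ((pencil q H k t p).adjugate * chess (fun z => H z + t * k z) p.2).trace.re))
    (hcont3.continuousOn.integrableOn_compact hSc)]
  have hsw := setIntegral_prod_swap (μ := (volume : Measure ℝ)) (ν := (volume : Measure (Cn n)))
    (Set.Icc (0 : ℝ) 1) K (fun p : ℝ × Cn n => k p.2 * ((pencil q H k t p).det.re + p.1 *
    ((pencil q H k t p).adjugate * chess (fun z => H z + t * k z) p.2).trace.re))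
  have hpr := setIntegral_prod (μ := (volume : Measure (Cn n))) (ν := (volume : Measure ℝ))
    (s := K) (t := Set.Icc (0 : ℝ) 1) _
    ((hcont3.comp continuous_swap).continuousOn.integrableOn_compact (hKc.prod isCompact_Icc))
  refine hsw.symm.trans (hpr.trans ?_)
  rw [integral_eq_setIntegral_of_zero (S := K)
    (f := fun z => k z * (chess q z + (chess H z + (t : ℂ) • chess k z)).det.re)
    (fun z hz => by rw [hk0 z hz, zero_mul])]
  refine setIntegral_congr_fun hKc.measurableSet fun z _ => ?_
  simp only [Function.comp_apply, Prod.swap_prod_mk]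
  rw [integral_const_mul, pencil_value hq hH hk]

lemma hasDerivAt_energy_aux (hq : ContDiff ℝ (⊤ : ℕ∞) q) (hH : ContDiff ℝ (⊤ : ℕ∞) H)
    (hk : ContDiff ℝ (⊤ : ℕ∞) k) {K : Set (Cn n)} (hKc : IsCompact K)
    (hH0 : ∀ z, z ∉ K → H z = 0) (hk0 : ∀ z, z ∉ K → k z = 0) (t : ℝ) :
    HasDerivAt (fun t : ℝ => ∫ s in Set.Icc (0 : ℝ) 1, ∫ z, (H z + t * k z) *
      (pencil q H k t (s, z)).det.re)
      (∫ z, k z * (chess q z + (chess H z + (t : ℂ) • chess k z)).det.re) t := by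
  have hSc : IsCompact (Set.Icc (0 : ℝ) 1 ×ˢ K) := isCompact_Icc.prod hKc
  have hen : ∀ t : ℝ, (∫ s in Set.Icc (0 : ℝ) 1, ∫ z, (H z + t * k z) *
      (pencil q H k t (s, z)).det.re) =
      ∫ p in Set.Icc (0 : ℝ) 1 ×ˢ K, (H p.2 + t * k p.2) * (pencil q H k t p).det.re
        ∂((volume : Measure ℝ).prod volume) := by
    intro t
    have hco : Continuous fun p : ℝ × Cn n => (H p.2 + t * k p.2) * (pencil q H k t p).det.re :=
      ((hH.continuous.add (continuous_const.mul hk.continuous)).comp continuous_snd).mul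
        (Complex.continuous_re.comp (pencil_continuous_right hq hH hk t).matrix_det)
    rw [setIntegral_prod _ (hco.continuousOn.integrableOn_compact hSc)]
    refine setIntegral_congr_fun measurableSet_Icc fun s _ => ?_
    exact integral_eq_setIntegral_of_zero (f := fun z => (H z + t * k z) *
      (pencil q H k t (s, z)).det.re) (fun z hz => by rw [hH0 z hz, hk0 z hz]; simp)
  rw [← pencil_total hq hH hk hKc hH0 hk0]
  simp only [hen]
  exact hasDerivAt_pencil_integral hq hH hk hSc t

end Pencil

lemma hasDerivAt_energy {q a b : Cn n → ℝ} (hq : ContDiff ℝ (⊤ : ℕ∞) q) (ha : ContDiff ℝ (⊤ : ℕ∞) a)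
    (hb : ContDiff ℝ (⊤ : ℕ∞) b) (hca : HasCompactSupport fun z => a z - q z)
    (hcb : HasCompactSupport fun z => b z - q z) (t : ℝ) :
    HasDerivAt (fun t : ℝ => energy q fun z => b z + t * (a z - b z))
      (∫ z, (a z - b z) * (chess b z + (t : ℂ) • (chess a z - chess b z)).det.re) t := by
  have hH0 : ∀ z, z ∉ tsupport (fun z => a z - q z) ∪ tsupport (fun z => b z - q z) →
      b z - q z = 0 := fun z hz =>
    image_eq_zero_of_notMem_tsupport (f := fun z => b z - q z) fun h => hz (Or.inr h)
  have hk0 : ∀ z, z ∉ tsupport (fun z => a z - q z) ∪ tsupport (fun z => b z - q z) →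
      a z - b z = 0 := fun z hz => by
    have h1 := image_eq_zero_of_notMem_tsupport (f := fun z => a z - q z) fun h => hz (Or.inl h)
    have h2 := hH0 z hz
    linarith
  have h := hasDerivAt_energy_aux hq (hb.sub hq) (ha.sub hb) (IsCompact.union hca hcb) hH0 hk0 t
  have e1 : ∀ (t : ℝ) z, chess (fun z => b z + t * (a z - b z)) z - chess q z =
      chess (fun z => b z - q z) z + (t : ℂ) • chess (fun z => a z - b z) z := fun t z => by
    rw [chess_add hb (ha.sub hb), chess_sub hb hq]; abel
  have e2 : ∀ (t : ℝ) z, b z + t * (a z - b z) - q z = b z - q z + t * (a z - b z) :=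
    fun t z => by ring
  simp only [pencil] at h
  simp only [energy, e1, e2]
  refine h.congr_deriv ?_
  refine integral_congr_ae (Eventually.of_forall fun z => ?_)
  simp only
  rw [chess_sub ha hb, chess_sub hb hq, ← add_assoc, add_sub_cancel]

lemma integral_mul_det_le_energy {q a b : Cn n → ℝ} (hq : ContDiff ℝ (⊤ : ℕ∞) q) (ha : Adm q a)
    (hb : Adm q b) (hab : ∀ z, b z ≤ a z) :
    ∫ z, (a z - b z) * (chess b z).det.re ≤ (n + 1) * (energy q a - energy q b) := by
  set D : ℝ := ∫ z, (a z - b z) * (chess b z).det.re with hD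
  have hd := hasDerivAt_energy hq ha.smooth hb.smooth ha.compact hb.compact
  have hcab : HasCompactSupport fun z => a z - b z := by
    have e : (fun z => a z - b z) = (fun z => a z - q z) + -(fun z => b z - q z) := by
      funext z; simp
    rw [e]
    exact ha.compact.add hb.compact.neg
  have hder : ∀ t : ℝ, HasDerivAt (fun t : ℝ => (energy q fun z => b z + t * (a z - b z)) +
      (1 - t) ^ (n + 1) / (n + 1) * D)
      ((∫ z, (a z - b z) * (chess b z + (t : ℂ) • (chess a z - chess b z)).det.re) -
        (1 - t) ^ n * D) t := by
    intro t
    have h1 : HasDerivAt (fun t : ℝ => (1 - t) ^ (n + 1) / (n + 1) * D) (-((1 - t) ^ n * D)) t := by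
      have := ((((hasDerivAt_id t).const_sub 1).pow (n + 1)).div_const ((n : ℝ) + 1)).mul_const D
      refine this.congr_deriv ?_
      have : (n : ℝ) + 1 ≠ 0 := by positivity
      push_cast
      simp only [id]
      field_simp
    rw [sub_eq_add_neg]
    exact (hd t).add h1
  have hi : ∀ g : Cn n → ℝ, Continuous g → Integrable fun z => (a z - b z) * g z := fun g hg =>
    ((ha.smooth.continuous.sub hb.smooth.continuous).mul hg).integrable_of_hasCompactSupport
      hcab.mul_right
  have hca := chess_continuous ha.smooth
  have hcb := chess_continuous hb.smooth
  have hmono : MonotoneOn (fun t : ℝ => (energy q fun z => b z + t * (a z - b z)) +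
      (1 - t) ^ (n + 1) / (n + 1) * D) (Set.Icc 0 1) := by
    refine monotoneOn_of_deriv_nonneg (convex_Icc 0 1)
      (fun t _ => (hder t).continuousAt.continuousWithinAt)
      (fun t _ => (hder t).differentiableAt.differentiableWithinAt) fun t ht => ?_
    rw [interior_Icc] at ht
    rw [(hder t).deriv, sub_nonneg, hD, ← integral_const_mul]
    have e1 : ∀ z, (1 - t) ^ n * ((a z - b z) * (chess b z).det.re) =
        (a z - b z) * ((1 - t) ^ n * (chess b z).det.re) := fun z => by ring
    simp only [e1]
    refine integral_mono (hi _ (continuous_const.mul (Complex.continuous_re.comp hcb.matrix_det)))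
      (hi _ (Complex.continuous_re.comp (hcb.add ((hca.sub hcb).const_smul (t : ℂ))).matrix_det))
      fun z => ?_
    refine mul_le_mul_of_nonneg_left ?_ (by linarith [hab z])
    have h2 := det_re_add_smul_ge (A := (t : ℂ) • chess a z) (c := 1 - t)
      ((ha.psd z).smul (by exact_mod_cast ht.1.le)) (hb.psd z) (by linarith [ht.2])
    rw [Fintype.card_fin] at h2
    refine h2.trans_eq ?_
    congr 2
    ext; simp; ring
  have := hmono (Set.left_mem_Icc.2 zero_le_one) (Set.right_mem_Icc.2 zero_le_one) zero_le_one
  simp only [zero_mul, add_zero, one_mul, add_sub_cancel, sub_zero, one_pow, sub_self, ne_eq,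
    Nat.add_eq_zero_iff, one_ne_zero, and_false, not_false_eq_true, zero_pow, zero_div] at this
  have h3 : (0 : ℝ) < n + 1 := by positivity
  have h4 : D / (n + 1) ≤ energy q a - energy q b := by
    have : 1 / ((n : ℝ) + 1) * D = D / (n + 1) := by ring
    linarith
  rw [div_le_iff₀ h3] at h4
  linarith

lemma energy_mono {q a b : Cn n → ℝ} (hq : ContDiff ℝ (⊤ : ℕ∞) q) (ha : Adm q a)
    (hb : Adm q b) (hab : ∀ z, b z ≤ a z) : energy q b ≤ energy q a := by
  have h := integral_mul_det_le_energy hq ha hb hab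
  have h2 : 0 ≤ ∫ z, (a z - b z) * (chess b z).det.re :=
    integral_nonneg fun z => mul_nonneg (by simpa using hab z) (det_re_nonneg (hb.psd z))
  have h3 : (0 : ℝ) < n + 1 := by positivity
  by_contra! h4
  nlinarith

end Energy

section Glue

open Matrix
open scoped ComplexOrder

/-- A smooth convex function vanishing on `(-∞, -1]` and of slope one on `[1, ∞)`. -/
def convexBend (t : ℝ) : ℝ := ∫ s in (-1 : ℝ)..t, Real.smoothTransition ((s + 1) / 2)

lemma hasDerivAt_convexBend (t : ℝ) :
    HasDerivAt convexBend (Real.smoothTransition ((t + 1) / 2)) t := by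
  have hc : Continuous fun s : ℝ => Real.smoothTransition ((s + 1) / 2) :=
    Real.smoothTransition.continuous.comp (by fun_prop)
  exact intervalIntegral.integral_hasDerivAt_right (hc.intervalIntegrable _ _)
    (hc.stronglyMeasurableAtFilter _ _) hc.continuousAt

lemma deriv_convexBend :
    deriv convexBend = fun t => Real.smoothTransition ((t + 1) / 2) :=
  funext fun t => (hasDerivAt_convexBend t).deriv

lemma convexBend_contDiff : ContDiff ℝ (⊤ : ℕ∞) convexBend := by
  refine contDiff_infty_iff_deriv.2 ⟨fun t => (hasDerivAt_convexBend t).differentiableAt, ?_⟩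
  rw [deriv_convexBend]
  exact Real.smoothTransition.contDiff.comp (by fun_prop)

lemma convexBend_mono : Monotone convexBend :=
  monotone_of_deriv_nonneg (fun t => (hasDerivAt_convexBend t).differentiableAt) fun t => by
    rw [(hasDerivAt_convexBend t).deriv]; exact Real.smoothTransition.nonneg _

lemma convexBend_of_le {t : ℝ} (ht : t ≤ -1) : convexBend t = 0 := by
  rw [convexBend, intervalIntegral.integral_symm, neg_eq_zero]
  have : Set.EqOn (fun s : ℝ => Real.smoothTransition ((s + 1) / 2)) (fun _ => 0)
      (Set.uIcc t (-1)) := fun s hs => by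
    rw [Set.uIcc_of_le ht] at hs
    exact Real.smoothTransition.zero_of_nonpos (by linarith [hs.2])
  rw [intervalIntegral.integral_congr this]
  simp

lemma convexBend_of_ge {t : ℝ} (ht : 1 ≤ t) : convexBend t = convexBend 1 + (t - 1) := by
  have hc : Continuous fun s : ℝ => Real.smoothTransition ((s + 1) / 2) :=
    Real.smoothTransition.continuous.comp (by fun_prop)
  rw [convexBend, convexBend, ← intervalIntegral.integral_add_adjacent_intervals (b := 1)
    (hc.intervalIntegrable _ _) (hc.intervalIntegrable _ _)]
  have : Set.EqOn (fun s : ℝ => Real.smoothTransition ((s + 1) / 2)) (fun _ => 1)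
      (Set.uIcc 1 t) := fun s hs => by
    rw [Set.uIcc_of_le ht] at hs
    exact Real.smoothTransition.one_of_one_le (by linarith [hs.1])
  rw [intervalIntegral.integral_congr this]
  simp

variable {n : ℕ}

/-- The quadratic function `A |z - x₀|² - B`. -/
def quad (A B : ℝ) (x0 z : Cn n) : ℝ := A * ∑ j, ‖z j - x0 j‖ ^ 2 - B

lemma quad_contDiff (A B : ℝ) (x0 : Cn n) : ContDiff ℝ (⊤ : ℕ∞) (quad A B x0) := by
  refine (contDiff_const.mul (ContDiff.sum fun j _ => ?_)).sub contDiff_const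
  exact (contDiff_norm_sq ℝ).comp ((contDiff_apply ℝ ℂ j).sub contDiff_const)

lemma fderiv_quad (A B : ℝ) (x0 z w : Cn n) :
    fderiv ℝ (quad A B x0) z w = 2 * A * ∑ j, ((starRingEnd ℂ) (z j - x0 j) * w j).re := by
  have h1 : ∀ j, HasFDerivAt (fun z : Cn n => z j - x0 j)
      (ContinuousLinearMap.proj (R := ℝ) (φ := fun _ : Fin n => ℂ) j) z := fun j =>
    (ContinuousLinearMap.proj (R := ℝ) (φ := fun _ : Fin n => ℂ) j).hasFDerivAt.sub_const _
  have h2 := ((HasFDerivAt.fun_sum (u := Finset.univ) fun j _ => (h1 j).norm_sq).const_mul A).sub_const B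
  have : HasFDerivAt (quad A B x0) _ z := h2
  rw [this.fderiv]
  simp only [_root_.smul_apply, _root_.sum_apply, smul_eq_mul, ContinuousLinearMap.comp_apply,
    ContinuousLinearMap.proj_apply, innerSL_apply_apply, Complex.inner]
  simp only [Finset.mul_sum, nsmul_eq_mul, Nat.cast_ofNat]
  refine Finset.sum_congr rfl fun j _ => ?_
  rw [mul_comm (w j)]
  ring

lemma reB_quad (A B : ℝ) (x0 z v w : Cn n) :
    reB n (quad A B x0) z v w = 2 * A * ∑ j, ((starRingEnd ℂ) (v j) * w j).re := by
  let L : Cn n →ₗ[ℝ] ℝ :=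
    { toFun := fun v => 2 * A * ∑ j, ((starRingEnd ℂ) (v j) * w j).re
      map_add' := fun x y => by
        simp only [Pi.add_apply, map_add, add_mul, Complex.add_re, Finset.sum_add_distrib, mul_add]
      map_smul' := fun c x => by
        simp only [Pi.smul_apply, Complex.real_smul, map_mul, Complex.conj_ofReal, mul_assoc,
          Complex.re_ofReal_mul, ← Finset.mul_sum, RingHom.id_apply, smul_eq_mul]
        ring }
  have e : (fun x => fderiv ℝ (quad A B x0) x w) = fun x => L.toContinuousLinearMap (x - x0) := by
    funext x
    rw [fderiv_quad]
    rfl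
  rw [reB, e]
  have : HasFDerivAt (fun x => L.toContinuousLinearMap (x - x0)) L.toContinuousLinearMap z := by
    exact L.toContinuousLinearMap.hasFDerivAt.comp z ((hasFDerivAt_id z).sub_const x0)
  rw [this.fderiv]
  rfl

lemma chess_quad (A B : ℝ) (x0 z : Cn n) : chess (quad A B x0) z = (A : ℂ) • 1 := by
  have e : ∀ (j k : Fin n) (c d : ℂ), reB n (quad A B x0) z (Pi.single j c) (Pi.single k d) =
      if j = k then 2 * A * ((starRingEnd ℂ) c * d).re else 0 := by
    intro j k c d
    rw [reB_quad, Finset.sum_eq_single k]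
    · by_cases h : j = k
      · subst h; simp
      · simp [h, Ne.symm h]
    · intro i _ hi
      simp [Pi.single_apply, hi]
    · simp
  ext j k
  rw [chess, of_apply, cHessEntry, e, e, e, e]
  by_cases h : j = k
  · subst h
    simp
    ring
  · simp [h]

lemma chess_quad_posSemidef {A : ℝ} (hA : 0 ≤ A) (B : ℝ) (x0 z : Cn n) :
    (chess (quad A B x0) z).PosSemidef := by
  rw [chess_quad]
  exact PosSemidef.one.smul (by exact_mod_cast hA)

lemma levi_comp {θ : ℝ → ℝ} (hθ : ContDiff ℝ (⊤ : ℕ∞) θ) {k : Cn n → ℝ}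
    (hk : ContDiff ℝ (⊤ : ℕ∞) k) (z b : Cn n) :
    levi (fun z => θ (k z)) z b = deriv θ (k z) * levi k z b + deriv (deriv θ) (k z) *
      (fderiv ℝ k z b ^ 2 + fderiv ℝ k z (Complex.I • b) ^ 2) := by
  have key : ∀ v, fderiv ℝ (fderiv ℝ fun z => θ (k z)) z v v = deriv θ (k z) *
      fderiv ℝ (fderiv ℝ k) z v v + deriv (deriv θ) (k z) * fderiv ℝ k z v ^ 2 := by
    intro v
    have hc : ContDiff ℝ (⊤ : ℕ∞) fun z => θ (k z) := hθ.comp hk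
    have hθ' := (contDiff_infty_iff_deriv.1 hθ).2
    rw [← fderiv_fderiv_apply (hc.two z), ← fderiv_fderiv_apply (hk.two z)]
    have e : (fun y => fderiv ℝ (fun z => θ (k z)) y v) = fun y => deriv θ (k y) * fderiv ℝ k y v := by
      funext y
      have := ((hθ.differentiable (by simp) (k y)).hasDerivAt.comp_hasFDerivAt y (hk.diff_top y).hasFDerivAt).fderiv
      change fderiv ℝ (fun z => θ (k z)) y = _ at this
      rw [this]; rfl
    rw [e]
    have h1 : HasFDerivAt (fun y => deriv θ (k y)) (deriv (deriv θ) (k z) • fderiv ℝ k z) z :=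
      (hθ'.differentiable (by simp) (k z)).hasDerivAt.comp_hasFDerivAt z (hk.diff_top z).hasFDerivAt
    have h2 : HasFDerivAt (fun y => fderiv ℝ k y v) (fderiv ℝ (fun y => fderiv ℝ k y v) z) z :=
      ((fderiv_apply_contDiff hk v).diff_top z).hasFDerivAt
    have h3 := (h1.mul h2).fderiv
    change fderiv ℝ (fun y => deriv θ (k y) * fderiv ℝ k y v) z = _ at h3
    rw [h3]
    simp only [_root_.add_apply, _root_.smul_apply, smul_eq_mul]
    ring
  rw [levi, key, key, levi]
  ring

lemma levi_add {f g : Cn n → ℝ} (hf : ContDiff ℝ (⊤ : ℕ∞) f) (hg : ContDiff ℝ (⊤ : ℕ∞) g)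
    (c : ℝ) (z b : Cn n) : levi (fun z => f z + c * g z) z b = levi f z b + c * levi g z b := by
  have e1 : fderiv ℝ (fun z => f z + c * g z) = fun z => fderiv ℝ f z + c • fderiv ℝ g z := by
    funext y
    exact ((hf.diff_top y).hasFDerivAt.add ((hg.diff_top y).hasFDerivAt.const_mul c)).fderiv
  have d : ∀ {f : Cn n → ℝ}, ContDiff ℝ (⊤ : ℕ∞) f → DifferentiableAt ℝ (fderiv ℝ f) z :=
    fun hf => ((hf.two z).fderiv_right (m := 1) (by norm_num)).differentiableAt (by norm_num)
  have e2 : fderiv ℝ (fun z => fderiv ℝ f z + c • fderiv ℝ g z) z =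
      fderiv ℝ (fderiv ℝ f) z + c • fderiv ℝ (fderiv ℝ g) z :=
    ((d hf).hasFDerivAt.add ((d hg).hasFDerivAt.const_smul c)).fderiv
  simp only [levi, e1, e2, _root_.add_apply, _root_.smul_apply, smul_eq_mul]
  ring

/-- A smooth maximum of `q` and `f`. -/
def glue (q f : Cn n → ℝ) (z : Cn n) : ℝ := q z + convexBend (f z - q z)

lemma glue_contDiff {q f : Cn n → ℝ} (hq : ContDiff ℝ (⊤ : ℕ∞) q) (hf : ContDiff ℝ (⊤ : ℕ∞) f) :
    ContDiff ℝ (⊤ : ℕ∞) (glue q f) :=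
  hq.add (convexBend_contDiff.comp (hf.sub hq))

lemma glue_eq {q f : Cn n → ℝ} {z : Cn n} (h : f z ≤ 0) (hq : 1 ≤ q z) : glue q f z = q z := by
  rw [glue, convexBend_of_le (by linarith), add_zero]

lemma glue_mono {q f g : Cn n → ℝ} (hf : ∀ z, f z ≤ 0) (hg : ∀ z, g z ≤ 0)
    (h : ∀ z, q z < 1 → f z ≤ g z) (z : Cn n) : glue q f z ≤ glue q g z := by
  rcases lt_or_ge (q z) 1 with hz | hz
  · exact add_le_add_right (convexBend_mono (by linarith [h z hz])) _
  · rw [glue_eq (hf z) hz, glue_eq (hg z) hz]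

lemma glue_eq_add {q f : Cn n → ℝ} {z : Cn n} (h : q z + 1 ≤ f z) :
    glue q f z = f z + (convexBend 1 - 1) := by
  rw [glue, convexBend_of_ge (by linarith)]; ring

lemma adm_glue {q f : Cn n → ℝ} (hq : ContDiff ℝ (⊤ : ℕ∞) q) (hf : ContDiff ℝ (⊤ : ℕ∞) f)
    (hqp : ∀ z, (chess q z).PosSemidef) (hqc : ∃ K, IsCompact K ∧ {z | q z < 1} ⊆ K)
    (hf0 : ∀ z, f z ≤ 0) (hfp : ∀ z, q z < 1 → ∀ b, 0 ≤ levi f z b) : Adm q (glue q f) where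
  smooth := glue_contDiff hq hf
  compact := by
    obtain ⟨K, hK, hqK⟩ := hqc
    refine HasCompactSupport.intro hK fun z hz => ?_
    rw [glue_eq (hf0 z) (not_lt.1 fun h => hz (hqK h)), sub_self]
  psd z := by
    refine posSemidef_chess ((glue_contDiff hq hf).two z) fun b => ?_
    have hs : ContDiff ℝ (⊤ : ℕ∞) fun z => f z - q z := hf.sub hq
    have e := levi_add hq (convexBend_contDiff.comp hs) 1 z b
    have e' := levi_add hf hq (-1) z b
    simp only [one_mul, neg_mul, ← sub_eq_add_neg] at e e'
    have e2 := levi_comp convexBend_contDiff hs z b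
    change levi (glue q f) z b = _ + levi (fun z => convexBend (f z - q z)) z b at e
    rw [e, e2, e']
    have hd2 : 0 ≤ deriv (deriv convexBend) (f z - q z) := by
      refine Monotone.deriv_nonneg ?_
      rw [deriv_convexBend]
      exact fun x y hxy => Real.smoothTransition.monotone (by linarith)
    have hqz := levi_nonneg_of_posSemidef (hq.two z) (hqp z) b
    have h3 : 0 ≤ deriv (deriv convexBend) (f z - q z) *
      (fderiv ℝ (fun z => f z - q z) z b ^ 2 +
        fderiv ℝ (fun z => f z - q z) z (Complex.I • b) ^ 2) := by positivity
    rw [deriv_convexBend] at h3 ⊢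
    simp only at h3 ⊢
    rcases lt_or_ge (q z) 1 with hz | hz
    · have hfz := hfp z hz b
      have h1 := Real.smoothTransition.nonneg ((f z - q z + 1) / 2)
      have h2 := Real.smoothTransition.le_one ((f z - q z + 1) / 2)
      nlinarith [mul_nonneg h1 hfz, mul_nonneg (sub_nonneg.2 h2) hqz]
    · rw [Real.smoothTransition.zero_of_nonpos (x := (f z - q z + 1) / 2) (by linarith [hf0 z])]
      linarith

end Glue

section CapEstimate

open Matrix
open scoped ComplexOrder

variable {n : ℕ}

lemma chess_const (c : ℝ) (z : Cn n) : chess (fun _ => c) z = 0 := by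
  have h := chess_sub (φ := fun _ : Cn n => c) (ψ := fun _ => c) contDiff_const contDiff_const z
  have h0 : chess (fun _ : Cn n => (0 : ℝ)) z = 0 := by simpa using h
  have h2 := chess_quad (0 : ℝ) (-c) (0 : Cn n) z
  have e : quad 0 (-c) (0 : Cn n) = fun _ => c := by funext x; simp [quad]
  rw [e] at h2
  simpa using h2

lemma integral_mul_det_le_of_support {q a b w g : Cn n → ℝ} (hq : ContDiff ℝ (⊤ : ℕ∞) q)
    (ha : Adm q a) (hb : Adm q b) (hab : ∀ z, b z ≤ a z) (hw : ContDiff ℝ (⊤ : ℕ∞) w)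
    (hw1 : ∀ z, |w z| ≤ 1) (hwp : ∀ z, b z < a z → (chess w z).PosSemidef) {ε : ℝ} (hε : 0 < ε)
    (hg : Continuous g) (hg0 : ∀ z, 0 ≤ g z) (hg1 : ∀ z, g z ≤ 1)
    (hgs : ∀ z, g z ≠ 0 → ε < a z - b z) :
    ∫ z, g z * (chess w z).det.re ≤ (4 / ε) ^ (n + 1) * (n + 1) * (energy q a - energy q b) := by
  set h : Cn n → ℝ := fun z => a z + (ε / 4) * (w z - 2) - b z with hh
  set f : Cn n → ℝ := fun z => Real.smoothTransition (4 / ε * h z) with hfdef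
  have hw2 : ContDiff ℝ (⊤ : ℕ∞) fun z => w z - 2 := hw.sub contDiff_const
  have hφ : ContDiff ℝ (⊤ : ℕ∞) fun z => a z + (ε / 4) * (w z - 2) :=
    ha.smooth.add (contDiff_const.mul hw2)
  have hhs : ContDiff ℝ (⊤ : ℕ∞) h := hφ.sub hb.smooth
  have hfs : ContDiff ℝ (⊤ : ℕ∞) f :=
    Real.smoothTransition.contDiff.comp (contDiff_const.mul hhs)
  have hle : ∀ z, 0 ≤ h z → ε / 4 ≤ a z - b z := fun z hz => by
    have := (abs_le.1 (hw1 z)).2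
    simp only [hh] at hz
    nlinarith
  have hge : ∀ z, ε < a z - b z → ε / 4 ≤ h z := fun z hz => by
    have := (abs_le.1 (hw1 z)).1
    simp only [hh]
    nlinarith
  have hf0 : ∀ z, h z ≤ 0 → f z = 0 := fun z hz =>
    Real.smoothTransition.zero_of_nonpos (mul_nonpos_of_nonneg_of_nonpos (by positivity) hz)
  have hcab : HasCompactSupport fun z => a z - b z := by
    have e : (fun z => a z - b z) = (fun z => a z - q z) + -(fun z => b z - q z) := by
      funext z; simp
    rw [e]
    exact ha.compact.add hb.compact.neg
  have hfc : HasCompactSupport f := HasCompactSupport.intro hcab fun z hz => by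
    have := image_eq_zero_of_notMem_tsupport hz
    refine hf0 z (not_lt.1 fun hz' => ?_)
    linarith [hle z hz'.le]
  have hHφ : ∀ z, chess (fun z => a z + (ε / 4) * (w z - 2)) z =
      chess a z + ((ε / 4 : ℝ) : ℂ) • chess w z := fun z => by
    rw [chess_add ha.smooth hw2, chess_sub hw contDiff_const, chess_const, sub_zero]
  have hcp := integral_mul_det_le hφ hb.smooth hfs hfc fun z hz => by
    have hder : fderiv ℝ f z = (deriv Real.smoothTransition (4 / ε * h z) * (4 / ε)) •
        fderiv ℝ h z := by
      have h1 : HasFDerivAt (fun z => 4 / ε * h z) ((4 / ε) • fderiv ℝ h z) z :=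
        (hhs.diff_top z).hasFDerivAt.const_mul _
      have h2 : DifferentiableAt ℝ Real.smoothTransition (4 / ε * h z) :=
        (Real.smoothTransition.contDiff (n := ⊤)).differentiable (by simp) _
      have := (h2.hasDerivAt.comp_hasFDerivAt z h1).fderiv
      rw [mul_smul]
      exact this
    have hpos : 0 ≤ h z := by
      by_contra! hneg
      refine hz ?_
      have : f =ᶠ[𝓝 z] fun _ => 0 := by
        filter_upwards [hhs.continuous.continuousAt.eventually_lt continuousAt_const hneg] with y hy
        exact hf0 y hy.le
      rw [this.fderiv_eq, fderiv_const_apply]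
    have hε4 : (0 : ℝ) ≤ ε / 4 := by positivity
    have hw := hwp z (by linarith [hle z hpos])
    refine ⟨?_, hb.psd z, _, ?_, hder⟩
    · rw [hHφ]
      exact (ha.psd z).add (hw.smul (by exact_mod_cast hε4))
    · exact mul_nonneg (Monotone.deriv_nonneg Real.smoothTransition.monotone) (by positivity)
  have hen := integral_mul_det_le_energy hq ha hb hab
  have hcHw := chess_continuous hw
  have hcHb := chess_continuous hb.smooth
  have step1 : ∫ z, g z * (chess w z).det.re ≤
      ∫ z, (4 / ε) ^ n * (f z * (chess (fun z => a z + (ε / 4) * (w z - 2)) z).det.re) := by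
    refine integral_mono ?_ ?_ fun z => ?_
    · refine (hg.mul (Complex.continuous_re.comp hcHw.matrix_det)).integrable_of_hasCompactSupport ?_
      refine HasCompactSupport.intro hcab fun z hz => ?_
      have := image_eq_zero_of_notMem_tsupport hz
      have : g z = 0 := by by_contra hne; linarith [hgs z hne]
      rw [Pi.mul_apply, this, zero_mul]
    · exact ((hfs.continuous.mul (Complex.continuous_re.comp
        (chess_continuous hφ).matrix_det)).integrable_of_hasCompactSupport hfc.mul_right).const_mul _
    · simp only
      have hfn : 0 ≤ f z := Real.smoothTransition.nonneg _
      by_cases hgz : g z = 0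
      · rw [hgz, zero_mul]
        by_cases hfz : f z = 0
        · rw [hfz]; simp
        · have hpos : 0 ≤ h z := by
            by_contra! hneg
            exact hfz (hf0 z hneg.le)
          have hw := hwp z (by linarith [hle z hpos])
          refine mul_nonneg (by positivity) (mul_nonneg hfn ?_)
          rw [hHφ]
          refine det_re_nonneg ((ha.psd z).add (hw.smul ?_))
          exact_mod_cast (by positivity : (0 : ℝ) ≤ ε / 4)
      · have h1 := hgs z hgz
        have hfz : f z = 1 := by
          refine Real.smoothTransition.one_of_one_le ?_
          have := mul_le_mul_of_nonneg_left (hge z h1) (by positivity : 0 ≤ 4 / ε)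
          refine le_trans (le_of_eq ?_) this
          field_simp
        have hw := hwp z (by linarith)
        have h2 := det_re_add_smul_ge (c := ε / 4) (ha.psd z) hw (by positivity)
        rw [Fintype.card_fin] at h2
        rw [hfz, one_mul, hHφ]
        have h3 := mul_le_mul_of_nonneg_left h2 (by positivity : 0 ≤ (4 / ε) ^ n)
        have h4 : (4 / ε) ^ n * ((ε / 4) ^ n * (chess w z).det.re) = (chess w z).det.re := by
          rw [← mul_assoc, ← mul_pow]
          have : 4 / ε * (ε / 4) = 1 := by field_simp
          rw [this, one_pow, one_mul]
        rw [h4] at h3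
        refine le_trans ?_ h3
        exact mul_le_of_le_one_left (det_re_nonneg hw) (hg1 z)
  have step2 : ∫ z, f z * (chess b z).det.re ≤ ∫ z, 4 / ε * ((a z - b z) * (chess b z).det.re) := by
    have hci := Complex.continuous_re.comp hcHb.matrix_det
    refine integral_mono ((hfs.continuous.mul hci).integrable_of_hasCompactSupport hfc.mul_right)
      ((((ha.smooth.continuous.sub hb.smooth.continuous).mul
        hci).integrable_of_hasCompactSupport hcab.mul_right).const_mul _) fun z => ?_
    simp only
    rw [← mul_assoc]
    refine mul_le_mul_of_nonneg_right ?_ (det_re_nonneg (hb.psd z))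
    rcases le_or_gt (h z) 0 with hz | hz
    · rw [hf0 z hz]
      exact mul_nonneg (by positivity) (by linarith [hab z])
    · refine (Real.smoothTransition.le_one _).trans ?_
      have := mul_le_mul_of_nonneg_left (hle z hz.le) (by positivity : 0 ≤ 4 / ε)
      refine le_trans (le_of_eq ?_) this
      field_simp
  rw [integral_const_mul] at step1 step2
  calc _ ≤ _ := step1
    _ ≤ (4 / ε) ^ n * ∫ z, f z * (chess b z).det.re :=
      mul_le_mul_of_nonneg_left hcp (by positivity)
    _ ≤ (4 / ε) ^ n * (4 / ε * ((n + 1) * (energy q a - energy q b))) := by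
      refine mul_le_mul_of_nonneg_left (step2.trans ?_) (by positivity)
      exact mul_le_mul_of_nonneg_left hen (by positivity)
    _ = _ := by ring

end CapEstimate

lemma measure_le_of_forall_isCompact {X : Type*} [PseudoMetricSpace X] [ProperSpace X]
    [MeasurableSpace X] {μ : Measure X} {S : Set X} (hS : IsOpen S) {C : ℝ≥0∞}
    (h : ∀ L, IsCompact L → L ⊆ S → μ L ≤ C) : μ S ≤ C := by
  rcases S.eq_empty_or_nonempty with rfl | ⟨x, -⟩
  · simp
  obtain ⟨F, hF, hFS, hU, hm⟩ := hS.exists_iUnion_isClosed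
  have e : S = ⋃ i : ℕ, F i ∩ Metric.closedBall x i := by
    refine Set.Subset.antisymm (fun y hy => ?_) (Set.iUnion_subset fun i =>
      Set.inter_subset_left.trans (hFS i))
    rw [← hU, Set.mem_iUnion] at hy
    obtain ⟨i, hi⟩ := hy
    obtain ⟨k, hk⟩ := exists_nat_ge (dist y x)
    refine Set.mem_iUnion.2 ⟨max i k, hm (le_max_left i k) hi, ?_⟩
    rw [Metric.mem_closedBall]
    exact hk.trans (by exact_mod_cast le_max_right i k)
  have hmono : Monotone fun i : ℕ => F i ∩ Metric.closedBall x i := fun i k hik =>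
    Set.inter_subset_inter (hm hik) (Metric.closedBall_subset_closedBall (by exact_mod_cast hik))
  rw [e, hmono.measure_iUnion]
  exact iSup_le fun i => h _ ((isCompact_closedBall x (i : ℝ)).inter_left (hF i))
    (Set.inter_subset_left.trans (hFS i))

section LocalCapacity

open Matrix
open scoped ComplexOrder

variable {n : ℕ}

/-- The measure with density the determinant of the complex Hessian. -/
def hessMeasure (w : Cn n → ℝ) : Measure (Cn n) :=
  volume.withDensity fun z => ENNReal.ofReal (chess w z).det.re

lemma hessMeasure_le_integral {w g : Cn n → ℝ} (hw : ContDiff ℝ (⊤ : ℕ∞) w) (hg : Continuous g)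
    (hgc : HasCompactSupport g) (h0 : ∀ z, 0 ≤ g z * (chess w z).det.re) {L : Set (Cn n)}
    (hL : IsCompact L) (hgL : ∀ z ∈ L, g z = 1) :
    hessMeasure w L ≤ ENNReal.ofReal (∫ z, g z * (chess w z).det.re) := by
  have hi : Integrable (fun z => g z * (chess w z).det.re) :=
    (hg.mul (Complex.continuous_re.comp
      (chess_continuous hw).matrix_det)).integrable_of_hasCompactSupport hgc.mul_right
  rw [ofReal_integral_eq_lintegral_ofReal hi
    (Eventually.of_forall h0), hessMeasure, withDensity_apply _ hL.measurableSet,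
    ← lintegral_indicator hL.measurableSet]
  refine lintegral_mono fun z => ?_
  by_cases hz : z ∈ L
  · simp [hz, hgL z hz]
  · simp [hz]

lemma integral_le_hessMeasure {w g : Cn n → ℝ} (hw : ContDiff ℝ (⊤ : ℕ∞) w) (hg : Continuous g)
    (hgc : HasCompactSupport g) (hg0 : ∀ z, 0 ≤ g z) (hg1 : ∀ z, g z ≤ 1) {S : Set (Cn n)}
    (hS : MeasurableSet S) (hgS : ∀ z, g z ≠ 0 → z ∈ S) (hwS : ∀ z ∈ S, 0 ≤ (chess w z).det.re) :
    ENNReal.ofReal (∫ z, g z * (chess w z).det.re) ≤ hessMeasure w S := by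
  have hi : Integrable (fun z => g z * (chess w z).det.re) :=
    (hg.mul (Complex.continuous_re.comp
      (chess_continuous hw).matrix_det)).integrable_of_hasCompactSupport hgc.mul_right
  rw [ofReal_integral_eq_lintegral_ofReal hi,
    hessMeasure, withDensity_apply _ hS, ← lintegral_indicator hS]
  · refine lintegral_mono fun z => ?_
    by_cases hz : z ∈ S
    · simp only [hz, Set.indicator_of_mem]
      exact ENNReal.ofReal_le_ofReal (mul_le_of_le_one_left (hwS z hz) (hg1 z))
    · have : g z = 0 := by by_contra h; exact hz (hgS z h)
      simp [this]
  · refine Eventually.of_forall fun z => ?_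
    by_cases hz : z ∈ S
    · exact mul_nonneg (hg0 z) (hwS z hz)
    · have : g z = 0 := by by_contra h; exact hz (hgS z h)
      simp [this]

/-- A smooth psh function `q`, large outside a compact subset of `Ω`. -/
structure Cutoff (Ω : Set (Cn n)) (q : Cn n → ℝ) (δ₀ : ℝ) : Prop where
  isOpen : IsOpen Ω
  smooth : ContDiff ℝ (⊤ : ℕ∞) q
  psd : ∀ z, (chess q z).PosSemidef
  compact : ∃ K, IsCompact K ∧ {z | q z < 1} ⊆ K
  pos : 0 < δ₀
  sub : {z | q z < 1} ⊆ shrink Ω δ₀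

/-- Measurable functions with values in `[-N, 0]` which are psh on `Ω`. -/
structure NegPsh (Ω : Set (Cn n)) (N : ℝ) (F : Cn n → ℝ) : Prop where
  meas : Measurable F
  lower : ∀ z, -N ≤ F z
  upper : ∀ z, F z ≤ 0
  psh : RPsh F Ω

variable {Ω : Set (Cn n)} {q F G : Cn n → ℝ} {δ₀ N : ℝ}

lemma NegPsh.abs_le (hF : NegPsh Ω N F) (z : Cn n) : |F z| ≤ N :=
  _root_.abs_le.2 ⟨hF.lower z, (hF.upper z).trans (by linarith [hF.lower z, hF.upper z])⟩

/-- Mollification of functions on `ℂⁿ`. -/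
abbrev mol (δ : ℝ) (F : Cn n → ℝ) : Cn n → ℝ := moll (volume : Measure (Cn n)) δ F

lemma NegPsh.mol_smooth (hF : NegPsh Ω N F) {δ : ℝ} (hδ : 0 < δ) :
    ContDiff ℝ (⊤ : ℕ∞) (mol δ F) :=
  moll_contDiff _ hF.meas hF.abs_le hδ

lemma NegPsh.mol_le_zero (hF : NegPsh Ω N F) (δ : ℝ) (z : Cn n) : mol δ F z ≤ 0 :=
  integral_nonpos fun _ => mul_nonpos_of_nonneg_of_nonpos (kern_nonneg _ _) (hF.upper _)

lemma NegPsh.le_mol_apply (hF : NegPsh Ω N F) (δ : ℝ) (z : Cn n) : -N ≤ mol δ F z :=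
  (_root_.abs_le.1 (abs_moll_le _ hF.meas hF.abs_le δ z)).1

lemma Cutoff.isOpen_lt (hq : Cutoff Ω q δ₀) (c : ℝ) : IsOpen {z | q z < c} :=
  _root_.isOpen_lt hq.smooth.continuous continuous_const

lemma Cutoff.mol_levi (hq : Cutoff Ω q δ₀) (hF : NegPsh Ω N F) {δ : ℝ} (hδ : 0 < δ) (h : δ ≤ δ₀)
    {z : Cn n} (hz : q z < 1) (b : Cn n) : 0 ≤ levi (mol δ F) z b :=
  RPsh.levi_nonneg (hq.isOpen_lt 1)
    ((rpsh_moll volume hF.meas hF.abs_le hF.psh hδ).mono (hq.sub.trans (shrink_anti h))) hz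
    ((hF.mol_smooth hδ).two z) b

lemma Cutoff.mol_psd (hq : Cutoff Ω q δ₀) (hF : NegPsh Ω N F) {δ : ℝ} (hδ : 0 < δ) (h : δ ≤ δ₀)
    {z : Cn n} (hz : q z < 1) : (chess (mol δ F) z).PosSemidef :=
  posSemidef_chess ((hF.mol_smooth hδ).two z) (hq.mol_levi hF hδ h hz)

lemma Cutoff.adm (hq : Cutoff Ω q δ₀) (hF : NegPsh Ω N F) {δ : ℝ} (hδ : 0 < δ) (h : δ ≤ δ₀) :
    Adm q (glue q (mol δ F)) :=
  adm_glue hq.smooth (hF.mol_smooth hδ) hq.psd hq.compact (hF.mol_le_zero δ)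
    fun _ hz => hq.mol_levi hF hδ h hz

lemma Cutoff.adm_const (hq : Cutoff Ω q δ₀) {c : ℝ} (hc : c ≤ 0) : Adm q (glue q fun _ => c) :=
  adm_glue hq.smooth contDiff_const hq.psd hq.compact (fun _ => hc) fun z _ b => by simp [levi]

lemma Cutoff.glue_mol_mono (hq : Cutoff Ω q δ₀) (hF : NegPsh Ω N F) (hG : NegPsh Ω N G)
    (hFG : ∀ z, F z ≤ G z) {δ δ' : ℝ} (hδ' : 0 < δ') (hδ : δ' ≤ δ) (h : δ ≤ δ₀) (z : Cn n) :
    glue q (mol δ' F) z ≤ glue q (mol δ G) z :=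
  glue_mono (hF.mol_le_zero δ') (hG.mol_le_zero δ) (fun z hz =>
    (moll_mono_fun volume hF.meas hF.abs_le hG.meas hG.abs_le hFG δ' z).trans
      (moll_mono volume hG.meas hG.abs_le hG.psh hδ' hδ (shrink_anti h (hq.sub hz)))) z

/-- The energy of the glued mollification. -/
def molEnergy (q : Cn n → ℝ) (δ : ℝ) (F : Cn n → ℝ) : ℝ := energy q (glue q (mol δ F))

lemma Cutoff.molEnergy_mono (hq : Cutoff Ω q δ₀) (hF : NegPsh Ω N F) (hG : NegPsh Ω N G)
    (hFG : ∀ z, F z ≤ G z) {δ δ' : ℝ} (hδ' : 0 < δ') (hδ : δ' ≤ δ) (h : δ ≤ δ₀) :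
    molEnergy q δ' F ≤ molEnergy q δ G :=
  energy_mono hq.smooth (hq.adm hG (hδ'.trans_le hδ) h) (hq.adm hF hδ' (hδ.trans h))
    (hq.glue_mol_mono hF hG hFG hδ' hδ h)

lemma Cutoff.le_molEnergy (hq : Cutoff Ω q δ₀) (hF : NegPsh Ω N F) {δ : ℝ} (hδ : 0 < δ)
    (h : δ ≤ δ₀) : energy q (glue q fun _ => -N) ≤ molEnergy q δ F :=
  energy_mono hq.smooth (hq.adm hF hδ h)
    (hq.adm_const (by linarith [hF.lower 0, hF.upper 0])) (glue_mono
      (fun _ => by linarith [hF.lower 0, hF.upper 0]) (hF.mol_le_zero δ) fun z _ => hF.le_mol_apply δ z)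

/-- The scales at which functions are mollified. -/
def scale (δ₀ : ℝ) (m : ℕ) : ℝ := δ₀ / (m + 1)

lemma scale_pos (h : 0 < δ₀) (m : ℕ) : 0 < scale δ₀ m := div_pos h (by positivity)

lemma scale_anti (h : 0 < δ₀) : Antitone (scale δ₀) := fun m k hmk =>
  div_le_div_of_nonneg_left h.le (by positivity) (by exact_mod_cast Nat.succ_le_succ hmk)

lemma scale_le (h : 0 < δ₀) (m : ℕ) : scale δ₀ m ≤ δ₀ := by
  simpa [scale] using scale_anti h (Nat.zero_le m)

lemma scale_tendsto (h : 0 < δ₀) : Tendsto (scale δ₀) atTop (𝓝[>] 0) := by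
  refine tendsto_nhdsWithin_iff.2 ⟨?_, Eventually.of_forall fun m => scale_pos h m⟩
  have := (tendsto_one_div_add_atTop_nhds_zero_nat (𝕜 := ℝ)).const_mul δ₀
  show Tendsto (fun m : ℕ => δ₀ / ((m : ℝ) + 1)) atTop (𝓝 0)
  simpa [div_eq_mul_inv] using this

/-- The energy of the glued function. -/
def pshEnergy (q : Cn n → ℝ) (δ₀ : ℝ) (F : Cn n → ℝ) : ℝ := ⨅ m, molEnergy q (scale δ₀ m) F

lemma Cutoff.molEnergy_anti (hq : Cutoff Ω q δ₀) (hF : NegPsh Ω N F) :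
    Antitone fun m => molEnergy q (scale δ₀ m) F := fun m k hmk =>
  hq.molEnergy_mono hF hF (fun _ => le_rfl) (scale_pos hq.pos k) (scale_anti hq.pos hmk)
    (scale_le hq.pos m)

lemma Cutoff.bddBelow (hq : Cutoff Ω q δ₀) (hF : NegPsh Ω N F) :
    BddBelow (Set.range fun m => molEnergy q (scale δ₀ m) F) :=
  ⟨_, Set.forall_mem_range.2 fun m => hq.le_molEnergy hF (scale_pos hq.pos m) (scale_le hq.pos m)⟩

lemma Cutoff.tendsto_molEnergy (hq : Cutoff Ω q δ₀) (hF : NegPsh Ω N F) :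
    Tendsto (fun m => molEnergy q (scale δ₀ m) F) atTop (𝓝 (pshEnergy q δ₀ F)) :=
  tendsto_atTop_ciInf (hq.molEnergy_anti hF) (hq.bddBelow hF)

lemma Cutoff.pshEnergy_le (hq : Cutoff Ω q δ₀) (hF : NegPsh Ω N F) (m : ℕ) :
    pshEnergy q δ₀ F ≤ molEnergy q (scale δ₀ m) F :=
  ciInf_le (hq.bddBelow hF) m

lemma Cutoff.pshEnergy_mono (hq : Cutoff Ω q δ₀) (hF : NegPsh Ω N F) (hG : NegPsh Ω N G)
    (hFG : ∀ z, F z ≤ G z) : pshEnergy q δ₀ F ≤ pshEnergy q δ₀ G :=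
  ciInf_mono (hq.bddBelow hF) fun m =>
    hq.molEnergy_mono hF hG hFG (scale_pos hq.pos m) le_rfl (scale_le hq.pos m)

/-- The constant in the capacity estimates. -/
def capConst (n : ℕ) (ε : ℝ) : ℝ := (4 / ε) ^ (n + 1) * (n + 1)

lemma capConst_nonneg {ε : ℝ} (hε : 0 < ε) : 0 ≤ capConst n ε := by
  unfold capConst; positivity

/-- The competitors for the capacity. -/
structure Competitor (q w : Cn n → ℝ) : Prop where
  smooth : ContDiff ℝ (⊤ : ℕ∞) w
  abs_le : ∀ z, |w z| ≤ 1
  psd : ∀ z, q z < 1 → (chess w z).PosSemidef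

variable {w : Cn n → ℝ} {ε : ℝ}

lemma Cutoff.hessMeasure_mol_sub_mol_le (hq : Cutoff Ω q δ₀) (hw : Competitor q w)
    (hF : NegPsh Ω N F) (hG : NegPsh Ω N G) (hFG : ∀ z, F z ≤ G z) (hε : 0 < ε) {δ δ' : ℝ}
    (hδ' : 0 < δ') (hδ : δ' ≤ δ) (h : δ ≤ δ₀) :
    hessMeasure w {z | q z < -N - 1 ∧ ε < mol δ G z - mol δ' F z} ≤
      ENNReal.ofReal (capConst n ε * (molEnergy q δ G - molEnergy q δ' F)) := by
  have hδ0 := hδ'.trans_le hδ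
  have hN : 0 ≤ N := by linarith [hF.lower 0, hF.upper 0]
  have hopen : IsOpen {z | q z < -N - 1 ∧ ε < mol δ G z - mol δ' F z} :=
    (hq.isOpen_lt _).inter (_root_.isOpen_lt continuous_const
      ((hG.mol_smooth hδ0).continuous.sub (hF.mol_smooth hδ').continuous))
  refine measure_le_of_forall_isCompact hopen fun L hL hLS => ?_
  obtain ⟨g, hg1, hgc, hgS, hg01⟩ := exists_continuousMap_one_of_isCompact_subset_isOpen hL hopen hLS
  have hS : ∀ z, g z ≠ 0 → q z < -N - 1 ∧ ε < mol δ G z - mol δ' F z := fun z hz =>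
    hgS (subset_tsupport _ hz)
  refine (hessMeasure_le_integral hw.smooth g.continuous hgc (fun z => ?_) hL
    fun z hz => hg1 hz).trans (ENNReal.ofReal_le_ofReal ?_)
  · by_cases hz : g z = 0
    · rw [hz, zero_mul]
    · exact mul_nonneg (hg01 z).1 (det_re_nonneg (hw.psd z (by linarith [(hS z hz).1])))
  · refine integral_mul_det_le_of_support hq.smooth (hq.adm hG hδ0 h) (hq.adm hF hδ' (hδ.trans h))
      (hq.glue_mol_mono hF hG hFG hδ' hδ h) hw.smooth hw.abs_le (fun z hz => ?_) hε g.continuous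
      (fun z => (hg01 z).1) (fun z => (hg01 z).2) fun z hz => ?_
    · refine hw.psd z (not_le.1 fun hz' => ?_)
      rw [glue_eq (hF.mol_le_zero _ z) hz', glue_eq (hG.mol_le_zero _ z) hz'] at hz
      exact lt_irrefl _ hz
    · obtain ⟨h1, h2⟩ := hS z hz
      rw [glue_eq_add (by linarith [hG.le_mol_apply δ z]),
        glue_eq_add (by linarith [hF.le_mol_apply δ' z])]
      linarith

lemma Cutoff.hessMeasure_mol_sub_le (hq : Cutoff Ω q δ₀) (hw : Competitor q w)
    (hF : NegPsh Ω N F) (hG : NegPsh Ω N G) (hFG : ∀ z, F z ≤ G z) (hε : 0 < ε) (m : ℕ) :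
    hessMeasure w {z | q z < -N - 1 ∧ ε < mol (scale δ₀ m) G z - F z} ≤
      ENNReal.ofReal (capConst n ε * (molEnergy q (scale δ₀ m) G - pshEnergy q δ₀ F)) := by
  have hN : 0 ≤ N := by linarith [hF.lower 0, hF.upper 0]
  have hsub : {z | q z < -N - 1 ∧ ε < mol (scale δ₀ m) G z - F z} ⊆
      ⋃ k : ℕ, {z | q z < -N - 1 ∧
        ε < mol (scale δ₀ m) G z - mol (scale δ₀ (m + k)) F z} := by
    intro z hz
    have hzΩ : z ∈ Ω := shrink_subset hq.pos.le (hq.sub (show q z < 1 by linarith [hz.1]))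
    have ht := (moll_tendsto volume hF.meas hF.abs_le hF.psh hq.isOpen hzΩ).comp
      (scale_tendsto hq.pos)
    have hev := ht.eventually_lt_const (show F z < mol (scale δ₀ m) G z - ε by linarith [hz.2])
    obtain ⟨k, hk⟩ := ((tendsto_add_atTop_nat m).eventually hev).exists
    refine Set.mem_iUnion.2 ⟨k, hz.1, ?_⟩
    simp only [Function.comp_apply] at hk
    rw [add_comm k m] at hk
    change mol (scale δ₀ (m + k)) F z < _ at hk
    linarith
  refine (measure_mono hsub).trans ?_
  rw [Monotone.measure_iUnion]
  · refine iSup_le fun k => (hq.hessMeasure_mol_sub_mol_le hw hF hG hFG hε (scale_pos hq.pos _)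
      (scale_anti hq.pos (Nat.le_add_right m k)) (scale_le hq.pos m)).trans ?_
    refine ENNReal.ofReal_le_ofReal (mul_le_mul_of_nonneg_left ?_ (capConst_nonneg hε))
    linarith [hq.pshEnergy_le hF (m + k)]
  · intro k l hkl z hz
    refine ⟨hz.1, hz.2.trans_le ?_⟩
    have := moll_mono volume hF.meas hF.abs_le hF.psh (scale_pos hq.pos (m + l))
      (scale_anti hq.pos (Nat.add_le_add_left hkl m))
      (shrink_anti (scale_le hq.pos _) (hq.sub (show q z < 1 by linarith [hz.1])))
    linarith

lemma Cutoff.hessMeasure_sub_le (hq : Cutoff Ω q δ₀) (hw : Competitor q w)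
    (hF : NegPsh Ω N F) (hG : NegPsh Ω N G) (hFG : ∀ z, F z ≤ G z) (hε : 0 < ε) :
    hessMeasure w {z | q z < -N - 1 ∧ ε < G z - F z} ≤
      ENNReal.ofReal (capConst n ε * (pshEnergy q δ₀ G - pshEnergy q δ₀ F)) := by
  have hN : 0 ≤ N := by linarith [hF.lower 0, hF.upper 0]
  have ht := (((hq.tendsto_molEnergy hG).sub_const (pshEnergy q δ₀ F)).const_mul (capConst n ε))
  refine ge_of_tendsto ((ENNReal.continuous_ofReal.tendsto _).comp ht) (Eventually.of_forall fun m => ?_)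
  refine (measure_mono fun z hz => ?_).trans (hq.hessMeasure_mol_sub_le hw hF hG hFG hε m)
  refine ⟨hz.1, hz.2.trans_le (sub_le_sub_right ?_ _)⟩
  exact le_moll volume hG.meas hG.abs_le hG.psh (scale_pos hq.pos m)
    (shrink_anti (scale_le hq.pos _) (hq.sub (show q z < 1 by linarith [hz.1])))

lemma Cutoff.exists_hessMeasure_le (hq : Cutoff Ω q δ₀) {v : ℕ → Cn n → ℝ}
    (hv : ∀ j, NegPsh Ω N (v j)) (hG : NegPsh Ω N G) (hvm : Monotone v) (hvG : ∀ j z, v j z ≤ G z)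
    (hlim : ∀ᵐ z, z ∈ Ω → Tendsto (fun j => v j z) atTop (𝓝 (G z))) (hε : 0 < ε) {η : ℝ}
    (hη : 0 < η) : ∃ m J : ℕ, ∀ j, J ≤ j → ∀ w, Competitor q w →
      hessMeasure w {z | q z < -N - 1 ∧ 2 * ε < mol (scale δ₀ m) G z - v j z} ≤
        ENNReal.ofReal η := by
  have hN : 0 ≤ N := by linarith [hG.lower 0, hG.upper 0]
  have hmono : Monotone fun j => pshEnergy q δ₀ (v j) := fun i j hij =>
    hq.pshEnergy_mono (hv i) (hv j) (hvm hij)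
  have hbdd : BddAbove (Set.range fun j => pshEnergy q δ₀ (v j)) :=
    ⟨_, Set.forall_mem_range.2 fun j => hq.pshEnergy_mono (hv j) hG (hvG j)⟩
  set e : ℝ := ⨆ j, pshEnergy q δ₀ (v j) with he
  have hc := capConst_nonneg (n := n) hε
  have ht1 : Tendsto (fun m => capConst n ε * (molEnergy q (scale δ₀ m) G - pshEnergy q δ₀ G)) atTop
      (𝓝 0) := by
    simpa using ((hq.tendsto_molEnergy hG).sub_const (pshEnergy q δ₀ G)).const_mul (capConst n ε)
  have ht2 : Tendsto (fun j => capConst n ε * (e - pshEnergy q δ₀ (v j))) atTop (𝓝 0) := by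
    have := ((tendsto_atTop_ciSup hmono hbdd).const_sub e).const_mul (capConst n ε)
    rwa [← he, sub_self, mul_zero] at this
  obtain ⟨m, hm⟩ := (ht1.eventually_lt_const (half_pos hη)).exists
  obtain ⟨J, hJ⟩ := eventually_atTop.1 (ht2.eventually_lt_const (half_pos hη))
  refine ⟨m, J, fun j hj w hw => ?_⟩
  have hA := hq.hessMeasure_mol_sub_le hw hG hG (fun _ => le_rfl) hε m
  have hB : hessMeasure w {z | q z < -N - 1 ∧ ε < G z - v j z} ≤
      ENNReal.ofReal (capConst n ε * (e - pshEnergy q δ₀ (v j))) := by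
    have hae : ({z | q z < -N - 1 ∧ ε < G z - v j z} : Set (Cn n)) ≤ᵐ[hessMeasure w]
        ⋃ k : ℕ, {z | q z < -N - 1 ∧ ε < v (j + k) z - v j z} := by
      filter_upwards [(withDensity_absolutelyContinuous _ _).ae_le hlim] with z hz hzS
      have hzΩ : z ∈ Ω := shrink_subset hq.pos.le (hq.sub (show q z < 1 by linarith [hzS.1]))
      have hev := (hz hzΩ).eventually_const_lt (show v j z + ε < G z by linarith [hzS.2])
      obtain ⟨k, hk⟩ := ((tendsto_add_atTop_nat j).eventually hev).exists
      rw [add_comm k j] at hk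
      exact Set.mem_iUnion.2 ⟨k, hzS.1, by linarith⟩
    refine (measure_mono_ae hae).trans ?_
    rw [Monotone.measure_iUnion]
    · refine iSup_le fun k => (hq.hessMeasure_sub_le hw (hv j) (hv (j + k))
        (hvm (Nat.le_add_right j k)) hε).trans
        (ENNReal.ofReal_le_ofReal (mul_le_mul_of_nonneg_left ?_ hc))
      linarith [le_ciSup hbdd (j + k)]
    · intro k l hkl z hz
      refine ⟨hz.1, hz.2.trans_le ?_⟩
      linarith [hvm (Nat.add_le_add_left hkl j) z]
  have hsub : {z | q z < -N - 1 ∧ 2 * ε < mol (scale δ₀ m) G z - v j z} ⊆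
      {z | q z < -N - 1 ∧ ε < mol (scale δ₀ m) G z - G z} ∪
        {z | q z < -N - 1 ∧ ε < G z - v j z} := by
    intro z hz
    rcases lt_or_ge ε (mol (scale δ₀ m) G z - G z) with h | h
    · exact Or.inl ⟨hz.1, h⟩
    · exact Or.inr ⟨hz.1, by linarith [hz.2]⟩
  calc _ ≤ _ := measure_mono hsub
    _ ≤ _ := measure_union_le _ _
    _ ≤ ENNReal.ofReal (η / 2) + ENNReal.ofReal (η / 2) :=
      add_le_add (hA.trans (ENNReal.ofReal_le_ofReal hm.le))
        (hB.trans (ENNReal.ofReal_le_ofReal (hJ j hj).le))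
    _ = _ := by rw [← ENNReal.ofReal_add (by positivity) (by positivity), add_halves]

end LocalCapacity

section Capacity

variable {n : ℕ} {Ω : Set (Cn n)} {q : Cn n → ℝ} {δ₀ : ℝ}

/-- The normalization of the Monge–Ampère density. -/
def maConst (n : ℕ) : ℝ := (4 : ℝ) ^ n * (n.factorial : ℝ)

lemma maConst_pos (n : ℕ) : 0 < maConst n := by unfold maConst; positivity

lemma maDensity_eq (u : Cn n → ℝ) (z : Cn n) : maDensity n u z = maConst n * (chess u z).det.re :=
  rfl

lemma IsMAMeasure.le_integral {u : Cn n → EReal} {μ : Measure (Cn n)} (hμ : IsMAMeasure n u Ω μ)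
    {L : Set (Cn n)} (hL : IsCompact L) {f : Cn n → ℝ} (hf : Continuous f)
    (hfc : HasCompactSupport f) (hfΩ : tsupport f ⊆ Ω) (hf0 : ∀ z, 0 ≤ f z)
    (hfL : ∀ z ∈ L, f z = 1) : μ L ≤ ENNReal.ofReal (∫ z, f z ∂μ) := by
  have hi : Integrable f μ := by
    rw [← integrableOn_iff_integrable_of_support_subset (subset_tsupport f)]
    obtain ⟨M, hM⟩ := hfc.exists_bound_of_continuous hf
    exact Measure.integrableOn_of_bounded (hμ.2.1 _ hfc hfΩ) hf.aestronglyMeasurable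
      (Eventually.of_forall hM)
  rw [ofReal_integral_eq_lintegral_ofReal hi (Eventually.of_forall hf0)]
  calc μ L = ∫⁻ z, L.indicator (fun _ => 1) z ∂μ := by
        rw [lintegral_indicator hL.measurableSet, setLIntegral_one]
    _ ≤ _ := lintegral_mono fun z => by
        by_cases hz : z ∈ L
        · simp [hz, hfL z hz]
        · simp [hz]

lemma Cutoff.measure_le (hq : Cutoff Ω q δ₀) {u : Cn n → EReal} (hu : PlurisubharmonicOn u Ω)
    (hu1 : ∀ z ∈ Ω, -1 ≤ u z ∧ u z ≤ 0) {μ : Measure (Cn n)} (hμ : IsMAMeasure n u Ω μ)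
    {S : Set (Cn n)} (hS : IsOpen S) (hSq : ∀ z ∈ S, q z < 1) {C : ℝ≥0∞}
    (hC : ∀ w, Competitor q w → hessMeasure w S ≤ C) :
    μ S ≤ ENNReal.ofReal (maConst n) * C := by
  set U : Cn n → ℝ := Ω.indicator fun z => (u z).toReal with hU
  have hcoe : ∀ z ∈ Ω, (((u z).toReal : ℝ) : EReal) = u z := fun z hz =>
    EReal.coe_toReal (fun h => by simpa [h] using (hu1 z hz).2)
      (fun h => by
        have := (hu1 z hz).1
        rw [h] at this
        exact absurd (this.trans_eq' rfl) (by decide))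
  have hUu : ∀ z ∈ Ω, ((U z : ℝ) : EReal) = u z := fun z hz => by
    rw [hU, Set.indicator_of_mem hz, hcoe z hz]
  have hRu : RPsh (fun z => (u z).toReal) Ω := hu.congr fun z hz => (hcoe z hz).symm
  have hN : NegPsh Ω 1 U := by
    refine ⟨measurable_indicator_usc hq.isOpen hRu.usc, fun z => ?_, fun z => ?_,
      hu.congr fun z hz => (hUu z hz).symm⟩
    · by_cases hz : z ∈ Ω
      · have := (hu1 z hz).1
        rw [← hUu z hz] at this
        exact EReal.coe_le_coe_iff.1 this
      · simp [hU, hz]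
    · by_cases hz : z ∈ Ω
      · have := (hu1 z hz).2
        rw [← hUu z hz] at this
        exact_mod_cast this
      · simp [hU, hz]
  have hqΩ : ∀ z, q z < 1 → z ∈ Ω := fun z hz => shrink_subset hq.pos.le (hq.sub hz)
  have hcomp : ∀ k, Competitor q (mol (scale δ₀ k) U) := fun k =>
    ⟨hN.mol_smooth (scale_pos hq.pos k), abs_moll_le volume hN.meas hN.abs_le _,
      fun z hz => hq.mol_psd hN (scale_pos hq.pos k) (scale_le hq.pos k) hz⟩
  have hmono : ∀ z, q z < 1 → Antitone fun k => mol (scale δ₀ k) U z := fun z hz k l hkl =>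
    moll_mono volume hN.meas hN.abs_le hN.psh (scale_pos hq.pos l) (scale_anti hq.pos hkl)
      (shrink_anti (scale_le hq.pos k) (hq.sub hz))
  refine measure_le_of_forall_isCompact hS fun L hL hLS => ?_
  obtain ⟨f, hf1, hfc, hfS, hf01⟩ := exists_continuousMap_one_of_isCompact_subset_isOpen hL hS hLS
  refine (hμ.le_integral hL f.continuous hfc (fun z hz => hqΩ z (hSq z (hfS hz)))
    (fun z => (hf01 z).1) fun z hz => hf1 hz).trans ?_
  have ht := hμ.2.2 {z | q z < 1} (hq.isOpen_lt 1) hqΩ (fun k => mol (scale δ₀ k) U)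
    (fun k => (hcomp k).smooth.contDiffOn)
    (fun k => (rpsh_moll volume hN.meas hN.abs_le hN.psh (scale_pos hq.pos k)).mono
      (hq.sub.trans (shrink_anti (scale_le hq.pos k))))
    (fun k z hz => hmono z hz k.le_succ)
    (fun z hz => by
      have h1 := (moll_tendsto volume hN.meas hN.abs_le hN.psh hq.isOpen (hqΩ z hz)).comp
        (scale_tendsto hq.pos)
      have h2 := (continuous_coe_real_ereal.tendsto _).comp h1
      rw [hUu z (hqΩ z hz)] at h2
      exact tendsto_nhds_unique (tendsto_atTop_iInf fun k l hkl =>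
        EReal.coe_le_coe_iff.2 (hmono z hz hkl)) h2)
    f f.continuous hfc (fun z hz => hSq z (hfS hz))
  refine le_of_tendsto ((ENNReal.continuous_ofReal.tendsto _).comp ht) (Eventually.of_forall fun k => ?_)
  simp only [Function.comp_apply, maDensity_eq]
  rw [show (fun z => f z * (maConst n * (chess (mol (scale δ₀ k) U) z).det.re)) =
    fun z => maConst n * (f z * (chess (mol (scale δ₀ k) U) z).det.re) from by ext; ring,
    integral_const_mul, ENNReal.ofReal_mul (maConst_pos n).le]
  gcongr
  exact (integral_le_hessMeasure (hcomp k).smooth f.continuous hfc (fun z => (hf01 z).1)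
    (fun z => (hf01 z).2) hS.measurableSet (fun z hz => hfS (subset_tsupport _ hz))
    fun z hz => det_re_nonneg ((hcomp k).psd z (hSq z hz))).trans (hC _ (hcomp k))

lemma exists_cutoff (hΩ : IsOpen Ω) {x0 : Cn n} (hx : x0 ∈ Ω) {N : ℝ} (hN : 0 ≤ N) :
    ∃ q δ₀, Cutoff Ω q δ₀ ∧ q x0 < -N - 1 := by
  obtain ⟨r, hr, hrΩ⟩ := Metric.isOpen_iff.1 hΩ x0 hx
  have hA : 0 < (N + 3) / (r / 3) ^ 2 := by positivity
  have hsub : ∀ z, quad ((N + 3) / (r / 3) ^ 2) (N + 2) x0 z < 1 →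
      z ∈ Metric.closedBall x0 (r / 3) := by
    intro z hz
    rw [mem_closedBall_iff_norm, pi_norm_le_iff_of_nonneg (by positivity)]
    intro j
    have h1 : ‖z j - x0 j‖ ^ 2 ≤ ∑ i, ‖z i - x0 i‖ ^ 2 :=
      Finset.single_le_sum (f := fun i => ‖z i - x0 i‖ ^ 2) (fun i _ => sq_nonneg _)
        (Finset.mem_univ j)
    have h2 : (N + 3) / (r / 3) ^ 2 * ∑ i, ‖z i - x0 i‖ ^ 2 < N + 3 := by
      unfold quad at hz; linarith
    rw [div_mul_eq_mul_div, div_lt_iff₀ (by positivity)] at h2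
    have h3 := lt_of_mul_lt_mul_left h2 (by positivity)
    rw [Pi.sub_apply]
    exact le_of_sq_le_sq (h1.trans h3.le) (by positivity)
  refine ⟨quad ((N + 3) / (r / 3) ^ 2) (N + 2) x0, r / 3, ⟨hΩ, quad_contDiff _ _ _,
    chess_quad_posSemidef hA.le _ _, ⟨_, isCompact_closedBall x0 (r / 3), hsub⟩, by positivity,
    fun z hz => ?_⟩, ?_⟩
  · refine (Metric.closedBall_subset_closedBall' ?_).trans
      ((Metric.closedBall_subset_ball (show r * (2 / 3) < r by linarith)).trans hrΩ)
    have := Metric.mem_closedBall.1 (hsub z hz)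
    linarith
  · simp only [quad, sub_self, norm_zero]
    norm_num
    linarith

lemma maCap_mono {S T : Set (Cn n)} (h : S ⊆ T) : MACap n Ω S ≤ MACap n Ω T :=
  iSup₂_mono fun _ _ => iSup₂_mono fun _ _ => measure_mono h

lemma maCap_union_le (S T : Set (Cn n)) : MACap n Ω (S ∪ T) ≤ MACap n Ω S + MACap n Ω T :=
  iSup₂_le fun u hu => iSup₂_le fun μ hμ => (measure_union_le S T).trans
    (add_le_add (le_iSup₂_of_le u hu (le_iSup₂_of_le μ hμ le_rfl))
      (le_iSup₂_of_le u hu (le_iSup₂_of_le μ hμ le_rfl)))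

lemma maCap_empty : MACap n Ω ∅ = 0 := by simp [MACap]

/-- Increasing sequences of bounded psh functions converge in capacity. -/
theorem exists_maCap_le (hΩ : IsOpen Ω) {v : ℕ → Cn n → ℝ} {G : Cn n → ℝ} {N : ℝ} (hN : 0 ≤ N)
    (hv : ∀ j, RPsh (v j) Ω) (hG : RPsh G Ω) (hvN : ∀ j, ∀ z ∈ Ω, -N ≤ v j z)
    (hvm : ∀ j, ∀ z ∈ Ω, v j z ≤ v (j + 1) z) (hvG : ∀ j, ∀ z ∈ Ω, v j z ≤ G z)
    (hG0 : ∀ z ∈ Ω, G z ≤ 0)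
    (hlim : ∀ᵐ z, z ∈ Ω → Tendsto (fun j => v j z) atTop (𝓝 (G z)))
    {K : Set (Cn n)} (hK : IsCompact K) (hKΩ : K ⊆ Ω) {ε η : ℝ} (hε : 0 < ε) (hη : 0 < η) :
    ∃ J : ℕ, ∀ j, J ≤ j → MACap n Ω {z | z ∈ K ∧ v j z + ε < G z} ≤ ENNReal.ofReal η := by
  have key : ∀ F : Cn n → ℝ, RPsh F Ω → (∀ z ∈ Ω, -N ≤ F z) → (∀ z ∈ Ω, F z ≤ 0) →
      NegPsh Ω N (Ω.indicator F) := fun F hF h1 h2 =>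
    ⟨measurable_indicator_usc hΩ hF.usc, fun z => by
      by_cases hz : z ∈ Ω
      · simpa [hz] using h1 z hz
      · simpa [hz] using hN, fun z => by
      by_cases hz : z ∈ Ω
      · simpa [hz] using h2 z hz
      · simp [hz], hF.congr fun z hz => by simp [hz]⟩
  have hvn := fun j => key (v j) (hv j) (hvN j) fun z hz => (hvG j z hz).trans (hG0 z hz)
  have hGn := key G hG (fun z hz => (hvN 0 z hz).trans (hvG 0 z hz)) hG0
  have hloc : ∀ x ∈ K, ∃ W ∈ 𝓝[K] x, ∀ t : ℝ, 0 < t → ∃ J : ℕ, ∀ j, J ≤ j →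
      MACap n Ω {z | z ∈ W ∧ z ∈ Ω ∧ v j z + ε < G z} ≤ ENNReal.ofReal t := by
    intro x hx
    obtain ⟨q, δ₀, hq, hqx⟩ := exists_cutoff hΩ (hKΩ hx) hN
    refine ⟨{z | q z < -N - 1}, mem_nhdsWithin_of_mem_nhds ((hq.isOpen_lt _).mem_nhds hqx),
      fun t ht => ?_⟩
    have hη' : 0 < t / maConst n := div_pos ht (maConst_pos n)
    obtain ⟨m, J, hJ⟩ := hq.exists_hessMeasure_le hvn hGn
      (monotone_nat_of_le_succ fun j z => Set.indicator_le_indicator' fun hz => hvm j z hz)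
      (fun j z => Set.indicator_le_indicator' fun hz => hvG j z hz)
      (by
        filter_upwards [hlim] with z hz hzΩ
        simpa [hzΩ] using hz hzΩ) (half_pos hε) hη'
    refine ⟨J, fun j hj => iSup₂_le fun u hu => iSup₂_le fun μ hμ => ?_⟩
    have hSq : ∀ z ∈ {z | q z < -N - 1 ∧
        2 * (ε / 2) < mol (scale δ₀ m) (Ω.indicator G) z - Ω.indicator (v j) z}, q z < 1 :=
      fun z hz => by linarith [hz.1]
    have hqΩ : ∀ z, q z < 1 → z ∈ Ω := fun z hz => shrink_subset hq.pos.le (hq.sub hz)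
    have hopen : IsOpen {z | q z < -N - 1 ∧
        2 * (ε / 2) < mol (scale δ₀ m) (Ω.indicator G) z - Ω.indicator (v j) z} := by
      rw [isOpen_iff_mem_nhds]
      intro z hz
      have hzΩ := hqΩ z (hSq z hz)
      have husc := (hvn j).psh.usc z hzΩ
      obtain ⟨c, hc1, hc2⟩ := exists_between (show Ω.indicator (v j) z <
        mol (scale δ₀ m) (Ω.indicator G) z - 2 * (ε / 2) by linarith [hz.2])
      have h1 := hΩ.nhdsWithin_eq hzΩ ▸ husc c hc1
      have h2 := ((hGn.mol_smooth (scale_pos hq.pos m)).continuous.tendsto z).eventually_const_lt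
        (show c + 2 * (ε / 2) < _ by linarith)
      filter_upwards [h1, h2, (hq.isOpen_lt (-N - 1)).mem_nhds hz.1] with y hy1 hy2 hy3
      exact ⟨hy3, by linarith⟩
    refine (measure_mono fun z hz => ?_).trans ((hq.measure_le hu.1 hu.2 hμ hopen hSq
      (fun w hw => hJ j hj w hw)).trans ?_)
    · have hz1 : q z < -N - 1 := hz.1
      refine ⟨hz1, ?_⟩
      have := le_moll volume hGn.meas hGn.abs_le hGn.psh (scale_pos hq.pos m)
        (shrink_anti (scale_le hq.pos m) (hq.sub (show q z < 1 by linarith)))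
      rw [Set.indicator_of_mem hz.2.1] at this ⊢
      have h3 := hz.2.2
      change _ ≤ mol _ _ _ at this
      linarith
    · rw [← ENNReal.ofReal_mul (maConst_pos n).le, mul_div_cancel₀ _ (maConst_pos n).ne']
  obtain ⟨J, hJ⟩ := hK.induction_on
    (p := fun W => ∀ t : ℝ, 0 < t → ∃ J : ℕ, ∀ j, J ≤ j →
      MACap n Ω {z | z ∈ W ∧ z ∈ Ω ∧ v j z + ε < G z} ≤ ENNReal.ofReal t)
    (fun t ht => ⟨0, fun j _ => by simp [maCap_empty]⟩)
    (fun W W' hW h t ht => (h t ht).imp fun J hJ j hj =>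
      (maCap_mono (T := {z | z ∈ W' ∧ z ∈ Ω ∧ v j z + ε < G z})
        fun z hz => ⟨hW hz.1, hz.2⟩).trans (hJ j hj))
    (fun W W' h h' t ht => by
      obtain ⟨J, hJ⟩ := h _ (half_pos ht)
      obtain ⟨J', hJ'⟩ := h' _ (half_pos ht)
      refine ⟨max J J', fun j hj => (maCap_mono (T := {z | z ∈ W ∧ z ∈ Ω ∧ v j z + ε < G z} ∪
        {z | z ∈ W' ∧ z ∈ Ω ∧ v j z + ε < G z}) fun z hz => ?_).trans ((maCap_union_le _ _).trans
        ((add_le_add (hJ j (le_of_max_le_left hj)) (hJ' j (le_of_max_le_right hj))).trans ?_))⟩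
      · exact hz.1.imp (fun h => ⟨h, hz.2⟩) fun h => ⟨h, hz.2⟩
      · rw [← ENNReal.ofReal_add (by positivity) (by positivity), add_halves])
    hloc η hη
  exact ⟨J, fun j hj => (maCap_mono (T := {z | z ∈ K ∧ z ∈ Ω ∧ v j z + ε < G z})
    fun z hz => ⟨hz.1, hKΩ hz.1, hz.2⟩).trans (hJ j hj)⟩

end Capacity

section SmoothMA

open Matrix
open scoped ComplexOrder

lemma exists_smooth_cutoff {E : Type*} [NormedAddCommGroup E] [NormedSpace ℝ E]
    [FiniteDimensional ℝ E] {K U : Set E} (hK : IsCompact K) (hU : IsOpen U) (hKU : K ⊆ U) :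
    ∃ χ : E → ℝ, ContDiff ℝ (⊤ : ℕ∞) χ ∧ HasCompactSupport χ ∧ tsupport χ ⊆ U ∧
      (∀ z, χ z ∈ Set.Icc (0 : ℝ) 1) ∧ ∃ V, IsOpen V ∧ K ⊆ V ∧ V ⊆ U ∧ ∀ z ∈ V, χ z = 1 := by
  have : ProperSpace E := FiniteDimensional.proper ℝ E
  obtain ⟨K1, hK1, h01, h1U⟩ := exists_compact_between hK hU hKU
  obtain ⟨K2, hK2, h12, h2U⟩ := exists_compact_between hK1 hU h1U
  obtain ⟨χ, hχ, hr, hs, h1⟩ := exists_contMDiff_support_eq_eq_one_iff (n := (⊤ : ℕ∞))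
    (modelWithCornersSelf ℝ E) isOpen_interior hK1.isClosed h12
  have hsub : tsupport χ ⊆ K2 := by
    rw [tsupport, hs]; exact closure_minimal interior_subset hK2.isClosed
  exact ⟨χ, hχ.contDiff, hK2.of_isClosed_subset (isClosed_tsupport _) hsub, hsub.trans h2U,
    fun z => hr ⟨z, rfl⟩, interior K1, isOpen_interior, h01, interior_subset.trans h1U,
    fun z hz => (h1 z).1 (interior_subset hz)⟩

variable {n : ℕ} {U K : Set (Cn n)}

lemma chess_const_mul {φ : Cn n → ℝ} (hφ : ContDiff ℝ (⊤ : ℕ∞) φ) (c : ℝ) (z : Cn n) :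
    chess (fun z => c * φ z) z = (c : ℂ) • chess φ z := by
  have := chess_add (contDiff_const (c := (0 : ℝ))) hφ c z
  simpa [chess_const] using this

lemma negPsh_const (Ω : Set (Cn n)) {N c : ℝ} (h1 : -N ≤ c) (h2 : c ≤ 0) :
    NegPsh Ω N fun _ : Cn n => c :=
  ⟨measurable_const, fun _ => h1, fun _ => h2, rpsh_const c Ω⟩

lemma Cutoff.exists_hessMeasure_const {q : Cn n → ℝ} {δ₀ : ℝ} (hq : Cutoff U q δ₀) :
    ∃ C : ℝ, ∀ w, Competitor q w → hessMeasure w {z | q z < -1 - 1} ≤ ENNReal.ofReal C := by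
  have hF := negPsh_const U (N := 1) (c := -1) le_rfl (by norm_num)
  have hG := negPsh_const U (N := 1) (c := 0) (by norm_num) le_rfl
  refine ⟨_, fun w hw => le_trans (measure_mono fun z hz => ?_)
    (hq.hessMeasure_mol_sub_mol_le hw hF hG (fun z => by norm_num) (ε := 1 / 2) (by norm_num)
    (scale_pos hq.pos 0) le_rfl (scale_le hq.pos 0))⟩
  refine ⟨hz, ?_⟩
  have h1 := le_moll volume hG.meas hG.abs_le hG.psh (scale_pos hq.pos 0)
    (shrink_anti (scale_le hq.pos 0) (hq.sub (show q z < 1 by linarith [show q z < -1 - 1 from hz])))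
  have h2 : mol (scale δ₀ 0) (fun _ : Cn n => (-1 : ℝ)) z = -1 := by
    simp [mol, moll, integral_neg, kern_integral]
  change _ ≤ mol _ _ _ at h1
  linarith

/-- The Chern–Levine–Nirenberg inequality. -/
lemma exists_integral_det_le (hU : IsOpen U) (hK : IsCompact K) (hKU : K ⊆ U) :
    ∃ K', IsCompact K' ∧ K' ⊆ U ∧ ∀ M : ℝ, 0 < M → ∃ C : ℝ, 0 ≤ C ∧ ∀ φ : Cn n → ℝ, ContDiff ℝ (⊤ : ℕ∞) φ →
      (∀ z ∈ U, (chess φ z).PosSemidef) → (∀ z ∈ K', |φ z| ≤ M) →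
      ∫ z in K, (chess φ z).det.re ≤ C := by
  obtain ⟨K', hK', hK'U, C, hC⟩ := hK.induction_on
    (p := fun W => ∃ K', IsCompact K' ∧ K' ⊆ U ∧ ∃ C : ℝ, ∀ φ : Cn n → ℝ,
      ContDiff ℝ (⊤ : ℕ∞) φ → (∀ z ∈ U, (chess φ z).PosSemidef) → (∀ z ∈ K', |φ z| ≤ 1) →
      hessMeasure φ W ≤ ENNReal.ofReal C)
    ⟨∅, isCompact_empty, Set.empty_subset _, 0, fun φ _ _ _ => by simp⟩
    (fun W W' hW ⟨K', h1, h2, C, hC⟩ => ⟨K', h1, h2, C, fun φ a b c =>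
      (measure_mono hW).trans (hC φ a b c)⟩)
    (fun W W' ⟨K1, h1, h2, C, hC⟩ ⟨K2, h1', h2', C', hC'⟩ => by
      refine ⟨K1 ∪ K2, h1.union h1', Set.union_subset h2 h2', max C 0 + max C' 0, fun φ a b c =>
        (measure_union_le _ _).trans ?_⟩
      rw [ENNReal.ofReal_add (le_max_right _ _) (le_max_right _ _)]
      exact add_le_add ((hC φ a b fun z hz => c z (Or.inl hz)).trans
        (ENNReal.ofReal_le_ofReal (le_max_left _ _)))
        ((hC' φ a b fun z hz => c z (Or.inr hz)).trans
        (ENNReal.ofReal_le_ofReal (le_max_left _ _))))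
    (fun x hx => by
      obtain ⟨q, δ₀, hq, hqx⟩ := exists_cutoff hU (hKU hx) zero_le_one
      obtain ⟨K0, hK0, hqK0⟩ := hq.compact
      have hcl : closure {z | q z < 1} ⊆ U := fun y hy => by
        obtain ⟨z, hz, hyz⟩ := Metric.mem_closure_iff.1 hy δ₀ hq.pos
        exact hq.sub hz (Metric.mem_closedBall.2 hyz.le)
      obtain ⟨χ, hχ, hχc, hχU, hχ1, V, hV, hV1, -, hV2⟩ := exists_smooth_cutoff
        (hK0.of_isClosed_subset isClosed_closure (closure_minimal hqK0 hK0.isClosed)) hU hcl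
      obtain ⟨C, hC⟩ := hq.exists_hessMeasure_const
      refine ⟨{z | q z < -1 - 1}, mem_nhdsWithin_of_mem_nhds ((hq.isOpen_lt _).mem_nhds hqx),
        tsupport χ, hχc, hχU, C, fun φ hφ hp h1 => ?_⟩
      have heq : ∀ z, q z < 1 → chess (fun z => χ z * φ z) z = chess φ z := fun z hz =>
        chess_congr (by
          filter_upwards [hV.mem_nhds (hV1 (subset_closure hz))] with y hy
          rw [hV2 y hy, one_mul])
      have hw : Competitor q fun z => χ z * φ z := by
        refine ⟨hχ.mul hφ, fun z => ?_, fun z hz => ?_⟩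
        · by_cases hz : z ∈ tsupport χ
          · rw [abs_mul, abs_of_nonneg (hχ1 z).1]
            exact mul_le_one₀ (hχ1 z).2 (abs_nonneg _) (h1 z hz)
          · simp [image_eq_zero_of_notMem_tsupport hz]
        · rw [heq z hz]
          exact hp z (hcl (subset_closure hz))
      refine le_trans (le_of_eq ?_) (hC _ hw)
      have hm : MeasurableSet {z | q z < -1 - 1} := (hq.isOpen_lt _).measurableSet
      rw [hessMeasure, hessMeasure, withDensity_apply _ hm, withDensity_apply _ hm]
      exact setLIntegral_congr_fun hm fun z hz => by
        rw [heq z (by linarith [show q z < -1 - 1 from hz])])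
  refine ⟨K', hK', hK'U, fun M hM => ⟨M ^ n * max C 0, by positivity, fun φ hφ hp hb => ?_⟩⟩
  have h1 := hC (fun z => M⁻¹ * φ z) (contDiff_const.mul hφ) (fun z hz => by
    rw [chess_const_mul hφ]
    exact (hp z hz).smul (by exact_mod_cast (inv_pos.2 hM).le)) (fun z hz => by
    rw [abs_mul, abs_of_pos (inv_pos.2 hM)]
    exact inv_mul_le_one_of_le₀ (hb z hz) hM.le)
  have hdet : ∀ z, (chess (fun z => M⁻¹ * φ z) z).det.re = (M⁻¹) ^ n * (chess φ z).det.re := by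
    intro z
    rw [chess_const_mul hφ, Matrix.det_smul, Fintype.card_fin, ← Complex.ofReal_pow,
      Complex.re_ofReal_mul]
  have hcont : Continuous fun z => (chess φ z).det.re :=
    Complex.continuous_re.comp (chess_continuous hφ).matrix_det
  have hi : IntegrableOn (fun z => (chess φ z).det.re) K := hcont.continuousOn.integrableOn_compact hK
  rw [hessMeasure, withDensity_apply _ hK.measurableSet] at h1
  simp only [hdet] at h1
  rw [← ofReal_integral_eq_lintegral_ofReal (hi.const_mul _) (by
    refine (ae_restrict_iff' hK.measurableSet).2 (Eventually.of_forall fun z hz => ?_)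
    exact mul_nonneg (by positivity) (det_re_nonneg (hp z (hKU hz)))), integral_const_mul] at h1
  have h2 := (ENNReal.ofReal_le_ofReal_iff (le_max_right C 0)).1
    (h1.trans (ENNReal.ofReal_le_ofReal (le_max_left C 0)))
  rw [inv_pow, inv_mul_le_iff₀ (by positivity)] at h2
  exact h2

lemma exists_abs_integral_sub_le (hU : IsOpen U) {f q : Cn n → ℝ} (hf : ContDiff ℝ (⊤ : ℕ∞) f)
    (hfc : HasCompactSupport f) (hfU : tsupport f ⊆ U) (hq : ContDiff ℝ (⊤ : ℕ∞) q)
    (hqp : ∀ z ∈ U, (chess q z).PosSemidef) :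
    ∃ K', IsCompact K' ∧ K' ⊆ U ∧ ∃ C : ℝ, ∀ v : Cn n → ℝ, ContDiff ℝ (⊤ : ℕ∞) v →
      (∀ z ∈ U, (chess v z).PosSemidef) → ∀ τ, 0 ≤ τ → τ ≤ 1 → (∀ z ∈ K', |v z - q z| ≤ τ) →
      |(∫ z, f z * (chess v z).det.re) - ∫ z, f z * (chess q z).det.re| ≤ C * τ := by
  obtain ⟨K0, hK0, hK0U, hmass⟩ := exists_integral_det_le hU hfc hfU
  set Q : Cn n → ℝ := quad 1 0 0 with hQdef
  have hQ : ContDiff ℝ (⊤ : ℕ∞) Q := quad_contDiff _ _ _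
  obtain ⟨M, hM⟩ := hK0.exists_bound_of_continuousOn
    ((hq.continuous.add hQ.continuous).continuousOn (s := K0))
  obtain ⟨C, hC0, hC⟩ := hmass (|M| + 1) (by positivity)
  obtain ⟨c, hc⟩ := (hfc : IsCompact (tsupport f)).exists_bound_of_continuousOn
    (continuous_finsetSum Finset.univ fun j _ => continuous_finsetSum Finset.univ fun k _ =>
      ((chess_contDiff hf j k).continuous.norm)).continuousOn
  refine ⟨K0 ∪ tsupport f, hK0.union hfc, Set.union_subset hK0U hfU, n * |c| * (n * C),
    fun v hv hvp τ hτ0 hτ hvq => ?_⟩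
  set h : Cn n → ℝ := fun z => v z - q z with hh
  have hhs : ContDiff ℝ (⊤ : ℕ∞) h := hv.sub hq
  have hcq := chess_continuous hq
  have hch := chess_continuous hhs
  have hd := hasDerivAt_setIntegral_compact (μ := (volume : Measure (Cn n))) (S := tsupport f) hfc
    (Φ := fun t z => f z * (chess q z + (t : ℂ) • chess h z).det.re)
    (Φ' := fun t z => f z * ((chess q z + (t : ℂ) • chess h z).adjugate * chess h z).trace.re)
    (fun t => hf.continuous.mul (Complex.continuous_re.comp
      (hcq.add (hch.const_smul (t : ℂ))).matrix_det)) (by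
      refine (hf.continuous.comp continuous_snd).mul (Complex.continuous_re.comp ?_)
      refine Continuous.matrix_trace (Continuous.matrix_mul (Continuous.matrix_adjugate ?_)
        (hch.comp continuous_snd))
      exact (hcq.comp continuous_snd).add
        ((Complex.continuous_ofReal.comp continuous_fst).smul (hch.comp continuous_snd)))
    (fun t z => (hasDerivAt_det_re _ _ t).const_mul (f z))
  have hbound : ∀ t ∈ Set.Icc (0 : ℝ) 1, ‖∫ z in tsupport f,
      f z * ((chess q z + (t : ℂ) • chess h z).adjugate * chess h z).trace.re‖ ≤
        n * |c| * (n * C) * τ := by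
    intro t ht
    have hsm : ContDiff ℝ (⊤ : ℕ∞) fun z => q z + t * h z := hq.add (contDiff_const.mul hhs)
    have hH : ∀ z, chess (fun z => q z + t * h z) z = chess q z + (t : ℂ) • chess h z :=
      chess_add hq hhs t
    have hHp : ∀ z ∈ U, (chess q z + (t : ℂ) • chess h z).PosSemidef := fun z hz => by
      rw [hh, chess_sub hv hq]
      exact posSemidef_lerp (hvp z hz) (hqp z hz) ht.1 ht.2
    rw [← integral_eq_setIntegral_of_zero fun x hx => by
      rw [image_eq_zero_of_notMem_tsupport hx, zero_mul]]
    have hsymm := integral_trace_symm hsm hf hhs (Or.inl hfc)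
    simp only [hH] at hsymm
    rw [hsymm]
    have hzero : ∀ z, z ∉ tsupport f → chess f z = 0 := fun z hz => by
      have : f =ᶠ[𝓝 z] fun _ => 0 := by
        filter_upwards [(isClosed_tsupport f).isOpen_compl.mem_nhds hz] with y hy
        exact image_eq_zero_of_notMem_tsupport hy
      rw [chess_congr this, chess_const]
    rw [integral_eq_setIntegral_of_zero (S := tsupport f) fun x hx => by simp [hzero x hx]]
    have hφs : ContDiff ℝ (⊤ : ℕ∞) fun z => (q z + t * h z) + 1 * Q z :=
      hsm.add (contDiff_const.mul hQ)
    have hφ : ∀ z, chess (fun z => (q z + t * h z) + 1 * Q z) z =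
        (chess q z + (t : ℂ) • chess h z) + 1 := fun z => by
      rw [chess_add hsm hQ, hH, hQdef, chess_quad]; simp
    have hmassφ := hC _ hφs (fun z hz => by
      rw [hφ]; exact (hHp z hz).add Matrix.PosSemidef.one) (fun z hz => by
      have h1 := hM z hz
      have h2 : |h z| ≤ 1 := (hvq z (Or.inl hz)).trans hτ
      have h3 : |t * h z| ≤ 1 := by
        rw [abs_mul, abs_of_nonneg ht.1]
        exact mul_le_one₀ ht.2 (abs_nonneg _) h2
      rw [Real.norm_eq_abs] at h1
      calc |q z + t * h z + 1 * Q z| = |(q z + Q z) + t * h z| := by ring_nf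
        _ ≤ |q z + Q z| + |t * h z| := abs_add_le _ _
        _ ≤ _ := add_le_add (h1.trans (le_abs_self M)) h3)
    simp only [hφ] at hmassφ
    have hcd : Continuous fun z => (chess q z + (t : ℂ) • chess h z + 1).det.re :=
      Complex.continuous_re.comp ((hcq.add (hch.const_smul (t : ℂ))).add continuous_const).matrix_det
    calc _ ≤ ∫ z in tsupport f, τ * (n * |c| * (n * (chess q z + (t : ℂ) • chess h z + 1).det.re)) := by
          refine norm_integral_le_of_norm_le
            (((hcd.const_mul _).const_mul _).const_mul _ |>.continuousOn.integrableOn_compact hfc)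
            ((ae_restrict_iff' (isClosed_tsupport f).measurableSet).2
              (Eventually.of_forall fun z hz => ?_))
          have hp := hHp z (hfU hz)
          have h1 := abs_trace_mul_le (posSemidef_adjugate hp) (chess_isHermitian (hf.two z)) (c := |c|)
            (fun j k => ?_)
          · rw [norm_mul, Real.norm_eq_abs, Real.norm_eq_abs]
            refine mul_le_mul (hvq z (Or.inr hz)) (h1.trans ?_) (abs_nonneg _)
              ((abs_nonneg _).trans (hvq z (Or.inr hz)))
            have h2 := trace_adjugate_le hp
            rw [Fintype.card_fin] at h2 ⊢
            exact mul_le_mul_of_nonneg_left h2 (by positivity)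
          · refine le_trans ?_ ((hc z hz).trans (le_abs_self c))
            rw [Real.norm_of_nonneg (by positivity)]
            exact (Finset.single_le_sum (f := fun k => ‖chess f z j k‖) (fun _ _ => norm_nonneg _)
              (Finset.mem_univ k)).trans (Finset.single_le_sum
              (f := fun j => ∑ k, ‖chess f z j k‖)
              (fun _ _ => Finset.sum_nonneg fun _ _ => norm_nonneg _) (Finset.mem_univ j))
      _ ≤ _ := by
          rw [integral_const_mul, integral_const_mul, integral_const_mul, mul_comm τ]
          gcongr
  have := Convex.norm_image_sub_le_of_norm_hasDerivWithin_le
    (fun t _ => (hd t).hasDerivWithinAt) hbound (convex_Icc 0 1)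
    (Set.left_mem_Icc.2 zero_le_one) (Set.right_mem_Icc.2 zero_le_one)
  simp only [Complex.ofReal_one, one_smul, Complex.ofReal_zero, zero_smul, add_zero, hh,
    chess_sub hv hq, add_sub_cancel, sub_zero, norm_one, mul_one] at this
  rw [← integral_eq_setIntegral_of_zero fun x hx => by
      rw [image_eq_zero_of_notMem_tsupport hx, zero_mul], ← integral_eq_setIntegral_of_zero fun x hx => by
      rw [image_eq_zero_of_notMem_tsupport hx, zero_mul]] at this
  exact this

lemma abs_integral_mul_sub_le {v f g : Cn n → ℝ} (hv : ContDiff ℝ (⊤ : ℕ∞) v)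
    (hf : Continuous f) (hg : Continuous g) (hfc : HasCompactSupport f)
    (hgf : Function.support g ⊆ Function.support f) {ε : ℝ} (h : ∀ z, |g z - f z| ≤ ε)
    (hp : ∀ z ∈ tsupport f, (chess v z).PosSemidef) :
    |(∫ z, g z * (chess v z).det.re) - ∫ z, f z * (chess v z).det.re| ≤
      ε * ∫ z in tsupport f, (chess v z).det.re := by
  have hcont : Continuous fun z => (chess v z).det.re :=
    Complex.continuous_re.comp (chess_continuous hv).matrix_det
  have hf0 : ∀ z, z ∉ tsupport f → f z = 0 := fun z hz => image_eq_zero_of_notMem_tsupport hz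
  have hg0 : ∀ z, z ∉ tsupport f → g z = 0 := fun z hz => by
    by_contra hgz
    exact hz (subset_tsupport f (hgf hgz))
  have ef : ∫ z, f z * (chess v z).det.re = ∫ z in tsupport f, f z * (chess v z).det.re :=
    integral_eq_setIntegral_of_zero fun z hz => by rw [hf0 z hz, zero_mul]
  have eg : ∫ z, g z * (chess v z).det.re = ∫ z in tsupport f, g z * (chess v z).det.re :=
    integral_eq_setIntegral_of_zero fun z hz => by rw [hg0 z hz, zero_mul]
  have hif : IntegrableOn (fun z => f z * (chess v z).det.re) (tsupport f) :=
    (hf.mul hcont).continuousOn.integrableOn_compact hfc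
  have hig : IntegrableOn (fun z => g z * (chess v z).det.re) (tsupport f) :=
    (hg.mul hcont).continuousOn.integrableOn_compact hfc
  rw [ef, eg, ← integral_sub hig hif, ← integral_const_mul]
  rw [← Real.norm_eq_abs]
  refine norm_integral_le_of_norm_le
    (μ := volume.restrict (tsupport f)) ((hcont.const_mul ε).continuousOn.integrableOn_compact hfc)
    ((ae_restrict_iff' (isClosed_tsupport f).measurableSet).2 (Eventually.of_forall fun z hz => ?_))
  rw [← sub_mul, norm_mul, Real.norm_eq_abs, Real.norm_of_nonneg (det_re_nonneg (hp z hz))]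
  exact mul_le_mul_of_nonneg_right (h z) (det_re_nonneg (hp z hz))

lemma tendsto_integral_mul_det (hU : IsOpen U) {f q : Cn n → ℝ} {v : ℕ → Cn n → ℝ}
    (hf : Continuous f) (hfc : HasCompactSupport f) (hfU : tsupport f ⊆ U)
    (hq : ContDiff ℝ (⊤ : ℕ∞) q) (hqp : ∀ z ∈ U, (chess q z).PosSemidef)
    (hv : ∀ k, ContDiff ℝ (⊤ : ℕ∞) (v k)) (hvp : ∀ k, ∀ z ∈ U, (chess (v k) z).PosSemidef)
    (hlim : ∀ K, IsCompact K → K ⊆ U → ∀ τ : ℝ, 0 < τ → ∀ᶠ k in atTop, ∀ z ∈ K, |v k z - q z| ≤ τ) :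
    Tendsto (fun k => ∫ z, f z * (chess (v k) z).det.re) atTop
      (𝓝 (∫ z, f z * (chess q z).det.re)) := by
  obtain ⟨K0, hK0, hK0U, hmass⟩ := exists_integral_det_le hU hfc hfU
  obtain ⟨M, hM⟩ := hK0.exists_bound_of_continuousOn hq.continuous.continuousOn
  obtain ⟨C, hC0, hC⟩ := hmass (|M| + 1) (by positivity)
  rw [Metric.tendsto_nhds]
  intro ε hε
  set ε' : ℝ := ε / (4 * (C + 1)) with hε'
  have hε'0 : 0 < ε' := by positivity
  have hε'C : ε' * C ≤ ε / 4 := by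
    rw [hε', div_mul_eq_mul_div, div_le_div_iff₀ (by positivity) (by norm_num)]
    nlinarith
  obtain ⟨g, hg, hgf, hgs⟩ := hf.exists_contDiff_approx ⊤ (continuous_const (y := ε')) fun _ => hε'0
  have hgf' : ∀ z, |g z - f z| ≤ ε' := fun z => (hgf z).le
  have hgt : tsupport g ⊆ tsupport f := closure_mono hgs
  have hgc : HasCompactSupport g := hfc.of_isClosed_subset (isClosed_tsupport g) hgt
  obtain ⟨K1, hK1, hK1U, C1, hC1⟩ := exists_abs_integral_sub_le hU hg hgc (hgt.trans hfU) hq hqp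
  set τ : ℝ := min 1 (ε / (4 * (|C1| + 1))) with hτ
  have hτ0 : 0 < τ := lt_min one_pos (by positivity)
  have hτC : C1 * τ ≤ ε / 4 := by
    calc C1 * τ ≤ (|C1| + 1) * (ε / (4 * (|C1| + 1))) :=
          mul_le_mul ((le_abs_self _).trans (by linarith)) (min_le_right _ _) hτ0.le (by positivity)
      _ = ε / 4 := by field_simp
  filter_upwards [hlim K0 hK0 hK0U 1 one_pos, hlim K1 hK1 hK1U τ hτ0] with k hk0 hk1
  have h1 := abs_integral_mul_sub_le (hv k) hf hg.continuous hfc hgs hgf'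
    fun z hz => hvp k z (hfU hz)
  have h2 := abs_integral_mul_sub_le hq hf hg.continuous hfc hgs hgf' fun z hz => hqp z (hfU hz)
  have h3 := hC1 (v k) (hv k) (hvp k) τ hτ0.le (min_le_left _ _) hk1
  have h4 := hC (v k) (hv k) (hvp k) fun z hz => by
    have := hM z hz
    rw [Real.norm_eq_abs] at this
    calc |v k z| = |(v k z - q z) + q z| := by ring_nf
      _ ≤ |v k z - q z| + |q z| := abs_add_le _ _
      _ ≤ _ := by linarith [hk0 z hz, le_abs_self M]
  have h5 := hC q hq hqp fun z hz => by
    have := hM z hz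
    rw [Real.norm_eq_abs] at this
    linarith [le_abs_self M]
  have h6 := h1.trans ((mul_le_mul_of_nonneg_left h4 hε'0.le).trans hε'C)
  have h7 := h2.trans ((mul_le_mul_of_nonneg_left h5 hε'0.le).trans hε'C)
  have h8 := h3.trans hτC
  rw [Real.dist_eq]
  rw [abs_le] at h6 h7 h8
  rw [abs_lt]
  constructor <;> linarith [h6.1, h6.2, h7.1, h7.2, h8.1, h8.2]

/-- The Monge–Ampère measure of a quadratic polynomial. -/
lemma isMAMeasure_quad {Ω : Set (Cn n)} (hΩ : IsOpen Ω) {A : ℝ} (hA : 0 ≤ A) (B : ℝ) (x0 : Cn n) :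
    IsMAMeasure n (fun z => (quad A B x0 z : EReal)) Ω
      (ENNReal.ofReal (maConst n * A ^ n) • volume.restrict Ω) := by
  have hκ : 0 ≤ maConst n * A ^ n := mul_nonneg (maConst_pos n).le (by positivity)
  refine ⟨?_, fun K hK hKΩ => ?_, fun U hU hUΩ v hv hvp hvm hvl f hf hfc hfU => ?_⟩
  · simp [Measure.restrict_apply hΩ.measurableSet.compl]
  · rw [Measure.smul_apply, smul_eq_mul]
    exact ENNReal.mul_ne_top ENNReal.ofReal_ne_top
      ((Measure.restrict_apply_le _ _).trans_lt hK.measure_lt_top).ne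
  · set q := quad A B x0 with hq
    have hqs : ContDiff ℝ (⊤ : ℕ∞) q := quad_contDiff _ _ _
    have hqp := chess_quad_posSemidef hA B x0
    obtain ⟨χ, hχ, hχc, hχU, -, V, hV, hfV, hVU, hχ1⟩ := exists_smooth_cutoff hfc hU hfU
    have hs : ∀ k, ContDiff ℝ (⊤ : ℕ∞) fun z => χ z * v k z := fun k => by
      refine contDiff_iff_contDiffAt.2 fun z => ?_
      by_cases hz : z ∈ U
      · exact hχ.contDiffAt.mul ((hv k).contDiffAt (hU.mem_nhds hz))
      · refine (contDiffAt_const (c := (0 : ℝ))).congr_of_eventuallyEq ?_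
        filter_upwards [(isClosed_tsupport χ).isOpen_compl.mem_nhds fun h => hz (hχU h)] with y hy
        rw [image_eq_zero_of_notMem_tsupport hy, zero_mul]
    have hc : ∀ k, ∀ z ∈ V, chess (fun z => χ z * v k z) z = chess (v k) z := fun k z hz =>
      chess_congr (by
        filter_upwards [hV.mem_nhds hz] with y hy
        rw [hχ1 y hy, one_mul])
    have hge : ∀ k, ∀ z ∈ U, q z ≤ v k z := fun k z hz =>
      EReal.coe_le_coe_iff.1 ((hvl z hz).symm.trans_le (iInf_le _ k))
    have hanti : ∀ z ∈ U, Antitone fun k => v k z := fun z hz => antitone_nat_of_succ_le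
      fun k => hvm k z hz
    have key := tendsto_integral_mul_det hV hf hfc hfV hqs (fun z _ => hqp z) hs
      (fun k z hz => posSemidef_chess ((hs k).two z) (RPsh.levi_nonneg hV
        (((show RPsh (v k) U from hvp k).mono hVU).congr fun y hy => by rw [hχ1 y hy, one_mul])
        hz ((hs k).two z)))
      (fun K hK hKV τ hτ => by
        obtain ⟨k0, hk0⟩ := exists_forall_neg_of_antitone (g := fun k z => v k z - q z - τ) hK
          (fun k => (((hv k).continuousOn.mono (hKV.trans hVU)).sub
            hqs.continuous.continuousOn).sub continuousOn_const)
          (fun k z hz => by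
            have := hvm k z (hVU (hKV hz))
            linarith)
          (fun z hz => by
            by_contra! h
            have h1 : ((q z + τ : ℝ) : EReal) ≤ q z :=
              (le_iInf fun k => EReal.coe_le_coe_iff.2 (by linarith [h k])).trans_eq
                (hvl z (hVU (hKV hz)))
            linarith [EReal.coe_le_coe_iff.1 h1])
        filter_upwards [eventually_ge_atTop k0] with k hk z hz
        have h1 := hk0 z hz
        have h2 := hanti z (hVU (hKV hz)) hk
        have h3 := hge k z (hVU (hKV hz))
        simp only at h2
        rw [hχ1 z (hKV hz), one_mul, abs_of_nonneg (by linarith)]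
        linarith)
    have e1 : ∀ k, ∫ z, f z * maDensity n (v k) z =
        maConst n * ∫ z, f z * (chess (fun z => χ z * v k z) z).det.re := fun k => by
      rw [← integral_const_mul]
      refine integral_congr_ae (Eventually.of_forall fun z => ?_)
      simp only [maDensity_eq]
      by_cases hz : z ∈ V
      · rw [hc k z hz]; ring
      · rw [image_eq_zero_of_notMem_tsupport fun h => hz (hfV h)]; ring
    simp only [e1]
    convert key.const_mul (maConst n) using 2
    rw [integral_smul_measure, ENNReal.toReal_ofReal hκ, ← integral_eq_setIntegral_of_zero fun z hz =>
      image_eq_zero_of_notMem_tsupport fun h => hz (hUΩ (hfU h)), smul_eq_mul, mul_assoc,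
      ← integral_const_mul]
    congr 2
    ext z
    rw [hq, chess_quad, Matrix.det_smul, Matrix.det_one, Fintype.card_fin, mul_one,
      ← Complex.ofReal_pow, Complex.ofReal_re, mul_comm]

lemma rpsh_quad {A : ℝ} (hA : 0 ≤ A) (B : ℝ) (x0 : Cn n) (Ω : Set (Cn n)) :
    RPsh (quad A B x0) Ω := by
  refine rpsh_iff.2 ⟨(quad_contDiff A B x0).continuous.upperSemicontinuous.upperSemicontinuousOn _,
    fun a b r hr _ p hp ζ hζ => ?_⟩
  exact le_of_levi_nonneg (V := Set.univ) (g := fun ζ => a + ζ • b) (g1 := fun _ => b)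
    (g2 := fun _ => 0) (fun x _ => (quad_contDiff A B x0).two x)
    (fun x _ => levi_nonneg_of_posSemidef ((quad_contDiff A B x0).two x)
      (chess_quad_posSemidef hA B x0 x))
    (fun ζ => by simpa using ((hasDerivAt_id ζ).smul_const b).const_add a)
    (fun ζ => hasDerivAt_const _ _) hr (fun _ _ => trivial) p hp hζ

/-- Sets of positive volume have positive capacity. -/
theorem maCap_pos {Ω : Set (Cn n)} (hΩ : IsOpen Ω) (hb : Bornology.IsBounded Ω) {S : Set (Cn n)}
    (hSΩ : S ⊆ Ω) (hSm : MeasurableSet S) (hS : volume S ≠ 0) : MACap n Ω S ≠ 0 := by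
  obtain ⟨R, hR⟩ := hb.exists_norm_le
  set A : ℝ := 1 / (n * R ^ 2 + 1) with hA
  have hA0 : 0 < A := by positivity
  have hμ := isMAMeasure_quad hΩ hA0.le 1 0
  have h1 : (ENNReal.ofReal (maConst n * A ^ n) • volume.restrict Ω) S ≤ MACap n Ω S := by
    refine le_iSup₂_of_le (fun z => (quad A 1 0 z : EReal)) ⟨rpsh_quad hA0.le 1 0 Ω, fun z hz => ?_⟩
      (le_iSup₂_of_le _ hμ le_rfl)
    have h2 : ∑ j, ‖z j - (0 : Cn n) j‖ ^ 2 ≤ n * R ^ 2 := by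
      refine (Finset.sum_le_card_nsmul _ _ (R ^ 2) fun j _ => ?_).trans (by simp)
      have := (norm_le_pi_norm z j).trans (hR z hz)
      simpa using pow_le_pow_left₀ (norm_nonneg _) this 2
    have h3 : 0 ≤ ∑ j, ‖z j - (0 : Cn n) j‖ ^ 2 := Finset.sum_nonneg fun _ _ => sq_nonneg _
    constructor
    · refine EReal.coe_le_coe_iff.2 ?_
      unfold quad
      nlinarith
    · refine EReal.coe_le_coe_iff.2 ?_
      have : A * ∑ j, ‖z j - (0 : Cn n) j‖ ^ 2 ≤ 1 := by
        rw [hA, one_div, inv_mul_le_one₀ (by positivity)]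
        linarith
      unfold quad
      linarith
  intro h
  rw [h, nonpos_iff_eq_zero, Measure.smul_apply, smul_eq_mul, Measure.restrict_apply hSm,
    Set.inter_eq_left.2 hSΩ, mul_eq_zero, ENNReal.ofReal_eq_zero] at h1
  have := mul_pos (maConst_pos n) (pow_pos hA0 n)
  exact h1.elim (fun h => by linarith) hS

end SmoothMA

section Envelopes

variable {E : Type*} [NormedAddCommGroup E] [NormedSpace ℂ E] {Ω : Set E} {u v h : E → EReal}

lemma PlurisubharmonicOn.pEnv (hΩ : IsOpen Ω) (h : E → EReal) :
    PlurisubharmonicOn (PEnv h Ω) Ω := by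
  unfold PEnv
  simp only [← iSup_subtype'']
  exact plurisubharmonicOn_uscReg_iSup hΩ fun i => i.2.1

lemma le_pEnv (hv : PlurisubharmonicOn v Ω) (hvh : ∀ z ∈ Ω, v z ≤ h z) {z : E} (hz : z ∈ Ω) :
    v z ≤ PEnv h Ω z :=
  (le_iSup₂_of_le (f := fun (v : E → EReal)
    (_ : v ∈ {v : E → EReal | PlurisubharmonicOn v Ω ∧ ∀ x ∈ Ω, v x ≤ h x}) => v z)
    v ⟨hv, hvh⟩ le_rfl).trans (le_uscReg (f := fun z =>
      ⨆ v ∈ {v : E → EReal | PlurisubharmonicOn v Ω ∧ ∀ x ∈ Ω, v x ≤ h x}, v z) hz)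

lemma pEnv_le (hh : UpperSemicontinuousOn h Ω) {z : E} (hz : z ∈ Ω) : PEnv h Ω z ≤ h z :=
  uscReg_le (fun z hz => iSup₂_le fun _ hv => hv.2 z hz) hh hz

lemma UpperSemicontinuousOn.min_ereal (hu : UpperSemicontinuousOn u Ω)
    (hv : UpperSemicontinuousOn v Ω) : UpperSemicontinuousOn (fun z => min (u z) (v z)) Ω := by
  intro z hz c hc
  rcases min_lt_iff.1 hc with h | h
  · filter_upwards [hu z hz c h] with y hy using min_lt_iff.2 (Or.inl hy)
  · filter_upwards [hv z hz c h] with y hy using min_lt_iff.2 (Or.inr hy)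

lemma PlurisubharmonicOn.add_const (hu : PlurisubharmonicOn u Ω) (C : ℝ) :
    PlurisubharmonicOn (fun z => u z + (C : EReal)) Ω :=
  hu.add_pluriharmonic continuousOn_const (rpsh_const C Ω) (rpsh_const (-C) Ω)

lemma PlurisubharmonicOn.rooftop (hΩ : IsOpen Ω) (u v : E → EReal) :
    PlurisubharmonicOn (Rooftop u v Ω) Ω := .pEnv hΩ _

lemma rooftop_le_left (hu : PlurisubharmonicOn u Ω) (hv : PlurisubharmonicOn v Ω) {z : E}
    (hz : z ∈ Ω) : Rooftop u v Ω z ≤ u z :=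
  (pEnv_le (hu.1.min_ereal hv.1) hz).trans (min_le_left _ _)

lemma rooftop_le_right (hu : PlurisubharmonicOn u Ω) (hv : PlurisubharmonicOn v Ω) {z : E}
    (hz : z ∈ Ω) : Rooftop u v Ω z ≤ v z :=
  (pEnv_le (hu.1.min_ereal hv.1) hz).trans (min_le_right _ _)

lemma le_rooftop (hh : PlurisubharmonicOn h Ω) (hu : ∀ z ∈ Ω, h z ≤ u z)
    (hv : ∀ z ∈ Ω, h z ≤ v z) {z : E} (hz : z ∈ Ω) : h z ≤ Rooftop u v Ω z :=
  le_pEnv hh (fun z hz => le_min (hu z hz) (hv z hz)) hz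

lemma PlurisubharmonicOn.asympRooftop (hΩ : IsOpen Ω) (u v : E → EReal) :
    PlurisubharmonicOn (asympRooftop u v Ω) Ω :=
  plurisubharmonicOn_uscReg_iSup hΩ fun _ => .rooftop hΩ _ _

lemma rooftop_le_asympRooftop (u v : E → EReal) (C : ℝ) {z : E} (hz : z ∈ Ω) :
    Rooftop u (fun x => v x + (C : EReal)) Ω z ≤ asympRooftop u v Ω z :=
  (le_iSup (fun C : ℝ => Rooftop u (fun x => v x + (C : EReal)) Ω z) C).trans
    (le_uscReg (f := fun z => ⨆ C : ℝ, Rooftop u (fun x => v x + (C : EReal)) Ω z) hz)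

lemma asympRooftop_le (hu : PlurisubharmonicOn u Ω) (hv : PlurisubharmonicOn v Ω) {z : E}
    (hz : z ∈ Ω) : asympRooftop u v Ω z ≤ u z :=
  uscReg_le (f := fun z => ⨆ C : ℝ, Rooftop u (fun x => v x + (C : EReal)) Ω z)
    (fun _ hz => iSup_le fun C => rooftop_le_left hu (hv.add_const C) hz) hu.1 hz

lemma rooftop_mono_const (hΩ : IsOpen Ω) (hu : PlurisubharmonicOn u Ω)
    (hv : PlurisubharmonicOn v Ω) {C C' : ℝ} (hC : C ≤ C') {z : E} (hz : z ∈ Ω) :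
    Rooftop u (fun x => v x + (C : EReal)) Ω z ≤ Rooftop u (fun x => v x + (C' : EReal)) Ω z :=
  le_rooftop (.rooftop hΩ _ _) (fun _ hz => rooftop_le_left hu (hv.add_const C) hz)
    (fun _ hz => (rooftop_le_right hu (hv.add_const C) hz).trans
      (add_le_add_right (EReal.coe_le_coe_iff.2 hC) _)) hz

end Envelopes

section LowerBound

variable {n : ℕ} {Ω : Set (Cn n)} {u0 u1 : Cn n → EReal}

lemma rooftop_sub_le_geodesic (hΩ : IsOpen Ω) (h0 : PSHNeg u0 Ω) (h1 : PSHNeg u1 Ω) {C : ℝ}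
    (hC : 0 ≤ C) {t : ℝ} {z : Cn n} (hz : z ∈ Ω) :
    Rooftop u0 (fun x => u1 x + (C : EReal)) Ω z + ((-(C * t) : ℝ) : EReal) ≤
      geodesic n Ω u0 u1 t z := by
  set v := Rooftop u0 (fun x => u1 x + (C : EReal)) Ω with hv
  have hvp : PlurisubharmonicOn v Ω := .rooftop hΩ _ _
  have hv0 : ∀ z ∈ Ω, v z ≤ u0 z := fun z hz => rooftop_le_left h0.1 (h1.1.add_const C) hz
  have hv1 : ∀ z ∈ Ω, v z ≤ u1 z + (C : EReal) :=
    fun z hz => rooftop_le_right h0.1 (h1.1.add_const C) hz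
  have hlog : ∀ ζ ∈ annA, ((-C * Real.log ‖ζ‖ : ℝ) : EReal) ≤ 0 := fun ζ hζ => by
    have := Real.log_pos hζ.1
    exact_mod_cast (by nlinarith : -C * Real.log ‖ζ‖ ≤ 0)
  have hle : ∀ z ∈ Ω, ∀ ζ ∈ annA, v z + ((-C * Real.log ‖ζ‖ : ℝ) : EReal) ≤ v z :=
    fun z _ ζ hζ => (add_le_add_right (hlog ζ hζ) _).trans_eq (add_zero _)
  have hr : ∀ C : ℝ, RPsh (fun p : Cn n × ℂ => C * Real.log ‖p.2‖) (Ω ×ˢ annA) := fun C => by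
    have := (rpsh_log C).comp_affine (ContinuousLinearMap.snd ℂ (Cn n) ℂ) 0
      (Ω' := Ω ×ˢ annA) fun x hx => by simpa using hx.2
    simpa using this
  have hmem : (fun p : Cn n × ℂ => v p.1 + ((-C * Real.log ‖p.2‖ : ℝ) : EReal)) ∈
      geodClass n Ω u0 u1 := by
    refine ⟨⟨?_, ?_⟩, fun z hz => ?_, fun z hz => ?_⟩
    · have hv' : PlurisubharmonicOn (fun p : Cn n × ℂ => v p.1) (Ω ×ˢ annA) := by
        have := hvp.comp_affine (ContinuousLinearMap.fst ℂ (Cn n) ℂ) 0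
          (Ω' := Ω ×ˢ annA) fun x hx => by simpa using hx.1
        simpa using this
      refine hv'.add_pluriharmonic (fun p hp => ?_) (hr (-C)) ?_
      · have : ‖p.2‖ ≠ 0 := (one_pos.trans hp.2.1).ne'
        exact (ContinuousAt.log (f := fun p : Cn n × ℂ => ‖p.2‖)
          continuous_snd.norm.continuousAt this).const_mul _ |>.continuousWithinAt
      · simpa [neg_mul] using hr C
    · rintro ⟨z, ζ⟩ ⟨hz, hζ⟩
      exact (hle z hz ζ hζ).trans ((hv0 z hz).trans (h0.2 z hz))
    · refine limsup_le_of_le (by isBoundedDefault) ?_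
      filter_upwards [mem_inf_of_right (mem_principal_self annA)] with ζ hζ
      exact (hle z hz ζ hζ).trans (hv0 z hz)
    · rcases eq_or_ne (u1 z) ⊥ with hb | hb
      · have hvb : v z = ⊥ := by
          have := hv1 z hz
          rw [hb, EReal.bot_add] at this
          exact le_bot_iff.1 this
        simp only [hvb, EReal.bot_add, hb]
        exact limsup_le_of_le (by isBoundedDefault) (Eventually.of_forall fun _ => le_rfl)
      · obtain ⟨a, ha⟩ : ∃ a : ℝ, u1 z = a :=
          ⟨(u1 z).toReal, (EReal.coe_toReal (ne_top_of_le_ne_top EReal.zero_ne_top (h1.2 z hz)) hb).symm⟩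
        rw [ha]
        refine ereal_le_coe_of_forall_add fun ε hε => limsup_le_of_le (by isBoundedDefault) ?_
        have ht : Tendsto (fun x : ℝ => C + -C * Real.log x) (𝓝 (Real.exp 1)) (𝓝 0) := by
          have : Tendsto (fun x : ℝ => C + -C * Real.log x) (𝓝 (Real.exp 1))
              (𝓝 (C + -C * Real.log (Real.exp 1))) :=
            ((Real.continuousAt_log (Real.exp_ne_zero 1)).const_mul _).const_add _
          rwa [Real.log_exp, mul_one, add_neg_cancel] at this
        filter_upwards [mem_inf_of_left (preimage_mem_comap (ht.eventually_lt_const hε))] with ζ hζ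
        have h2 := hv1 z hz
        rw [ha] at h2
        refine (add_le_add_left h2 _).trans ?_
        simp only [Set.mem_preimage, Set.mem_ofPred_eq] at hζ
        exact_mod_cast (by linarith : a + C + -C * Real.log ‖ζ‖ ≤ a + ε)
  refine le_trans (le_of_eq ?_) (le_iSup₂_of_le (f := fun (u : Cn n × ℂ → EReal)
    (_ : u ∈ geodClass n Ω u0 u1) => u (z, ((Real.exp t : ℝ) : ℂ))) _ hmem le_rfl)
  simp only [Complex.norm_real, Real.norm_of_nonneg (Real.exp_pos t).le, Real.log_exp, neg_mul]

end LowerBound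

section CircSup

lemma ereal_add_coe_lt_iff {e : EReal} {a b : ℝ} :
    e + (a : EReal) < b ↔ e < ((b - a : ℝ) : EReal) := by
  induction e with
  | bot => exact iff_of_true (by simp [EReal.bot_lt_coe]) (EReal.bot_lt_coe _)
  | coe x => norm_cast; exact lt_sub_iff_add_lt.symm
  | top => simp

lemma ereal_add_coe_le_iff {e : EReal} {a b : ℝ} :
    e + (a : EReal) ≤ b ↔ e ≤ ((b - a : ℝ) : EReal) := by
  induction e with
  | bot => simp
  | coe x => norm_cast; exact le_sub_iff_add_le.symm
  | top => exact iff_of_false (by simp) (not_le_of_gt (EReal.coe_lt_top _))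

variable {n : ℕ} {Ω : Set (Cn n)} {w : Cn n × ℂ → EReal}

/-- The supremum of `w (z, ·)` over the circle of radius `e ^ x`. -/
def circSup (w : Cn n × ℂ → EReal) (z : Cn n) (x : ℝ) : EReal :=
  ⨆ θ : Circle, w (z, ((Real.exp x : ℝ) : ℂ) * θ)

lemma norm_exp_mul_circle (x : ℝ) (θ : Circle) : ‖((Real.exp x : ℝ) : ℂ) * θ‖ = Real.exp x := by
  rw [norm_mul, Circle.norm_coe, mul_one, Complex.norm_real, Real.norm_of_nonneg (Real.exp_pos x).le]

lemma exp_mul_circle_mem_annA {x : ℝ} (hx : x ∈ Set.Ioo (0 : ℝ) 1) (θ : Circle) :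
    ((Real.exp x : ℝ) : ℂ) * θ ∈ annA := by
  change 1 < ‖((Real.exp x : ℝ) : ℂ) * θ‖ ∧ ‖((Real.exp x : ℝ) : ℂ) * θ‖ < Real.exp 1
  rw [norm_exp_mul_circle]
  exact ⟨Real.one_lt_exp_iff.2 hx.1, Real.exp_lt_exp.2 hx.2⟩

lemma isOpen_annA : IsOpen annA :=
  (isOpen_lt continuous_const continuous_norm).inter (isOpen_lt continuous_norm continuous_const)

lemma circSup_nonpos (hw : PSHNeg w (Ω ×ˢ annA)) {z : Cn n} (hz : z ∈ Ω) {x : ℝ}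
    (hx : x ∈ Set.Ioo (0 : ℝ) 1) : circSup w z x ≤ 0 :=
  iSup_le fun θ => hw.2 _ ⟨hz, exp_mul_circle_mem_annA hx θ⟩

lemma circSup_lt_eventually (hΩ : IsOpen Ω) (hw : PSHNeg w (Ω ×ˢ annA)) {z : Cn n} (hz : z ∈ Ω)
    {x : ℝ} (hx : x ∈ Set.Ioo (0 : ℝ) 1) {c : EReal} (h : circSup w z x < c) :
    ∀ᶠ p : Cn n × ℝ in 𝓝 (z, x), circSup w p.1 p.2 < c := by
  obtain ⟨c', h1, h2⟩ := exists_between h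
  have key : ∀ᶠ p : Cn n × ℝ in 𝓝 (z, x), ∀ θ ∈ (Set.univ : Set Circle),
      w (p.1, ((Real.exp p.2 : ℝ) : ℂ) * θ) < c' := by
    refine isCompact_univ.eventually_forall_of_forall_eventually fun θ _ => ?_
    have hm : (z, ((Real.exp x : ℝ) : ℂ) * θ) ∈ Ω ×ˢ annA := ⟨hz, exp_mul_circle_mem_annA hx θ⟩
    have hev := (hΩ.prod isOpen_annA).nhdsWithin_eq hm ▸ hw.1.1 _ hm c'
      ((le_iSup (fun θ : Circle => w (z, ((Real.exp x : ℝ) : ℂ) * θ)) θ).trans_lt h1)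
    have hc : Continuous fun q : (Cn n × ℝ) × Circle =>
        (q.1.1, ((Real.exp q.1.2 : ℝ) : ℂ) * (q.2 : ℂ)) := by fun_prop
    exact (hc.tendsto ((z, x), θ)).eventually hev
  filter_upwards [key] with p hp
  exact (iSup_le fun θ => (hp θ trivial).le).trans_lt h2

lemma cexp_add_eq (q : ℂ) (y : ℝ) :
    Complex.exp (q + y * Complex.I) = ((Real.exp q.re : ℝ) : ℂ) * (Circle.exp (q.im + y) : ℂ) := by
  rw [Circle.coe_exp, Complex.ofReal_exp, ← Complex.exp_add]
  congr 1
  conv_lhs => rw [← Complex.re_add_im q]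
  push_cast
  ring

lemma circSup_le_re_poly (hΩ : IsOpen Ω) (hw : PSHNeg w (Ω ×ˢ annA)) {a b : Cn n} {r : ℝ}
    (hr : 0 < r) (hd : ∀ ζ : ℂ, ‖ζ‖ ≤ r → a + ζ • b ∈ Ω) (q p : Polynomial ℂ)
    (hq : ∀ ζ : ℂ, ‖ζ‖ ≤ r → (q.eval ζ).re ∈ Set.Ioo (0 : ℝ) 1)
    (h : ∀ ζ : ℂ, ‖ζ‖ = r → circSup w (a + ζ • b) (q.eval ζ).re ≤ ((p.eval ζ).re : EReal))
    {ζ : ℂ} (hζ : ‖ζ‖ ≤ r) : circSup w (a + ζ • b) (q.eval ζ).re ≤ ((p.eval ζ).re : EReal) := by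
  refine iSup_le fun θ => ?_
  set y : ℝ := Complex.arg θ - (q.eval ζ).im with hy
  have hg : ∀ ζ : ℂ, HasDerivAt (fun ζ => (a + ζ • b, Complex.exp (q.eval ζ + y * Complex.I)))
      (b, Complex.exp (q.eval ζ + y * Complex.I) * q.derivative.eval ζ) ζ := fun ζ => by
    refine HasDerivAt.prodMk ?_ ((q.hasDerivAt ζ).add_const _).cexp
    simpa using ((hasDerivAt_id ζ).smul_const b).const_add a
  have hg1 : ∀ ζ : ℂ, HasDerivAt
      (fun ζ => (b, Complex.exp (q.eval ζ + y * Complex.I) * q.derivative.eval ζ))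
      ((0 : Cn n), Complex.exp (q.eval ζ + y * Complex.I) * q.derivative.eval ζ *
        q.derivative.eval ζ +
        Complex.exp (q.eval ζ + y * Complex.I) * q.derivative.derivative.eval ζ) ζ := fun ζ =>
    (hasDerivAt_const ζ b).prodMk
      (((q.hasDerivAt ζ).add_const _).cexp.mul (q.derivative.hasDerivAt ζ))
  have key := PSHNeg.le_re_poly_of_curve (hΩ.prod isOpen_annA) hw hg hg1 hr
    (fun ζ hζ => ⟨hd ζ hζ, by
      simp only [cexp_add_eq]
      exact exp_mul_circle_mem_annA (hq ζ hζ) _⟩) p (fun ζ hζ => by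
      refine le_trans ?_ (h ζ hζ)
      simp only [cexp_add_eq]
      exact le_iSup (fun θ : Circle => w (a + ζ • b, ((Real.exp (q.eval ζ).re : ℝ) : ℂ) * θ)) _) hζ
  simp only [cexp_add_eq, hy, add_sub_cancel, Circle.exp_arg] at key
  exact key

/-- Convexity of `x ↦ sup_θ w (z, e ^ x θ)`. -/
lemma circSup_le_affine (hΩ : IsOpen Ω) (hw : PSHNeg w (Ω ×ˢ annA)) {z : Cn n} (hz : z ∈ Ω)
    {x1 x2 α β : ℝ} (hx1 : 0 < x1) (hx2 : x2 < 1)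
    (h1 : circSup w z x1 ≤ ((α * x1 + β : ℝ) : EReal))
    (h2 : circSup w z x2 ≤ ((α * x2 + β : ℝ) : EReal)) {s : ℝ} (hs : s ∈ Set.Icc x1 x2) :
    circSup w z s ≤ ((α * s + β : ℝ) : EReal) := by
  by_contra! hlt
  have hIcc : Set.Icc x1 x2 ⊆ Set.Ioo (0 : ℝ) 1 :=
    fun x hx => ⟨hx1.trans_le hx.1, hx.2.trans_lt hx2⟩
  have hreal : ∀ x ∈ Set.Icc x1 x2, circSup w z x ≠ ⊥ → ∃ f : ℝ, circSup w z x = f :=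
    fun x hx hb => ⟨_, (EReal.coe_toReal (ne_top_of_le_ne_top EReal.zero_ne_top
      (circSup_nonpos hw hz (hIcc hx))) hb).symm⟩
  obtain ⟨f, hf⟩ := hreal s hs (ne_bot_of_gt hlt)
  rw [hf, EReal.coe_lt_coe_iff] at hlt
  set η : ℝ := (f - (α * s + β)) / 2 with hη
  have hη0 : 0 < η := by rw [hη]; linarith
  set l : ℝ → ℝ := fun x => -(α * x + β) + η * x ^ 2 with hl
  have hlc : Continuous l := by fun_prop
  have husc : UpperSemicontinuousOn (fun x => circSup w z x + (l x : EReal)) (Set.Icc x1 x2) := by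
    intro x hx c hc
    obtain ⟨c', h1, h2⟩ := exists_between hc
    obtain ⟨r, rfl⟩ : ∃ r : ℝ, c' = r :=
      ⟨_, (EReal.coe_toReal (ne_top_of_lt h2) (ne_bot_of_gt h1)).symm⟩
    have hu : UpperSemicontinuousWithinAt (fun x => circSup w z x) (Set.Icc x1 x2) x := by
      intro c hc
      have := circSup_lt_eventually hΩ hw hz (hIcc hx) hc
      have ht : Tendsto (fun y : ℝ => (z, y)) (𝓝[Set.Icc x1 x2] x) (𝓝 (z, x)) :=
        (by fun_prop : Continuous fun y : ℝ => (z, y)).continuousWithinAt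
      exact ht.eventually this
    have := usc_lt_eventually hu (g := fun y => r - l y)
      (continuous_const.sub hlc).continuousWithinAt (ereal_add_coe_lt_iff.1 h1)
    filter_upwards [this] with y hy
    exact (ereal_add_coe_lt_iff.2 hy).trans h2
  obtain ⟨x, hx, hmax⟩ := husc.exists_isMaxOn ⟨s, hs⟩ isCompact_Icc
  have hxs := hmax hs
  simp only [Set.mem_ofPred_eq, hf] at hxs
  obtain ⟨g, hg⟩ := hreal x hx fun hb => by
    rw [hb, EReal.bot_add, le_bot_iff, ← EReal.coe_add] at hxs
    exact EReal.coe_ne_bot _ hxs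
  have hxs' : f + l s ≤ g + l x := by rw [hg] at hxs; exact_mod_cast hxs
  have hall : ∀ y ∈ Set.Icc x1 x2, circSup w z y ≤ ((g + l x - l y : ℝ) : EReal) := fun y hy => by
    have := hmax hy
    simp only [Set.mem_ofPred_eq, hg, ← EReal.coe_add] at this
    exact ereal_add_coe_le_iff.1 this
  have hend : ∀ y ∈ Set.Ioo (0 : ℝ) 1, circSup w z y ≤ ((α * y + β : ℝ) : EReal) → x ≠ y := by
    rintro y hy hle rfl
    rw [hg, EReal.coe_le_coe_iff] at hle
    have : x ^ 2 < 1 := by nlinarith [hy.1, hy.2]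
    simp only [hl] at hxs'
    nlinarith [sq_nonneg s]
  have hxl : x1 < x := lt_of_le_of_ne hx.1 (hend x1 (hIcc ⟨le_rfl, hx.1.trans hx.2⟩) h1).symm
  have hxr : x < x2 := lt_of_le_of_ne hx.2 (hend x2 (hIcc ⟨hx.1.trans hx.2, le_rfl⟩) h2)
  set ρ : ℝ := min (x - x1) (x2 - x) with hρ
  have hρ0 : 0 < ρ := lt_min (by linarith) (by linarith)
  have hρ1 : ρ ≤ x - x1 := min_le_left _ _
  have hρ2 : ρ ≤ x2 - x := min_le_right _ _
  have hin : ∀ ζ : ℂ, ‖ζ‖ ≤ 1 → x + ρ * ζ.re ∈ Set.Icc x1 x2 := fun ζ hζ => by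
    have := abs_le.1 ((Complex.abs_re_le_norm ζ).trans hζ)
    constructor <;> nlinarith [this.1, this.2]
  set q : Polynomial ℂ := Polynomial.C (x : ℂ) + Polynomial.C (ρ : ℂ) * Polynomial.X with hq
  have hqe : ∀ ζ : ℂ, (q.eval ζ).re = x + ρ * ζ.re := fun ζ => by simp [hq]
  set p : Polynomial ℂ := Polynomial.C ((g - η * ρ ^ 2 / 2 : ℝ) : ℂ) +
    Polynomial.C ((α * ρ - 2 * η * x * ρ : ℝ) : ℂ) * Polynomial.X -
    Polynomial.C ((η * ρ ^ 2 / 2 : ℝ) : ℂ) * Polynomial.X ^ 2 with hp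
  have hpe : ∀ ζ : ℂ, (p.eval ζ).re = g - η * ρ ^ 2 / 2 + (α * ρ - 2 * η * x * ρ) * ζ.re -
      η * ρ ^ 2 / 2 * (ζ.re ^ 2 - ζ.im ^ 2) := fun ζ => by
    simp only [hp, Polynomial.eval_sub, Polynomial.eval_add, Polynomial.eval_mul,
      Polynomial.eval_C, Polynomial.eval_X, Polynomial.eval_pow, Complex.sub_re, Complex.add_re,
      Complex.ofReal_re, Complex.ofReal_im, pow_two ζ, Complex.mul_re]
    ring
  have key := circSup_le_re_poly hΩ hw (a := z) (b := 0) one_pos (fun ζ _ => by simpa using hz)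
    q p (fun ζ hζ => by rw [hqe]; exact hIcc (hin ζ hζ)) (fun ζ hζ => by
      rw [hqe, hpe, smul_zero, add_zero]
      refine (hall _ (hin ζ hζ.le)).trans (EReal.coe_le_coe_iff.2 (le_of_eq ?_))
      have : ζ.re ^ 2 + ζ.im ^ 2 = 1 := by
        have := Complex.sq_norm ζ
        rw [hζ, Complex.normSq_apply] at this
        nlinarith
      have him : ζ.im ^ 2 = 1 - ζ.re ^ 2 := by linarith
      rw [him]
      simp only [hl]
      ring) (ζ := 0) (by simp)
  rw [hqe, hpe, smul_zero, add_zero, Complex.zero_re, Complex.zero_im, mul_zero, add_zero, hg,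
    EReal.coe_le_coe_iff] at key
  have : 0 < η * ρ ^ 2 := by positivity
  linarith

end CircSup

section Kiselev

variable {n : ℕ} {Ω : Set (Cn n)} {w : Cn n × ℂ → EReal}

/-- The partial Legendre transform of `w` in the variable `log |ζ|`. -/
def legendre (w : Cn n × ℂ → EReal) (C : ℝ) (z : Cn n) : EReal :=
  ⨅ x : Set.Ioo (0 : ℝ) 1, circSup w z x + ((C * x : ℝ) : EReal)

lemma legendre_le (w : Cn n × ℂ → EReal) (C : ℝ) (z : Cn n) {x : ℝ}
    (hx : x ∈ Set.Ioo (0 : ℝ) 1) : legendre w C z ≤ circSup w z x + ((C * x : ℝ) : EReal) :=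
  iInf_le (fun x : Set.Ioo (0 : ℝ) 1 => circSup w z x + ((C * x : ℝ) : EReal)) ⟨x, hx⟩

lemma exists_of_legendre_lt {C : ℝ} {z : Cn n} {c : EReal} (h : legendre w C z < c) :
    ∃ x ∈ Set.Ioo (0 : ℝ) 1, ∃ r : ℝ, (r : EReal) < c ∧
      circSup w z x < ((r - C * x : ℝ) : EReal) := by
  obtain ⟨r, h1, h2⟩ := EReal.lt_iff_exists_real_btwn.1 h
  obtain ⟨x, hx⟩ := iInf_lt_iff.1 h1
  exact ⟨x, x.2, r, h2, ereal_add_coe_lt_iff.1 hx⟩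

lemma legendre_usc (hΩ : IsOpen Ω) (hw : PSHNeg w (Ω ×ˢ annA)) (C : ℝ) :
    UpperSemicontinuousOn (legendre w C) Ω := by
  intro z hz c hc
  obtain ⟨x, hx, r, hr, hlt⟩ := exists_of_legendre_lt hc
  have hc : Tendsto (fun y : Cn n => (y, x)) (𝓝[Ω] z) (𝓝 (z, x)) :=
    (by fun_prop : Continuous fun y : Cn n => (y, x)).continuousWithinAt
  filter_upwards [hc.eventually (circSup_lt_eventually hΩ hw hz hx hlt)] with y hy
  exact ((legendre_le w C y hx).trans_lt (ereal_add_coe_lt_iff.2 hy)).trans hr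

lemma re_poly_mem_Ioo {r : ℝ} (hr : 0 < r) {q : Polynomial ℂ}
    (h : ∀ ζ : ℂ, ‖ζ‖ = r → (q.eval ζ).re ∈ Set.Ioo (0 : ℝ) 1) {ζ : ℂ} (hζ : ‖ζ‖ ≤ r) :
    (q.eval ζ).re ∈ Set.Ioo (0 : ℝ) 1 := by
  have hc : ContinuousOn (fun ζ : ℂ => (q.eval ζ).re) (Metric.sphere 0 r) :=
    (Complex.continuous_re.comp q.continuous).continuousOn
  have hne : (Metric.sphere (0 : ℂ) r).Nonempty := NormedSpace.sphere_nonempty.2 hr.le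
  obtain ⟨ζ1, h1, hmin⟩ := (isCompact_sphere (0 : ℂ) r).exists_isMinOn hne hc
  obtain ⟨ζ2, h2, hmax⟩ := (isCompact_sphere (0 : ℂ) r).exists_isMaxOn hne hc
  have hmem : ∀ ζ : ℂ, ‖ζ‖ = r → ζ ∈ Metric.sphere (0 : ℂ) r := fun ζ hζ => by simpa using hζ
  have k1 := (rpsh_iff.1 (rpsh_const ((q.eval ζ1).re) (Set.univ : Set ℂ))).2 0 0 r hr
    (fun _ _ => trivial) q (fun ζ hζ => hmin (hmem ζ hζ)) ζ hζ
  have k2 := (rpsh_iff.1 (rpsh_const (-(q.eval ζ2).re) (Set.univ : Set ℂ))).2 0 0 r hr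
    (fun _ _ => trivial) (-q) (fun ζ hζ => by
      have : (q.eval ζ).re ≤ (q.eval ζ2).re := hmax (hmem ζ hζ)
      simpa using this) ζ hζ
  simp only [Polynomial.eval_neg, Complex.neg_re, neg_le_neg_iff] at k2
  exact ⟨(h ζ1 (by simpa using h1)).1.trans_le k1, k2.trans_lt (h ζ2 (by simpa using h2)).2⟩

/-- Kiselev's minimum principle. -/
lemma plurisubharmonicOn_legendre (hΩ : IsOpen Ω) (hw : PSHNeg w (Ω ×ˢ annA)) (C : ℝ) :
    PlurisubharmonicOn (legendre w C) Ω := by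
  refine ⟨legendre_usc hΩ hw C, fun a b r hr hd p hp ζ₀ hζ₀ => ?_⟩
  refine ereal_le_coe_of_forall_add fun ε hε => ?_
  set S := Metric.sphere (0 : ℂ) r with hS
  have hSn : ∀ ζ : S, ‖(ζ : ℂ)‖ = r := fun ζ => by simpa using ζ.2
  have hcs : CompactSpace S := isCompact_iff_compactSpace.1 (isCompact_sphere 0 r)
  set t : S → Set ℝ := fun ζ => {x | x ∈ Set.Ioo (0 : ℝ) 1 ∧
    circSup w (a + (ζ : ℂ) • b) x ≤ ((-C * x + ((p.eval (ζ : ℂ)).re + ε / 2) : ℝ) : EReal)} with ht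
  have husc : ∀ ζ : S, ∀ x ∈ Set.Ioo (0 : ℝ) 1, ∀ (Y : Type) [TopologicalSpace Y] (y : Y)
      (f : Y → S) (g : Y → ℝ), Continuous f → Continuous g → f y = ζ → g y = x →
      UpperSemicontinuousWithinAt (fun y => circSup w (a + (f y : ℂ) • b) (g y)) Set.univ y := by
    rintro ζ x hx Y _ y f g hf hg rfl rfl c hc
    have hcont : Continuous fun y => (a + (f y : ℂ) • b, g y) := by fun_prop
    rw [nhdsWithin_univ]
    exact (hcont.tendsto y).eventually (circSup_lt_eventually hΩ hw (hd _ (hSn _).le) hx hc)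
  obtain ⟨x, hx⟩ := exists_continuous_forall_mem_convex_of_local_const (t := t) (fun ζ => by
      refine Set.OrdConnected.convex ⟨fun x1 h1 x2 h2 s hs => ⟨⟨h1.1.1.trans_le hs.1,
        hs.2.trans_lt h2.1.2⟩, ?_⟩⟩
      exact circSup_le_affine hΩ hw (hd _ (hSn ζ).le) h1.1.1 h2.1.2 h1.2 h2.2 hs) (fun ζ => by
    have h1 : legendre w C (a + (ζ : ℂ) • b) < (((p.eval (ζ : ℂ)).re + ε / 2 : ℝ) : EReal) :=
      (hp ζ (hSn ζ)).trans_lt (EReal.coe_lt_coe_iff.2 (by linarith))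
    obtain ⟨x, hx, s, hs, hlt⟩ := exists_of_legendre_lt h1
    have h2 := usc_lt_eventually (husc ζ x hx S ζ id (fun _ => x) continuous_id continuous_const
      rfl rfl) (g := fun ζ : S => -C * x + ((p.eval (ζ : ℂ)).re + ε / 2))
      (Continuous.continuousWithinAt (continuous_const.add ((Complex.continuous_re.comp
        (p.continuous.comp continuous_subtype_val)).add continuous_const))) (hlt.trans
        (EReal.coe_lt_coe_iff.2 (by linarith [EReal.coe_lt_coe_iff.1 hs])))
    rw [nhdsWithin_univ] at h2
    exact ⟨x, h2.mono fun ζ hζ => ⟨hx, hζ.le⟩⟩)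
  have hev : ∀ᶠ d : ℝ in 𝓝 0, ∀ ζ ∈ (Set.univ : Set S), (x ζ + d ∈ Set.Ioo (0 : ℝ) 1 ∧
      circSup w (a + (ζ : ℂ) • b) (x ζ + d) <
        (((p.eval (ζ : ℂ)).re + ε - C * (x ζ + d) : ℝ) : EReal)) := by
    refine isCompact_univ.eventually_forall_of_forall_eventually fun ζ _ => ?_
    have hc2 : Continuous fun q : ℝ × S => x q.2 + q.1 :=
      (x.continuous.comp continuous_snd).add continuous_fst
    have h0 : x ζ + 0 = x ζ := add_zero _
    have h1 := (hc2.tendsto (0, ζ)).eventually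
      (isOpen_Ioo.mem_nhds (by simpa using (hx ζ).1 : x ζ + 0 ∈ Set.Ioo (0 : ℝ) 1))
    have h2 := usc_lt_eventually (husc ζ (x ζ) (hx ζ).1 (ℝ × S) (0, ζ) Prod.snd
      (fun q => x q.2 + q.1) continuous_snd hc2 rfl h0)
      (g := fun q => (p.eval (q.2 : ℂ)).re + ε - C * (x q.2 + q.1))
      (Continuous.continuousWithinAt (((Complex.continuous_re.comp
        (p.continuous.comp (continuous_subtype_val.comp continuous_snd))).add continuous_const).sub
        (continuous_const.mul hc2))) (by
        simp only [h0]
        exact (hx ζ).2.trans_lt (EReal.coe_lt_coe_iff.2 (by linarith)))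
    rw [nhdsWithin_univ] at h2
    exact h1.and h2
  obtain ⟨δ, hδ, hball⟩ := Metric.eventually_nhds_iff.1 hev
  classical
  set g : ℂ → ℝ := fun ζ => if h : ζ ∈ S then x ⟨ζ, h⟩ else 0 with hg
  have hgc : ContinuousOn g S := by
    rw [continuousOn_iff_continuous_domRestrict]
    convert x.continuous using 1
    ext ζ
    simp [hg]
  obtain ⟨q, hq⟩ := exists_poly_re_approx hr hgc hδ
  have hq' : ∀ ζ : ℂ, ‖ζ‖ = r → (q.eval ζ).re ∈ Set.Ioo (0 : ℝ) 1 ∧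
      circSup w (a + ζ • b) (q.eval ζ).re <
        (((p.eval ζ).re + ε - C * (q.eval ζ).re : ℝ) : EReal) := fun ζ hζ => by
    have hζS : ζ ∈ S := by simpa [hS] using hζ
    have h1 := hq ζ hζ
    simp only [hg, hζS, dif_pos] at h1
    have h2 := hball (y := (q.eval ζ).re - x ⟨ζ, hζS⟩) (by
      rw [Real.dist_eq, sub_zero, abs_sub_comm]; exact h1) ⟨ζ, hζS⟩ trivial
    simpa only [add_sub_cancel] using h2
  have hdisc : ∀ ζ : ℂ, ‖ζ‖ ≤ r → (q.eval ζ).re ∈ Set.Ioo (0 : ℝ) 1 :=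
    fun ζ hζ => re_poly_mem_Ioo hr (fun ζ hζ => (hq' ζ hζ).1) hζ
  set P : Polynomial ℂ := p + Polynomial.C (ε : ℂ) - Polynomial.C (C : ℂ) * q with hP
  have hPe : ∀ ζ : ℂ, (P.eval ζ).re = (p.eval ζ).re + ε - C * (q.eval ζ).re := fun ζ => by
    simp [hP]
  have key := circSup_le_re_poly hΩ hw hr hd q P hdisc
    (fun ζ hζ => by rw [hPe]; exact (hq' ζ hζ).2.le) hζ₀
  rw [hPe] at key
  exact (legendre_le w C _ (hdisc ζ₀ hζ₀)).trans (ereal_add_coe_le_iff.2 key)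

end Kiselev

section UpperBound

variable {n : ℕ} {Ω : Set (Cn n)} {u0 u1 : Cn n → EReal} {w : Cn n × ℂ → EReal}

lemma circSup_le_of_limsup {z : Cn n} {s : ℝ} {c d : EReal}
    (h : limsup (fun ζ : ℂ => w (z, ζ))
      ((𝓝 (Real.exp s)).comap (fun ζ : ℂ => ‖ζ‖) ⊓ 𝓟 annA) ≤ d) (hc : d < c) :
    ∀ᶠ x in 𝓝 s, x ∈ Set.Ioo (0 : ℝ) 1 → circSup w z x ≤ c := by
  have h1 := eventually_lt_of_limsup_lt (h.trans_lt hc)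
  rw [eventually_inf_principal] at h1
  obtain ⟨V, hV, hVs⟩ := mem_comap.1 h1
  filter_upwards [Real.continuous_exp.continuousAt hV] with x hx hx01
  refine iSup_le fun θ => (hVs (a := ((Real.exp x : ℝ) : ℂ) * θ) ?_
    (exp_mul_circle_mem_annA hx01 θ)).le
  rw [Set.mem_preimage, norm_exp_mul_circle]
  exact hx

lemma legendre_le_of_limsup {z : Cn n} {s C : ℝ} (hs : s ∈ Set.Icc (0 : ℝ) 1) {d : EReal}
    (h : limsup (fun ζ : ℂ => w (z, ζ))
      ((𝓝 (Real.exp s)).comap (fun ζ : ℂ => ‖ζ‖) ⊓ 𝓟 annA) ≤ d) :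
    legendre w C z ≤ d + ((C * s : ℝ) : EReal) := by
  by_contra! hlt
  obtain ⟨r1, h1, h2⟩ := EReal.lt_iff_exists_real_btwn.1 hlt
  obtain ⟨r2, h3, h4⟩ := EReal.lt_iff_exists_real_btwn.1 h2
  have hr := EReal.coe_lt_coe_iff.1 h3
  have hev := circSup_le_of_limsup h (ereal_add_coe_lt_iff.1 h1)
  have hlim : ∀ᶠ x : ℝ in 𝓝 s, r1 - C * s + C * x < r2 := by
    have : Tendsto (fun x : ℝ => r1 - C * s + C * x) (𝓝 s) (𝓝 (r1 - C * s + C * s)) :=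
      (by fun_prop : Continuous fun x : ℝ => r1 - C * s + C * x).tendsto s
    exact this.eventually_lt_const (by linarith)
  have hcl : s ∈ closure (Set.Ioo (0 : ℝ) 1) := by rwa [closure_Ioo zero_ne_one]
  obtain ⟨x, ⟨hx1, hx2⟩, hx⟩ := mem_closure_iff_nhds.1 hcl _ (hev.and hlim)
  refine absurd ((legendre_le w C z hx).trans (add_le_add_left (hx1 hx) _)) (not_le_of_gt ?_)
  refine lt_trans ?_ h4
  exact_mod_cast hx2

lemma legendre_le_asympRooftop (hΩ : IsOpen Ω) (hw : w ∈ geodClass n Ω u0 u1) (C : ℝ) {z : Cn n}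
    (hz : z ∈ Ω) : legendre w C z ≤ asympRooftop u0 u1 Ω z := by
  refine (le_rooftop (plurisubharmonicOn_legendre hΩ hw.1 C) (fun z hz => ?_)
    (fun z hz => ?_) hz).trans (rooftop_le_asympRooftop u0 u1 C hz)
  · have := legendre_le_of_limsup (w := w) (z := z) (s := 0) (C := C) (by simp) (d := u0 z)
      (by rw [Real.exp_zero]; exact hw.2.1 z hz)
    simpa using this
  · have := legendre_le_of_limsup (w := w) (z := z) (s := 1) (C := C) (by simp) (d := u1 z)
      (hw.2.2 z hz)
    simpa using this

lemma exists_subgradient (hΩ : IsOpen Ω) (hw : PSHNeg w (Ω ×ˢ annA)) {z : Cn n} (hz : z ∈ Ω)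
    {s f : ℝ} (hs : s ∈ Set.Ioo (0 : ℝ) 1) (hf : circSup w z s = f) :
    ∃ m : ℝ, ∀ x ∈ Set.Ioo (0 : ℝ) 1, ∀ a : ℝ, circSup w z x ≤ a → f + m * (x - s) ≤ a := by
  obtain ⟨m, hm1, hm2⟩ := exists_between_of_forall_le
    (s := {m : ℝ | ∃ x ∈ Set.Ioo 0 s, ∃ a : ℝ, circSup w z x ≤ a ∧ m = (f - a) / (s - x)})
    (t := {m : ℝ | ∃ x ∈ Set.Ioo s 1, ∃ a : ℝ, circSup w z x ≤ a ∧ m = (a - f) / (x - s)})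
    ⟨_, s / 2, ⟨by linarith [hs.1], by linarith [hs.1]⟩, 0,
      circSup_nonpos hw hz ⟨by linarith [hs.1], by linarith [hs.1, hs.2]⟩, rfl⟩
    ⟨_, (s + 1) / 2, ⟨by linarith [hs.2], by linarith [hs.2]⟩, 0,
      circSup_nonpos hw hz ⟨by linarith [hs.1], by linarith [hs.1, hs.2]⟩, rfl⟩ (by
    rintro _ ⟨x, hx, a, ha, rfl⟩ _ ⟨y, hy, b, hb, rfl⟩
    have hxy : 0 < y - x := by linarith [hx.2, hy.1]
    set α := (b - a) / (y - x) with hα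
    have hαe : α * (y - x) = b - a := div_mul_cancel₀ _ hxy.ne'
    have key := circSup_le_affine hΩ hw hz (x1 := x) (x2 := y) (α := α) (β := a - α * x)
      hx.1 hy.2 (by simpa using ha) (by
        rw [show α * y + (a - α * x) = b by linarith]
        exact hb) (s := s) ⟨hx.2.le, hy.1.le⟩
    rw [hf, EReal.coe_le_coe_iff] at key
    calc (f - a) / (s - x) ≤ α := by
          rw [div_le_iff₀ (by linarith [hx.2])]
          nlinarith
      _ ≤ (b - f) / (y - s) := by
          rw [le_div_iff₀ (by linarith [hy.1])]
          nlinarith)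
  refine ⟨m, fun x hx a ha => ?_⟩
  rcases lt_trichotomy x s with h | rfl | h
  · have := hm1 ⟨x, ⟨hx.1, h⟩, a, ha, rfl⟩
    rw [div_le_iff₀ (by linarith)] at this
    linarith
  · rw [hf, EReal.coe_le_coe_iff] at ha
    linarith
  · have := hm2 ⟨x, ⟨h, hx.2⟩, a, ha, rfl⟩
    rw [le_div_iff₀ (by linarith)] at this
    linarith

lemma geodesic_le (hΩ : IsOpen Ω) {t : ℝ} (ht : t ∈ Set.Ioo (0 : ℝ) 1) {z : Cn n} (hz : z ∈ Ω)
    {c : ℝ} (hc0 : c ≤ 0) (hc : asympRooftop u0 u1 Ω z ≤ c) :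
    geodesic n Ω u0 u1 t z ≤ (((1 - t) * c : ℝ) : EReal) := by
  refine iSup₂_le fun w hw => ?_
  have hwc : w (z, ((Real.exp t : ℝ) : ℂ)) ≤ circSup w z t := by
    have := le_iSup (fun θ : Circle => w (z, ((Real.exp t : ℝ) : ℂ) * θ)) 1
    rw [Circle.coe_one, mul_one] at this
    exact this
  refine hwc.trans ?_
  rcases eq_or_ne (circSup w z t) ⊥ with hb | hb
  · rw [hb]; exact bot_le
  obtain ⟨f, hf⟩ : ∃ f : ℝ, circSup w z t = f :=
    ⟨_, (EReal.coe_toReal (ne_top_of_le_ne_top EReal.zero_ne_top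
      (circSup_nonpos hw.1 hz ht)) hb).symm⟩
  obtain ⟨m, hm⟩ := exists_subgradient hΩ hw.1 hz ht hf
  have h1 : ((f - m * t : ℝ) : EReal) ≤ legendre w (-m) z := by
    refine le_iInf fun x => ?_
    by_contra! hlt
    obtain ⟨r, hr1, hr2⟩ := EReal.lt_iff_exists_real_btwn.1 hlt
    have := hm x x.2 _ (ereal_add_coe_lt_iff.1 hr1).le
    have := EReal.coe_lt_coe_iff.1 hr2
    linarith
  have h2 : f - m * t ≤ c :=
    EReal.coe_le_coe_iff.1 (h1.trans ((legendre_le_asympRooftop hΩ hw (-m) hz).trans hc))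
  rw [hf, EReal.coe_le_coe_iff]
  rcases le_or_gt m 0 with hm0 | hm0
  · nlinarith [ht.1, ht.2]
  · have h3 : m * (1 - t) ≤ -f := by
      by_contra! h
      set e := (m * (1 - t) + f) / (2 * m) with he
      have he0 : 0 < e := by rw [he]; exact div_pos (by linarith) (by linarith)
      have hem : e * (2 * m) = m * (1 - t) + f := div_mul_cancel₀ _ (by linarith)
      have hd : 0 < min e ((1 - t) / 2) := lt_min he0 (by linarith [ht.2])
      have hd1 := min_le_left e ((1 - t) / 2)
      have hd2 := min_le_right e ((1 - t) / 2)
      have hx : 1 - min e ((1 - t) / 2) ∈ Set.Ioo (0 : ℝ) 1 :=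
        ⟨by linarith [ht.1, ht.2], by linarith⟩
      have := hm _ hx 0 (circSup_nonpos hw.1 hz hx)
      nlinarith
    nlinarith [ht.1, ht.2]

end UpperBound

section L1

variable {n : ℕ}

lemma exists_kern_lower : ∃ κ ρ : ℝ, 0 < κ ∧ 0 < ρ ∧
    ∀ y ∈ Metric.closedBall (0 : Cn n) ρ, κ ≤ kern (volume : Measure (Cn n)) y := by
  have h0 := kern_zero_pos (volume : Measure (Cn n))
  have hc := (kern_smooth (volume : Measure (Cn n))).continuous.continuousAt (x := 0)
  have := hc.eventually (lt_mem_nhds (half_lt_self h0))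
  obtain ⟨ρ, hρ, h⟩ := Metric.nhds_basis_closedBall.mem_iff.1 this
  exact ⟨_, ρ, half_pos h0, hρ, fun y hy => (h hy).le⟩

/-- Averages of nonnegative functions over balls are controlled by mollifications. -/
lemma setIntegral_le_moll {κ ρ : ℝ} (hκ : 0 < κ)
    (hk : ∀ y ∈ Metric.closedBall (0 : Cn n) ρ, κ ≤ kern (volume : Measure (Cn n)) y)
    {F : Cn n → ℝ} {M : ℝ} (hF : Measurable F) (hF0 : ∀ x, 0 ≤ F x) (hM : ∀ x, |F x| ≤ M)
    {δ : ℝ} (hδ : 0 < δ) (x : Cn n) :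
    ∫ w in Metric.closedBall x (ρ * δ), F w ≤
      δ ^ Module.finrank ℝ (Cn n) / κ * moll volume δ F x := by
  set G : Cn n → ℝ := (Metric.closedBall x (ρ * δ)).indicator F with hG
  have h1 : ∫ w in Metric.closedBall x (ρ * δ), F w = ∫ w, G w := by
    rw [hG, integral_indicator measurableSet_closedBall]
  have h2 : ∫ w, G w = ∫ w, G (x - w) := (integral_sub_left_eq_self G volume x).symm
  have h3 := Measure.integral_comp_smul (volume : Measure (Cn n)) (fun w => G (x - w)) δ
  rw [abs_of_nonneg (by positivity), smul_eq_mul, ← h2, ← h1] at h3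
  have h4 : ∫ y, G (x - δ • y) ≤ ∫ y, κ⁻¹ * (kern volume y * F (x - δ • y)) := by
    have hi := (moll_integrable volume hF hM δ x).const_mul κ⁻¹
    refine integral_mono_of_nonneg (Eventually.of_forall fun y => ?_) hi
      (Eventually.of_forall fun y => ?_)
    · exact Set.indicator_nonneg (fun _ _ => hF0 _) _
    · have hnn : 0 ≤ kern volume y * F (x - δ • y) := mul_nonneg (kern_nonneg _ y) (hF0 _)
      by_cases hy : x - δ • y ∈ Metric.closedBall x (ρ * δ)
      · simp only [hG, Set.indicator_of_mem hy]
        have hy' : y ∈ Metric.closedBall (0 : Cn n) ρ := by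
          simp only [Metric.mem_closedBall, dist_eq_norm, sub_sub_cancel_left, norm_neg, norm_smul,
            Real.norm_eq_abs, abs_of_pos hδ, sub_zero] at hy ⊢
          nlinarith
        have := mul_le_mul_of_nonneg_right (hk y hy') (hF0 (x - δ • y))
        rw [inv_mul_eq_div, le_div_iff₀ hκ]
        linarith
      · simp only [hG, Set.indicator_of_notMem hy]
        positivity
  rw [integral_const_mul, h3] at h4
  have hd : 0 < δ ^ Module.finrank ℝ (Cn n) := by positivity
  change _ ≤ κ⁻¹ * moll volume δ F x at h4
  rw [inv_mul_eq_div, div_le_iff₀ hd] at h4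
  calc _ ≤ _ := h4
    _ = _ := by ring

variable {Ω : Set (Cn n)} {u v : Cn n → EReal}

/-- The pointwise size `-u`, extended by zero outside `Ω`, as a monotone limit. -/
def negSize (Ω : Set (Cn n)) (u : Cn n → EReal) (z : Cn n) : ℝ≥0∞ :=
  ⨆ N : ℕ, ENNReal.ofReal (-(Ω.indicator (trunc N u) z))

lemma PSHNeg.measurable_indicator_trunc (hΩ : IsOpen Ω) (hu : PSHNeg u Ω) (N : ℝ) :
    Measurable (Ω.indicator (trunc N u)) :=
  measurable_indicator_usc hΩ (hu.rpsh_trunc N).usc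

lemma PSHNeg.abs_indicator_trunc_le (hu : PSHNeg u Ω) {N : ℝ} (hN : 0 ≤ N) (z : Cn n) :
    |Ω.indicator (trunc N u) z| ≤ N := by
  by_cases hz : z ∈ Ω
  · rw [Set.indicator_of_mem hz]; exact abs_trunc_le (hu.2 z hz) hN
  · rw [Set.indicator_of_notMem hz]; simpa using hN

lemma PSHNeg.indicator_trunc_nonpos (hu : PSHNeg u Ω) (N : ℕ) (z : Cn n) :
    Ω.indicator (trunc N u) z ≤ 0 := by
  by_cases hz : z ∈ Ω
  · rw [Set.indicator_of_mem hz]; exact trunc_le_zero (hu.2 z hz) (by positivity)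
  · rw [Set.indicator_of_notMem hz]

lemma measurable_negSize (hΩ : IsOpen Ω) (hu : PSHNeg u Ω) : Measurable (negSize Ω u) :=
  .iSup fun N => (hu.measurable_indicator_trunc hΩ N).neg.ennreal_ofReal

lemma negSize_eq_top {z : Cn n} (hz : z ∈ Ω) (h : u z = ⊥) : negSize Ω u z = ⊤ := by
  refine ENNReal.eq_top_of_forall_nnreal_le fun r => ?_
  obtain ⟨N, hN⟩ := exists_nat_ge (r : ℝ)
  refine le_trans ?_ (le_iSup _ N)
  rw [Set.indicator_of_mem hz]
  have : trunc N u z = -N := by simp [trunc, h, ← EReal.coe_coe_eq_natCast, ← EReal.coe_neg]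
  rw [this, neg_neg]
  rw [← ENNReal.ofReal_coe_nnreal]
  exact ENNReal.ofReal_le_ofReal hN

lemma ofReal_abs_toReal_le_negSize (hu : PSHNeg u Ω) {z : Cn n} (hz : z ∈ Ω) :
    ENNReal.ofReal |(u z).toReal| ≤ negSize Ω u z := by
  by_cases h : u z = ⊥
  · simp [h]
  obtain ⟨N, hN⟩ := exists_nat_ge (-(u z).toReal)
  refine le_trans ?_ (le_iSup _ N)
  rw [Set.indicator_of_mem hz, trunc_eq_bot_or (hu.2 z hz) h N, max_eq_left (by linarith)]
  refine ENNReal.ofReal_le_ofReal (abs_of_nonpos ?_).le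
  have := EReal.toReal_le_toReal (hu.2 z hz) h EReal.zero_ne_top
  simpa using this

lemma negSize_setLIntegral_lt_top (hΩ : IsOpen Ω) (hu : PSHNeg u Ω) {κ ρ : ℝ} (hκ : 0 < κ)
    (hk : ∀ y ∈ Metric.closedBall (0 : Cn n) ρ, κ ≤ kern (volume : Measure (Cn n)) y)
    {δ : ℝ} (hδ : 0 < δ) {y : Cn n} (hy : y ∈ shrink Ω δ) (huy : u y ≠ ⊥) :
    ∫⁻ w in Metric.closedBall y (ρ * δ), negSize Ω u w < ⊤ := by
  have hyΩ := shrink_subset hδ.le hy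
  set d := δ ^ Module.finrank ℝ (Cn n) / κ
  have hd : 0 ≤ d := by positivity
  have hm : Monotone fun (N : ℕ) w => ENNReal.ofReal (-(Ω.indicator (trunc N u) w)) := by
    intro N N' h w
    by_cases hw : w ∈ Ω
    · simp only [Set.indicator_of_mem hw]
      exact ENNReal.ofReal_le_ofReal
        (neg_le_neg (trunc_anti (hu.2 w hw) (by exact_mod_cast h)))
    · simp [Set.indicator_of_notMem hw]
  unfold negSize
  rw [lintegral_iSup (f := fun (N : ℕ) w => ENNReal.ofReal (-(Ω.indicator (trunc N u) w)))
    (fun N => (hu.measurable_indicator_trunc hΩ N).neg.ennreal_ofReal) hm]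
  refine lt_of_le_of_lt (iSup_le fun N => ?_)
    (ENNReal.ofReal_lt_top (r := d * -(u y).toReal))
  have hNM := hu.abs_indicator_trunc_le (N := N) (by positivity)
  have hmeas := hu.measurable_indicator_trunc hΩ N
  have h0 : ∀ x, 0 ≤ -(Ω.indicator (trunc N u) x) := fun x =>
    neg_nonneg.2 (hu.indicator_trunc_nonpos N x)
  have hM' : ∀ x, |-(Ω.indicator (trunc N u) x)| ≤ N := fun x => by rw [abs_neg]; exact hNM x
  have hB := setIntegral_le_moll hκ hk hmeas.neg h0 hM' hδ y
  have hmn : moll volume δ (-(Ω.indicator (trunc N u))) y =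
      -moll volume δ (Ω.indicator (trunc N u)) y := by
    simp only [moll, Pi.neg_apply, mul_neg, integral_neg]
  have hP : RPsh (Ω.indicator (trunc N u)) Ω :=
    (hu.rpsh_trunc N).congr fun z hz => (Set.indicator_of_mem hz _).symm
  have hle := le_moll volume hmeas hNM hP hδ hy
  rw [Set.indicator_of_mem hyΩ, trunc_eq_bot_or (hu.2 y hyΩ) huy N] at hle
  have hle2 : (u y).toReal ≤ _ := (le_max_left _ _).trans hle
  rw [← ofReal_integral_eq_lintegral_ofReal _ (Eventually.of_forall h0)]
  · refine ENNReal.ofReal_le_ofReal (hB.trans ?_)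
    rw [hmn]
    exact mul_le_mul_of_nonneg_left (neg_le_neg hle2) hd
  · refine Measure.integrableOn_of_bounded (M := N)
      (measure_closedBall_lt_top).ne hmeas.neg.aestronglyMeasurable
      (Eventually.of_forall fun x => hM' x)

lemma exists_ball_negSize (hΩ : IsOpen Ω) (hc : IsPreconnected Ω) (hu : PSHNeg u Ω)
    (hne : ∃ z ∈ Ω, u z ≠ ⊥) {x : Cn n} (hx : x ∈ Ω) :
    ∃ r, 0 < r ∧ ∫⁻ w in Metric.ball x r, negSize Ω u w < ⊤ := by
  obtain ⟨κ, ρ, hκ, hρ, hk⟩ := exists_kern_lower (n := n)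
  set P := {z | z ∈ Ω ∧ u z ≠ ⊥} with hPdef
  have key : ∀ x ∈ Ω, x ∈ closure P → ∃ r, 0 < r ∧ Metric.ball x r ⊆ Ω ∧
      ∫⁻ w in Metric.ball x r, negSize Ω u w < ⊤ := by
    intro x hx hxP
    obtain ⟨δ, hδ, hxs⟩ := exists_mem_shrink hΩ hx
    have hr : 0 < min (ρ * (δ / 2) / 2) (δ / 2) := by positivity
    obtain ⟨y, hyP, hxy⟩ := Metric.mem_closure_iff.1 hxP _ hr
    have h1 := hxy.trans_le (min_le_left _ _)
    have h2 := hxy.trans_le (min_le_right _ _)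
    have hys : y ∈ shrink Ω (δ / 2) := by
      refine Set.Subset.trans (Metric.closedBall_subset_closedBall' ?_) hxs
      rw [dist_comm]; linarith
    have := negSize_setLIntegral_lt_top hΩ hu hκ hk (half_pos hδ) hys hyP.2
    refine ⟨_, hr, ?_, (lintegral_mono_set ?_).trans_lt this⟩
    · exact ((Metric.ball_subset_ball (min_le_right _ _)).trans
        (Metric.ball_subset_closedBall.trans
          (Metric.closedBall_subset_closedBall (by linarith)))).trans hxs
    · refine Metric.ball_subset_closedBall.trans (Metric.closedBall_subset_closedBall' ?_)
      have := min_le_left (ρ * (δ / 2) / 2) (δ / 2)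
      linarith
  have hopen : IsOpen (Ω ∩ closure P) := by
    rw [Metric.isOpen_iff]
    rintro x ⟨hx, hxP⟩
    obtain ⟨r, hr, hrΩ, hInt⟩ := key x hx hxP
    refine ⟨r, hr, fun w hw => ⟨hrΩ hw, ?_⟩⟩
    have hae := ae_lt_top (measurable_negSize hΩ hu) hInt.ne
    rw [ae_restrict_iff' measurableSet_ball] at hae
    rw [mem_closure_iff_nhds]
    intro t ht
    obtain ⟨s, hst, hs, hws⟩ := mem_nhds_iff.1 ht
    by_contra hemp
    have hpos := (hs.inter Metric.isOpen_ball).measure_pos (volume : Measure (Cn n)) ⟨w, hws, hw⟩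
    refine hpos.ne' (measure_mono_null (fun q hq => ?_) hae)
    intro hlt
    refine hemp ⟨q, hst hq.1, hrΩ hq.2, fun hbot => ?_⟩
    exact (hlt hq.2).ne (negSize_eq_top (hrΩ hq.2) hbot)
  have hsub : Ω ⊆ Ω ∩ closure P := by
    refine hc.subset_of_closure_inter_subset hopen ?_ ?_
    · obtain ⟨z, hz, hzu⟩ := hne
      exact ⟨z, hz, hz, subset_closure ⟨hz, hzu⟩⟩
    · rintro z ⟨hz, hzΩ⟩
      exact ⟨hzΩ, closure_minimal Set.inter_subset_right isClosed_closure hz⟩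
  obtain ⟨r, hr, -, h⟩ := key x hx (hsub hx).2
  exact ⟨r, hr, h⟩

/-- A negative psh function which is not identically `-∞` is finite almost everywhere. -/
lemma PSHNeg.ae_ne_bot (hΩ : IsOpen Ω) (hc : IsPreconnected Ω) (hu : PSHNeg u Ω)
    (hne : ∃ z ∈ Ω, u z ≠ ⊥) : ∀ᵐ z, z ∈ Ω → u z ≠ ⊥ := by
  refine measure_null_of_locally_null _ fun x hx => ?_
  have hx' : x ∈ Ω := by by_contra h; exact hx fun h' => absurd h' h
  obtain ⟨r, hr, hInt⟩ := exists_ball_negSize hΩ hc hu hne hx'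
  have hae := ae_lt_top (measurable_negSize hΩ hu) hInt.ne
  rw [ae_restrict_iff' measurableSet_ball] at hae
  refine ⟨_, inter_mem_nhdsWithin _ (Metric.ball_mem_nhds x hr), measure_mono_null ?_ hae⟩
  rintro q ⟨hq, hqr⟩ hlt
  refine hq fun hqΩ hbot => (hlt hqr).ne (negSize_eq_top hqΩ hbot)

/-- A negative psh function which is not identically `-∞` is locally integrable. -/
lemma PSHNeg.lintegral_toReal_ne_top (hΩ : IsOpen Ω) (hc : IsPreconnected Ω) (hu : PSHNeg u Ω)
    (hne : ∃ z ∈ Ω, u z ≠ ⊥) {K : Set (Cn n)} (hK : IsCompact K) (hKΩ : K ⊆ Ω) :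
    ∫⁻ z in K, ENNReal.ofReal |(u z).toReal| ≠ ⊤ := by
  have h1 : ∫⁻ z in K, negSize Ω u z < ⊤ := by
    refine hK.induction_on (p := fun S => ∫⁻ z in S, negSize Ω u z < ⊤) (by simp)
      (fun S T hST h => (lintegral_mono_set hST).trans_lt h)
      (fun S T hS hT => (lintegral_union_le _ S T).trans_lt (ENNReal.add_lt_top.2 ⟨hS, hT⟩))
      fun x hx => ?_
    obtain ⟨r, hr, hInt⟩ := exists_ball_negSize hΩ hc hu hne (hKΩ hx)
    exact ⟨_, mem_nhdsWithin_of_mem_nhds (Metric.ball_mem_nhds x hr), hInt⟩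
  refine ((setLIntegral_mono' hK.measurableSet fun z hz => ?_).trans_lt h1).ne
  exact ofReal_abs_toReal_le_negSize hu (hKΩ hz)

lemma PSHNeg.rpsh_indicator_trunc (hu : PSHNeg u Ω) (N : ℝ) :
    RPsh (Ω.indicator (trunc N u)) Ω :=
  (hu.rpsh_trunc N).congr fun z hz => (Set.indicator_of_mem hz _).symm

/-- Almost everywhere inequalities between negative psh functions hold everywhere. -/
lemma PSHNeg.le_of_ae_le (hΩ : IsOpen Ω) (hu : PSHNeg u Ω) (hv : PSHNeg v Ω)
    (h : ∀ᵐ z, z ∈ Ω → u z ≤ v z) : ∀ z ∈ Ω, u z ≤ v z := by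
  intro z hz
  rw [← iInf_trunc (hu.2 z hz), ← iInf_trunc (hv.2 z hz)]
  refine iInf_mono fun N => EReal.coe_le_coe_iff.2 ?_
  have hN : (0 : ℝ) ≤ N := by positivity
  have h1 := moll_tendsto volume (hu.measurable_indicator_trunc hΩ N)
    (hu.abs_indicator_trunc_le hN) (hu.rpsh_indicator_trunc N) hΩ hz
  have h2 := moll_tendsto volume (hv.measurable_indicator_trunc hΩ N)
    (hv.abs_indicator_trunc_le hN) (hv.rpsh_indicator_trunc N) hΩ hz
  rw [Set.indicator_of_mem hz] at h1 h2
  refine le_of_tendsto_of_tendsto h1 h2 ?_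
  filter_upwards [self_mem_nhdsWithin] with δ (hδ : 0 < δ)
  refine integral_mono_ae (moll_integrable volume (hu.measurable_indicator_trunc hΩ N)
    (hu.abs_indicator_trunc_le hN) δ z) (moll_integrable volume
    (hv.measurable_indicator_trunc hΩ N) (hv.abs_indicator_trunc_le hN) δ z) ?_
  have hq : Measure.QuasiMeasurePreserving (fun y : Cn n => z - δ • y) volume volume := by
    have h1 : Measure.QuasiMeasurePreserving (fun y : Cn n => δ • y) volume volume :=
      ⟨by fun_prop, Measure.AbsolutelyContinuous.mk fun s hs h0 => by
        rw [Measure.map_apply (by fun_prop) hs, Measure.addHaar_preimage_smul _ hδ.ne', h0,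
          mul_zero]⟩
    exact (quasiMeasurePreserving_sub_left_of_right_invariant volume z).comp h1
  filter_upwards [hq.ae h] with y hy
  refine mul_le_mul_of_nonneg_left ?_ (kern_nonneg _ y)
  by_cases hw : z - δ • y ∈ Ω
  · simp only [Set.indicator_of_mem hw]
    exact trunc_mono (hy hw) (hv.2 _ hw) _
  · simp only [Set.indicator_of_notMem hw]; exact le_rfl

end L1

section IncreasingLimit

variable {n : ℕ} {Ω : Set (Cn n)}

/-- The Brelot–Cartan type fact that the usc regularization of an increasing sequence of negative
psh functions changes it only on a null set. -/
lemma ae_tendsto_trunc_uscReg (hΩ : IsOpen Ω) {v : ℕ → Cn n → EReal} (hv : ∀ j, PSHNeg (v j) Ω)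
    (hmono : ∀ z ∈ Ω, Monotone fun j => v j z)
    (hg : PSHNeg (uscReg (fun z => ⨆ j, v j z) Ω) Ω) (N : ℕ) :
    ∀ᵐ z, z ∈ Ω → Tendsto (fun j => trunc N (v j) z) atTop
      (𝓝 (trunc N (uscReg (fun z => ⨆ j, v j z) Ω) z)) := by
  set g := uscReg (fun z => ⨆ j, v j z) Ω with hgdef
  have hN : (0 : ℝ) ≤ N := by positivity
  set G := Ω.indicator (trunc N g) with hG
  set V : ℕ → Cn n → ℝ := fun j => Ω.indicator (trunc N (v j)) with hV
  have hVm : ∀ j, Measurable (V j) := fun j => (hv j).measurable_indicator_trunc hΩ N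
  have hVb : ∀ j z, |V j z| ≤ N := fun j => (hv j).abs_indicator_trunc_le hN
  have hGm : Measurable G := hg.measurable_indicator_trunc hΩ N
  have hGb : ∀ z, |G z| ≤ N := hg.abs_indicator_trunc_le hN
  have hbdd : ∀ z, BddAbove (Set.range fun j => V j z) := fun z =>
    ⟨N, by rintro _ ⟨j, rfl⟩; exact (le_abs_self _).trans (hVb j z)⟩
  set S : Cn n → ℝ := fun z => ⨆ j, V j z with hS
  have hSm : Measurable S := Measurable.iSup hVm
  have hVS : ∀ j z, V j z ≤ S z := fun j z => le_ciSup (hbdd z) j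
  have hSb : ∀ z, |S z| ≤ N := fun z => abs_le.2
    ⟨(abs_le.1 (hVb 0 z)).1.trans (hVS 0 z), ciSup_le fun j => (abs_le.1 (hVb j z)).2⟩
  have hVmono : ∀ z ∈ Ω, Monotone fun j => V j z := fun z hz i j hij => by
    simp only [hV, Set.indicator_of_mem hz]
    exact trunc_mono (hmono z hz hij) ((hv j).2 z hz) _
  have hvg : ∀ j, ∀ z ∈ Ω, v j z ≤ g z := fun j z hz =>
    (le_iSup (fun j => v j z) j).trans (le_uscReg (f := fun z => ⨆ j, v j z) hz)
  have hSG : ∀ z, S z ≤ G z := fun z => ciSup_le fun j => by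
    by_cases hz : z ∈ Ω
    · simp only [hV, hG, Set.indicator_of_mem hz]
      exact trunc_mono (hvg j z hz) (hg.2 z hz) _
    · simp only [hV, hG, Set.indicator_of_notMem hz]; exact le_rfl
  -- the regularization is dominated by mollifications of the supremum
  have hGS : ∀ δ, 0 < δ → ∀ z ∈ shrink Ω (2 * δ), G z ≤ moll volume δ S z := by
    intro δ hδ z hz
    have hzΩ := shrink_subset (by positivity) hz
    have hlow : -(N : ℝ) ≤ moll volume δ S z := (abs_le.1 (abs_moll_le volume hSm hSb δ z)).1
    have hnear : ∀ w ∈ Metric.ball z δ, (⨆ j, v j w) ≤ ((moll volume δ S w : ℝ) : EReal) := by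
      intro w hw
      have hws : w ∈ shrink Ω δ := by
        refine Set.Subset.trans (Metric.closedBall_subset_closedBall' ?_) hz
        have := (Metric.mem_ball.1 hw).le
        linarith
      have hwΩ := shrink_subset hδ.le hws
      refine iSup_le fun j => ?_
      have h1 := le_moll volume (hVm j) (hVb j) ((hv j).rpsh_indicator_trunc N) hδ hws
      have h2 := moll_mono_fun volume (hVm j) (hVb j) hSm hSb (hVS j) δ w
      have h3 : v j w ≤ (trunc N (v j) w : EReal) := by
        rw [coe_trunc ((hv j).2 w hwΩ)]; exact le_max_left _ _
      simp only [hV, Set.indicator_of_mem hwΩ] at h1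
      exact h3.trans (EReal.coe_le_coe_iff.2 (h1.trans h2))
    have hg1 : g z ≤ ((moll volume δ S z : ℝ) : EReal) := by
      have hcont : Tendsto (fun w => ((moll volume δ S w : ℝ) : EReal)) (𝓝[Ω] z)
          (𝓝 ((moll volume δ S z : ℝ) : EReal)) :=
        (continuous_coe_real_ereal.comp
          (moll_contDiff volume hSm hSb hδ).continuous).continuousAt.tendsto.mono_left
            nhdsWithin_le_nhds
      have : (𝓝[Ω] z).NeBot := mem_closure_iff_nhdsWithin_neBot.1 (subset_closure hzΩ)
      rw [← hcont.limsup_eq]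
      refine limsup_le_limsup ?_
      filter_upwards [mem_nhdsWithin_of_mem_nhds (Metric.ball_mem_nhds z hδ)] with w hw
      exact hnear w hw
    rw [hG, Set.indicator_of_mem hzΩ, ← EReal.coe_le_coe_iff, coe_trunc (hg.2 z hzΩ)]
    exact max_le hg1 (EReal.coe_le_coe_iff.2 hlow)
  obtain ⟨κ, ρ, hκ, hρ, hk⟩ := exists_kern_lower (n := n)
  set T : Cn n → ℝ := fun z => G z - S z with hT
  have hTm : Measurable T := hGm.sub hSm
  have hT0 : ∀ z, 0 ≤ T z := fun z => sub_nonneg.2 (hSG z)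
  have hTb : ∀ z, |T z| ≤ 2 * N := fun z => by
    have h1 := abs_le.1 (hGb z)
    have h2 := abs_le.1 (hSb z)
    exact abs_le.2 ⟨by simp only [hT]; linarith, by simp only [hT]; linarith⟩
  have hTloc : LocallyIntegrable T (volume : Measure (Cn n)) := by
    intro z
    refine ⟨Metric.closedBall z 1, Metric.closedBall_mem_nhds z one_pos, ?_⟩
    exact Measure.integrableOn_of_bounded (M := 2 * N) measure_closedBall_lt_top.ne
      hTm.aestronglyMeasurable (Eventually.of_forall hTb)
  have hmT : ∀ δ z, moll volume δ T z = moll volume δ G z - moll volume δ S z := fun δ z => by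
    simp only [moll, hT, mul_sub]
    exact integral_sub (moll_integrable volume hGm hGb δ z) (moll_integrable volume hSm hSb δ z)
  have hmT0 : ∀ z ∈ Ω, Tendsto (fun δ => moll volume δ T z) (𝓝[>] 0) (𝓝 0) := by
    intro z hz
    obtain ⟨δ0, hδ0, hzs⟩ := exists_mem_shrink hΩ hz
    have h1 := (moll_tendsto volume hGm hGb (hg.rpsh_indicator_trunc N) hΩ hz).sub_const (G z)
    rw [sub_self] at h1
    refine tendsto_of_tendsto_of_tendsto_of_le_of_le' tendsto_const_nhds h1
      (Eventually.of_forall fun δ => integral_nonneg fun y =>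
        mul_nonneg (kern_nonneg _ y) (hT0 _)) ?_
    filter_upwards [Ioo_mem_nhdsGT (half_pos hδ0)] with δ hδ
    have := hGS δ hδ.1 z (shrink_anti (by linarith [hδ.2]) hzs)
    rw [hmT]; linarith
  have hleb := IsUnifLocDoublingMeasure.ae_tendsto_average (volume : Measure (Cn n)) hTloc 1
  filter_upwards [hleb] with z hleb hz
  have hav := hleb (l := 𝓝[>] (0 : ℝ)) (fun _ => z) (fun δ => ρ * δ)
    (by
      rw [tendsto_nhdsWithin_iff]
      refine ⟨?_, ?_⟩
      · have : Tendsto (fun δ : ℝ => ρ * δ) (𝓝 0) (𝓝 (ρ * 0)) := by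
          exact (continuous_const.mul continuous_id).tendsto 0
        rw [mul_zero] at this
        exact this.mono_left nhdsWithin_le_nhds
      · filter_upwards [self_mem_nhdsWithin] with δ (hδ : 0 < δ)
        exact mul_pos hρ hδ)
    (by
      filter_upwards [self_mem_nhdsWithin] with δ (hδ : 0 < δ)
      exact Metric.mem_closedBall_self (by positivity))
  set d := Module.finrank ℝ (Cn n)
  set β := (volume : Measure (Cn n)).real (Metric.ball 0 1)
  have hβ : 0 < β := by
    refine ENNReal.toReal_pos (Metric.measure_ball_pos _ _ one_pos).ne' measure_ball_lt_top.ne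
  have hav0 : Tendsto (fun δ => ⨍ y in Metric.closedBall z (ρ * δ), T y) (𝓝[>] 0) (𝓝 0) := by
    have h1 := (hmT0 z hz).const_mul ((ρ ^ d * β * κ)⁻¹)
    rw [mul_zero] at h1
    refine tendsto_of_tendsto_of_tendsto_of_le_of_le' tendsto_const_nhds h1
      (Eventually.of_forall fun δ => ?_) ?_
    · rw [setAverage_eq, smul_eq_mul]
      exact mul_nonneg (by positivity) (integral_nonneg hT0)
    · filter_upwards [self_mem_nhdsWithin] with δ (hδ : 0 < δ)
      rw [setAverage_eq, smul_eq_mul]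
      have hvol : (volume : Measure (Cn n)).real (Metric.closedBall z (ρ * δ)) =
          (ρ * δ) ^ d * β := by
        rw [measureReal_def, Measure.addHaar_closedBall _ _ (by positivity), ENNReal.toReal_mul,
          ENNReal.toReal_ofReal (by positivity)]
        rfl
      rw [hvol]
      have hB := setIntegral_le_moll hκ hk hTm hT0 hTb hδ z
      refine (mul_le_mul_of_nonneg_left hB (by positivity)).trans_eq ?_
      rw [mul_pow]
      field_simp
      rfl
  have hT0' : T z = 0 := tendsto_nhds_unique hav hav0
  have hGz : trunc N g z = S z := by
    have : G z = S z := sub_eq_zero.1 hT0'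
    rwa [hG, Set.indicator_of_mem hz] at this
  rw [hGz]
  have := tendsto_atTop_ciSup (hVmono z hz) (hbdd z)
  simpa only [hV, Set.indicator_of_mem hz, hS] using this

end IncreasingLimit

section RooftopSequence

variable {n : ℕ} {Ω : Set (Cn n)} {u0 u1 : Cn n → EReal}

/-- The increasing sequence of rooftop envelopes defining the asymptotic rooftop. -/
def rooftopSeq (u0 u1 : Cn n → EReal) (Ω : Set (Cn n)) (j : ℕ) : Cn n → EReal :=
  Rooftop u0 (fun x => u1 x + ((j : ℝ) : EReal)) Ω

lemma pshNeg_rooftopSeq (hΩ : IsOpen Ω) (h0 : PSHNeg u0 Ω) (h1 : PSHNeg u1 Ω) (j : ℕ) :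
    PSHNeg (rooftopSeq u0 u1 Ω j) Ω :=
  ⟨PlurisubharmonicOn.rooftop hΩ _ _, fun z hz =>
    (rooftop_le_left h0.1 (PlurisubharmonicOn.add_const h1.1 (j : ℝ)) hz).trans (h0.2 z hz)⟩

lemma rooftopSeq_mono (hΩ : IsOpen Ω) (h0 : PSHNeg u0 Ω) (h1 : PSHNeg u1 Ω) {z : Cn n}
    (hz : z ∈ Ω) : Monotone fun j => rooftopSeq u0 u1 Ω j z := fun i j hij =>
  rooftop_mono_const hΩ h0.1 h1.1 (by exact_mod_cast hij) hz

lemma pshNeg_asympRooftop (hΩ : IsOpen Ω) (h0 : PSHNeg u0 Ω) (h1 : PSHNeg u1 Ω) :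
    PSHNeg (asympRooftop u0 u1 Ω) Ω :=
  ⟨PlurisubharmonicOn.asympRooftop hΩ _ _, fun z hz =>
    (asympRooftop_le h0.1 h1.1 hz).trans (h0.2 z hz)⟩

lemma asympRooftop_eq_uscReg (hΩ : IsOpen Ω) (h0 : PSHNeg u0 Ω) (h1 : PSHNeg u1 Ω) :
    asympRooftop u0 u1 Ω = uscReg (fun z => ⨆ j, rooftopSeq u0 u1 Ω j z) Ω := by
  funext z
  refine limsup_congr ?_
  filter_upwards [self_mem_nhdsWithin] with w hw
  refine le_antisymm (iSup_le fun C => ?_) (iSup_le fun j => ?_)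
  · obtain ⟨j, hj⟩ := exists_nat_ge C
    exact (rooftop_mono_const hΩ h0.1 h1.1 hj hw).trans
      (le_iSup (fun j => rooftopSeq u0 u1 Ω j w) j)
  · exact le_iSup (fun C : ℝ => Rooftop u0 (fun x => u1 x + (C : EReal)) Ω w) (j : ℝ)

lemma ae_tendsto_trunc_rooftopSeq (hΩ : IsOpen Ω) (h0 : PSHNeg u0 Ω) (h1 : PSHNeg u1 Ω) (N : ℕ) :
    ∀ᵐ z, z ∈ Ω → Tendsto (fun j => trunc N (rooftopSeq u0 u1 Ω j) z) atTop
      (𝓝 (trunc N (asympRooftop u0 u1 Ω) z)) := by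
  rw [asympRooftop_eq_uscReg hΩ h0 h1]
  refine ae_tendsto_trunc_uscReg hΩ (pshNeg_rooftopSeq hΩ h0 h1)
    (fun z hz => rooftopSeq_mono hΩ h0 h1 hz) ?_ N
  rw [← asympRooftop_eq_uscReg hΩ h0 h1]
  exact pshNeg_asympRooftop hΩ h0 h1

lemma exists_rooftopSeq_ne_bot (hΩ : IsOpen Ω) (h0 : PSHNeg u0 Ω) (h1 : PSHNeg u1 Ω)
    (hne : ∃ z ∈ Ω, asympRooftop u0 u1 Ω z ≠ ⊥) :
    ∃ j, ∃ z ∈ Ω, rooftopSeq u0 u1 Ω j z ≠ ⊥ := by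
  by_contra! h
  obtain ⟨z, hz, hzg⟩ := hne
  refine hzg (le_bot_iff.1 ?_)
  rw [asympRooftop_eq_uscReg hΩ h0 h1]
  exact uscReg_le (f := fun z => ⨆ j, rooftopSeq u0 u1 Ω j z) (h := fun _ => ⊥)
    (fun w hw => iSup_le fun j => (h j w hw).le) upperSemicontinuousOn_const hz

lemma rooftopSeq_le_asympRooftop {z : Cn n} (hz : z ∈ Ω) (j : ℕ) :
    rooftopSeq u0 u1 Ω j z ≤ asympRooftop u0 u1 Ω z :=
  rooftop_le_asympRooftop u0 u1 (j : ℝ) hz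

lemma ereal_ne_top_of_le_zero {e : EReal} (h : e ≤ 0) : e ≠ ⊤ :=
  ne_top_of_le_ne_top EReal.zero_ne_top h

/-- The basic two sided bound for the geodesic at points where the rooftops are finite. -/
lemma geodesic_toReal_bounds (hΩ : IsOpen Ω) (h0 : PSHNeg u0 Ω) (h1 : PSHNeg u1 Ω) {t : ℝ}
    (ht : t ∈ Set.Ioo (0 : ℝ) 1) {z : Cn n} (hz : z ∈ Ω) {j : ℕ}
    (hj : rooftopSeq u0 u1 Ω j z ≠ ⊥) :
    (rooftopSeq u0 u1 Ω j z).toReal - j * t ≤ (geodesic n Ω u0 u1 t z).toReal ∧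
    (geodesic n Ω u0 u1 t z).toReal ≤ (1 - t) * (asympRooftop u0 u1 Ω z).toReal ∧
    (rooftopSeq u0 u1 Ω j z).toReal ≤ (asympRooftop u0 u1 Ω z).toReal ∧
    (asympRooftop u0 u1 Ω z).toReal ≤ (u0 z).toReal ∧ (u0 z).toReal ≤ 0 := by
  have hg := pshNeg_asympRooftop hΩ h0 h1
  have hv := pshNeg_rooftopSeq hΩ h0 h1 j
  have hvg := rooftopSeq_le_asympRooftop (u0 := u0) (u1 := u1) hz j
  have hgu := asympRooftop_le h0.1 h1.1 hz
  have hgb : asympRooftop u0 u1 Ω z ≠ ⊥ := ne_bot_of_le_ne_bot hj hvg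
  have hub : u0 z ≠ ⊥ := ne_bot_of_le_ne_bot hgb hgu
  have hgt := ereal_ne_top_of_le_zero (hg.2 z hz)
  have hut := ereal_ne_top_of_le_zero (h0.2 z hz)
  have hvt := ereal_ne_top_of_le_zero (hv.2 z hz)
  have e1 : (rooftopSeq u0 u1 Ω j z).toReal ≤ (asympRooftop u0 u1 Ω z).toReal :=
    EReal.toReal_le_toReal hvg hj hgt
  have e2 : (asympRooftop u0 u1 Ω z).toReal ≤ (u0 z).toReal :=
    EReal.toReal_le_toReal hgu hgb hut
  have e3 : (u0 z).toReal ≤ 0 := by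
    simpa using EReal.toReal_le_toReal (h0.2 z hz) hub EReal.zero_ne_top
  have up := geodesic_le hΩ ht hz (e2.trans e3) (EReal.coe_toReal hgt hgb).ge
  have lo := rooftop_sub_le_geodesic hΩ h0 h1 (C := (j : ℝ)) (by positivity) (t := t) hz
  change rooftopSeq u0 u1 Ω j z + _ ≤ _ at lo
  rw [← EReal.coe_toReal hvt hj, ← EReal.coe_add] at lo
  have hbt : geodesic n Ω u0 u1 t z ≠ ⊤ := ne_top_of_le_ne_top (EReal.coe_ne_top _) up
  have hbb : geodesic n Ω u0 u1 t z ≠ ⊥ := ne_bot_of_le_ne_bot (EReal.coe_ne_bot _) lo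
  rw [← EReal.coe_toReal hbt hbb, EReal.coe_le_coe_iff] at up lo
  exact ⟨by linarith, up, e1, e2, e3⟩

lemma geodesic_eq_bot (hΩ : IsOpen Ω) {t : ℝ} (ht : t ∈ Set.Ioo (0 : ℝ) 1) {z : Cn n} (hz : z ∈ Ω)
    (hg : asympRooftop u0 u1 Ω z = ⊥) : geodesic n Ω u0 u1 t z = ⊥ := by
  rw [EReal.eq_bot_iff_forall_lt]
  intro y
  have h1t : 0 < 1 - t := by linarith [ht.2]
  have hc : min (y - 1) 0 / (1 - t) ≤ 0 :=
    div_nonpos_of_nonpos_of_nonneg (min_le_right _ _) h1t.le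
  refine (geodesic_le hΩ ht hz hc (by rw [hg]; exact bot_le)).trans_lt ?_
  rw [EReal.coe_lt_coe_iff, mul_div_cancel₀ _ h1t.ne']
  linarith [min_le_left (y - 1) 0]

/-- Negative psh functions finite almost everywhere are almost everywhere measurable. -/
lemma PSHNeg.aemeasurable_toReal {u : Cn n → EReal} (hΩ : IsOpen Ω) (hu : PSHNeg u Ω)
    (hne : ∀ᵐ z, z ∈ Ω → u z ≠ ⊥) {K : Set (Cn n)} (hK : MeasurableSet K) (hKΩ : K ⊆ Ω) :
    AEMeasurable (fun z => (u z).toReal) (volume.restrict K) := by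
  refine aemeasurable_of_tendsto_metrizable_ae atTop
    (f := fun N : ℕ => Ω.indicator (trunc N u))
    (fun N => (hu.measurable_indicator_trunc hΩ N).aemeasurable) ?_
  rw [ae_restrict_iff' hK]
  filter_upwards [hne] with z hz hzK
  have hzΩ := hKΩ hzK
  refine tendsto_const_nhds.congr' ?_
  obtain ⟨N, hN⟩ := exists_nat_ge (-(u z).toReal)
  filter_upwards [eventually_ge_atTop N] with N' hN'
  have : (N : ℝ) ≤ N' := by exact_mod_cast hN'
  rw [Set.indicator_of_mem hzΩ, trunc_eq_bot_or (hu.2 z hzΩ) (hz hzΩ), max_eq_left (by linarith)]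

/-- The truncated rooftops converge, hence so do the rooftops themselves. -/
lemma ae_tendsto_toReal_rooftopSeq (hΩ : IsOpen Ω) (h0 : PSHNeg u0 Ω) (h1 : PSHNeg u1 Ω) {j0 : ℕ}
    (hne : ∀ᵐ z, z ∈ Ω → rooftopSeq u0 u1 Ω j0 z ≠ ⊥) :
    ∀ᵐ z, z ∈ Ω → Tendsto (fun j => (rooftopSeq u0 u1 Ω (j + j0) z).toReal) atTop
      (𝓝 (asympRooftop u0 u1 Ω z).toReal) := by
  filter_upwards [hne, ae_all_iff.2 (ae_tendsto_trunc_rooftopSeq hΩ h0 h1)] with z hz hlim hzΩ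
  have hg := pshNeg_asympRooftop hΩ h0 h1
  have hb := hz hzΩ
  obtain ⟨N, hN⟩ := exists_nat_ge (-(rooftopSeq u0 u1 Ω j0 z).toReal)
  have hge : ∀ e : EReal, rooftopSeq u0 u1 Ω j0 z ≤ e → e ≤ 0 →
      max e.toReal (-(N : ℝ)) = e.toReal := fun e he he0 => max_eq_left (by
    have := EReal.toReal_le_toReal he hb (ereal_ne_top_of_le_zero he0)
    linarith)
  have hgz := rooftopSeq_le_asympRooftop (u0 := u0) (u1 := u1) hzΩ j0
  have hl := (tendsto_add_atTop_iff_nat j0).2 (hlim N hzΩ)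
  rw [trunc_eq_bot_or (hg.2 z hzΩ) (ne_bot_of_le_ne_bot hb hgz),
    hge _ hgz (hg.2 z hzΩ)] at hl
  refine hl.congr fun j => ?_
  have hv := (pshNeg_rooftopSeq hΩ h0 h1 (j + j0)).2 z hzΩ
  have hm := rooftopSeq_mono hΩ h0 h1 hzΩ (Nat.le_add_left j0 j)
  rw [trunc_eq_bot_or hv (ne_bot_of_le_ne_bot hb hm), hge _ hm hv]

end RooftopSequence

section Convergence

variable {n : ℕ} {Ω : Set (Cn n)} {u0 u1 : Cn n → EReal}

lemma tendstoL1loc_geodesic_of_ne_bot (hΩ : IsOpen Ω) (hc : IsPreconnected Ω) (h0 : PSHNeg u0 Ω)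
    (h1 : PSHNeg u1 Ω) (hg : Set.EqOn (asympRooftop u0 u1 Ω) u0 Ω)
    (hne : ∃ z ∈ Ω, u0 z ≠ ⊥) : TendstoL1loc n Ω (geodesic n Ω u0 u1) u0 0 := by
  intro K hK hKΩ
  rw [nhdsWithin_Ioo_eq_nhdsGT one_pos]
  have hneg : ∃ z ∈ Ω, asympRooftop u0 u1 Ω z ≠ ⊥ := by
    obtain ⟨z, hz, h⟩ := hne
    exact ⟨z, hz, by rwa [hg hz]⟩
  obtain ⟨j0, hj0⟩ := exists_rooftopSeq_ne_bot hΩ h0 h1 hneg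
  have hv := pshNeg_rooftopSeq hΩ h0 h1
  have hvae := (hv j0).ae_ne_bot hΩ hc hj0
  have huae := h0.ae_ne_bot hΩ hc hne
  have hvaej : ∀ j, ∀ᵐ z, z ∈ Ω → rooftopSeq u0 u1 Ω (j + j0) z ≠ ⊥ := fun j => by
    filter_upwards [hvae] with z hz hzΩ
    exact ne_bot_of_le_ne_bot (hz hzΩ) (rooftopSeq_mono hΩ h0 h1 hzΩ (Nat.le_add_left j0 j))
  have hum := h0.aemeasurable_toReal hΩ huae hK.measurableSet hKΩ
  -- the rooftops converge in `L¹`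
  have hdct : Tendsto (fun j => ∫⁻ z in K, ENNReal.ofReal
      ((u0 z).toReal - (rooftopSeq u0 u1 Ω (j + j0) z).toReal)) atTop (𝓝 0) := by
    have h := tendsto_lintegral_of_dominated_convergence' (μ := volume.restrict K)
      (F := fun j z => ENNReal.ofReal
        ((u0 z).toReal - (rooftopSeq u0 u1 Ω (j + j0) z).toReal)) (f := fun _ => 0)
      (fun z => ENNReal.ofReal |(rooftopSeq u0 u1 Ω j0 z).toReal|)
      (fun j => (hum.sub ((hv (j + j0)).aemeasurable_toReal hΩ (hvaej j) hK.measurableSet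
        hKΩ)).ennreal_ofReal)
      (fun j => ?_) ((hv j0).lintegral_toReal_ne_top hΩ hc hj0 hK hKΩ) ?_
    · simpa using h
    · refine (ae_restrict_iff' hK.measurableSet).2 ?_
      filter_upwards [hvae] with z hz hzK
      have hzΩ := hKΩ hzK
      refine ENNReal.ofReal_le_ofReal ?_
      have hm := EReal.toReal_le_toReal
        (rooftopSeq_mono hΩ h0 h1 hzΩ (Nat.le_add_left j0 j)) (hz hzΩ)
        (ereal_ne_top_of_le_zero ((hv (j + j0)).2 z hzΩ))
      have hu : (u0 z).toReal ≤ 0 := EReal.toReal_nonpos (h0.2 z hzΩ)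
      refine le_trans ?_ (neg_le_abs _)
      simp only at hm ⊢
      linarith
    · refine (ae_restrict_iff' hK.measurableSet).2 ?_
      filter_upwards [ae_tendsto_toReal_rooftopSeq hΩ h0 h1 hvae] with z hz hzK
      have hzΩ := hKΩ hzK
      have h := (hz hzΩ).const_sub (u0 z).toReal
      rw [hg hzΩ, sub_self] at h
      simpa using ENNReal.tendsto_ofReal h
  rw [ENNReal.tendsto_nhds_zero]
  intro η hη
  obtain ⟨J, hJ⟩ := ((ENNReal.tendsto_nhds_zero.1 hdct) (η / 2) (ENNReal.half_pos hη.ne')).exists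
  set I := ∫⁻ z in K, ENNReal.ofReal |(u0 z).toReal| with hI
  have hItop : I ≠ ⊤ := h0.lintegral_toReal_ne_top hΩ hc hne hK hKΩ
  have hsmall : Tendsto (fun t : ℝ => ENNReal.ofReal t * I +
      ENNReal.ofReal (((J + j0 : ℕ) : ℝ) * t) * volume K) (𝓝[>] 0) (𝓝 0) := by
    have a1 : Tendsto (fun t : ℝ => ENNReal.ofReal t) (𝓝[>] 0) (𝓝 0) := by
      have : Tendsto (fun t : ℝ => ENNReal.ofReal t) (𝓝 0) (𝓝 (ENNReal.ofReal 0)) :=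
        ENNReal.tendsto_ofReal tendsto_id
      rw [ENNReal.ofReal_zero] at this
      exact this.mono_left nhdsWithin_le_nhds
    have a2 : Tendsto (fun t : ℝ => ENNReal.ofReal (((J + j0 : ℕ) : ℝ) * t)) (𝓝[>] 0) (𝓝 0) := by
      have : Tendsto (fun t : ℝ => ENNReal.ofReal (((J + j0 : ℕ) : ℝ) * t)) (𝓝 0)
          (𝓝 (ENNReal.ofReal (((J + j0 : ℕ) : ℝ) * 0))) :=
        ENNReal.tendsto_ofReal (tendsto_id.const_mul _)
      rw [mul_zero, ENNReal.ofReal_zero] at this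
      exact this.mono_left nhdsWithin_le_nhds
    have b1 := ENNReal.Tendsto.mul_const a1 (Or.inr hItop)
    have b2 := ENNReal.Tendsto.mul_const a2 (Or.inr (hK.measure_lt_top (μ := volume)).ne)
    simpa using b1.add b2
  filter_upwards [(ENNReal.tendsto_nhds_zero.1 hsmall) (η / 2) (ENNReal.half_pos hη.ne'),
    Ioo_mem_nhdsGT one_pos] with t ht ht1
  have hpt : ∀ᵐ z ∂volume.restrict K,
      ENNReal.ofReal |(geodesic n Ω u0 u1 t z).toReal - (u0 z).toReal| ≤
      ENNReal.ofReal t * ENNReal.ofReal |(u0 z).toReal| +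
      (ENNReal.ofReal (((J + j0 : ℕ) : ℝ) * t) + ENNReal.ofReal
        ((u0 z).toReal - (rooftopSeq u0 u1 Ω (J + j0) z).toReal)) := by
    refine (ae_restrict_iff' hK.measurableSet).2 ?_
    filter_upwards [hvaej J] with z hz hzK
    have hzΩ := hKΩ hzK
    obtain ⟨b1, b2, b3, -, b5⟩ := geodesic_toReal_bounds hΩ h0 h1 ht1 hzΩ (hz hzΩ)
    rw [hg hzΩ] at b2 b3
    have hJt : 0 ≤ ((J + j0 : ℕ) : ℝ) * t := mul_nonneg (by positivity) ht1.1.le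
    rw [← ENNReal.ofReal_mul ht1.1.le, ← ENNReal.ofReal_add hJt (sub_nonneg.2 b3),
      ← ENNReal.ofReal_add (mul_nonneg ht1.1.le (abs_nonneg _)) (by linarith)]
    refine ENNReal.ofReal_le_ofReal ?_
    have hab := abs_of_nonpos b5
    have : 0 ≤ t * |(u0 z).toReal| := mul_nonneg ht1.1.le (abs_nonneg _)
    rw [abs_le]
    constructor
    · linarith
    · rw [hab]; linarith
  calc _ ≤ ∫⁻ z in K, (ENNReal.ofReal t * ENNReal.ofReal |(u0 z).toReal| +
      (ENNReal.ofReal (((J + j0 : ℕ) : ℝ) * t) + ENNReal.ofReal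
        ((u0 z).toReal - (rooftopSeq u0 u1 Ω (J + j0) z).toReal))) := lintegral_mono_ae hpt
    _ = ENNReal.ofReal t * I + (ENNReal.ofReal (((J + j0 : ℕ) : ℝ) * t) * volume K +
        ∫⁻ z in K, ENNReal.ofReal
          ((u0 z).toReal - (rooftopSeq u0 u1 Ω (J + j0) z).toReal)) := by
      have hm1 : AEMeasurable (fun z => ENNReal.ofReal |(u0 z).toReal|) (volume.restrict K) :=
        (continuous_abs.measurable.comp_aemeasurable hum).ennreal_ofReal
      rw [lintegral_add_left' (hm1.const_mul _), lintegral_const_mul'' _ hm1,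
        lintegral_add_left measurable_const, setLIntegral_const]
    _ = (ENNReal.ofReal t * I + ENNReal.ofReal (((J + j0 : ℕ) : ℝ) * t) * volume K) +
        ∫⁻ z in K, ENNReal.ofReal
          ((u0 z).toReal - (rooftopSeq u0 u1 Ω (J + j0) z).toReal) := by rw [add_assoc]
    _ ≤ η / 2 + η / 2 := add_le_add ht hJ
    _ = η := ENNReal.add_halves η

lemma trunc_lt_imp_eq {u : Cn n → EReal} {z : Cn n} (hz : u z ≤ 0) {N : ℝ} (h : -N < trunc N u z) :
    u z = (trunc N u z : EReal) := by
  rw [coe_trunc hz]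
  refine (max_eq_left ?_).symm
  by_contra! hlt
  have : (trunc N u z : EReal) = ((-N : ℝ) : EReal) := by rw [coe_trunc hz, max_eq_right hlt.le]
  exact h.ne' (EReal.coe_injective this)

/-- The set where a psh function is very negative has small capacity. -/
lemma exists_maCap_trunc_le (hΩ : IsOpen Ω) {u : Cn n → EReal} (hu : PSHNeg u Ω)
    (hne : ∀ᵐ z, z ∈ Ω → u z ≠ ⊥) {K : Set (Cn n)} (hK : IsCompact K) (hKΩ : K ⊆ Ω) {η : ℝ}
    (hη : 0 < η) : ∃ J : ℕ, ∀ N : ℕ, J ≤ N →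
      MACap n Ω {z | z ∈ K ∧ trunc ((N : ℝ) + 1) u z < -((N + 1 : ℝ) / 2)} ≤ ENNReal.ofReal η := by
  have hz0 : ∀ (N : ℕ), ∀ z ∈ Ω, trunc ((N : ℝ) + 1) u z ≤ 0 := fun N z hz =>
    trunc_le_zero (hu.2 z hz) (by positivity)
  have hlow : ∀ (N : ℕ), ∀ z ∈ Ω, -1 ≤ ((N : ℝ) + 1)⁻¹ * trunc ((N : ℝ) + 1) u z := fun N z hz => by
    have h := neg_le_trunc (hu.2 z hz) ((N : ℝ) + 1)
    have hp : (0 : ℝ) < (N : ℝ) + 1 := by positivity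
    rw [inv_mul_eq_div, le_div_iff₀ hp]
    linarith
  have hmono : ∀ (N : ℕ), ∀ z ∈ Ω, ((N : ℝ) + 1)⁻¹ * trunc ((N : ℝ) + 1) u z ≤
      (((N + 1 : ℕ) : ℝ) + 1)⁻¹ * trunc (((N + 1 : ℕ) : ℝ) + 1) u z := fun N z hz => by
    have hp : (0 : ℝ) < (N : ℝ) + 1 := by positivity
    push_cast
    by_cases hb : u z = ⊥
    · have hval : ∀ M : ℝ, trunc M u z = -M := fun M => by
        simp [trunc, hb]
      rw [hval, hval]
      field_simp
      exact le_rfl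
    · rw [trunc_eq_bot_or (hu.2 z hz) hb, trunc_eq_bot_or (hu.2 z hz) hb]
      have hu0 : (u z).toReal ≤ 0 := EReal.toReal_nonpos (hu.2 z hz)
      rw [mul_max_of_nonneg _ _ (by positivity), mul_max_of_nonneg _ _ (by positivity)]
      refine max_le_max (mul_le_mul_of_nonpos_right ?_ hu0) ?_
      · exact inv_anti₀ hp (by linarith)
      · rw [mul_neg, mul_neg, inv_mul_cancel₀ hp.ne', inv_mul_cancel₀ (by positivity)]
  have hlim : ∀ᵐ z, z ∈ Ω →
      Tendsto (fun N : ℕ => ((N : ℝ) + 1)⁻¹ * trunc ((N : ℝ) + 1) u z) atTop (𝓝 0) := by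
    filter_upwards [hne] with z hz hzΩ
    have hb := hz hzΩ
    have h1 : Tendsto (fun N : ℕ => ((N : ℝ) + 1)⁻¹) atTop (𝓝 0) := by
      simpa using tendsto_one_div_add_atTop_nhds_zero_nat (𝕜 := ℝ)
    have h2 := h1.mul_const (u z).toReal
    rw [zero_mul] at h2
    refine tendsto_of_tendsto_of_tendsto_of_le_of_le h2 tendsto_const_nhds (fun N => ?_)
      (fun N => mul_nonpos_of_nonneg_of_nonpos (by positivity) (hz0 N z hzΩ))
    rw [trunc_eq_bot_or (hu.2 z hzΩ) hb]
    exact mul_le_mul_of_nonneg_left (le_max_left _ _) (by positivity)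
  obtain ⟨J, hJ⟩ := exists_maCap_le hΩ (N := 1) zero_le_one
    (v := fun N z => ((N : ℝ) + 1)⁻¹ * trunc ((N : ℝ) + 1) u z) (G := fun _ => 0)
    (fun N => (hu.rpsh_trunc _).const_mul (M := (N : ℝ) + 1)
      (fun z hz => abs_trunc_le (hu.2 z hz) (by positivity)) (by positivity))
    (rpsh_const 0 Ω) hlow hmono
    (fun N z hz => mul_nonpos_of_nonneg_of_nonpos (by positivity) (hz0 N z hz))
    (fun _ _ => le_rfl) hlim hK hKΩ one_half_pos hη
  refine ⟨J, fun N hN => le_trans (maCap_mono ?_) (hJ N hN)⟩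
  rintro z ⟨hz, hlt⟩
  refine ⟨hz, ?_⟩
  have hp : (0 : ℝ) < (N : ℝ) + 1 := by positivity
  have : ((N : ℝ) + 1)⁻¹ * trunc ((N : ℝ) + 1) u z < ((N : ℝ) + 1)⁻¹ * -((N + 1 : ℝ) / 2) :=
    mul_lt_mul_of_pos_left hlt (inv_pos.2 hp)
  have e : ((N : ℝ) + 1)⁻¹ * -((N + 1 : ℝ) / 2) = -(1 / 2) := by field_simp
  linarith

lemma tendstoInCap_geodesic_of_ne_bot (hΩ : IsOpen Ω) (hc : IsPreconnected Ω) (h0 : PSHNeg u0 Ω)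
    (h1 : PSHNeg u1 Ω) (hg : Set.EqOn (asympRooftop u0 u1 Ω) u0 Ω)
    (hne : ∃ z ∈ Ω, u0 z ≠ ⊥) : TendstoInCap n Ω (geodesic n Ω u0 u1) u0 0 := by
  intro ε hε K hK hKΩ
  rw [nhdsWithin_Ioo_eq_nhdsGT one_pos, ENNReal.tendsto_nhds_zero]
  intro η hη
  obtain ⟨η', hη', hle⟩ : ∃ η' : ℝ, 0 < η' ∧ ENNReal.ofReal η' ≤ η / 2 := by
    obtain ⟨a, ha0, ha⟩ := ENNReal.lt_iff_exists_nnreal_btwn.1 (ENNReal.half_pos hη.ne')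
    exact ⟨a, by exact_mod_cast ha0, by rw [ENNReal.ofReal_coe_nnreal]; exact ha.le⟩
  have huae := h0.ae_ne_bot hΩ hc hne
  obtain ⟨N0, hN0⟩ := exists_maCap_trunc_le hΩ h0 huae hK hKΩ hη'
  obtain ⟨N1, hN1⟩ := exists_nat_ge ε
  set N : ℕ := max N0 N1 with hN
  have hNε : ε ≤ N := hN1.trans (by exact_mod_cast le_max_right _ _)
  have hcap1 := hN0 N (le_max_left _ _)
  have hv := pshNeg_rooftopSeq hΩ h0 h1
  have hgneg := pshNeg_asympRooftop hΩ h0 h1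
  have htr : ∀ z ∈ Ω, trunc ((N + 1 : ℕ) : ℝ) (asympRooftop u0 u1 Ω) z =
      trunc ((N + 1 : ℕ) : ℝ) u0 z := fun z hz => by simp only [trunc, hg hz]
  obtain ⟨J, hJ⟩ := exists_maCap_le hΩ (N := ((N + 1 : ℕ) : ℝ)) (by positivity)
    (v := fun j => trunc ((N + 1 : ℕ) : ℝ) (rooftopSeq u0 u1 Ω j))
    (G := trunc ((N + 1 : ℕ) : ℝ) u0)
    (fun j => (hv j).rpsh_trunc _) (h0.rpsh_trunc _)
    (fun j z hz => neg_le_trunc ((hv j).2 z hz) _)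
    (fun j z hz => trunc_mono (rooftopSeq_mono hΩ h0 h1 hz (Nat.le_succ j)) ((hv (j + 1)).2 z hz) _)
    (fun j z hz => trunc_mono ((rooftopSeq_le_asympRooftop hz j).trans (hg hz).le) (h0.2 z hz) _)
    (fun z hz => trunc_le_zero (h0.2 z hz) (by positivity))
    (by
      filter_upwards [ae_tendsto_trunc_rooftopSeq hΩ h0 h1 (N + 1)] with z hz hzΩ
      rw [← htr z hzΩ]
      exact hz hzΩ) hK hKΩ (half_pos hε) hη'
  have hcap2 := hJ J le_rfl
  have hlim1 : ∀ᶠ t : ℝ in 𝓝[>] 0, (J : ℝ) * t < ε / 2 := by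
    have : Tendsto (fun t : ℝ => (J : ℝ) * t) (𝓝 0) (𝓝 (J * 0)) := tendsto_id.const_mul _
    rw [mul_zero] at this
    exact (this.mono_left nhdsWithin_le_nhds).eventually (gt_mem_nhds (half_pos hε))
  have hlim2 : ∀ᶠ t : ℝ in 𝓝[>] 0, ((N + 1 : ℝ) / 2) * t < ε := by
    have : Tendsto (fun t : ℝ => ((N + 1 : ℝ) / 2) * t) (𝓝 0) (𝓝 (((N + 1 : ℝ) / 2) * 0)) :=
      tendsto_id.const_mul _
    rw [mul_zero] at this
    exact (this.mono_left nhdsWithin_le_nhds).eventually (gt_mem_nhds hε)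
  filter_upwards [hlim1, hlim2, Ioo_mem_nhdsGT one_pos] with t ht1 ht2 ht
  refine le_trans (maCap_mono
    (T := {z | z ∈ K ∧ trunc ((N : ℝ) + 1) u0 z < -((N + 1 : ℝ) / 2)} ∪
      {z | z ∈ K ∧ trunc ((N + 1 : ℕ) : ℝ) (rooftopSeq u0 u1 Ω J) z + ε / 2 <
        trunc ((N + 1 : ℕ) : ℝ) u0 z}) ?_) ?_
  · rintro z ⟨hzK, hbad⟩
    have hzΩ := hKΩ hzK
    by_contra hnot
    simp only [Set.mem_union, Set.mem_ofPred_eq, hzK, true_and, not_or, not_lt] at hnot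
    obtain ⟨g1, g2⟩ := hnot
    push_cast at g2
    apply hbad
    set c := trunc ((N : ℝ) + 1) u0 z with hcdef
    have hc0 : c ≤ 0 := trunc_le_zero (h0.2 z hzΩ) (by positivity)
    have huc : u0 z = (c : EReal) := trunc_lt_imp_eq (h0.2 z hzΩ) (by linarith)
    have hvc : rooftopSeq u0 u1 Ω J z =
        (trunc ((N : ℝ) + 1) (rooftopSeq u0 u1 Ω J) z : EReal) :=
      trunc_lt_imp_eq ((hv J).2 z hzΩ) (by linarith)
    have hvb : rooftopSeq u0 u1 Ω J z ≠ ⊥ := by rw [hvc]; exact EReal.coe_ne_bot _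
    have up := geodesic_le hΩ ht hzΩ hc0 (by rw [hg hzΩ, huc])
    have lo := rooftop_sub_le_geodesic hΩ h0 h1 (C := (J : ℝ)) (by positivity) (t := t) hzΩ
    change rooftopSeq u0 u1 Ω J z + _ ≤ _ at lo
    rw [hvc, ← EReal.coe_add] at lo
    rw [huc, ← EReal.coe_add]
    refine ⟨up.trans (EReal.coe_le_coe_iff.2 ?_), ?_⟩
    · nlinarith [ht.1]
    · refine le_trans ?_ (add_le_add_left lo _)
      rw [← EReal.coe_add, EReal.coe_le_coe_iff]
      linarith
  · refine (maCap_union_le _ _).trans ((add_le_add hcap1 hcap2).trans ?_)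
    exact (add_le_add hle hle).trans (ENNReal.add_halves η).le

end Convergence

section Characterization

variable {n : ℕ} {Ω : Set (Cn n)} {u0 u1 : Cn n → EReal}

lemma tendsto_geodesic_of_eq_bot (hΩ : IsOpen Ω)
    (hg : Set.EqOn (asympRooftop u0 u1 Ω) u0 Ω) (hbot : ∀ z ∈ Ω, u0 z = ⊥) :
    TendstoL1loc n Ω (geodesic n Ω u0 u1) u0 0 ∧
      TendstoInCap n Ω (geodesic n Ω u0 u1) u0 0 := by
  have hgeo : ∀ t ∈ Set.Ioo (0 : ℝ) 1, ∀ z ∈ Ω, geodesic n Ω u0 u1 t z = u0 z := fun t ht z hz => by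
    rw [hbot z hz]
    exact geodesic_eq_bot hΩ ht hz ((hg hz).trans (hbot z hz))
  refine ⟨fun K hK hKΩ => ?_, fun ε hε K hK hKΩ => ?_⟩
  · refine tendsto_const_nhds.congr' ?_
    filter_upwards [self_mem_nhdsWithin] with t ht
    rw [eq_comm, setLIntegral_congr_fun hK.measurableSet (g := fun _ => 0)
      fun z hz => by simp [hgeo t ht z (hKΩ hz)], lintegral_zero]
  · refine tendsto_const_nhds.congr' ?_
    filter_upwards [self_mem_nhdsWithin] with t ht
    rw [eq_comm]
    convert maCap_empty (n := n) (Ω := Ω)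
    rw [Set.eq_empty_iff_forall_notMem]
    rintro z ⟨hz, hnot⟩
    refine hnot ?_
    rw [hgeo t ht z (hKΩ hz), hbot z (hKΩ hz)]
    simp

/-- If an a.e. property holds on all compact subsets of an open set then it holds a.e. there. -/
lemma ae_of_ae_compact (hΩ : IsOpen Ω) {p : Cn n → Prop}
    (h : ∀ K, IsCompact K → K ⊆ Ω → ∀ᵐ z ∂volume.restrict K, p z) : ∀ᵐ z, z ∈ Ω → p z := by
  refine measure_null_of_locally_null _ fun x hx => ?_
  have hxΩ : x ∈ Ω := by by_contra h'; exact hx fun h'' => absurd h'' h'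
  obtain ⟨δ, hδ, hxs⟩ := exists_mem_shrink hΩ hxΩ
  have hK := h _ (isCompact_closedBall x δ) hxs
  rw [ae_restrict_iff' measurableSet_closedBall] at hK
  refine ⟨_, inter_mem_nhdsWithin _ (Metric.closedBall_mem_nhds x hδ), measure_mono_null ?_ hK⟩
  rintro q ⟨hq, hqx⟩ hp
  exact hq fun _ => hp hqx

lemma asympRooftop_eq_of_tendsto (hΩ : IsOpen Ω) (hc : IsPreconnected Ω) (h0 : PSHNeg u0 Ω)
    (h1 : PSHNeg u1 Ω) (hne : ∃ z ∈ Ω, asympRooftop u0 u1 Ω z ≠ ⊥)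
    (hL : TendstoL1loc n Ω (geodesic n Ω u0 u1) u0 0) :
    Set.EqOn (asympRooftop u0 u1 Ω) u0 Ω := by
  have hg := pshNeg_asympRooftop hΩ h0 h1
  obtain ⟨j, hj⟩ := exists_rooftopSeq_ne_bot hΩ h0 h1 hne
  have hvae := (pshNeg_rooftopSeq hΩ h0 h1 j).ae_ne_bot hΩ hc hj
  have hgae := hg.ae_ne_bot hΩ hc hne
  have hune : ∃ z ∈ Ω, u0 z ≠ ⊥ := by
    obtain ⟨z, hz, h⟩ := hne
    exact ⟨z, hz, ne_bot_of_le_ne_bot h (asympRooftop_le h0.1 h1.1 hz)⟩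
  have huae := h0.ae_ne_bot hΩ hc hune
  have hle : ∀ᵐ z, z ∈ Ω → u0 z ≤ asympRooftop u0 u1 Ω z := by
    refine ae_of_ae_compact hΩ fun K hK hKΩ => ?_
    have hum := h0.aemeasurable_toReal hΩ huae hK.measurableSet hKΩ
    have hgm := hg.aemeasurable_toReal hΩ hgae hK.measurableSet hKΩ
    set I := ∫⁻ z in K, ENNReal.ofReal |(asympRooftop u0 u1 Ω z).toReal| with hI
    have hItop : I ≠ ⊤ := hg.lintegral_toReal_ne_top hΩ hc hne hK hKΩ
    have hlim := hL K hK hKΩ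
    rw [nhdsWithin_Ioo_eq_nhdsGT one_pos] at hlim
    have a1 : Tendsto (fun t : ℝ => ENNReal.ofReal t) (𝓝[>] 0) (𝓝 0) := by
      have : Tendsto (fun t : ℝ => ENNReal.ofReal t) (𝓝 0) (𝓝 (ENNReal.ofReal 0)) :=
        ENNReal.tendsto_ofReal tendsto_id
      rw [ENNReal.ofReal_zero] at this
      exact this.mono_left nhdsWithin_le_nhds
    have hsum := hlim.add (ENNReal.Tendsto.mul_const a1 (Or.inr hItop))
    rw [zero_mul, add_zero] at hsum
    have hzero : ∫⁻ z in K, ENNReal.ofReal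
        ((u0 z).toReal - (asympRooftop u0 u1 Ω z).toReal) = 0 := by
      refine le_antisymm (ge_of_tendsto hsum ?_) zero_le
      filter_upwards [Ioo_mem_nhdsGT one_pos] with t ht
      have hm1 : AEMeasurable (fun z => ENNReal.ofReal |(asympRooftop u0 u1 Ω z).toReal|)
          (volume.restrict K) :=
        (continuous_abs.measurable.comp_aemeasurable hgm).ennreal_ofReal
      rw [hI, ← lintegral_const_mul'' _ hm1, ← lintegral_add_right' _ (hm1.const_mul _)]
      refine lintegral_mono_ae ((ae_restrict_iff' hK.measurableSet).2 ?_)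
      filter_upwards [hvae] with z hz hzK
      have hzΩ := hKΩ hzK
      obtain ⟨-, b2, -, b4, b5⟩ := geodesic_toReal_bounds hΩ h0 h1 ht hzΩ (hz hzΩ)
      rw [← ENNReal.ofReal_mul ht.1.le, ← ENNReal.ofReal_add (abs_nonneg _)
        (mul_nonneg ht.1.le (abs_nonneg _))]
      refine ENNReal.ofReal_le_ofReal ?_
      rw [abs_of_nonpos (b4.trans b5)]
      have := neg_abs_le ((geodesic n Ω u0 u1 t z).toReal - (u0 z).toReal)
      linarith
    have hzero' := (lintegral_eq_zero_iff'
      (f := fun z => ENNReal.ofReal ((u0 z).toReal - (asympRooftop u0 u1 Ω z).toReal))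
      (hum.sub hgm).ennreal_ofReal).1 hzero
    have hg' := (ae_restrict_iff' hK.measurableSet).2 (hgae.mono fun z hz hzK => hz (hKΩ hzK))
    have hu' := (ae_restrict_iff' hK.measurableSet).2 (huae.mono fun z hz hzK => hz (hKΩ hzK))
    filter_upwards [hzero', hg', hu', ae_restrict_mem hK.measurableSet] with z hz hgz huz hzK
    have hzΩ := hKΩ hzK
    simp only [Pi.zero_apply, ENNReal.ofReal_eq_zero, sub_nonpos] at hz
    rw [← EReal.coe_toReal (ereal_ne_top_of_le_zero (h0.2 z hzΩ)) huz,
      ← EReal.coe_toReal (ereal_ne_top_of_le_zero (hg.2 z hzΩ)) hgz]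
    exact EReal.coe_le_coe_iff.2 hz
  have hle' := h0.le_of_ae_le hΩ hg hle
  exact fun z hz => le_antisymm (asympRooftop_le h0.1 h1.1 hz) (hle' z hz)

lemma not_tendsto_geodesic_of_asympRooftop_eq_bot (hΩ : IsOpen Ω) (hc : IsPreconnected Ω)
    (hb : Bornology.IsBounded Ω) (h0 : PSHNeg u0 Ω)
    (hbot : ∀ z ∈ Ω, asympRooftop u0 u1 Ω z = ⊥) (hne : ∃ z ∈ Ω, u0 z ≠ ⊥)
    (hL : TendstoL1loc n Ω (geodesic n Ω u0 u1) u0 0)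
    (hC : TendstoInCap n Ω (geodesic n Ω u0 u1) u0 0) : False := by
  have hgeo : ∀ t ∈ Set.Ioo (0 : ℝ) 1, ∀ z ∈ Ω, geodesic n Ω u0 u1 t z = ⊥ := fun t ht z hz =>
    geodesic_eq_bot hΩ ht hz (hbot z hz)
  have huae := h0.ae_ne_bot hΩ hc hne
  have hzpsh : PSHNeg (fun _ : Cn n => (0 : EReal)) Ω := ⟨rpsh_const 0 Ω, fun _ _ => le_rfl⟩
  have hle : ∀ᵐ z, z ∈ Ω → 0 ≤ u0 z := by
    refine ae_of_ae_compact hΩ fun K hK hKΩ => ?_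
    have hum := h0.aemeasurable_toReal hΩ huae hK.measurableSet hKΩ
    have hlim := hL K hK hKΩ
    rw [nhdsWithin_Ioo_eq_nhdsGT one_pos] at hlim
    have hconst : ∫⁻ z in K, ENNReal.ofReal |(u0 z).toReal| = 0 := by
      refine tendsto_nhds_unique (tendsto_const_nhds.congr' ?_) hlim
      filter_upwards [Ioo_mem_nhdsGT one_pos] with t ht
      refine setLIntegral_congr_fun hK.measurableSet fun z hz => ?_
      simp [hgeo t ht z (hKΩ hz)]
    have hconst' := (lintegral_eq_zero_iff' (f := fun z => ENNReal.ofReal |(u0 z).toReal|)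
      (continuous_abs.measurable.comp_aemeasurable hum).ennreal_ofReal).1 hconst
    have hu' := (ae_restrict_iff' hK.measurableSet).2 (huae.mono fun z hz hzK => hz (hKΩ hzK))
    filter_upwards [hconst', hu', ae_restrict_mem hK.measurableSet] with z hz huz hzK
    have hzΩ := hKΩ hzK
    simp only [Pi.zero_apply, ENNReal.ofReal_eq_zero, abs_nonpos_iff] at hz
    rw [← EReal.coe_toReal (ereal_ne_top_of_le_zero (h0.2 z hzΩ)) huz, hz]
    simp
  have hzero : ∀ z ∈ Ω, u0 z = 0 := fun z hz =>
    le_antisymm (h0.2 z hz) (hzpsh.le_of_ae_le hΩ h0 hle z hz)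
  obtain ⟨x, hx, -⟩ := hne
  obtain ⟨δ, hδ, hxs⟩ := exists_mem_shrink hΩ hx
  refine maCap_pos hΩ hb hxs measurableSet_closedBall
    (Metric.measure_closedBall_pos volume x hδ).ne' ?_
  have hlim := hC 1 one_pos _ (isCompact_closedBall x δ) hxs
  rw [nhdsWithin_Ioo_eq_nhdsGT one_pos] at hlim
  refine tendsto_nhds_unique (tendsto_const_nhds.congr' ?_) hlim
  filter_upwards [Ioo_mem_nhdsGT one_pos] with t ht
  congr 1
  ext z
  refine ⟨fun hz => ⟨hz, fun h => ?_⟩, fun h => h.1⟩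
  have := h.2
  rw [hgeo t ht z (hxs hz), hzero z (hxs hz), EReal.bot_add] at this
  exact absurd this (by simp)

end Characterization

/-- Theorem 8.1: the geodesic `u_t` converges to `u₀` in `L¹_loc(D)` (and in capacity)
as `t → 0` if and only if `P[u₁](u₀) = u₀`. -/
theorem statement17 {n : ℕ} (Ω : Set (Cn n)) (hΩconn : IsConnected Ω) (hΩopen : IsOpen Ω)
    (hΩbd : Bornology.IsBounded Ω) (hΩhc : Hyperconvex Ω)
    (u0 u1 : Cn n → EReal) (h0 : PSHNeg u0 Ω) (h1 : PSHNeg u1 Ω) :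
    (TendstoL1loc n Ω (geodesic n Ω u0 u1) u0 0 ∧
      TendstoInCap n Ω (geodesic n Ω u0 u1) u0 0) ↔
    Set.EqOn (asympRooftop u0 u1 Ω) u0 Ω := by
  have hc := hΩconn.isPreconnected
  by_cases hne : ∃ z ∈ Ω, u0 z ≠ ⊥
  · refine ⟨fun ⟨hL, hC⟩ => ?_, fun hg =>
      ⟨tendstoL1loc_geodesic_of_ne_bot hΩopen hc h0 h1 hg hne,
        tendstoInCap_geodesic_of_ne_bot hΩopen hc h0 h1 hg hne⟩⟩
    by_cases hgne : ∃ z ∈ Ω, asympRooftop u0 u1 Ω z ≠ ⊥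
    · exact asympRooftop_eq_of_tendsto hΩopen hc h0 h1 hgne hL
    · push Not at hgne
      exact (not_tendsto_geodesic_of_asympRooftop_eq_bot hΩopen hc hΩbd h0 hgne hne hL hC).elim
  · push Not at hne
    refine ⟨fun _ z hz => ?_, fun hg => tendsto_geodesic_of_eq_bot hΩopen hg hne⟩
    exact le_antisymm (asympRooftop_le h0.1 h1.1 hz) (by rw [hne z hz]; exact bot_le)
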